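/- Fix T ∈ (0,∞), d ∈ ℕ, a probability measure ν on ℝ^d, and Borel functions a^{ij}, b^i, c : [0,T]×ℝ^d → ℝ with c ≤ 0 and A(t,x) := (a^{ij}(t,x)) symmetric nonnegative definite. Assume (H1) and (H2), and that for some p > d+2 one has b^i ∈ L^p_loc([0,T]×ℝ^d, dt dx) and c ∈ L^{p/2}_loc([0,T]×ℝ^d, dt dx). Suppose there exists (μ_t) ∈ 𝓢𝓟_ν such that |a^{ij}|/(1+|x|²) + |b^i|/(1+|x|) ∈ L¹([0,T]×ℝ^d, μ_t dt) for all 1 ≤ i,j ≤ d. Then every (μ̃_t) ∈ 𝓢𝓟_ν satisfies μ̃_t = μ_t for Lebesgue-a.e. t ∈ [0,T]; in particular 𝓢𝓟_ν consists of exactly one element. -/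

import Mathlib

open MeasureTheory Set

noncomputable section

/-- Euclidean space `ℝ^d`. -/
abbrev Rd (d : ℕ) := EuclideanSpace ℝ (Fin d)

/-- First partial derivative `∂_{x_i} φ`. -/
def pd {d : ℕ} (i : Fin d) (φ : Rd d → ℝ) (x : Rd d) : ℝ :=
  fderiv ℝ φ x (EuclideanSpace.single i 1)

/-- Second partial derivative `∂_{x_i} ∂_{x_j} φ`. -/
def pd2 {d : ℕ} (i j : Fin d) (φ : Rd d → ℝ) (x : Rd d) : ℝ :=
  fderiv ℝ (fun y => fderiv ℝ φ y (EuclideanSpace.single j 1)) x (EuclideanSpace.single i 1)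

/-- `C_c^∞` test functions on `ℝ^d`. -/
def IsTest {d : ℕ} (φ : Rd d → ℝ) : Prop :=
  ContDiff ℝ (⊤ : ℕ∞) φ ∧ HasCompactSupport φ

/-- The Kolmogorov operator
`L₀φ(t,x) = Σ a^{ij}(t,x) ∂_i∂_j φ(x) + Σ b^i(t,x) ∂_i φ(x) + c(t,x) φ(x)`. -/
def L0 {d : ℕ} (a : Fin d → Fin d → ℝ × Rd d → ℝ) (b : Fin d → ℝ × Rd d → ℝ)
    (c : ℝ × Rd d → ℝ) (φ : Rd d → ℝ) (z : ℝ × Rd d) : ℝ :=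
  (∑ i, ∑ j, a i j z * pd2 i j φ z.2) + (∑ i, b i z * pd i φ z.2) + c z * φ z.2

/-- Local strict ellipticity and local boundedness (H1): on each ball `U` there are
`γ(U), M(U) ∈ (0,∞)` with `γ(U)·I ≤ A(t,x) ≤ M(U)·I` for `t ∈ [0,T]`, `x ∈ U`. -/
def CondH1 {d : ℕ} (T : ℝ) (a : Fin d → Fin d → ℝ × Rd d → ℝ) : Prop :=
  ∀ R : ℝ, 0 < R → ∃ γ M : ℝ, 0 < γ ∧ 0 < M ∧
    ∀ t ∈ Set.Icc (0 : ℝ) T, ∀ x ∈ Metric.ball (0 : Rd d) R, ∀ ξ : Fin d → ℝ,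
      γ * ∑ i, ξ i ^ 2 ≤ (∑ i, ∑ j, a i j (t, x) * ξ i * ξ j) ∧
      (∑ i, ∑ j, a i j (t, x) * ξ i * ξ j) ≤ M * ∑ i, ξ i ^ 2

/-- Membership in the class `𝓢𝓟_ν` of subprobability solutions to the FPKE on `[0,T]`. -/
def MemSP {d : ℕ} (T : ℝ) (a : Fin d → Fin d → ℝ × Rd d → ℝ)
    (b : Fin d → ℝ × Rd d → ℝ) (c : ℝ × Rd d → ℝ)
    (ν : Measure (Rd d)) (μ : ℝ → Measure (Rd d)) : Prop :=
  (∀ A : Set (Rd d), MeasurableSet A → Measurable fun t => μ t A) ∧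
  (∀ t ∈ Set.Icc (0 : ℝ) T, μ t Set.univ ≤ 1) ∧
  -- a^{ij}, b^i, c ∈ L¹_loc([0,T] × ℝ^d, μ_t dt)
  (∀ R : ℝ, 0 < R → ∀ i j : Fin d,
    ∫⁻ t in Set.Icc (0 : ℝ) T, ∫⁻ x in Metric.ball (0 : Rd d) R,
      ENNReal.ofReal |a i j (t, x)| ∂(μ t) < ⊤) ∧
  (∀ R : ℝ, 0 < R → ∀ i : Fin d,
    ∫⁻ t in Set.Icc (0 : ℝ) T, ∫⁻ x in Metric.ball (0 : Rd d) R,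
      ENNReal.ofReal |b i (t, x)| ∂(μ t) < ⊤) ∧
  (∀ R : ℝ, 0 < R →
    ∫⁻ t in Set.Icc (0 : ℝ) T, ∫⁻ x in Metric.ball (0 : Rd d) R,
      ENNReal.ofReal |c (t, x)| ∂(μ t) < ⊤) ∧
  -- the Fokker–Planck–Kolmogorov equation
  (∀ φ : Rd d → ℝ, IsTest φ →
    ∀ᵐ t ∂(volume.restrict (Set.Icc (0 : ℝ) T)),
      ∫ x, φ x ∂(μ t)
        = ∫ x, φ x ∂ν + ∫ s in (0 : ℝ)..t, ∫ x, L0 a b c φ (s, x) ∂(μ s)) ∧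
  -- c ∈ L¹([0,T] × ℝ^d, μ_t dt)
  (∫⁻ t in Set.Icc (0 : ℝ) T, ∫⁻ x, ENNReal.ofReal |c (t, x)| ∂(μ t) < ⊤) ∧
  -- b ∈ L²([0,T] × U, μ_t dt; ℝ^d) for every ball U
  (∀ R : ℝ, 0 < R →
    ∫⁻ t in Set.Icc (0 : ℝ) T, ∫⁻ x in Metric.ball (0 : Rd d) R,
      ENNReal.ofReal (∑ i, b i (t, x) ^ 2) ∂(μ t) < ⊤) ∧
  μ 0 = ν ∧
  (∀ᵐ t ∂(volume.restrict (Set.Icc (0 : ℝ) T)),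
    (μ t Set.univ).toReal
      ≤ (ν Set.univ).toReal + ∫ s in (0 : ℝ)..t, ∫ x, c (s, x) ∂(μ s))

/-- Local Lipschitz continuity of the diffusion coefficients (H2). -/
def CondH2 {d : ℕ} (T : ℝ) (a : Fin d → Fin d → ℝ × Rd d → ℝ) : Prop :=
  ∀ R : ℝ, 0 < R → ∃ Λ : ℝ, 0 < Λ ∧
    ∀ t ∈ Set.Icc (0 : ℝ) T, ∀ x ∈ Metric.ball (0 : Rd d) R,
      ∀ y ∈ Metric.ball (0 : Rd d) R, ∀ i j : Fin d,
        |a i j (t, x) - a i j (t, y)| ≤ Λ * dist x y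

/-- `g ∈ L^p_loc([0,T] × ℝ^d, dt dx)`. -/
def MemLplocDtDx {d : ℕ} (T : ℝ) (p : ℝ) (g : ℝ × Rd d → ℝ) : Prop :=
  ∀ R : ℝ, 0 < R →
    ∫⁻ t in Set.Icc (0 : ℝ) T, ∫⁻ x in Metric.ball (0 : Rd d) R,
      ENNReal.ofReal (|g (t, x)| ^ p) ∂(volume) ∂(volume) < ⊤

/-! ### Partial derivatives -/

section PartialDerivatives

variable {d : ℕ}

lemma pd_mul {f g : Rd d → ℝ} {x : Rd d} (i : Fin d) (hf : DifferentiableAt ℝ f x)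
    (hg : DifferentiableAt ℝ g x) :
    pd i (fun y => f y * g y) x = pd i f x * g x + f x * pd i g x := by
  unfold pd
  rw [fderiv_fun_mul hf hg]
  simp; ring

lemma pd_sub {f g : Rd d → ℝ} {x : Rd d} (i : Fin d) (hf : DifferentiableAt ℝ f x)
    (hg : DifferentiableAt ℝ g x) :
    pd i (fun y => f y - g y) x = pd i f x - pd i g x := by
  unfold pd
  rw [fderiv_fun_sub hf hg]
  simp

lemma pd_sum {ι : Type*} {s : Finset ι} {f : ι → Rd d → ℝ} {x : Rd d} (i : Fin d)
    (hf : ∀ k ∈ s, DifferentiableAt ℝ (f k) x) :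
    pd i (fun y => ∑ k ∈ s, f k y) x = ∑ k ∈ s, pd i (f k) x := by
  unfold pd
  rw [fderiv_fun_sum hf]
  simp

lemma pd_eq_of_hasFDerivAt {f : Rd d → ℝ} {f' : Rd d →L[ℝ] ℝ} {x : Rd d} (i : Fin d)
    (hf : HasFDerivAt f f' x) : pd i f x = f' (EuclideanSpace.single i 1) := by
  unfold pd; rw [hf.fderiv]

lemma pd2_eq (i j : Fin d) (f : Rd d → ℝ) : pd2 i j f = pd i (pd j f) := rfl

lemma ContDiff.pd_continuous {f : Rd d → ℝ} (hf : ContDiff ℝ 1 f) (i : Fin d) :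
    Continuous (pd i f) :=
  (hf.continuous_fderiv one_ne_zero).clm_apply continuous_const

lemma abs_pd_le_norm_fderiv (i : Fin d) (f : Rd d → ℝ) (x : Rd d) :
    |pd i f x| ≤ ‖fderiv ℝ f x‖ := by
  unfold pd
  simpa using (fderiv ℝ f x).le_opNorm (EuclideanSpace.single i (1 : ℝ))

lemma norm_fderiv_le_sum_pd (f : Rd d → ℝ) (x : Rd d) :
    ‖fderiv ℝ f x‖ ≤ ∑ i, |pd i f x| := by
  refine ContinuousLinearMap.opNorm_le_bound _ (by positivity) fun v => ?_
  have hv : v = ∑ i, v i • EuclideanSpace.single i (1 : ℝ) := by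
    have := (EuclideanSpace.basisFun (Fin d) ℝ).sum_repr v
    simpa using this.symm
  conv_lhs => rw [hv]
  rw [map_sum, Finset.sum_mul]
  refine (norm_sum_le _ _).trans (Finset.sum_le_sum fun i _ => ?_)
  rw [map_smul, norm_smul, mul_comm]
  exact mul_le_mul_of_nonneg_left (PiLp.norm_apply_le v i) (abs_nonneg _)

lemma HasCompactSupport.pd {f : Rd d → ℝ} (hf : HasCompactSupport f) (i : Fin d) :
    HasCompactSupport (_root_.pd i f) :=
  (hf.fderiv ℝ).comp_left (g := fun L : Rd d →L[ℝ] ℝ => L (EuclideanSpace.single i 1)) (by simp)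

lemma tsupport_pd_subset (f : Rd d → ℝ) (i : Fin d) : tsupport (pd i f) ⊆ tsupport f := by
  refine closure_minimal (fun x hx => ?_) (isClosed_tsupport f)
  apply support_fderiv_subset ℝ
  intro h
  exact hx (by simp [pd, h])

lemma ContDiff.pd_top {f : Rd d → ℝ} (hf : ContDiff ℝ (⊤ : ℕ∞) f) (i : Fin d) :
    ContDiff ℝ (⊤ : ℕ∞) (pd i f) :=
  (hf.fderiv_right (m := (⊤ : ℕ∞)) le_rfl).clm_apply contDiff_const

lemma IsTest.pd {f : Rd d → ℝ} (hf : IsTest f) (i : Fin d) : IsTest (pd i f) :=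
  ⟨hf.1.pd_top i, hf.2.pd i⟩

lemma IsTest.contDiff {f : Rd d → ℝ} (hf : IsTest f) {n : ℕ} : ContDiff ℝ n f :=
  hf.1.of_le (by exact_mod_cast le_top)

lemma IsTest.contDiff_one {f : Rd d → ℝ} (hf : IsTest f) : ContDiff ℝ 1 f :=
  hf.contDiff (n := 1)

lemma IsTest.continuous {f : Rd d → ℝ} (hf : IsTest f) : Continuous f := hf.1.continuous

lemma integral_mul_pd {u f : Rd d → ℝ} (i : Fin d) (hu : ContDiff ℝ 1 u)
    (huc : HasCompactSupport u) (hf : ContDiff ℝ 1 f) :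
    ∫ x, u x * pd i f x = -∫ x, pd i u x * f x := by
  have h1 : Continuous (pd i f) := hf.pd_continuous i
  have h2 : Continuous (pd i u) := hu.pd_continuous i
  refine integral_mul_fderiv_eq_neg_fderiv_mul_of_integrable (f := u) (g := f)
    (v := EuclideanSpace.single i 1) ?_ ?_ ?_ ?_ ?_
  · exact (h2.mul hf.continuous).integrable_of_hasCompactSupport ((huc.pd i).mul_right)
  · exact (hu.continuous.mul h1).integrable_of_hasCompactSupport (huc.mul_right)
  · exact (hu.continuous.mul hf.continuous).integrable_of_hasCompactSupport (huc.mul_right)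
  · exact fun x _ => hu.differentiable one_ne_zero x
  · exact fun x _ => hf.differentiable one_ne_zero x

end PartialDerivatives

/-! ### The energy inequality at a fixed time -/

section Energy

variable {d : ℕ}

lemma energy_pointwise (ψ p M γ cn C1 Cm : ℝ) (hψ : 0 ≤ ψ) (hM : 0 < M) (hγ : 0 < γ) (hp : 0 ≤ p)
    (hp1 : p ≤ 1) (dp dψ J1 Jm bn : Fin d → ℝ) (a D : Fin d → Fin d → ℝ)
    (hell : ψ ≠ 0 → γ * ∑ i, dp i ^ 2 ≤ ∑ i, ∑ j, a i j * dp i * dp j) :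
    -(∑ i, ((dψ i * p + ψ * dp i) * 2 * J1 i - (dψ i * p ^ 2 + ψ * (2 * p * dp i)) * Jm i))
      + ψ * (2 * p * C1 - p ^ 2 * Cm)
      + ∑ i, (∑ j, (D i j * p ^ 2 + 2 * a i j * M * p * dp j)) * dψ i
    ≤ p ^ 2 * M * (∑ i, bn i * dψ i) + p ^ 2 * M * cn * ψ
      + ψ * (∑ i, ((J1 i - ∑ j, (D i j * p + a i j * M * dp j) + bn i * (p * M)) ^ 2
          + (Jm i - ∑ j, D i j + bn i * M) ^ 2)) / (γ * M)
      + ∑ i, (2 * |J1 i - ∑ j, (D i j * p + a i j * M * dp j) + bn i * (p * M)|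
          + |Jm i - ∑ j, D i j + bn i * M|) * |dψ i|
      + ψ * (2 * |C1 - cn * (p * M)| + |Cm - cn * M|) := by
  set S : Fin d → ℝ := fun i => ∑ j, D i j with hS
  set Tt : Fin d → ℝ := fun i => ∑ j, a i j * dp j with hT
  have e1 : ∀ i, ∑ j, (D i j * p ^ 2 + 2 * a i j * M * p * dp j) = S i * p ^ 2 + 2 * M * p * Tt i := by
    intro i
    simp only [hS, hT, Finset.sum_add_distrib, Finset.sum_mul, Finset.mul_sum]
    congr 1
    exact Finset.sum_congr rfl fun j _ => by ring
  have e2 : ∀ i, ∑ j, (D i j * p + a i j * M * dp j) = S i * p + M * Tt i := by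
    intro i
    simp only [hS, hT, Finset.sum_add_distrib, Finset.sum_mul, Finset.mul_sum]
    congr 1
    exact Finset.sum_congr rfl fun j _ => by ring
  have e3 : ∑ i, ∑ j, a i j * dp i * dp j = ∑ i, dp i * Tt i := by
    simp only [hT, Finset.mul_sum]
    exact Finset.sum_congr rfl fun i _ => Finset.sum_congr rfl fun j _ => by ring
  simp only [e1, e2]
  rw [e3] at hell
  set E1 : Fin d → ℝ := fun i => J1 i - (S i * p + M * Tt i) + bn i * (p * M) with hE1
  set Em : Fin d → ℝ := fun i => Jm i - S i + bn i * M with hEm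
  have key : -(∑ i, ((dψ i * p + ψ * dp i) * 2 * J1 i - (dψ i * p ^ 2 + ψ * (2 * p * dp i)) * Jm i))
      + ∑ i, (S i * p ^ 2 + 2 * M * p * Tt i) * dψ i
      = p ^ 2 * M * (∑ i, bn i * dψ i) - 2 * ψ * M * (∑ i, dp i * Tt i)
        - 2 * ψ * ∑ i, dp i * (E1 i - p * Em i) - ∑ i, dψ i * (2 * p * E1 i - p ^ 2 * Em i) := by
    simp only [Finset.mul_sum, ← Finset.sum_neg_distrib, ← Finset.sum_add_distrib,
      ← Finset.sum_sub_distrib]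
    refine Finset.sum_congr rfl fun i _ => ?_
    simp only [hE1, hEm]; ring
  have h1 : - ∑ i, dψ i * (2 * p * E1 i - p ^ 2 * Em i) ≤ ∑ i, (2 * |E1 i| + |Em i|) * |dψ i| := by
    rw [← Finset.sum_neg_distrib]
    refine Finset.sum_le_sum fun i _ => ?_
    have : -(dψ i * (2 * p * E1 i - p ^ 2 * Em i)) ≤ |dψ i| * |2 * p * E1 i - p ^ 2 * Em i| := by
      rw [← abs_mul]; exact neg_le_abs _
    have h2 : |2 * p * E1 i - p ^ 2 * Em i| ≤ 2 * |E1 i| + |Em i| := by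
      refine (abs_sub _ _).trans ?_
      rw [abs_mul, abs_mul, abs_mul, abs_of_nonneg hp, abs_of_nonneg (sq_nonneg p), abs_two]
      have : p ^ 2 ≤ 1 := pow_le_one₀ hp hp1
      nlinarith [abs_nonneg (E1 i), abs_nonneg (Em i)]
    nlinarith [abs_nonneg (dψ i)]
  have h2 : ψ * (2 * p * C1 - p ^ 2 * Cm) ≤ p ^ 2 * M * cn * ψ
      + ψ * (2 * |C1 - cn * (p * M)| + |Cm - cn * M|) := by
    have : 2 * p * C1 - p ^ 2 * Cm ≤ p ^ 2 * M * cn + (2 * |C1 - cn * (p * M)| + |Cm - cn * M|) := by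
      have a1 := le_abs_self (C1 - cn * (p * M))
      have a2 := neg_abs_le (Cm - cn * M)
      have : p ^ 2 ≤ 1 := pow_le_one₀ hp hp1
      have e : 2 * p * C1 - p ^ 2 * Cm = p ^ 2 * M * cn + (2 * p * (C1 - cn * (p * M))
        - p ^ 2 * (Cm - cn * M)) := by ring
      rw [e]
      nlinarith [abs_nonneg (C1 - cn * (p * M)), abs_nonneg (Cm - cn * M), sq_nonneg p]
    nlinarith
  have h3 : - 2 * ψ * M * (∑ i, dp i * Tt i) - 2 * ψ * ∑ i, dp i * (E1 i - p * Em i)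
      ≤ ψ * (∑ i, (E1 i ^ 2 + Em i ^ 2)) / (γ * M) := by
    rcases hψ.eq_or_lt with h0 | hpos
    · simp [← h0]
    have hl := hell hpos.ne'
    have h4 : ∀ i, - 2 * M * γ * dp i ^ 2 - 2 * (dp i * (E1 i - p * Em i))
        ≤ (E1 i ^ 2 + Em i ^ 2) / (γ * M) := by
      intro i
      rw [le_div_iff₀ (by positivity)]
      have hx : (E1 i - p * Em i) ^ 2 ≤ 2 * (E1 i ^ 2 + Em i ^ 2) := by
        have : p ^ 2 ≤ 1 := pow_le_one₀ hp hp1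
        nlinarith [sq_nonneg (E1 i + p * Em i), sq_nonneg (Em i)]
      nlinarith [sq_nonneg (2 * (M * γ * dp i) + (E1 i - p * Em i))]
    have h5 := Finset.sum_le_sum fun i (_ : i ∈ Finset.univ) => h4 i
    rw [Finset.sum_sub_distrib, ← Finset.mul_sum, ← Finset.mul_sum, ← Finset.sum_div] at h5
    have h6 : - 2 * M * (∑ i, dp i * Tt i) - 2 * ∑ i, dp i * (E1 i - p * Em i)
      ≤ (∑ i, (E1 i ^ 2 + Em i ^ 2)) / (γ * M) := by nlinarith
    have := mul_le_mul_of_nonneg_left h6 hψ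
    calc _ = ψ * (- 2 * M * (∑ i, dp i * Tt i) - 2 * ∑ i, dp i * (E1 i - p * Em i)) := by ring
      _ ≤ _ := this
      _ = _ := by ring
  linarith

end Energy

/-! ### Convolution with respect to a measure -/

section MeasureConvolution

variable {d : ℕ}

/-- The convolution `x ↦ ∫ w(y) φ(x - y) ρ(dy)`. -/
def cv (ρ : Measure (Rd d)) (w φ : Rd d → ℝ) (x : Rd d) : ℝ := ∫ y, w y * φ (x - y) ∂ρ

variable {ρ : Measure (Rd d)} {w φ : Rd d → ℝ}

lemma contDiff_cv {n : ℕ∞} (hw : Integrable w ρ) (hφ : ContDiff ℝ n φ)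
    (hφc : HasCompactSupport φ) : ContDiff ℝ n (cv ρ w φ) :=
  hφc.contDiff_convolution_right (ContinuousLinearMap.mul ℝ ℝ) hw.locallyIntegrable hφ

lemma continuous_cv (hw : Integrable w ρ) (hφ : Continuous φ) (hφc : HasCompactSupport φ) :
    Continuous (cv ρ w φ) :=
  (contDiff_cv (n := 0) hw (contDiff_zero.2 hφ) hφc).continuous

lemma integrable_mul_comp_sub (hw : Integrable w ρ) (hφ : Continuous φ)
    (hφc : HasCompactSupport φ) (x : Rd d) : Integrable (fun y => w y * φ (x - y)) ρ := by
  obtain ⟨C, hC⟩ := hφc.exists_bound_of_continuous hφ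
  exact hw.mul_bdd (c := C) (hφ.comp (by fun_prop)).aestronglyMeasurable
    (Filter.Eventually.of_forall fun y => hC _)

lemma pd_cv (hw : Integrable w ρ) (hφ : ContDiff ℝ 1 φ) (hφc : HasCompactSupport φ) (i : Fin d) :
    pd i (cv ρ w φ) = cv ρ w (pd i φ) := by
  funext x
  obtain ⟨C, hC⟩ := (hφc.fderiv ℝ).exists_bound_of_continuous (hφ.continuous_fderiv one_ne_zero)
  have hm : ∀ x, AEStronglyMeasurable (fun y => w y • fderiv ℝ φ (x - y)) ρ := fun x =>
    hw.aestronglyMeasurable.smul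
      ((hφ.continuous_fderiv one_ne_zero).comp (by fun_prop)).aestronglyMeasurable
  have hb : ∀ x y, ‖w y • fderiv ℝ φ (x - y)‖ ≤ |w y| * C := fun x y => by
    rw [norm_smul, Real.norm_eq_abs]
    exact mul_le_mul_of_nonneg_left (hC _) (abs_nonneg _)
  have h : HasFDerivAt (cv ρ w φ) (∫ y, w y • fderiv ℝ φ (x - y) ∂ρ) x := by
    refine hasFDerivAt_integral_of_dominated_of_fderiv_le (bound := fun y => |w y| * C)
      (s := univ) Filter.univ_mem ?_ (integrable_mul_comp_sub hw hφ.continuous hφc x) (hm x)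
      (Filter.Eventually.of_forall fun y x _ => hb x y) (hw.norm.mul_const C)
      (Filter.Eventually.of_forall fun y x _ => ?_)
    · exact Filter.Eventually.of_forall fun x =>
        (integrable_mul_comp_sub hw hφ.continuous hφc x).aestronglyMeasurable
    · exact ((hφ.differentiable one_ne_zero (x - y)).hasFDerivAt.comp x
        ((hasFDerivAt_id x).sub_const y)).const_mul (w y)
  rw [pd_eq_of_hasFDerivAt i h, ContinuousLinearMap.integral_apply]
  · simp [cv, pd]
  · exact (hw.norm.mul_const C).mono' (hm x) (Filter.Eventually.of_forall fun y => hb x y)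

lemma abs_cv_le (x : Rd d) :
    |cv ρ w φ x| ≤ cv ρ (fun y => |w y|) (fun y => |φ y|) x := by
  refine (abs_integral_le_integral_abs).trans (le_of_eq ?_)
  simp only [cv, abs_mul]

lemma cv_nonneg (hw : ∀ y, 0 ≤ w y) (hφ : ∀ y, 0 ≤ φ y) (x : Rd d) : 0 ≤ cv ρ w φ x :=
  integral_nonneg fun y => mul_nonneg (hw y) (hφ _)

lemma integrable_prod_mul_comp_sub [SFinite ρ] (hw : Integrable w ρ) (hφ : Continuous φ)
    (hφc : HasCompactSupport φ) {ψ : Rd d → ℝ} (hψ : Continuous ψ) {C : ℝ}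
    (hC : ∀ x, |ψ x| ≤ C) :
    Integrable (fun z : Rd d × Rd d => ψ z.1 * (w z.2 * φ (z.1 - z.2))) (volume.prod ρ) := by
  have hφi : Integrable φ := hφ.integrable_of_hasCompactSupport hφc
  have hm : AEStronglyMeasurable (fun z : Rd d × Rd d => w z.2 * φ (z.1 - z.2))
      (volume.prod ρ) :=
    hw.aestronglyMeasurable.comp_snd.mul (hφ.comp (by fun_prop)).aestronglyMeasurable
  have h : Integrable (fun z : Rd d × Rd d => w z.2 * φ (z.1 - z.2)) (volume.prod ρ) := by
    rw [integrable_prod_iff' hm]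
    refine ⟨Filter.Eventually.of_forall fun y => (hφi.comp_sub_right y).const_mul (w y), ?_⟩
    simp only [norm_mul, integral_const_mul]
    have : ∀ y, ∫ x, ‖φ (x - y)‖ = ∫ x, ‖φ x‖ := fun y =>
      integral_sub_right_eq_self (fun x => ‖φ x‖) y
    simp only [this]
    exact hw.norm.mul_const _
  exact h.bdd_mul (c := C) (hψ.comp continuous_fst).aestronglyMeasurable
    (Filter.Eventually.of_forall fun z => hC _)

lemma integral_mul_cv [SFinite ρ] (hw : Integrable w ρ) (hφ : Continuous φ)
    (hφc : HasCompactSupport φ) {ψ : Rd d → ℝ} (hψ : Continuous ψ) {C : ℝ}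
    (hC : ∀ x, |ψ x| ≤ C) :
    ∫ x, ψ x * cv ρ w φ x = ∫ y, w y * ∫ x, ψ x * φ (x - y) ∂volume ∂ρ := by
  have h := integrable_prod_mul_comp_sub hw hφ hφc hψ hC
  calc ∫ x, ψ x * cv ρ w φ x = ∫ x, ∫ y, ψ x * (w y * φ (x - y)) ∂ρ := by
        simp only [cv, integral_const_mul]
    _ = ∫ y, ∫ x, ψ x * (w y * φ (x - y)) ∂volume ∂ρ := integral_integral_swap h
    _ = _ := by
        congr 1; ext y
        rw [← integral_const_mul]
        congr 1; ext x; ring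

lemma integrable_cv [SFinite ρ] (hw : Integrable w ρ) (hφ : Continuous φ)
    (hφc : HasCompactSupport φ) : Integrable (cv ρ w φ) := by
  have h := (integrable_prod_mul_comp_sub hw hφ hφc (ψ := fun _ => 1) continuous_const
    (C := 1) (by simp)).integral_prod_left
  simp only [one_mul] at h
  exact h

lemma integral_cv [SFinite ρ] (hw : Integrable w ρ) (hφ : Continuous φ)
    (hφc : HasCompactSupport φ) : ∫ x, cv ρ w φ x = (∫ y, w y ∂ρ) * ∫ x, φ x := by
  have h := integral_mul_cv hw hφ hφc (ψ := fun _ => 1) continuous_const (C := 1) (by simp)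
  simp only [one_mul] at h
  rw [h, ← integral_mul_const]
  congr 1; ext y
  rw [integral_sub_right_eq_self φ y]

lemma cv_mono {w' φ' : Rd d → ℝ} (hw : Integrable w ρ) (hw' : Integrable w' ρ)
    (hφ : Continuous φ) (hφc : HasCompactSupport φ) (hφ' : Continuous φ')
    (hφc' : HasCompactSupport φ') (x : Rd d)
    (h : ∀ y, w y * φ (x - y) ≤ w' y * φ' (x - y)) : cv ρ w φ x ≤ cv ρ w' φ' x :=
  integral_mono (integrable_mul_comp_sub hw hφ hφc x) (integrable_mul_comp_sub hw' hφ' hφc' x) h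

end MeasureConvolution

/-! ### Mollifiers -/

section Mollifier

variable {d : ℕ}

/-- The bump function from which mollifiers are built. -/
def mollBump (d : ℕ) : ContDiffBump (0 : Rd d) := ⟨1 / 2, 1, by norm_num, by norm_num⟩

/-- The kernel `z ↦ N g(z/ε)^k` where `g` is a fixed bump function and `N` normalizes `g(·/ε)^4`. -/
def mollPow (ε : ℝ) (k : ℕ) (z : Rd d) : ℝ :=
  (∫ y : Rd d, mollBump d (ε⁻¹ • y) ^ 4)⁻¹ * mollBump d (ε⁻¹ • z) ^ k

/-- The standard mollifier at scale `ε`. -/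
abbrev moll (ε : ℝ) : Rd d → ℝ := mollPow ε 4

lemma mollPow_contDiff (ε : ℝ) (k : ℕ) : ContDiff ℝ (⊤ : ℕ∞) (mollPow (d := d) ε k) := by
  unfold mollPow
  exact contDiff_const.mul (((mollBump d).contDiff.comp (contDiff_const_smul _)).pow k)

lemma mollPow_continuous (ε : ℝ) (k : ℕ) : Continuous (mollPow (d := d) ε k) :=
  (mollPow_contDiff ε k).continuous

lemma mollPow_nonneg (ε : ℝ) (k : ℕ) (z : Rd d) : 0 ≤ mollPow ε k z := by
  unfold mollPow
  exact mul_nonneg (inv_nonneg.2 (integral_nonneg fun y => pow_nonneg (mollBump d).nonneg _))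
    (pow_nonneg (mollBump d).nonneg _)

lemma mollPow_eq_zero {ε : ℝ} (hε : 0 < ε) {k : ℕ} (hk : k ≠ 0) {z : Rd d} (hz : ε ≤ ‖z‖) :
    mollPow ε k z = 0 := by
  unfold mollPow
  rw [(mollBump d).zero_of_le_dist, zero_pow hk, mul_zero]
  rw [dist_zero_right, norm_smul, norm_inv, Real.norm_of_nonneg hε.le]
  change 1 ≤ ε⁻¹ * ‖z‖
  rw [inv_mul_eq_div, le_div_iff₀ hε, one_mul]; exact hz

lemma tsupport_mollPow_subset {ε : ℝ} (hε : 0 < ε) {k : ℕ} (hk : k ≠ 0) :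
    tsupport (mollPow (d := d) ε k) ⊆ Metric.closedBall 0 ε := by
  refine closure_minimal (fun z hz => ?_) Metric.isClosed_closedBall
  by_contra h
  rw [mem_closedBall_zero_iff, not_le] at h
  exact hz (mollPow_eq_zero hε hk h.le)

lemma mollPow_hasCompactSupport {ε : ℝ} (hε : 0 < ε) {k : ℕ} (hk : k ≠ 0) :
    HasCompactSupport (mollPow (d := d) ε k) :=
  (isCompact_closedBall _ _).of_isClosed_subset (isClosed_tsupport _) (tsupport_mollPow_subset hε hk)

lemma integral_mollBump_comp (ε : ℝ) (hε : 0 < ε) (k : ℕ) :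
    ∫ y : Rd d, mollBump d (ε⁻¹ • y) ^ k = ε ^ d * ∫ y : Rd d, mollBump d y ^ k := by
  rw [Measure.integral_comp_inv_smul volume (fun y => mollBump d y ^ k) ε]
  simp [abs_of_pos hε]

lemma integral_mollBump_pos (k : ℕ) (hk : k ≠ 0) : 0 < ∫ y : Rd d, mollBump d y ^ k := by
  refine Continuous.integral_pos_of_hasCompactSupport_nonneg_nonzero (x := 0)
    ((mollBump d).continuous.pow k) ?_ (fun x => pow_nonneg (mollBump d).nonneg _) ?_
  · exact (mollBump d).hasCompactSupport.comp_left (g := fun r : ℝ => r ^ k) (zero_pow hk)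
  · rw [(mollBump d).one_of_mem_closedBall (by simp [mollBump])]; simp

lemma integral_mollPow (ε : ℝ) (hε : 0 < ε) (k : ℕ) :
    ∫ y : Rd d, mollPow ε k y = (∫ y : Rd d, mollBump d y ^ k) / ∫ y : Rd d, mollBump d y ^ 4 := by
  unfold mollPow
  rw [integral_const_mul, integral_mollBump_comp ε hε, integral_mollBump_comp ε hε]
  have := integral_mollBump_pos (d := d) 4 (by norm_num)
  field_simp

lemma integral_moll (ε : ℝ) (hε : 0 < ε) : ∫ y : Rd d, moll ε y = 1 := by
  rw [integral_mollPow ε hε, div_self (integral_mollBump_pos 4 (by norm_num)).ne']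

lemma mollPow_le {ε : ℝ} {k l : ℕ} (hkl : k ≤ l) (z : Rd d) : mollPow ε l z ≤ mollPow ε k z := by
  unfold mollPow
  exact mul_le_mul_of_nonneg_left
    (pow_le_pow_of_le_one (mollBump d).nonneg (mollBump d).le_one hkl)
    (inv_nonneg.2 (integral_nonneg fun y => pow_nonneg (mollBump d).nonneg _))

lemma mollPow_sq (ε : ℝ) (k l m : ℕ) (h : k + m = 2 * l) (z : Rd d) :
    mollPow ε l z ^ 2 = mollPow ε k z * mollPow ε m z := by
  unfold mollPow
  rw [mul_pow, ← pow_mul, show l * 2 = k + m by omega, pow_add]; ring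

lemma exists_abs_pd_moll_le (d : ℕ) : ∃ C : ℝ, 0 ≤ C ∧ ∀ ε : ℝ, 0 < ε → ∀ (i : Fin d) (z : Rd d),
    |pd i (moll ε) z| ≤ C / ε * mollPow ε 3 z := by
  have hc : HasCompactSupport (fderiv ℝ (mollBump d)) := (mollBump d).hasCompactSupport.fderiv ℝ
  obtain ⟨C, hC⟩ := hc.exists_bound_of_continuous
    (((mollBump d).contDiff (n := 1)).continuous_fderiv one_ne_zero)
  have hC0 : 0 ≤ C := (norm_nonneg _).trans (hC 0)
  refine ⟨4 * C, by positivity, fun ε hε i z => ?_⟩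
  have hd : HasFDerivAt (moll (d := d) ε) ((∫ y : Rd d, mollBump d (ε⁻¹ • y) ^ 4)⁻¹ •
      ((4 * mollBump d (ε⁻¹ • z) ^ 3) • ((fderiv ℝ (mollBump d) (ε⁻¹ • z)).comp
        (ε⁻¹ • ContinuousLinearMap.id ℝ (Rd d))))) z := by
    have h1 : HasFDerivAt (fun z : Rd d => mollBump d (ε⁻¹ • z))
        ((fderiv ℝ (mollBump d) (ε⁻¹ • z)).comp (ε⁻¹ • ContinuousLinearMap.id ℝ (Rd d))) z := by
      have h2 : HasFDerivAt (fun z : Rd d => ε⁻¹ • z) (ε⁻¹ • ContinuousLinearMap.id ℝ (Rd d)) z :=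
        (ε⁻¹ • ContinuousLinearMap.id ℝ (Rd d)).hasFDerivAt
      exact (((mollBump d).contDiff (n := 1)).differentiable one_ne_zero _).hasFDerivAt.comp z h2
    have := (h1.pow 4).const_mul (∫ y : Rd d, mollBump d (ε⁻¹ • y) ^ 4)⁻¹
    refine this.congr_fderiv ?_
    ext v; simp
  rw [pd_eq_of_hasFDerivAt i hd]
  simp only [smul_apply, ContinuousLinearMap.comp_apply,
    ContinuousLinearMap.id_apply, map_smul, smul_eq_mul]
  have hN : 0 ≤ (∫ y : Rd d, mollBump d (ε⁻¹ • y) ^ 4)⁻¹ :=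
    inv_nonneg.2 (integral_nonneg fun y => pow_nonneg (mollBump d).nonneg _)
  have hg : 0 ≤ mollBump d (ε⁻¹ • z) := (mollBump d).nonneg
  have hf : |fderiv ℝ (mollBump d) (ε⁻¹ • z) (EuclideanSpace.single i 1)| ≤ C :=
    (abs_pd_le_norm_fderiv i _ _).trans (hC _)
  rw [abs_mul, abs_mul, abs_mul, abs_mul, abs_of_nonneg hN, abs_of_nonneg (pow_nonneg hg 3),
    abs_of_pos (inv_pos.2 hε), abs_of_pos (by norm_num : (0:ℝ) < 4)]
  unfold mollPow
  calc _ = (∫ y : Rd d, mollBump d (ε⁻¹ • y) ^ 4)⁻¹ * (4 * mollBump d (ε⁻¹ • z) ^ 3) * ε⁻¹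
        * |fderiv ℝ (mollBump d) (ε⁻¹ • z) (EuclideanSpace.single i 1)| := by ring
    _ ≤ (∫ y : Rd d, mollBump d (ε⁻¹ • y) ^ 4)⁻¹ * (4 * mollBump d (ε⁻¹ • z) ^ 3) * ε⁻¹ * C := by
        gcongr
    _ = _ := by ring

end Mollifier

section EnergyIntegrated

variable {d : ℕ}

lemma integrable_of_eq_zero_off_tsupport {f ψ : Rd d → ℝ} (hf : Continuous f)
    (hψ : HasCompactSupport ψ) (h : ∀ x, x ∉ tsupport ψ → f x = 0) : Integrable f :=
  hf.integrable_of_hasCompactSupport (HasCompactSupport.intro hψ h)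

lemma eq_zero_of_notMem_tsupport {ψ : Rd d → ℝ} {x : Rd d} (hx : x ∉ tsupport ψ) : ψ x = 0 :=
  image_eq_zero_of_notMem_tsupport hx

lemma pd_eq_zero_of_notMem_tsupport {ψ : Rd d → ℝ} {x : Rd d} (hx : x ∉ tsupport ψ) (i : Fin d) :
    pd i ψ x = 0 :=
  image_eq_zero_of_notMem_tsupport fun h => hx (tsupport_pd_subset ψ i h)

lemma pd_pd_eq_zero_of_notMem_tsupport {ψ : Rd d → ℝ} {x : Rd d} (hx : x ∉ tsupport ψ)
    (i j : Fin d) : pd i (pd j ψ) x = 0 :=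
  pd_eq_zero_of_notMem_tsupport (fun h => hx (tsupport_pd_subset ψ j h)) i

lemma integrable_mul_pd_add {u f : Rd d → ℝ} (i : Fin d) (hu : ContDiff ℝ 1 u)
    (huc : HasCompactSupport u) (hf : ContDiff ℝ 1 f) :
    Integrable (fun x => u x * pd i f x + pd i u x * f x) ∧
      ∫ x, (u x * pd i f x + pd i u x * f x) = 0 := by
  have h1 : Integrable fun x => u x * pd i f x :=
    (hu.continuous.mul (hf.pd_continuous i)).integrable_of_hasCompactSupport huc.mul_right
  have h2 : Integrable fun x => pd i u x * f x :=
    ((hu.pd_continuous i).mul hf.continuous).integrable_of_hasCompactSupport (huc.pd i).mul_right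
  exact ⟨h1.add h2, by rw [integral_add h1 h2, integral_mul_pd i hu huc hf]; ring⟩

lemma integral_sum_eq_zero {ι α : Type*} [MeasurableSpace α] {μ : Measure α} (s : Finset ι)
    {f : ι → α → ℝ} (h : ∀ i ∈ s, Integrable (f i) μ ∧ ∫ x, f i x ∂μ = 0) :
    Integrable (fun x => ∑ i ∈ s, f i x) μ ∧ ∫ x, ∑ i ∈ s, f i x ∂μ = 0 := by
  refine ⟨integrable_finsetSum _ fun i hi => (h i hi).1, ?_⟩
  rw [integral_finsetSum _ fun i hi => (h i hi).1]
  exact Finset.sum_eq_zero fun i hi => (h i hi).2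

lemma energy_divergence_identity (ψ p M C1 Cm : ℝ) (dψ dp J1 Jm d1 dm : Fin d → ℝ)
    (a D H : Fin d → Fin d → ℝ) :
    ψ * (2 * p * (∑ i, d1 i + C1) - p ^ 2 * (∑ i, dm i + Cm))
      - ((-(∑ i, ((dψ i * p + ψ * dp i) * 2 * J1 i - (dψ i * p ^ 2 + ψ * (2 * p * dp i)) * Jm i))
        + ψ * (2 * p * C1 - p ^ 2 * Cm)
        + ∑ i, (∑ j, (D i j * p ^ 2 + 2 * a i j * M * p * dp j)) * dψ i)
        + p ^ 2 * M * (∑ i, ∑ j, a i j * H i j))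
    = 2 * (∑ i, (ψ * p * d1 i + (dψ i * p + ψ * dp i) * J1 i))
      - (∑ i, (ψ * p * p * dm i + (dψ i * p ^ 2 + ψ * (2 * p * dp i)) * Jm i))
      - ∑ i, ∑ j, (dψ i * (D i j * p ^ 2 + 2 * a i j * M * p * dp j)
        + H i j * (a i j * M * (p * p))) := by
  have h1 : 2 * (∑ i, (ψ * p * d1 i + (dψ i * p + ψ * dp i) * J1 i))
      = 2 * ψ * p * ∑ i, d1 i + ∑ i, (dψ i * p + ψ * dp i) * 2 * J1 i := by
    simp only [Finset.mul_sum, ← Finset.sum_add_distrib]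
    exact Finset.sum_congr rfl fun i _ => by ring
  have h2 : (∑ i, (ψ * p * p * dm i + (dψ i * p ^ 2 + ψ * (2 * p * dp i)) * Jm i))
      = ψ * p ^ 2 * ∑ i, dm i + ∑ i, (dψ i * p ^ 2 + ψ * (2 * p * dp i)) * Jm i := by
    simp only [Finset.mul_sum, ← Finset.sum_add_distrib]
    exact Finset.sum_congr rfl fun i _ => by ring
  have h3 : ∑ i, ∑ j, (dψ i * (D i j * p ^ 2 + 2 * a i j * M * p * dp j)
        + H i j * (a i j * M * (p * p)))
      = ∑ i, (∑ j, (D i j * p ^ 2 + 2 * a i j * M * p * dp j)) * dψ i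
        + p ^ 2 * M * (∑ i, ∑ j, a i j * H i j) := by
    simp only [Finset.mul_sum, Finset.sum_mul, ← Finset.sum_add_distrib]
    exact Finset.sum_congr rfl fun i _ => Finset.sum_congr rfl fun j _ => by ring
  rw [h1, h2, h3, Finset.sum_sub_distrib]
  ring

/-- The defect of `J` from being the flux `∑ⱼ ∂ⱼ(A i j R) - bᵢ R`. -/
def fluxDefect (A : Fin d → Fin d → Rd d → ℝ) (bn : Fin d → Rd d → ℝ) (R : Rd d → ℝ)
    (J : Fin d → Rd d → ℝ) (i : Fin d) (x : Rd d) : ℝ :=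
  J i x - ∑ j, pd j (fun y => A i j y * R y) x + bn i x * R x

lemma energy_inequality {ψ R M cn C1 Cm : Rd d → ℝ} {J1 Jm bn : Fin d → Rd d → ℝ}
    {A : Fin d → Fin d → Rd d → ℝ} {γ : ℝ} (hψ : IsTest ψ) (hψ0 : ∀ x, 0 ≤ ψ x)
    (hR : ContDiff ℝ 1 R) (hM : ContDiff ℝ 1 M) (hR0 : ∀ x, 0 ≤ R x) (hRM : ∀ x, R x ≤ M x)
    (hM0 : ∀ x, 0 < M x) (hA : ∀ i j, ContDiff ℝ 1 (A i j)) (hJ1 : ∀ i, ContDiff ℝ 1 (J1 i))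
    (hJm : ∀ i, ContDiff ℝ 1 (Jm i)) (hC1 : Continuous C1) (hCm : Continuous Cm)
    (hγ : 0 < γ)
    (hell : ∀ x, ψ x ≠ 0 → ∀ ξ : Fin d → ℝ,
      γ * ∑ i, ξ i ^ 2 ≤ ∑ i, ∑ j, A i j x * ξ i * ξ j)
    {g : Rd d → ℝ} (hg : Integrable g) (hle : ∀ x, (R x / M x) ^ 2 * M x * (∑ i, ∑ j, A i j x * pd j (pd i ψ) x)
      + (R x / M x) ^ 2 * M x * (∑ i, bn i x * pd i ψ x) + (R x / M x) ^ 2 * M x * cn x * ψ x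
      + ψ x * (∑ i, (fluxDefect A bn R J1 i x ^ 2 + fluxDefect A bn M Jm i x ^ 2)) / (γ * M x)
      + ∑ i, (2 * |fluxDefect A bn R J1 i x| + |fluxDefect A bn M Jm i x|) * |pd i ψ x|
      + ψ x * (2 * |C1 x - cn x * R x| + |Cm x - cn x * M x|) ≤ g x) :
    ∫ x, ψ x * (2 * (R x / M x) * (∑ i, pd i (J1 i) x + C1 x)
        - (R x / M x) ^ 2 * (∑ i, pd i (Jm i) x + Cm x))
    ≤ ∫ x, g x := by
  set p : Rd d → ℝ := fun x => R x / M x with hpdef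
  have hp : ContDiff ℝ 1 p := hR.div hM fun x => (hM0 x).ne'
  have hpM : ∀ x, R x = p x * M x := fun x => by
    simp only [hpdef]; field_simp [(hM0 x).ne']
  have hψ1 : ContDiff ℝ 1 ψ := hψ.contDiff_one
  have hpd1 : ∀ i, ContDiff ℝ 1 (pd i ψ) := fun i => (hψ.pd i).contDiff_one
  have hdψ : ∀ x, DifferentiableAt ℝ ψ x := fun x => hψ1.differentiable one_ne_zero x
  have hdp : ∀ x, DifferentiableAt ℝ p x := fun x => hp.differentiable one_ne_zero x
  have hdM : ∀ x, DifferentiableAt ℝ M x := fun x => hM.differentiable one_ne_zero x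
  have hdA : ∀ i j x, DifferentiableAt ℝ (A i j) x := fun i j x =>
    (hA i j).differentiable one_ne_zero x
  have cψ := hψ.continuous
  have cp := hp.continuous
  have cM := hM.continuous
  have cR := hR.continuous
  have cA := fun i j => (hA i j).continuous
  have cpp := fun i => hp.pd_continuous i
  have cpψ := fun i => hψ1.pd_continuous i
  have cppψ := fun i j => (hpd1 i).pd_continuous j
  have cJ1 := fun i => (hJ1 i).continuous
  have cJm := fun i => (hJm i).continuous
  have cpJ1 := fun i => (hJ1 i).pd_continuous i
  have cpJm := fun i => (hJm i).pd_continuous i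
  have cD : ∀ i j, Continuous (pd j (fun y => A i j y * M y)) :=
    fun i j => ((hA i j).mul hM).pd_continuous j
  -- integration by parts for the two fluxes
  have hu : ContDiff ℝ 1 (fun x => ψ x * p x) := hψ1.mul hp
  have hv : ContDiff ℝ 1 (fun x => ψ x * p x * p x) := hu.mul hp
  have ibp1 := fun i => integrable_mul_pd_add i hu hψ.2.mul_right (hJ1 i)
  have ibp2 := fun i => integrable_mul_pd_add i hv (hψ.2.mul_right.mul_right) (hJm i)
  have ibp3 := fun i j => integrable_mul_pd_add j (hpd1 i) (hψ.2.pd i)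
    (((hA i j).mul hM).mul (hp.mul hp))
  have e1 : ∀ i x, pd i (fun x => ψ x * p x) x = pd i ψ x * p x + ψ x * pd i p x := fun i x =>
    pd_mul i (hdψ x) (hdp x)
  have e2 : ∀ i x, pd i (fun x => ψ x * p x * p x) x
      = pd i ψ x * p x ^ 2 + ψ x * (2 * p x * pd i p x) := fun i x => by
    rw [pd_mul (f := fun x => ψ x * p x) i ((hdψ x).mul (hdp x)) (hdp x), e1]; ring
  have e3 : ∀ i j x, pd j (fun y => A i j y * M y * (p y * p y)) x
      = pd j (fun y => A i j y * M y) x * p x ^ 2 + 2 * A i j x * M x * p x * pd j p x :=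
    fun i j x => by
      rw [pd_mul (f := fun y => A i j y * M y) (g := fun y => p y * p y) j
        ((hdA i j x).mul (hdM x)) ((hdp x).mul (hdp x)), pd_mul j (hdp x) (hdp x)]; ring
  have e4 : ∀ i j x, pd j (fun y => A i j y * R y) x
      = pd j (fun y => A i j y * M y) x * p x + A i j x * M x * pd j p x := fun i j x => by
    have : (fun y => A i j y * R y) = fun y => (A i j y * M y) * p y := by
      funext y; rw [hpM y]; ring
    rw [this, pd_mul (f := fun y => A i j y * M y) j ((hdA i j x).mul (hdM x)) (hdp x)]
  have I : ∀ {f : Rd d → ℝ}, Continuous f → (∀ x, x ∉ tsupport ψ → f x = 0) → Integrable f :=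
    fun hf h => integrable_of_eq_zero_off_tsupport hf hψ.2 h
  have henergy : ∫ x, ψ x * (2 * p x * (∑ i, pd i (J1 i) x + C1 x)
        - p x ^ 2 * (∑ i, pd i (Jm i) x + Cm x))
      = ∫ x, ((-(∑ i, ((pd i ψ x * p x + ψ x * pd i p x) * 2 * J1 i x
          - (pd i ψ x * p x ^ 2 + ψ x * (2 * p x * pd i p x)) * Jm i x))
        + ψ x * (2 * p x * C1 x - p x ^ 2 * Cm x)
        + ∑ i, (∑ j, (pd j (fun y => A i j y * M y) x * p x ^ 2
            + 2 * A i j x * M x * p x * pd j p x)) * pd i ψ x)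
        + p x ^ 2 * M x * (∑ i, ∑ j, A i j x * pd j (pd i ψ) x)) := by
    simp only [e1, e2] at ibp1 ibp2
    simp only [e3] at ibp3
    have z1 := integral_sum_eq_zero Finset.univ fun i _ => ibp1 i
    have z2 := integral_sum_eq_zero Finset.univ fun i _ => ibp2 i
    have z3 := integral_sum_eq_zero Finset.univ fun i _ =>
      integral_sum_eq_zero Finset.univ fun j _ => ibp3 i j
    have z12 := (z1.1.const_mul 2).sub z2.1
    have z := integral_sub z12 z3.1
    simp only [Pi.sub_apply] at z
    rw [integral_sub (z1.1.const_mul 2) z2.1, integral_const_mul, z1.2, z2.2, z3.2] at z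
    rw [← sub_eq_zero, ← integral_sub (I (by fun_prop) fun x hx => by
        simp [eq_zero_of_notMem_tsupport hx]) (I (by fun_prop) fun x hx => by
        simp [eq_zero_of_notMem_tsupport hx, pd_eq_zero_of_notMem_tsupport hx,
          pd_pd_eq_zero_of_notMem_tsupport hx])]
    refine Eq.trans ?_ (z.trans (by ring))
    congr 1; ext x
    exact energy_divergence_identity (ψ x) (p x) (M x) (C1 x) (Cm x) (fun i => pd i ψ x)
      (fun i => pd i p x) (fun i => J1 i x) (fun i => Jm i x) (fun i => pd i (J1 i) x)
      (fun i => pd i (Jm i) x) (fun i j => A i j x) (fun i j => pd j (fun y => A i j y * M y) x)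
      (fun i j => pd j (pd i ψ) x)
  simp only [← show ∀ x, p x = R x / M x from fun _ => rfl]
  rw [henergy]
  refine integral_mono (I ?_ ?_) hg fun x => le_trans ?_ (hle x)
  · fun_prop
  · intro x hx
    simp [eq_zero_of_notMem_tsupport hx, pd_eq_zero_of_notMem_tsupport hx,
      pd_pd_eq_zero_of_notMem_tsupport hx]
  have key := energy_pointwise (ψ x) (p x) (M x) γ (cn x) (C1 x) (Cm x) (hψ0 x) (hM0 x) hγ
    (div_nonneg (hR0 x) (hM0 x).le) ((div_le_one (hM0 x)).2 (hRM x)) (fun i => pd i p x)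
    (fun i => pd i ψ x) (fun i => J1 i x) (fun i => Jm i x) (fun i => bn i x)
    (fun i j => A i j x) (fun i j => pd j (fun y => A i j y * M y) x) (fun h => hell x h _)
  simp only [fluxDefect, e4]
  simp only [← hpM] at key
  linarith

end EnergyIntegrated

section FrozenTime

variable {d : ℕ}

/-- Diffusion coefficients at a fixed time, cut off outside the ball of radius `r + 2`. -/
structure FrozenCoeff (r γ K Λ : ℝ) (a : Fin d → Fin d → Rd d → ℝ) : Prop where
  meas : ∀ i j, Measurable (a i j)
  bdd : ∀ i j x, |a i j x| ≤ K
  supp : ∀ i j x, x ∉ Metric.ball (0 : Rd d) (r + 2) → a i j x = 0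
  ell : ∀ x ∈ Metric.ball (0 : Rd d) (r + 2), ∀ ξ : Fin d → ℝ,
    γ * ∑ i, ξ i ^ 2 ≤ ∑ i, ∑ j, a i j x * ξ i * ξ j
  lip : ∀ x ∈ Metric.ball (0 : Rd d) (r + 2), ∀ y ∈ Metric.ball (0 : Rd d) (r + 2), ∀ i j,
    |a i j x - a i j y| ≤ Λ * dist x y
  ell_pos : 0 < γ
  bdd_nonneg : 0 ≤ K
  lip_nonneg : 0 ≤ Λ

lemma abs_integral_le_of_abs_le {α : Type*} [MeasurableSpace α] {m : Measure α} {f g : α → ℝ}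
    (hg : Integrable g m) (h : ∀ x, |f x| ≤ g x) : |∫ x, f x ∂m| ≤ ∫ x, g x ∂m :=
  (Real.norm_eq_abs _).symm.le.trans
    (norm_integral_le_of_norm_le hg (Filter.Eventually.of_forall h))

lemma mollPow_pd_hasCompactSupport {ε : ℝ} (hε : 0 < ε) (j : Fin d) :
    HasCompactSupport (pd j (moll (d := d) ε)) :=
  (mollPow_hasCompactSupport hε (by norm_num)).pd j

lemma moll_contDiff_one (ε : ℝ) : ContDiff ℝ 1 (moll (d := d) ε) :=
  (mollPow_contDiff ε 4).of_le (by exact_mod_cast le_top)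

lemma pd_moll_continuous (ε : ℝ) (j : Fin d) : Continuous (pd j (moll (d := d) ε)) :=
  (moll_contDiff_one ε).pd_continuous j

lemma pd_moll_contDiff_one (ε : ℝ) (j : Fin d) : ContDiff ℝ 1 (pd j (moll (d := d) ε)) :=
  ((mollPow_contDiff ε 4).pd_top j).of_le (by exact_mod_cast le_top)

lemma integral_pd_moll {ε : ℝ} (hε : 0 < ε) (j : Fin d) : ∫ z, pd j (moll (d := d) ε) z = 0 := by
  have := integral_mul_pd (f := fun _ => (1 : ℝ)) j (moll_contDiff_one (d := d) ε)
    (mollPow_hasCompactSupport hε (by norm_num)) contDiff_const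
  simp only [mul_one] at this
  rw [eq_neg_iff_add_eq_zero] at this
  simpa [pd] using this

/-- The density of `ρ` mollified at scale `ε`. -/
def mollDens (ρ : Measure (Rd d)) (ε : ℝ) : Rd d → ℝ := cv ρ (fun _ => 1) (moll ε)

/-- The mollified diffusion coefficients. -/
def mollCoeff (a : Fin d → Fin d → Rd d → ℝ) (ε : ℝ) (i j : Fin d) : Rd d → ℝ :=
  cv volume (a i j) (moll ε)

/-- The mollified flux of the equation. -/
def mollFlux (ρ : Measure (Rd d)) (a : Fin d → Fin d → Rd d → ℝ) (b : Fin d → Rd d → ℝ) (ε : ℝ)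
    (i : Fin d) (x : Rd d) : ℝ :=
  ∑ j, cv ρ (a i j) (pd j (moll ε)) x - cv ρ (b i) (moll ε) x

/-- The commutator of mollification with multiplication by the diffusion coefficients. -/
def mollComm (ρ : Measure (Rd d)) (a : Fin d → Fin d → Rd d → ℝ) (ε : ℝ) (i : Fin d) (x : Rd d) : ℝ :=
  ∑ j, (cv ρ (a i j) (pd j (moll ε)) x - pd j (fun y => mollCoeff a ε i j y * mollDens ρ ε y) x)

/-- The integral kernel of `mollComm`. -/
def commKer (a : Fin d → Fin d → Rd d → ℝ) (ε : ℝ) (i : Fin d) (x y : Rd d) : ℝ :=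
  ∑ j, ((a i j y - mollCoeff a ε i j x) * pd j (moll ε) (x - y)
    - pd j (mollCoeff a ε i j) x * moll ε (x - y))

variable {ρ : Measure (Rd d)} [IsFiniteMeasure ρ] {r γ K Λ : ℝ} {a : Fin d → Fin d → Rd d → ℝ}

lemma FrozenCoeff.integrable (ha : FrozenCoeff r γ K Λ a) (i j : Fin d) : Integrable (a i j) ρ :=
  Integrable.of_bound (ha.meas i j).aestronglyMeasurable K
    (Filter.Eventually.of_forall fun x => ha.bdd i j x)

lemma FrozenCoeff.integrable_volume (ha : FrozenCoeff r γ K Λ a) (i j : Fin d) :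
    Integrable (a i j) := by
  have h : IntegrableOn (a i j) (Metric.ball 0 (r + 2)) :=
    Measure.integrableOn_of_bounded measure_ball_lt_top.ne (ha.meas i j).aestronglyMeasurable
      (Filter.Eventually.of_forall fun x => ha.bdd i j x)
  exact h.integrable_of_forall_notMem_eq_zero fun x hx => ha.supp i j x hx

omit [IsFiniteMeasure ρ] in
lemma integrable_moll_sub {ε : ℝ} (hε : 0 < ε) (k : ℕ) (hk : k ≠ 0) (x : Rd d)  :
    Integrable (fun y => mollPow ε k (x - y)) (volume : Measure (Rd d)) :=
  ((mollPow_continuous ε k).integrable_of_hasCompactSupport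
    (mollPow_hasCompactSupport hε hk)).comp_sub_left x

lemma mollDens_contDiff {ε : ℝ} (hε : 0 < ε) : ContDiff ℝ 1 (mollDens ρ ε) :=
  contDiff_cv (n := 1) (integrable_const _) (moll_contDiff_one ε)
    (mollPow_hasCompactSupport hε (by norm_num))

omit [IsFiniteMeasure ρ] in
lemma mollDens_nonneg (ε : ℝ) (x : Rd d) : 0 ≤ mollDens ρ ε x :=
  cv_nonneg (fun _ => zero_le_one) (mollPow_nonneg ε 4) x

lemma mollCoeff_contDiff (ha : FrozenCoeff r γ K Λ a) {ε : ℝ} (hε : 0 < ε) (i j : Fin d) :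
    ContDiff ℝ 1 (mollCoeff a ε i j) :=
  contDiff_cv (n := 1) (ha.integrable_volume i j) (moll_contDiff_one ε)
    (mollPow_hasCompactSupport hε (by norm_num))

lemma mollFlux_contDiff (ha : FrozenCoeff r γ K Λ a) {b : Fin d → Rd d → ℝ}
    (hb : ∀ i, Integrable (b i) ρ) {ε : ℝ} (hε : 0 < ε) (i : Fin d) :
    ContDiff ℝ 1 (mollFlux ρ a b ε i) := by
  refine ContDiff.sub (ContDiff.sum fun j _ => ?_) ?_
  · exact contDiff_cv (n := 1) (ha.integrable i j) (pd_moll_contDiff_one ε j)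
      (mollPow_pd_hasCompactSupport hε j)
  · exact contDiff_cv (n := 1) (hb i) (moll_contDiff_one ε)
      (mollPow_hasCompactSupport hε (by norm_num))

lemma mollComm_continuous (ha : FrozenCoeff r γ K Λ a) {ε : ℝ} (hε : 0 < ε) (i : Fin d) :
    Continuous (mollComm ρ a ε i) := by
  refine continuous_finsetSum _ fun j _ => Continuous.sub ?_ ?_
  · exact continuous_cv (ha.integrable i j) (pd_moll_continuous ε j)
      (mollPow_pd_hasCompactSupport hε j)
  · exact ((mollCoeff_contDiff ha hε i j).mul (mollDens_contDiff hε)).pd_continuous j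

lemma mollComm_eq_integral (ha : FrozenCoeff r γ K Λ a) {ε : ℝ} (hε : 0 < ε) (i : Fin d) (x : Rd d) :
    mollComm ρ a ε i x = ∫ y, commKer a ε i x y ∂ρ := by
  have hc := mollPow_hasCompactSupport (d := d) hε (k := 4) (by norm_num)
  have i1 : ∀ j, Integrable (fun y => a i j y * pd j (moll ε) (x - y)) ρ := fun j =>
    integrable_mul_comp_sub (ha.integrable i j) (pd_moll_continuous ε j)
      (mollPow_pd_hasCompactSupport hε j) x
  have i2 : ∀ j, Integrable (fun y => (1 : ℝ) * pd j (moll ε) (x - y)) ρ := fun j =>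
    integrable_mul_comp_sub (integrable_const _) (pd_moll_continuous ε j)
      (mollPow_pd_hasCompactSupport hε j) x
  have i3 : Integrable (fun y => (1 : ℝ) * moll ε (x - y)) ρ :=
    integrable_mul_comp_sub (integrable_const _) (mollPow_continuous ε 4) hc x
  have e : ∀ y, commKer a ε i x y = ∑ j, (a i j y * pd j (moll ε) (x - y)
      - mollCoeff a ε i j x * (1 * pd j (moll ε) (x - y))
      - pd j (mollCoeff a ε i j) x * (1 * moll ε (x - y))) := fun y =>
    Finset.sum_congr rfl fun j _ => by ring
  simp only [e]
  have i4 : ∀ j, Integrable (fun y => a i j y * pd j (moll ε) (x - y)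
      - mollCoeff a ε i j x * (1 * pd j (moll ε) (x - y))) ρ := fun j =>
    (i1 j).sub ((i2 j).const_mul _)
  have i5 : ∀ j, Integrable (fun y => a i j y * pd j (moll ε) (x - y)
      - mollCoeff a ε i j x * (1 * pd j (moll ε) (x - y))
      - pd j (mollCoeff a ε i j) x * (1 * moll ε (x - y))) ρ := fun j =>
    (i4 j).sub (i3.const_mul _)
  rw [integral_finsetSum _ fun j _ => i5 j]
  refine Finset.sum_congr rfl fun j _ => ?_
  rw [integral_sub (i4 j) (i3.const_mul _), integral_sub (i1 j) ((i2 j).const_mul _),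
    integral_const_mul, integral_const_mul,
    pd_mul j ((mollCoeff_contDiff ha hε i j).differentiable one_ne_zero x)
      ((mollDens_contDiff hε).differentiable one_ne_zero x)]
  have : pd j (mollDens ρ ε) = cv ρ (fun _ => 1) (pd j (moll ε)) :=
    pd_cv (integrable_const _) (moll_contDiff_one ε) hc j
  rw [this]
  simp only [cv, mollDens, integral_const_mul, one_mul]
  ring

lemma integral_commKer (ha : FrozenCoeff r γ K Λ a) {ε : ℝ} (hε : 0 < ε) (i : Fin d) (x : Rd d) :
    ∫ y, commKer a ε i x y = 0 := by
  have hc := mollPow_hasCompactSupport (d := d) hε (k := 4) (by norm_num)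
  have i1 : ∀ j, Integrable (fun y => a i j y * pd j (moll ε) (x - y)) := fun j =>
    integrable_mul_comp_sub (ha.integrable_volume i j) (pd_moll_continuous ε j)
      (mollPow_pd_hasCompactSupport hε j) x
  have i2 : ∀ j, Integrable (fun y => pd j (moll ε) (x - y)) := fun j =>
    ((pd_moll_continuous ε j).integrable_of_hasCompactSupport
      (mollPow_pd_hasCompactSupport hε j)).comp_sub_left x
  have i3 := integrable_moll_sub hε 4 (by norm_num) x
  have e : ∀ y, commKer a ε i x y = ∑ j, (a i j y * pd j (moll ε) (x - y)
      - mollCoeff a ε i j x * (pd j (moll ε) (x - y))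
      - pd j (mollCoeff a ε i j) x * (moll ε (x - y))) := fun y =>
    Finset.sum_congr rfl fun j _ => by ring
  simp only [e]
  have i4 : ∀ j, Integrable (fun y => a i j y * pd j (moll ε) (x - y)
      - mollCoeff a ε i j x * (pd j (moll ε) (x - y))) := fun j =>
    (i1 j).sub ((i2 j).const_mul _)
  have i5 : ∀ j, Integrable (fun y => a i j y * pd j (moll ε) (x - y)
      - mollCoeff a ε i j x * (pd j (moll ε) (x - y))
      - pd j (mollCoeff a ε i j) x * (moll ε (x - y))) := fun j =>
    (i4 j).sub (i3.const_mul _)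
  rw [integral_finsetSum _ fun j _ => i5 j]
  refine Finset.sum_eq_zero fun j _ => ?_
  rw [integral_sub (i4 j) (i3.const_mul _), integral_sub (i1 j) ((i2 j).const_mul _),
    integral_const_mul, integral_const_mul, integral_sub_left_eq_self (moll ε), integral_moll ε hε,
    integral_sub_left_eq_self (pd j (moll ε)), integral_pd_moll hε]
  have : pd j (mollCoeff a ε i j) = cv volume (a i j) (pd j (moll ε)) :=
    pd_cv (ha.integrable_volume i j) (moll_contDiff_one ε) hc j
  rw [this, cv]
  ring

lemma mem_ball_of_mollPow_ne_zero {ε : ℝ} (hε : 0 < ε) (hε1 : ε ≤ 1) {k : ℕ} (hk : k ≠ 0)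
    {x y : Rd d} (hx : x ∈ Metric.ball (0 : Rd d) (r + 1)) (h : mollPow ε k (x - y) ≠ 0) :
    y ∈ Metric.ball (0 : Rd d) (r + 2) ∧ ‖x - y‖ < ε := by
  have h1 : ‖x - y‖ < ε := not_le.1 fun h' => h (mollPow_eq_zero hε hk h')
  refine ⟨?_, h1⟩
  rw [mem_ball_zero_iff] at hx ⊢
  calc ‖y‖ = ‖x - (x - y)‖ := by simp
    _ ≤ ‖x‖ + ‖x - y‖ := norm_sub_le _ _
    _ < r + 2 := by linarith

lemma abs_mollCoeff_le (ha : FrozenCoeff r γ K Λ a) {ε : ℝ} (hε : 0 < ε) (i j : Fin d) (x : Rd d) :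
    |mollCoeff a ε i j x| ≤ K := by
  have h3 := integrable_moll_sub hε 4 (by norm_num) x
  have h1 : |mollCoeff a ε i j x| ≤ ∫ y, K * moll ε (x - y) := by
    refine abs_integral_le_of_abs_le (h3.const_mul K) fun y => ?_
    rw [abs_mul, abs_of_nonneg (mollPow_nonneg ε 4 _)]
    exact mul_le_mul_of_nonneg_right (ha.bdd i j y) (mollPow_nonneg ε 4 _)
  rwa [integral_const_mul, integral_sub_left_eq_self (moll ε), integral_moll ε hε, mul_one] at h1

lemma mollCoeff_ell (ha : FrozenCoeff r γ K Λ a) {ε : ℝ} (hε : 0 < ε) (hε1 : ε ≤ 1) {x : Rd d}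
    (hx : x ∈ Metric.ball (0 : Rd d) (r + 1)) (ξ : Fin d → ℝ) :
    γ * ∑ i, ξ i ^ 2 ≤ ∑ i, ∑ j, mollCoeff a ε i j x * ξ i * ξ j := by
  have h3 := integrable_moll_sub hε 4 (by norm_num) x
  have i1 : ∀ i j, Integrable (fun y => a i j y * moll ε (x - y)) := fun i j =>
    integrable_mul_comp_sub (ha.integrable_volume i j) (mollPow_continuous ε 4)
      (mollPow_hasCompactSupport hε (by norm_num)) x
  have e : ∑ i, ∑ j, mollCoeff a ε i j x * ξ i * ξ j
      = ∫ y, ∑ i, ∑ j, (a i j y * moll ε (x - y)) * ξ i * ξ j := by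
    rw [integral_finsetSum _ fun i _ => integrable_finsetSum _ fun j _ =>
      ((i1 i j).mul_const _).mul_const _]
    refine Finset.sum_congr rfl fun i _ => ?_
    rw [integral_finsetSum _ fun j _ => ((i1 i j).mul_const _).mul_const _]
    refine Finset.sum_congr rfl fun j _ => ?_
    rw [integral_mul_const, integral_mul_const]; rfl
  have e2 : γ * ∑ i, ξ i ^ 2 = ∫ y, (γ * ∑ i, ξ i ^ 2) * moll ε (x - y) := by
    rw [integral_const_mul, integral_sub_left_eq_self (moll ε), integral_moll ε hε, mul_one]
  rw [e, e2]
  refine integral_mono (h3.const_mul _) (integrable_finsetSum _ fun i _ =>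
    integrable_finsetSum _ fun j _ => ((i1 i j).mul_const _).mul_const _) fun y => ?_
  by_cases h : moll ε (x - y) = 0
  · simp [h]
  have hy := (mem_ball_of_mollPow_ne_zero hε hε1 (by norm_num) hx h).1
  have := mul_le_mul_of_nonneg_right (ha.ell y hy ξ) (mollPow_nonneg ε 4 (x - y))
  refine this.trans (le_of_eq ?_)
  simp only [Finset.sum_mul]
  exact Finset.sum_congr rfl fun i _ => Finset.sum_congr rfl fun j _ => by ring

lemma abs_sub_mollCoeff_le (ha : FrozenCoeff r γ K Λ a) {ε : ℝ} (hε : 0 < ε) (hε1 : ε ≤ 1)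
    {x y : Rd d} (hx : x ∈ Metric.ball (0 : Rd d) (r + 1)) (hxy : ‖x - y‖ ≤ ε)
    (i j : Fin d) : |a i j y - mollCoeff a ε i j x| ≤ 2 * Λ * ε := by
  have hy : y ∈ Metric.ball (0 : Rd d) (r + 2) := by
    rw [mem_ball_zero_iff] at hx ⊢
    calc ‖y‖ = ‖x - (x - y)‖ := by simp
      _ ≤ ‖x‖ + ‖x - y‖ := norm_sub_le _ _
      _ < r + 2 := by linarith
  have h3 := integrable_moll_sub hε 4 (by norm_num) x
  have i1 : Integrable (fun z => a i j z * moll ε (x - z)) :=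
    integrable_mul_comp_sub (ha.integrable_volume i j) (mollPow_continuous ε 4)
      (mollPow_hasCompactSupport hε (by norm_num)) x
  have e : a i j y - mollCoeff a ε i j x = ∫ z, (a i j y - a i j z) * moll ε (x - z) := by
    simp only [sub_mul]
    rw [integral_sub (h3.const_mul _) i1, integral_const_mul,
      integral_sub_left_eq_self (moll ε), integral_moll ε hε, mul_one]; rfl
  rw [e]
  have h1 : |∫ z, (a i j y - a i j z) * moll ε (x - z)| ≤ ∫ z, 2 * Λ * ε * moll ε (x - z) := by
    refine abs_integral_le_of_abs_le (h3.const_mul _) fun z => ?_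
    rw [abs_mul, abs_of_nonneg (mollPow_nonneg ε 4 _)]
    by_cases h : moll ε (x - z) = 0
    · simp [h]
    obtain ⟨hz, hzε⟩ := mem_ball_of_mollPow_ne_zero hε hε1 (by norm_num) hx h
    refine mul_le_mul_of_nonneg_right ((ha.lip y hy z hz i j).trans ?_) (mollPow_nonneg ε 4 _)
    have : dist y z ≤ 2 * ε := by
      calc dist y z ≤ dist y x + dist x z := dist_triangle _ _ _
        _ ≤ ε + ε := by
          rw [dist_comm y x, dist_eq_norm, dist_eq_norm]; linarith
        _ = 2 * ε := by ring
    nlinarith [ha.lip_nonneg]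
  rwa [integral_const_mul, integral_sub_left_eq_self (moll ε), integral_moll ε hε, mul_one] at h1

/-- The common value of the integrals of `mollPow ε k`. -/
def mollMass (d k : ℕ) : ℝ := (∫ y : Rd d, mollBump d y ^ k) / ∫ y : Rd d, mollBump d y ^ 4

omit [IsFiniteMeasure ρ] in
lemma integral_mollPow_eq {ε : ℝ} (hε : 0 < ε) (k : ℕ) :
    ∫ y : Rd d, mollPow ε k y = mollMass d k := integral_mollPow ε hε k

lemma mollMass_nonneg (d k : ℕ) : 0 ≤ mollMass d k := by
  rw [← integral_mollPow_eq one_pos]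
  exact integral_nonneg (mollPow_nonneg 1 k)

/-- A constant with `|∂ᵢ moll ε| ≤ (mollGradConst d / ε) mollPow ε 3`. -/
def mollGradConst (d : ℕ) : ℝ := (exists_abs_pd_moll_le d).choose

lemma mollGradConst_nonneg (d : ℕ) : 0 ≤ mollGradConst d := (exists_abs_pd_moll_le d).choose_spec.1

lemma abs_pd_moll_le {ε : ℝ} (hε : 0 < ε) (i : Fin d) (z : Rd d) :
    |pd i (moll ε) z| ≤ mollGradConst d / ε * mollPow ε 3 z :=
  (exists_abs_pd_moll_le d).choose_spec.2 ε hε i z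

lemma abs_pd_mollCoeff_le (ha : FrozenCoeff r γ K Λ a) {ε : ℝ} (hε : 0 < ε) (hε1 : ε ≤ 1)
    {x : Rd d} (hx : x ∈ Metric.ball (0 : Rd d) (r + 1)) (i j k : Fin d) :
    |pd k (mollCoeff a ε i j) x| ≤ Λ * mollGradConst d * mollMass d 3 := by
  have hx2 : x ∈ Metric.ball (0 : Rd d) (r + 2) := Metric.ball_subset_ball (by linarith) hx
  have h3 := integrable_moll_sub hε 3 (by norm_num) x
  have i1 : Integrable (fun y => a i j y * pd k (moll ε) (x - y)) :=
    integrable_mul_comp_sub (ha.integrable_volume i j) (pd_moll_continuous ε k)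
      (mollPow_pd_hasCompactSupport hε k) x
  have i2 : Integrable (fun y => pd k (moll ε) (x - y)) :=
    ((pd_moll_continuous ε k).integrable_of_hasCompactSupport
      (mollPow_pd_hasCompactSupport hε k)).comp_sub_left x
  have e : pd k (mollCoeff a ε i j) x = ∫ y, (a i j y - a i j x) * pd k (moll ε) (x - y) := by
    simp only [sub_mul]
    rw [integral_sub i1 (i2.const_mul _), integral_const_mul,
      integral_sub_left_eq_self (pd k (moll ε)), integral_pd_moll hε, mul_zero, sub_zero]
    have : pd k (mollCoeff a ε i j) = cv volume (a i j) (pd k (moll ε)) :=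
      pd_cv (ha.integrable_volume i j) (moll_contDiff_one ε)
        (mollPow_hasCompactSupport hε (by norm_num)) k
    rw [this]; rfl
  rw [e]
  have h1 : |∫ y, (a i j y - a i j x) * pd k (moll ε) (x - y)|
      ≤ ∫ y, Λ * mollGradConst d * mollPow ε 3 (x - y) := by
    refine abs_integral_le_of_abs_le (h3.const_mul _) fun y => ?_
    have hb := abs_pd_moll_le hε k (x - y)
    by_cases h : mollPow ε 3 (x - y) = 0
    · rw [h, mul_zero] at hb
      have : pd k (moll ε) (x - y) = 0 := abs_nonpos_iff.1 hb
      simp [this, h]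
    obtain ⟨hy, hyε⟩ := mem_ball_of_mollPow_ne_zero hε hε1 (by norm_num) hx h
    rw [abs_mul]
    have hl := ha.lip y hy x hx2 i j
    rw [dist_comm, dist_eq_norm] at hl
    calc _ ≤ (Λ * ε) * (mollGradConst d / ε * mollPow ε 3 (x - y)) := by
          refine mul_le_mul (hl.trans ?_) hb (abs_nonneg _) (mul_nonneg ha.lip_nonneg hε.le)
          exact mul_le_mul_of_nonneg_left hyε.le ha.lip_nonneg
      _ = _ := by field_simp
  rwa [integral_const_mul, integral_sub_left_eq_self (mollPow ε 3), integral_mollPow_eq hε] at h1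

/-- The constant in the bound for `commKer`. -/
def commConst (d : ℕ) (Λ : ℝ) : ℝ :=
  d * (2 * Λ * mollGradConst d + Λ * mollGradConst d * mollMass d 3)

lemma commConst_nonneg (d : ℕ) {Λ : ℝ} (hΛ : 0 ≤ Λ) : 0 ≤ commConst d Λ := by
  have := mollGradConst_nonneg d
  have := mollMass_nonneg d 3
  unfold commConst; positivity

lemma abs_commKer_le (ha : FrozenCoeff r γ K Λ a) {ε : ℝ} (hε : 0 < ε) (hε1 : ε ≤ 1)
    {x : Rd d} (hx : x ∈ Metric.ball (0 : Rd d) (r + 1)) (i : Fin d) (y : Rd d) :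
    |commKer a ε i x y| ≤ commConst d Λ * mollPow ε 3 (x - y) := by
  refine (Finset.abs_sum_le_sum_abs _ _).trans ?_
  have h : ∀ j ∈ Finset.univ, |(a i j y - mollCoeff a ε i j x) * pd j (moll ε) (x - y)
      - pd j (mollCoeff a ε i j) x * moll ε (x - y)|
      ≤ (2 * Λ * mollGradConst d + Λ * mollGradConst d * mollMass d 3) * mollPow ε 3 (x - y) := by
    intro j _
    have hb := abs_pd_moll_le hε j (x - y)
    have h4 := mollPow_le (ε := ε) (show 3 ≤ 4 by norm_num) (x - y)
    have h40 := mollPow_nonneg ε 4 (x - y)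
    have h30 := mollPow_nonneg ε 3 (x - y)
    have hp := abs_pd_mollCoeff_le ha hε hε1 hx i j j
    have t2 : |pd j (mollCoeff a ε i j) x * moll ε (x - y)|
        ≤ Λ * mollGradConst d * mollMass d 3 * mollPow ε 3 (x - y) := by
      rw [abs_mul, abs_of_nonneg h40]
      exact mul_le_mul hp h4 h40 ((abs_nonneg _).trans hp)
    have t1 : |(a i j y - mollCoeff a ε i j x) * pd j (moll ε) (x - y)|
        ≤ 2 * Λ * mollGradConst d * mollPow ε 3 (x - y) := by
      by_cases h : mollPow ε 3 (x - y) = 0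
      · rw [h, mul_zero] at hb
        rw [abs_nonpos_iff.1 hb, h]; simp
      obtain ⟨hy, hyε⟩ := mem_ball_of_mollPow_ne_zero hε hε1 (by norm_num) hx h
      rw [abs_mul]
      calc _ ≤ (2 * Λ * ε) * (mollGradConst d / ε * mollPow ε 3 (x - y)) :=
            mul_le_mul (abs_sub_mollCoeff_le ha hε hε1 hx hyε.le i j) hb (abs_nonneg _)
              (by have := ha.lip_nonneg; positivity)
        _ = _ := by field_simp
    calc _ ≤ _ := abs_sub _ _
      _ ≤ _ := add_le_add t1 t2
      _ = _ := by ring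
  refine (Finset.sum_le_sum h).trans (le_of_eq ?_)
  simp [commConst]; ring

/-- The mass integrals `∫ mollPow ε k (x - y) ρ(dy)`. -/
def mollInt (ρ : Measure (Rd d)) (ε : ℝ) (k : ℕ) : Rd d → ℝ := cv ρ (fun _ => 1) (mollPow ε k)

lemma abs_mollComm_le (ha : FrozenCoeff r γ K Λ a) {ε : ℝ} (hε : 0 < ε) (hε1 : ε ≤ 1)
    {x : Rd d} (hx : x ∈ Metric.ball (0 : Rd d) (r + 1)) (i : Fin d) :
    |mollComm ρ a ε i x| ≤ commConst d Λ * mollInt ρ ε 3 x := by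
  rw [mollComm_eq_integral ha hε, mollInt, cv, ← integral_const_mul]
  refine abs_integral_le_of_abs_le (Integrable.const_mul ?_ _) fun y => ?_
  · exact integrable_mul_comp_sub (integrable_const _) (mollPow_continuous ε 3)
      (mollPow_hasCompactSupport hε (by norm_num)) x
  · rw [one_mul]; exact abs_commKer_le ha hε hε1 hx i y

end FrozenTime

section FrozenTimeErrors

variable {d : ℕ}

/-- Cauchy–Schwarz for integrals, in pointwise form. -/
lemma sq_integral_le {α : Type*} [MeasurableSpace α] {m : Measure α} {f g h : α → ℝ}
    (hf : Integrable f m) (hg : Integrable g m) (hh : Integrable h m) (hf0 : ∀ x, 0 ≤ f x)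
    (hh0 : ∀ x, 0 ≤ h x) (hle : ∀ x, g x ^ 2 ≤ f x * h x) :
    (∫ x, g x ∂m) ^ 2 ≤ (∫ x, f x ∂m) * ∫ x, h x ∂m := by
  have key : ∀ t : ℝ, 0 ≤ (∫ x, f x ∂m) * (t * t) + (2 * ∫ x, g x ∂m) * t + ∫ x, h x ∂m := by
    intro t
    have e : (∫ x, f x ∂m) * (t * t) + (2 * ∫ x, g x ∂m) * t + ∫ x, h x ∂m
        = ∫ x, (f x * (t * t) + g x * (2 * t) + h x) ∂m := by
      have i1 : Integrable (fun x => f x * (t * t)) m := hf.mul_const _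
      have i2 : Integrable (fun x => g x * (2 * t)) m := hg.mul_const _
      have i3 : Integrable (fun x => f x * (t * t) + g x * (2 * t)) m := i1.add i2
      rw [integral_add i3 hh, integral_add i1 i2, integral_mul_const, integral_mul_const]
      ring
    rw [e]
    refine integral_nonneg fun x => ?_
    have h1 := hf0 x
    have h2 := hh0 x
    have h3 := hle x
    show 0 ≤ f x * (t * t) + g x * (2 * t) + h x
    rcases h1.eq_or_lt with h0 | h0
    · have : g x = 0 := by
        rw [← h0, zero_mul] at h3
        exact pow_eq_zero_iff (two_ne_zero) |>.1 (le_antisymm h3 (sq_nonneg _))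
      rw [← h0, this]; simpa using h2
    · have h4 : 0 ≤ f x * (f x * (t * t) + g x * (2 * t) + h x) := by
        nlinarith [sq_nonneg (f x * t + g x)]
      exact nonneg_of_mul_nonneg_right h4 h0
  have := discrim_le_zero key
  rw [discrim] at this
  nlinarith

variable {ρ : Measure (Rd d)} [IsFiniteMeasure ρ] {r γ K Λ : ℝ} {a : Fin d → Fin d → Rd d → ℝ}
  {b bn : Fin d → Rd d → ℝ} {c cn : Rd d → ℝ} {ε : ℝ}

lemma integrable_mollInt_integrand (hε : 0 < ε) {k : ℕ} (hk : k ≠ 0) (x : Rd d) :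
    Integrable (fun y => (1 : ℝ) * mollPow ε k (x - y)) ρ :=
  integrable_mul_comp_sub (integrable_const _) (mollPow_continuous ε k)
    (mollPow_hasCompactSupport hε hk) x

omit [IsFiniteMeasure ρ] in
lemma integrable_mul_moll (hε : 0 < ε) {w : Rd d → ℝ} (hw : Integrable w ρ) (x : Rd d) :
    Integrable (fun y => w y * moll ε (x - y)) ρ :=
  integrable_mul_comp_sub hw (mollPow_continuous ε 4)
    (mollPow_hasCompactSupport hε (by norm_num)) x

omit [IsFiniteMeasure ρ] in
lemma mollInt_nonneg (ε : ℝ) (k : ℕ) (x : Rd d) : 0 ≤ mollInt ρ ε k x :=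
  cv_nonneg (fun _ => zero_le_one) (mollPow_nonneg ε k) x

lemma mollInt_sq_le (hε : 0 < ε) {k l m : ℕ} (hk : k ≠ 0) (hl : l ≠ 0) (hm : m ≠ 0)
    (h : k + m = 2 * l) (x : Rd d) :
    mollInt ρ ε l x ^ 2 ≤ mollInt ρ ε k x * mollInt ρ ε m x :=
  sq_integral_le (integrable_mollInt_integrand hε hk x) (integrable_mollInt_integrand hε hl x)
    (integrable_mollInt_integrand hε hm x)
    (fun y => mul_nonneg zero_le_one (mollPow_nonneg _ _ _))
    (fun y => mul_nonneg zero_le_one (mollPow_nonneg _ _ _))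
    (fun y => by simp only [one_mul]; rw [mollPow_sq ε k l m h])

lemma mollInt_continuous (hε : 0 < ε) {k : ℕ} (hk : k ≠ 0) : Continuous (mollInt ρ ε k) :=
  continuous_cv (integrable_const _) (mollPow_continuous ε k) (mollPow_hasCompactSupport hε hk)

lemma integrable_mollInt (hε : 0 < ε) {k : ℕ} (hk : k ≠ 0) : Integrable (mollInt ρ ε k) :=
  integrable_cv (integrable_const _) (mollPow_continuous ε k) (mollPow_hasCompactSupport hε hk)

lemma integral_mollInt (hε : 0 < ε) {k : ℕ} (hk : k ≠ 0) :
    ∫ x, mollInt ρ ε k x = ρ.real univ * mollMass d k := by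
  rw [mollInt, integral_cv (integrable_const _) (mollPow_continuous ε k)
    (mollPow_hasCompactSupport hε hk), integral_mollPow_eq hε]
  simp

lemma integral_cv_moll (hε : 0 < ε) {w : Rd d → ℝ} (hw : Integrable w ρ) :
    ∫ x, cv ρ w (moll ε) x = ∫ y, w y ∂ρ := by
  rw [integral_cv hw (mollPow_continuous ε 4) (mollPow_hasCompactSupport hε (by norm_num)),
    integral_moll ε hε, mul_one]

lemma integrable_cv_moll (hε : 0 < ε) {w : Rd d → ℝ} (hw : Integrable w ρ) :
    Integrable (cv ρ w (moll ε)) :=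
  integrable_cv hw (mollPow_continuous ε 4) (mollPow_hasCompactSupport hε (by norm_num))

omit [IsFiniteMeasure ρ] in
lemma continuous_cv_moll (hε : 0 < ε) {w : Rd d → ℝ} (hw : Integrable w ρ) :
    Continuous (cv ρ w (moll ε)) :=
  continuous_cv hw (mollPow_continuous ε 4) (mollPow_hasCompactSupport hε (by norm_num))

lemma mollComm_sq_le (ha : FrozenCoeff r γ K Λ a) (hε : 0 < ε) (hε1 : ε ≤ 1)
    {x : Rd d} (hx : x ∈ Metric.ball (0 : Rd d) (r + 1)) (i : Fin d) :
    mollComm ρ a ε i x ^ 2 ≤ mollDens ρ ε x * (commConst d Λ ^ 2 * mollInt ρ ε 2 x) := by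
  have h1 := abs_mollComm_le (ρ := ρ) ha hε hε1 hx i
  have h2 : mollInt ρ ε 3 x ^ 2 ≤ mollDens ρ ε x * mollInt ρ ε 2 x :=
    mollInt_sq_le (k := 4) (l := 3) (m := 2) hε (by norm_num) (by norm_num) (by norm_num)
      (by norm_num) x
  calc mollComm ρ a ε i x ^ 2 = |mollComm ρ a ε i x| ^ 2 := (sq_abs _).symm
    _ ≤ (commConst d Λ * mollInt ρ ε 3 x) ^ 2 := pow_le_pow_left₀ (abs_nonneg _) h1 2
    _ = commConst d Λ ^ 2 * mollInt ρ ε 3 x ^ 2 := by ring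
    _ ≤ commConst d Λ ^ 2 * (mollDens ρ ε x * mollInt ρ ε 2 x) :=
      mul_le_mul_of_nonneg_left h2 (sq_nonneg _)
    _ = _ := by ring

lemma sq_le_of_interpolation {y C R I1 I2 I3 θ : ℝ} (hy : 0 ≤ y) (hC : 0 ≤ C) (hR : 0 ≤ R)
    (h10 : 0 ≤ I1) (h30 : 0 ≤ I3) (hθ : 0 < θ) (h1 : y ≤ C * I3)
    (h2 : I3 ^ 2 ≤ R * I2) (h3 : I2 ^ 2 ≤ I3 * I1) :
    y ^ 2 ≤ R * (θ * I1 + C ^ 3 / θ * y) := by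
  have h4 : I3 ^ 3 ≤ R ^ 2 * I1 := by
    rcases h30.eq_or_lt with h0 | h0
    · rw [← h0]; simpa using by positivity
    · have : I3 * I3 ^ 3 ≤ I3 * (R ^ 2 * I1) := by
        calc I3 * I3 ^ 3 = (I3 ^ 2) ^ 2 := by ring
          _ ≤ (R * I2) ^ 2 := pow_le_pow_left₀ (sq_nonneg _) h2 2
          _ = R ^ 2 * I2 ^ 2 := by ring
          _ ≤ R ^ 2 * (I3 * I1) := mul_le_mul_of_nonneg_left h3 (sq_nonneg _)
          _ = _ := by ring
      exact le_of_mul_le_mul_left this h0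
  have h5 : (y ^ 2) ^ 2 ≤ (R * (θ * I1 + C ^ 3 / θ * y)) ^ 2 := by
    have e : θ * I1 * (C ^ 3 / θ * y) = C ^ 3 * y * I1 := by field_simp
    calc (y ^ 2) ^ 2 = y * y ^ 3 := by ring
      _ ≤ y * (C * I3) ^ 3 := mul_le_mul_of_nonneg_left (pow_le_pow_left₀ hy h1 3) hy
      _ = y * C ^ 3 * I3 ^ 3 := by ring
      _ ≤ y * C ^ 3 * (R ^ 2 * I1) := mul_le_mul_of_nonneg_left h4 (by positivity)
      _ = R ^ 2 * (θ * I1 * (C ^ 3 / θ * y)) := by rw [e]; ring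
      _ ≤ R ^ 2 * (θ * I1 + C ^ 3 / θ * y) ^ 2 := by
        refine mul_le_mul_of_nonneg_left ?_ (sq_nonneg _)
        have p1 : 0 ≤ θ * I1 := by positivity
        have p2 : 0 ≤ C ^ 3 / θ * y := by positivity
        nlinarith [mul_nonneg p1 p2, sq_nonneg (θ * I1), sq_nonneg (C ^ 3 / θ * y)]
      _ = _ := by ring
  exact le_of_sq_le_sq h5 (by positivity)

lemma mollComm_sq_le_interpolation (ha : FrozenCoeff r γ K Λ a) (hε : 0 < ε) (hε1 : ε ≤ 1)
    {x : Rd d} (hx : x ∈ Metric.ball (0 : Rd d) (r + 1)) (i : Fin d) {θ : ℝ} (hθ : 0 < θ) :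
    mollComm ρ a ε i x ^ 2 ≤ mollDens ρ ε x *
      (θ * mollInt ρ ε 1 x + commConst d Λ ^ 3 / θ * |mollComm ρ a ε i x|) := by
  rw [← sq_abs]
  exact sq_le_of_interpolation (abs_nonneg _) (commConst_nonneg d ha.lip_nonneg)
    (mollDens_nonneg ε x) (mollInt_nonneg ε 1 x) (mollInt_nonneg ε 3 x) hθ
    (abs_mollComm_le ha hε hε1 hx i)
    (mollInt_sq_le (k := 4) (l := 3) (m := 2) hε (by norm_num) (by norm_num) (by norm_num)
      (by norm_num) x)
    (mollInt_sq_le (k := 3) (l := 2) (m := 1) hε (by norm_num) (by norm_num) (by norm_num)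
      (by norm_num) x)

/-- The error of replacing the drift `b` by `bn`, whose oscillation at scale `ε` is at most `m`. -/
def driftErr (ρ : Measure (Rd d)) (b bn : Fin d → Rd d → ℝ) (ε m : ℝ) (i : Fin d) (x : Rd d) : ℝ :=
  2 * cv ρ (fun y => (b i y - bn i y) ^ 2) (moll ε) x + 2 * m ^ 2 * mollDens ρ ε x

/-- The error of replacing the potential `c` by `cn`, whose oscillation at scale `ε` is at most
`m`. -/
def potErr (ρ : Measure (Rd d)) (c cn : Rd d → ℝ) (ε m : ℝ) (x : Rd d) : ℝ :=
  cv ρ (fun y => |c y - cn y|) (moll ε) x + m * mollDens ρ ε x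

/-- The mollified deviation of `w` from the constant `v`. -/
def mollDev (ρ : Measure (Rd d)) (w : Rd d → ℝ) (ε v : ℝ) (x : Rd d) : ℝ :=
  cv ρ (fun y => |w y - v|) (moll ε) x

lemma abs_cv_sub_le_mollDev {w : Rd d → ℝ} (hw : Integrable w ρ) (hε : 0 < ε) (v : ℝ) (x : Rd d) :
    |cv ρ w (moll ε) x - v * mollDens ρ ε x| ≤ mollDev ρ w ε v x := by
  have h1 := integrable_mul_moll hε hw x
  have h2 : Integrable (fun y => v * ((1 : ℝ) * moll ε (x - y))) ρ :=
    (integrable_mul_moll hε (integrable_const (1 : ℝ)) x).const_mul v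
  rw [cv, mollDens, cv, ← integral_const_mul, ← integral_sub h1 h2]
  refine abs_integral_le_of_abs_le (integrable_mul_moll hε (hw.sub (integrable_const v)).abs x)
    fun y => ?_
  rw [one_mul, ← sub_mul, abs_mul, abs_of_nonneg (mollPow_nonneg ε 4 _)]

lemma abs_mul_mollDens_le {w : Rd d → ℝ} (hw : Integrable w ρ) (hε : 0 < ε) (v : ℝ) (x : Rd d) :
    |v| * mollDens ρ ε x ≤ cv ρ (fun y => |w y|) (moll ε) x + mollDev ρ w ε v x := by
  have h1 := integrable_mul_moll hε hw.abs x
  have h2 := integrable_mul_moll hε (hw.sub (integrable_const v)).abs x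
  have h3 := (integrable_mul_moll (ρ := ρ) hε (integrable_const (1 : ℝ)) x).const_mul |v|
  rw [mollDens, mollDev, cv, cv, cv, ← integral_const_mul]
  refine (integral_mono h3 (h1.add h2) fun y => ?_).trans (integral_add h1 h2).le
  have := mul_le_mul_of_nonneg_right
    (show |v| ≤ |w y| + |w y - v| by
      have := abs_sub_abs_le_abs_sub v (w y); rw [abs_sub_comm v] at this; linarith)
    (mollPow_nonneg ε 4 (x - y))
  simp only [Pi.add_apply, Pi.sub_apply]
  calc |v| * (1 * moll ε (x - y)) = |v| * moll ε (x - y) := by ring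
    _ ≤ _ := this
    _ = _ := by ring

lemma integrable_of_sq {w : Rd d → ℝ} (hw : Measurable w) (h2 : Integrable (fun y => w y ^ 2) ρ) :
    Integrable w ρ := by
  refine ((integrable_const (1 : ℝ)).add h2).mono' hw.aestronglyMeasurable
    (Filter.Eventually.of_forall fun y => ?_)
  rw [Real.norm_eq_abs]
  simp only [Pi.add_apply]
  nlinarith [sq_abs (w y), sq_nonneg (|w y| - 1)]

lemma integrable_sq_sub {w v : Rd d → ℝ} (hw : Measurable w)
    (h2 : Integrable (fun y => w y ^ 2) ρ) (hv : Measurable v) {C : ℝ} (hC : ∀ y, |v y| ≤ C) :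
    Integrable (fun y => (w y - v y) ^ 2) ρ := by
  refine ((h2.const_mul 2).add (integrable_const (2 * C ^ 2))).mono'
    ((hw.sub hv).pow_const 2).aestronglyMeasurable (Filter.Eventually.of_forall fun y => ?_)
  rw [Real.norm_of_nonneg (sq_nonneg _)]
  simp only [Pi.add_apply]
  have : v y ^ 2 ≤ C ^ 2 := by
    rw [← sq_abs]; exact pow_le_pow_left₀ (abs_nonneg _) (hC y) 2
  nlinarith [sq_nonneg (w y + v y)]

lemma mollDev_sq_le {w v : Rd d → ℝ} (hw : Measurable w) (h2 : Integrable (fun y => w y ^ 2) ρ)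
    (hv : Measurable v) {C : ℝ} (hC : ∀ y, |v y| ≤ C) (hε : 0 < ε) {m : ℝ}
    (hm : ∀ x y, ‖x - y‖ ≤ ε → |v x - v y| ≤ m) (x : Rd d) :
    mollDev ρ w ε (v x) x ^ 2 ≤ mollDens ρ ε x *
      (2 * cv ρ (fun y => (w y - v y) ^ 2) (moll ε) x + 2 * m ^ 2 * mollDens ρ ε x) := by
  have i0 := integrable_mul_moll (ρ := ρ) hε (integrable_const (1 : ℝ)) x
  have i1 := integrable_mul_moll (ρ := ρ) hε
    ((integrable_of_sq hw h2).sub (integrable_const (v x))).abs x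
  have i2 := integrable_mul_moll (ρ := ρ) hε (integrable_sq_sub hw h2 hv hC) x
  have i3 := integrable_mul_moll (ρ := ρ) hε
    (integrable_sq_sub hw h2 (measurable_const (a := v x)) fun _ => hC x) x
  refine (sq_integral_le i0 i1 i3 (fun y => mul_nonneg zero_le_one (mollPow_nonneg _ _ _))
    (fun y => mul_nonneg (sq_nonneg _) (mollPow_nonneg _ _ _)) fun y => le_of_eq ?_).trans
    (mul_le_mul_of_nonneg_left ?_ (mollDens_nonneg ε x))
  · simp only [Pi.sub_apply]; rw [mul_pow, sq_abs]; ring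
  · rw [mollDens, cv, cv, ← integral_const_mul, ← integral_const_mul,
      ← integral_add (i2.const_mul _) (i0.const_mul _)]
    refine integral_mono i3 ((i2.const_mul _).add (i0.const_mul _)) fun y => ?_
    simp only
    by_cases h : moll ε (x - y) = 0
    · simp [h]
    have hxy : ‖x - y‖ ≤ ε := (not_le.1 fun h' => h (mollPow_eq_zero hε (by norm_num) h')).le
    have h4 : (v x - v y) ^ 2 ≤ m ^ 2 := by
      rw [← sq_abs]; exact pow_le_pow_left₀ (abs_nonneg _) (hm x y hxy) 2
    have := mul_le_mul_of_nonneg_right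
      (show (w y - v x) ^ 2 ≤ 2 * (w y - v y) ^ 2 + 2 * m ^ 2 by
        nlinarith [sq_nonneg (w y - v y + (v x - v y))]) (mollPow_nonneg ε 4 (x - y))
    refine this.trans (le_of_eq (by ring))

lemma mollDev_le_potErr (hc : Integrable c ρ) (hcn : Integrable cn ρ) (hε : 0 < ε) {m : ℝ}
    (hm : ∀ x y, ‖x - y‖ ≤ ε → |cn x - cn y| ≤ m) (x : Rd d) :
    mollDev ρ c ε (cn x) x ≤ potErr ρ c cn ε m x := by
  have i0 := integrable_mul_moll (ρ := ρ) hε (integrable_const (1 : ℝ)) x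
  have i1 := integrable_mul_moll (ρ := ρ) hε (hc.sub (integrable_const (cn x))).abs x
  have i2 := integrable_mul_moll (ρ := ρ) hε (hc.sub hcn).abs x
  rw [mollDev, potErr, mollDens, cv, cv, cv, ← integral_const_mul]
  refine (integral_mono i1 (i2.add (i0.const_mul _)) fun y => ?_).trans
    (integral_add i2 (i0.const_mul _)).le
  simp only [Pi.add_apply, Pi.sub_apply]
  by_cases h : moll ε (x - y) = 0
  · simp [h]
  have hxy : ‖x - y‖ ≤ ε := (not_le.1 fun h' => h (mollPow_eq_zero hε (by norm_num) h')).le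
  have := mul_le_mul_of_nonneg_right
    (show |c y - cn x| ≤ |c y - cn y| + m by
      have h1 := abs_sub_le (c y) (cn y) (cn x)
      have h2 := hm x y hxy
      rw [abs_sub_comm] at h2
      linarith) (mollPow_nonneg ε 4 (x - y))
  refine this.trans (le_of_eq (by ring))

omit [IsFiniteMeasure ρ] in
lemma fluxDefect_moll (i : Fin d) (x : Rd d) :
    fluxDefect (mollCoeff a ε) bn (mollDens ρ ε) (mollFlux ρ a b ε) i x
      = mollComm ρ a ε i x - (cv ρ (b i) (moll ε) x - bn i x * mollDens ρ ε x) := by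
  simp only [fluxDefect, mollFlux, mollComm, Finset.sum_sub_distrib]
  ring

end FrozenTimeErrors

section FrozenTimeInequality

variable {d : ℕ}

set_option maxHeartbeats 400000 in
lemma energy_rhs_pointwise {ψ R1 R2 δ γ κ cn C1 C2 P1 P2 S : ℝ}
    {dψ E1 E2 Em e0 bn B1 W1 W2 Z1 Z2 : Fin d → ℝ}
    {A H : Fin d → Fin d → ℝ} (hψ : 0 ≤ ψ) (hψS : ψ ≤ S) (hdψ : ∀ i, |dψ i| ≤ S)
    (hR1 : 0 ≤ R1) (hR2 : 0 ≤ R2) (hδ : 0 < δ) (hγ : 0 < γ) (hκ : 0 ≤ κ)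
    (hcn : cn ≤ 0) (hcnκ : |cn| ≤ κ) (hP1 : |C1 - cn * R1| ≤ P1) (hP2 : |C2 - cn * R2| ≤ P2)
    (hEm : ∀ i, Em i = E1 i + E2 i + δ * e0 i) (he0 : ∀ i, |e0 i| ≤ κ)
    (hE1 : ∀ i, E1 i ^ 2 ≤ R1 * W1 i) (hE2 : ∀ i, E2 i ^ 2 ≤ R2 * W2 i)
    (hW1 : ∀ i, 0 ≤ W1 i) (hW2 : ∀ i, 0 ≤ W2 i)
    (hZ1 : ∀ i, |E1 i| ≤ Z1 i) (hZ2 : ∀ i, |E2 i| ≤ Z2 i)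
    (hB : ∀ i, |bn i| * R1 ≤ B1 i + Z1 i) :
    (R1 / (R1 + R2 + δ)) ^ 2 * (R1 + R2 + δ) * (∑ i, ∑ j, A i j * H i j)
      + (R1 / (R1 + R2 + δ)) ^ 2 * (R1 + R2 + δ) * (∑ i, bn i * dψ i)
      + (R1 / (R1 + R2 + δ)) ^ 2 * (R1 + R2 + δ) * cn * ψ
      + ψ * (∑ i, (E1 i ^ 2 + Em i ^ 2)) / (γ * (R1 + R2 + δ))
      + ∑ i, (2 * |E1 i| + |Em i|) * |dψ i|
      + ψ * (2 * |C1 - cn * R1| + |C1 + C2 - cn * (R1 + R2 + δ)|)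
    ≤ ∑ i, ∑ j, |A i j| * R1 * |H i j| + ∑ i, B1 i * |dψ i| + (3 / 4 * (ψ * C1) - 1 / 4 * (ψ * C2))
      + S * (∑ i, (4 / γ * (W1 i + W2 i) + 4 * Z1 i + Z2 i) + 5 * P1 + 3 * P2
        + δ * (d * (4 / γ * κ ^ 2 + κ) + 3 * κ)) := by
  set M := R1 + R2 + δ with hM
  have hM0 : 0 < M := by positivity
  set F := (R1 / M) ^ 2 * M with hF
  have hp1 : R1 / M ≤ 1 := (div_le_one hM0).2 (by linarith)
  have hp0 : 0 ≤ R1 / M := div_nonneg hR1 hM0.le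
  have hpM : R1 / M * M = R1 := div_mul_cancel₀ _ hM0.ne'
  have hF0 : 0 ≤ F := by positivity
  have hFR : F ≤ R1 := by
    calc F = R1 / M * (R1 / M * M) := by rw [hF]; ring
      _ ≤ 1 * R1 := by rw [hpM]; exact mul_le_mul_of_nonneg_right hp1 hR1
      _ = R1 := one_mul _
  have hFM : R1 - M / 4 ≤ F := by
    have h1 : 0 ≤ (R1 / M - 1 / 2) ^ 2 * M := by positivity
    have h2 : (R1 / M - 1 / 2) ^ 2 * M = F - R1 / M * M + M / 4 := by rw [hF]; ring
    linarith
  have hS : 0 ≤ S := hψ.trans hψS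
  have hP1' : 0 ≤ P1 := (abs_nonneg _).trans hP1
  have hP2' : 0 ≤ P2 := (abs_nonneg _).trans hP2
  have hZ1' : ∀ i, 0 ≤ Z1 i := fun i => (abs_nonneg _).trans (hZ1 i)
  have t1 : F * (∑ i, ∑ j, A i j * H i j) ≤ ∑ i, ∑ j, |A i j| * R1 * |H i j| := by
    simp only [Finset.mul_sum]
    refine Finset.sum_le_sum fun i _ => Finset.sum_le_sum fun j _ => ?_
    calc F * (A i j * H i j) ≤ F * (|A i j| * |H i j|) := by
          refine mul_le_mul_of_nonneg_left ?_ hF0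
          rw [← abs_mul]; exact le_abs_self _
      _ ≤ R1 * (|A i j| * |H i j|) := mul_le_mul_of_nonneg_right hFR (by positivity)
      _ = _ := by ring
  have t2 : F * (∑ i, bn i * dψ i) ≤ ∑ i, B1 i * |dψ i| + S * ∑ i, Z1 i := by
    rw [Finset.mul_sum, Finset.mul_sum, ← Finset.sum_add_distrib]
    refine Finset.sum_le_sum fun i _ => ?_
    calc F * (bn i * dψ i) ≤ F * (|bn i| * |dψ i|) := by
          refine mul_le_mul_of_nonneg_left ?_ hF0
          rw [← abs_mul]; exact le_abs_self _
      _ ≤ R1 * (|bn i| * |dψ i|) := mul_le_mul_of_nonneg_right hFR (by positivity)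
      _ = |bn i| * R1 * |dψ i| := by ring
      _ ≤ (B1 i + Z1 i) * |dψ i| := mul_le_mul_of_nonneg_right (hB i) (abs_nonneg _)
      _ = B1 i * |dψ i| + |dψ i| * Z1 i := by ring
      _ ≤ B1 i * |dψ i| + S * Z1 i := by
        have := mul_le_mul_of_nonneg_right (hdψ i) (hZ1' i)
        linarith
  have hcκ : -κ ≤ cn := by rw [abs_le] at hcnκ; exact hcnκ.1
  have t3 : F * cn * ψ ≤ 3 / 4 * (ψ * C1) - 1 / 4 * (ψ * C2) + S * (P1 + P2 + δ * κ) := by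
    have h1 : F * cn ≤ (R1 - M / 4) * cn := mul_le_mul_of_nonpos_right hFM hcn
    rw [abs_le] at hP1 hP2
    have h2 : F * cn ≤ 3 / 4 * C1 - 1 / 4 * C2 + (P1 + P2 + δ * κ) := by
      have : δ * -κ ≤ δ * cn := mul_le_mul_of_nonneg_left hcκ hδ.le
      have h5 : 0 ≤ δ * κ := by positivity
      rw [hM] at h1
      linarith [hP1.1, hP1.2, hP2.1, hP2.2]
    have h3 := mul_le_mul_of_nonneg_right h2 hψ
    have h4 := mul_le_mul_of_nonneg_right hψS (show 0 ≤ P1 + P2 + δ * κ by positivity)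
    linarith
  have t4 : ψ * (∑ i, (E1 i ^ 2 + Em i ^ 2)) / (γ * M)
      ≤ S * ∑ i, 4 / γ * (W1 i + W2 i + δ * κ ^ 2) := by
    have hW : ∀ i, E1 i ^ 2 + Em i ^ 2 ≤ 4 * M * (W1 i + W2 i + δ * κ ^ 2) := by
      intro i
      have h1 := hE1 i
      have h2 := hE2 i
      have h3 : e0 i ^ 2 ≤ κ ^ 2 := by
        rw [← sq_abs]; exact pow_le_pow_left₀ (abs_nonneg _) (he0 i) 2
      have h4 : R1 * W1 i ≤ M * W1 i := mul_le_mul_of_nonneg_right (by linarith) (hW1 i)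
      have h5 : R2 * W2 i ≤ M * W2 i := mul_le_mul_of_nonneg_right (by linarith) (hW2 i)
      have h6 : δ ^ 2 * e0 i ^ 2 ≤ M * (δ * κ ^ 2) := by
        calc δ ^ 2 * e0 i ^ 2 ≤ δ ^ 2 * κ ^ 2 := mul_le_mul_of_nonneg_left h3 (sq_nonneg _)
          _ = δ * (δ * κ ^ 2) := by ring
          _ ≤ _ := mul_le_mul_of_nonneg_right (by linarith) (by positivity)
      have h7 : Em i ^ 2 ≤ 3 * (E1 i ^ 2 + E2 i ^ 2 + δ ^ 2 * e0 i ^ 2) := by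
        rw [hEm]
        nlinarith [sq_nonneg (E1 i - E2 i), sq_nonneg (E1 i - δ * e0 i),
          sq_nonneg (E2 i - δ * e0 i)]
      have h8 : 0 ≤ M * W2 i := mul_nonneg hM0.le (hW2 i)
      have h9 : 0 ≤ M * (δ * κ ^ 2) := by positivity
      linarith
    have hsum : ∑ i, (E1 i ^ 2 + Em i ^ 2) ≤ γ * M * ∑ i, 4 / γ * (W1 i + W2 i + δ * κ ^ 2) := by
      rw [Finset.mul_sum]
      refine Finset.sum_le_sum fun i _ => (hW i).trans (le_of_eq ?_)
      field_simp
    have hnn : 0 ≤ ∑ i, 4 / γ * (W1 i + W2 i + δ * κ ^ 2) :=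
      Finset.sum_nonneg fun i _ => by
        have := hW1 i; have := hW2 i; positivity
    rw [div_le_iff₀ (by positivity)]
    calc ψ * ∑ i, (E1 i ^ 2 + Em i ^ 2)
        ≤ ψ * (γ * M * ∑ i, 4 / γ * (W1 i + W2 i + δ * κ ^ 2)) :=
          mul_le_mul_of_nonneg_left hsum hψ
      _ ≤ S * (γ * M * ∑ i, 4 / γ * (W1 i + W2 i + δ * κ ^ 2)) :=
          mul_le_mul_of_nonneg_right hψS (by positivity)
      _ = _ := by ring
  have t5 : ∑ i, (2 * |E1 i| + |Em i|) * |dψ i| ≤ S * ∑ i, (3 * Z1 i + Z2 i + δ * κ) := by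
    rw [Finset.mul_sum]
    refine Finset.sum_le_sum fun i _ => ?_
    have h1 : |Em i| ≤ Z1 i + Z2 i + δ * κ := by
      rw [hEm]
      refine (abs_add_three _ _ _).trans ?_
      rw [abs_mul, abs_of_pos hδ]
      have := mul_le_mul_of_nonneg_left (he0 i) hδ.le
      linarith [hZ1 i, hZ2 i]
    calc (2 * |E1 i| + |Em i|) * |dψ i| ≤ (3 * Z1 i + Z2 i + δ * κ) * S :=
          mul_le_mul (by linarith [hZ1 i]) (hdψ i) (abs_nonneg _)
            (by linarith [abs_nonneg (Em i), hZ1' i])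
      _ = _ := by ring
  have t6 : ψ * (2 * |C1 - cn * R1| + |C1 + C2 - cn * M|) ≤ S * (3 * P1 + P2 + δ * κ) := by
    have h1 : |C1 + C2 - cn * M| ≤ P1 + P2 + δ * κ := by
      have e : C1 + C2 - cn * M = (C1 - cn * R1) + (C2 - cn * R2) + (-(δ * cn)) := by
        rw [hM]; ring
      rw [e]
      refine (abs_add_three _ _ _).trans ?_
      rw [abs_neg, abs_mul, abs_of_pos hδ]
      have := mul_le_mul_of_nonneg_left hcnκ hδ.le
      linarith
    exact mul_le_mul hψS (by linarith) (by positivity) hS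
  have e : S * (∑ i, (4 / γ * (W1 i + W2 i) + 4 * Z1 i + Z2 i) + 5 * P1 + 3 * P2
        + δ * (d * (4 / γ * κ ^ 2 + κ) + 3 * κ))
      = S * ∑ i, Z1 i + S * (P1 + P2 + δ * κ) + S * ∑ i, 4 / γ * (W1 i + W2 i + δ * κ ^ 2)
        + S * ∑ i, (3 * Z1 i + Z2 i + δ * κ) + S * (3 * P1 + P2 + δ * κ)
        + S * (P1 + P2 + δ * κ) := by
    simp only [mul_add, Finset.sum_add_distrib, Finset.sum_const, Finset.card_univ,
      Fintype.card_fin, nsmul_eq_mul, ← Finset.mul_sum]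
    ring
  have h0 : 0 ≤ S * (P1 + P2 + δ * κ) := by positivity
  rw [e]
  linarith

/-- The measure and lower order coefficients at a fixed time. -/
structure FrozenMeas (ρ : Measure (Rd d)) (b : Fin d → Rd d → ℝ) (c : Rd d → ℝ) : Prop where
  mass : ρ univ ≤ 1
  drift_meas : ∀ i, Measurable (b i)
  drift_sq : ∀ i, Integrable (fun y => b i y ^ 2) ρ
  pot : Integrable c ρ

lemma FrozenMeas.isFiniteMeasure {ρ : Measure (Rd d)} {b : Fin d → Rd d → ℝ} {c : Rd d → ℝ}
    (h : FrozenMeas ρ b c) : IsFiniteMeasure ρ :=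
  ⟨h.mass.trans_lt ENNReal.one_lt_top⟩

lemma FrozenMeas.real_le {ρ : Measure (Rd d)} {b : Fin d → Rd d → ℝ} {c : Rd d → ℝ}
    (h : FrozenMeas ρ b c) : ρ.real univ ≤ 1 :=
  ENNReal.toReal_le_of_le_ofReal zero_le_one (by simpa using h.mass)

/-- Continuous substitutes for the lower order coefficients, bounded by `κ` and oscillating by at
most `m` at scale `ε`. -/
structure FrozenApprox (bn : Fin d → Rd d → ℝ) (cn : Rd d → ℝ) (κ ε m : ℝ) : Prop where
  drift_cont : ∀ i, Continuous (bn i)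
  pot_cont : Continuous cn
  drift_bdd : ∀ i x, |bn i x| ≤ κ
  pot_bdd : ∀ x, |cn x| ≤ κ
  pot_nonpos : ∀ x, cn x ≤ 0
  drift_osc : ∀ i x y, ‖x - y‖ ≤ ε → |bn i x - bn i y| ≤ m
  pot_osc : ∀ x y, ‖x - y‖ ≤ ε → |cn x - cn y| ≤ m
  bdd_nonneg : 0 ≤ κ
  osc_nonneg : 0 ≤ m

/-- The size of a test function and its gradient. -/
def testMass (ψ : Rd d → ℝ) (x : Rd d) : ℝ := ψ x + ∑ i, |pd i ψ x|

/-- A nonnegative test function supported in the ball of radius `r`, with derivatives up to second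
order bounded by `Ψ` and oscillating by at most `o` at scale `ε`. -/
structure TestBounds (ψ : Rd d → ℝ) (r Ψ ε o : ℝ) : Prop where
  test : IsTest ψ
  nonneg : ∀ x, 0 ≤ ψ x
  supp : tsupport ψ ⊆ Metric.ball 0 r
  mass_le : ∀ x, testMass ψ x ≤ Ψ
  hess_le : ∀ i j x, |pd j (pd i ψ) x| ≤ Ψ
  osc : ∀ x y, ‖x - y‖ ≤ ε → |ψ x - ψ y| ≤ o
  grad_osc : ∀ i x y, ‖x - y‖ ≤ ε → |pd i ψ x - pd i ψ y| ≤ o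
  hess_osc : ∀ i j x y, ‖x - y‖ ≤ ε → |pd j (pd i ψ) x - pd j (pd i ψ) y| ≤ o

lemma abs_integral_mul_cv_sub_le {ρ : Measure (Rd d)} [IsFiniteMeasure ρ] {w h : Rd d → ℝ}
    {ε o C : ℝ} (hε : 0 < ε) (hw : Integrable w ρ) (hh : Continuous h) (hC : ∀ x, |h x| ≤ C)
    (ho : ∀ x y, ‖x - y‖ ≤ ε → |h x - h y| ≤ o) :
    |(∫ x, h x * cv ρ w (moll ε) x) - ∫ y, w y * h y ∂ρ| ≤ o * ∫ y, |w y| ∂ρ := by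
  have hmc := mollPow_hasCompactSupport (d := d) hε (k := 4) (by norm_num)
  have hint : ∀ y : Rd d, Integrable (fun x => moll ε (x - y)) (volume : Measure (Rd d)) :=
    fun y => ((mollPow_continuous ε 4).integrable_of_hasCompactSupport hmc).comp_sub_right y
  have hone : ∀ y : Rd d, ∫ x, moll ε (x - y) = 1 := fun y => by
    rw [integral_sub_right_eq_self (moll ε) y, integral_moll ε hε]
  have hhint : ∀ y : Rd d, Integrable (fun x => h x * moll ε (x - y)) := fun y => by
    have := (hint y).bdd_mul (c := C) hh.aestronglyMeasurable
      (Filter.Eventually.of_forall fun x => hC x)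
    exact this
  have key : ∀ y, |(∫ x, h x * moll ε (x - y)) - h y| ≤ o := by
    intro y
    have e : (∫ x, h x * moll ε (x - y)) - h y = ∫ x, (h x - h y) * moll ε (x - y) := by
      simp only [sub_mul]
      rw [integral_sub (hhint y) ((hint y).const_mul _), integral_const_mul, hone, mul_one]
    rw [e]
    refine (abs_integral_le_of_abs_le ((hint y).const_mul o) fun x => ?_).trans
      (by rw [integral_const_mul, hone, mul_one])
    rw [abs_mul, abs_of_nonneg (mollPow_nonneg ε 4 _)]
    by_cases h0 : moll ε (x - y) = 0
    · simp [h0]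
    have hxy : ‖x - y‖ ≤ ε := (not_le.1 fun h' => h0 (mollPow_eq_zero hε (by norm_num) h')).le
    exact mul_le_mul_of_nonneg_right (ho x y hxy) (mollPow_nonneg ε 4 _)
  have i1 : Integrable (fun y => w y * ∫ x, h x * moll ε (x - y)) ρ := by
    have := (integrable_prod_mul_comp_sub hw (mollPow_continuous ε 4) hmc hh hC).integral_prod_right
    refine this.congr (Filter.Eventually.of_forall fun y => ?_)
    simp only
    rw [← integral_const_mul]
    exact integral_congr_ae (Filter.Eventually.of_forall fun x => by simp only; ring)
  have i2 : Integrable (fun y => w y * h y) ρ := by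
    have := hw.bdd_mul (c := C) hh.aestronglyMeasurable
      (Filter.Eventually.of_forall fun x => hC x)
    simpa only [mul_comm] using this
  rw [integral_mul_cv hw (mollPow_continuous ε 4) hmc hh hC, ← integral_sub i1 i2,
    ← integral_const_mul]
  refine abs_integral_le_of_abs_le (hw.abs.const_mul o) fun y => ?_
  rw [← mul_sub, abs_mul, mul_comm]
  exact mul_le_mul_of_nonneg_right (key y) (abs_nonneg _)

end FrozenTimeInequality

section FrozenTimeIntegrated

variable {d : ℕ}

/-- `f` is integrable with integral at most `u`. -/
def IntLE {α : Type*} [MeasurableSpace α] (m : Measure α) (f : α → ℝ) (u : ℝ) : Prop :=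
  Integrable f m ∧ ∫ x, f x ∂m ≤ u

lemma IntLE.add {α : Type*} [MeasurableSpace α] {m : Measure α} {f g : α → ℝ} {u v : ℝ}
    (hf : IntLE m f u) (hg : IntLE m g v) : IntLE m (fun x => f x + g x) (u + v) :=
  ⟨hf.1.add hg.1, (integral_add hf.1 hg.1).le.trans (add_le_add hf.2 hg.2)⟩

lemma IntLE.const_mul {α : Type*} [MeasurableSpace α] {m : Measure α} {f : α → ℝ} {u k : ℝ}
    (hf : IntLE m f u) (hk : 0 ≤ k) : IntLE m (fun x => k * f x) (k * u) :=
  ⟨hf.1.const_mul k, (integral_const_mul k f).le.trans (mul_le_mul_of_nonneg_left hf.2 hk)⟩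

lemma IntLE.sum {α ι : Type*} [MeasurableSpace α] {m : Measure α} {s : Finset ι} {f : ι → α → ℝ}
    {u : ι → ℝ} (hf : ∀ i ∈ s, IntLE m (f i) (u i)) :
    IntLE m (fun x => ∑ i ∈ s, f i x) (∑ i ∈ s, u i) :=
  ⟨integrable_finsetSum _ fun i hi => (hf i hi).1,
    (integral_finsetSum _ fun i hi => (hf i hi).1).le.trans
      (Finset.sum_le_sum fun i hi => (hf i hi).2)⟩

lemma IntLE.mono {α : Type*} [MeasurableSpace α] {m : Measure α} {f : α → ℝ} {u v : ℝ}
    (hf : IntLE m f u) (huv : u ≤ v) : IntLE m f v := ⟨hf.1, hf.2.trans huv⟩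

/-- The mollified right-hand side of the equation. -/
def mollGen (ρ : Measure (Rd d)) (a : Fin d → Fin d → Rd d → ℝ) (b : Fin d → Rd d → ℝ)
    (c : Rd d → ℝ) (ε : ℝ) (x : Rd d) : ℝ :=
  ∑ i, pd i (mollFlux ρ a b ε i) x + cv ρ c (moll ε) x

lemma pd_add {f g : Rd d → ℝ} {x : Rd d} (i : Fin d) (hf : DifferentiableAt ℝ f x)
    (hg : DifferentiableAt ℝ g x) : pd i (fun y => f y + g y) x = pd i f x + pd i g x := by
  have := fderiv_fun_add hf hg
  simp [pd, this]

lemma fluxDefect_add_const {A : Fin d → Fin d → Rd d → ℝ} {bn : Fin d → Rd d → ℝ}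
    {R1 R2 : Rd d → ℝ} {J1 J2 : Fin d → Rd d → ℝ} (δ : ℝ) (hA : ∀ i j, ContDiff ℝ 1 (A i j))
    (hR1 : ContDiff ℝ 1 R1) (hR2 : ContDiff ℝ 1 R2) (i : Fin d) (x : Rd d) :
    fluxDefect A bn (fun x => R1 x + R2 x + δ) (fun i x => J1 i x + J2 i x) i x
      = fluxDefect A bn R1 J1 i x + fluxDefect A bn R2 J2 i x
        + δ * (bn i x - ∑ j, pd j (A i j) x) := by
  have h : ∀ j, pd j (fun y => A i j y * (R1 y + R2 y + δ)) x
      = pd j (fun y => A i j y * R1 y) x + pd j (fun y => A i j y * R2 y) x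
        + δ * pd j (A i j) x := by
    intro j
    have dA := (hA i j).differentiable one_ne_zero x
    have d1 := hR1.differentiable one_ne_zero x
    have d2 := hR2.differentiable one_ne_zero x
    have e : (fun y => A i j y * (R1 y + R2 y + δ))
        = fun y => (A i j y * R1 y + A i j y * R2 y) + A i j y * δ := by
      funext y; ring
    rw [e, pd_add (f := fun y => A i j y * R1 y + A i j y * R2 y) (g := fun y => A i j y * δ) j
        ((dA.mul d1).add (dA.mul d2)) (dA.mul_const δ),
      pd_add (f := fun y => A i j y * R1 y) (g := fun y => A i j y * R2 y) j
        (dA.mul d1) (dA.mul d2), pd_mul (g := fun _ => δ) j dA (differentiableAt_const δ)]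
    simp [pd]; ring
  simp only [fluxDefect, h, Finset.sum_add_distrib, mul_sub, Finset.mul_sum]
  ring

variable {ρ ρ1 ρ2 : Measure (Rd d)} {r γ K Λ κ ε m δ θ Ψ o : ℝ} {a : Fin d → Fin d → Rd d → ℝ}
  {b bn : Fin d → Rd d → ℝ} {c cn ψ : Rd d → ℝ}

lemma TestBounds.testMass_nonneg (hψ : TestBounds ψ r Ψ ε o) (x : Rd d) : 0 ≤ testMass ψ x :=
  add_nonneg (hψ.nonneg x) (Finset.sum_nonneg fun _ _ => abs_nonneg _)

lemma le_testMass (x : Rd d) : ψ x ≤ testMass ψ x :=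
  le_add_of_nonneg_right (Finset.sum_nonneg fun _ _ => abs_nonneg _)

lemma TestBounds.pd_le_testMass (hψ : TestBounds ψ r Ψ ε o) (i : Fin d) (x : Rd d) :
    |pd i ψ x| ≤ testMass ψ x :=
  (Finset.single_le_sum (f := fun i => |pd i ψ x|) (fun _ _ => abs_nonneg _)
    (Finset.mem_univ i)).trans (le_add_of_nonneg_left (hψ.nonneg x))

lemma TestBounds.bound_nonneg (hψ : TestBounds ψ r Ψ ε o) : 0 ≤ Ψ :=
  (hψ.testMass_nonneg 0).trans (hψ.mass_le 0)

lemma testMass_eq_zero {x : Rd d} (hx : x ∉ tsupport ψ) : testMass ψ x = 0 := by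
  simp [testMass, eq_zero_of_notMem_tsupport hx, pd_eq_zero_of_notMem_tsupport hx]

lemma IsTest.continuous_testMass (hψ : IsTest ψ) : Continuous (testMass ψ) := by
  have := hψ.continuous
  have := fun i => (hψ.pd i).continuous
  unfold testMass
  fun_prop

lemma IsTest.integrable_testMass_mul (hψ : IsTest ψ) {X : Rd d → ℝ} (hX : Continuous X) :
    Integrable (fun x => testMass ψ x * X x) :=
  integrable_of_eq_zero_off_tsupport (hψ.continuous_testMass.mul hX) hψ.2 fun x hx => by
    rw [testMass_eq_zero hx, zero_mul]

lemma IsTest.integrable_testMass (hψ : IsTest ψ) : Integrable (testMass ψ) :=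
  integrable_of_eq_zero_off_tsupport hψ.continuous_testMass hψ.2 fun _ hx => testMass_eq_zero hx

lemma continuous_driftErr [IsFiniteMeasure ρ] (hε : 0 < ε) (i : Fin d)
    (h : Integrable (fun y => (b i y - bn i y) ^ 2) ρ) : Continuous (driftErr ρ b bn ε m i) :=
  ((continuous_cv_moll hε h).const_mul 2).add
    ((continuous_cv_moll hε (integrable_const 1)).const_mul _)

lemma FrozenMeas.integrable_drift (h : FrozenMeas ρ b c) (i : Fin d) : Integrable (b i) ρ := by
  have := h.isFiniteMeasure
  exact integrable_of_sq (h.drift_meas i) (h.drift_sq i)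

lemma FrozenMeas.integrable_sub_sq (h : FrozenMeas ρ b c) (hap : FrozenApprox bn cn κ ε m)
    (i : Fin d) : Integrable (fun y => (b i y - bn i y) ^ 2) ρ := by
  have := h.isFiniteMeasure
  exact integrable_sq_sub (h.drift_meas i) (h.drift_sq i) (hap.drift_cont i).measurable
    (hap.drift_bdd i)

lemma FrozenApprox.integrable_pot [IsFiniteMeasure ρ] (hap : FrozenApprox bn cn κ ε m) :
    Integrable cn ρ :=
  Integrable.of_bound hap.pot_cont.aestronglyMeasurable κ (Filter.Eventually.of_forall hap.pot_bdd)

lemma FrozenMeas.intLE_driftErr (h : FrozenMeas ρ b c) (hap : FrozenApprox bn cn κ ε m)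
    (hε : 0 < ε) (i : Fin d) :
    IntLE volume (driftErr ρ b bn ε m i) (2 * ∫ y, (b i y - bn i y) ^ 2 ∂ρ + 2 * m ^ 2) := by
  have := h.isFiniteMeasure
  have h1 : IntLE volume (cv ρ (fun y => (b i y - bn i y) ^ 2) (moll ε))
      (∫ y, (b i y - bn i y) ^ 2 ∂ρ) :=
    ⟨integrable_cv_moll hε (h.integrable_sub_sq hap i),
      (integral_cv_moll hε (h.integrable_sub_sq hap i)).le⟩
  have h2 : IntLE volume (mollDens ρ ε) 1 :=
    ⟨integrable_cv_moll hε (integrable_const _), by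
      rw [mollDens, integral_cv_moll hε (integrable_const _)]; simpa using h.real_le⟩
  exact ((h1.const_mul (by norm_num)).add (h2.const_mul (by positivity))).mono (by simp)

lemma FrozenMeas.intLE_mollDens (h : FrozenMeas ρ b c) (hε : 0 < ε) :
    IntLE volume (mollDens ρ ε) 1 := by
  have := h.isFiniteMeasure
  exact ⟨integrable_cv_moll hε (integrable_const _), by
      rw [mollDens, integral_cv_moll hε (integrable_const _)]; simpa using h.real_le⟩

lemma FrozenMeas.intLE_potErr (h : FrozenMeas ρ b c) (hap : FrozenApprox bn cn κ ε m)
    (hε : 0 < ε) :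
    IntLE volume (potErr ρ c cn ε m) (∫ y, |c y - cn y| ∂ρ + m) := by
  have := h.isFiniteMeasure
  have hi : Integrable (fun y => |c y - cn y|) ρ := (h.pot.sub hap.integrable_pot).abs
  have h1 : IntLE volume (cv ρ (fun y => |c y - cn y|) (moll ε)) (∫ y, |c y - cn y| ∂ρ) :=
    ⟨integrable_cv_moll hε hi, (integral_cv_moll hε hi).le⟩
  exact (h1.add ((h.intLE_mollDens hε).const_mul hap.osc_nonneg)).mono (by simp)

lemma driftErr_nonneg (i : Fin d) (x : Rd d) : 0 ≤ driftErr ρ b bn ε m i x :=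
  add_nonneg (mul_nonneg zero_le_two (cv_nonneg (fun _ => sq_nonneg _) (mollPow_nonneg ε 4) x))
    (mul_nonneg (by positivity) (mollDens_nonneg ε x))

lemma potErr_nonneg (hm : 0 ≤ m) (x : Rd d) : 0 ≤ potErr ρ c cn ε m x :=
  add_nonneg (cv_nonneg (fun _ => abs_nonneg _) (mollPow_nonneg ε 4) x)
    (mul_nonneg hm (mollDens_nonneg ε x))

lemma le_young_of_sq_le {D R Q θ : ℝ} (hR : 0 ≤ R) (hQ : 0 ≤ Q) (hθ : 0 < θ)
    (h : D ^ 2 ≤ R * Q) : D ≤ θ * R + Q / θ := by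
  have e : θ * R * (Q / θ) = R * Q := by field_simp
  have h1 : 0 ≤ θ * R := by positivity
  have h2 : 0 ≤ Q / θ := by positivity
  refine le_of_sq_le_sq ?_ (by positivity)
  nlinarith

/-- The pointwise bounds for the flux defect of one measure. -/
lemma FrozenMeas.fluxDefect_bounds (h : FrozenMeas ρ b c) (hap : FrozenApprox bn cn κ ε m)
    (hε : 0 < ε) (hθ : 0 < θ) {x : Rd d} {X Y : ℝ} (i : Fin d)
    (hX : mollComm ρ a ε i x ^ 2 ≤ mollDens ρ ε x * X) (hY : |mollComm ρ a ε i x| ≤ Y) :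
    fluxDefect (mollCoeff a ε) bn (mollDens ρ ε) (mollFlux ρ a b ε) i x ^ 2
        ≤ mollDens ρ ε x * (2 * X + 2 * driftErr ρ b bn ε m i x) ∧
      |fluxDefect (mollCoeff a ε) bn (mollDens ρ ε) (mollFlux ρ a b ε) i x|
        ≤ Y + θ * mollDens ρ ε x + driftErr ρ b bn ε m i x / θ ∧
      |bn i x| * mollDens ρ ε x ≤ cv ρ (fun y => |b i y|) (moll ε) x
        + (Y + θ * mollDens ρ ε x + driftErr ρ b bn ε m i x / θ) := by
  have := h.isFiniteMeasure
  have hD2 := mollDev_sq_le (h.drift_meas i) (h.drift_sq i) (hap.drift_cont i).measurable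
    (hap.drift_bdd i) hε (hap.drift_osc i) x
  have hD := le_young_of_sq_le (mollDens_nonneg (ρ := ρ) ε x)
    (driftErr_nonneg (ρ := ρ) (b := b) (bn := bn) (ε := ε) (m := m) i x) hθ hD2
  have h1 := abs_cv_sub_le_mollDev (h.integrable_drift i) hε (bn i x) x
  have h2 := abs_mul_mollDens_le (h.integrable_drift i) hε (bn i x) x
  have hY0 := (abs_nonneg _).trans hY
  rw [fluxDefect_moll]
  refine ⟨?_, ?_, by linarith⟩
  · have h3 : (cv ρ (b i) (moll ε) x - bn i x * mollDens ρ ε x) ^ 2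
        ≤ mollDens ρ ε x * driftErr ρ b bn ε m i x := by
      rw [← sq_abs]
      exact (pow_le_pow_left₀ (abs_nonneg _) h1 2).trans hD2
    nlinarith [sq_nonneg (mollComm ρ a ε i x + (cv ρ (b i) (moll ε) x - bn i x * mollDens ρ ε x))]
  · exact (abs_sub _ _).trans (by linarith)

end FrozenTimeIntegrated

section FrozenIntegrated

variable {d : ℕ}

lemma IntLE.congr {α : Type*} [MeasurableSpace α] {m : Measure α} {f g : α → ℝ} {u v : ℝ}
    (hf : IntLE m f u) (h : ∀ x, g x = f x) (huv : u ≤ v) : IntLE m g v := by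
  rw [show g = f from funext h]
  exact hf.mono huv

variable {ρ ρ1 ρ2 : Measure (Rd d)} {r γ K Λ κ ε m δ θ Ψ o : ℝ} {a : Fin d → Fin d → Rd d → ℝ}
  {b bn : Fin d → Rd d → ℝ} {c cn ψ : Rd d → ℝ}

lemma abs_mollCoeff_mul_mollDens_le [IsFiniteMeasure ρ] (ha : FrozenCoeff r γ K Λ a) (hε : 0 < ε)
    (hε1 : ε ≤ 1) {x : Rd d} (hx : x ∈ Metric.ball (0 : Rd d) (r + 1)) (i j : Fin d) :
    |mollCoeff a ε i j x| * mollDens ρ ε x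
      ≤ cv ρ (fun y => |a i j y|) (moll ε) x + 2 * Λ * ε * mollDens ρ ε x := by
  have h1 := abs_mul_mollDens_le (ha.integrable (ρ := ρ) i j) hε (mollCoeff a ε i j x) x
  have h2 : mollDev ρ (a i j) ε (mollCoeff a ε i j x) x ≤ 2 * Λ * ε * mollDens ρ ε x := by
    have e : 2 * Λ * ε * mollDens ρ ε x = cv ρ (fun _ => 2 * Λ * ε) (moll ε) x := by
      simp only [mollDens, cv]
      rw [← integral_const_mul]
      simp
    rw [e]
    have hc := mollPow_hasCompactSupport (d := d) hε (k := 4) (by norm_num)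
    refine cv_mono (((ha.integrable i j).sub (integrable_const _)).abs) (integrable_const _)
      (mollPow_continuous ε 4) hc (mollPow_continuous ε 4) hc x fun y => ?_
    by_cases h0 : moll ε (x - y) = 0
    · simp [h0]
    have hxy : ‖x - y‖ ≤ ε := (not_le.1 fun h' => h0 (mollPow_eq_zero hε (by norm_num) h')).le
    exact mul_le_mul_of_nonneg_right (abs_sub_mollCoeff_le ha hε hε1 hx hxy i j)
      (mollPow_nonneg ε 4 _)
  linarith

lemma TestBounds.osc_nonneg (hψ : TestBounds ψ r Ψ ε o) (hε : 0 < ε) : 0 ≤ o := by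
  simpa using hψ.osc 0 0 (by simpa using hε.le)

lemma TestBounds.intLE_testMass_mul (hψ : TestBounds ψ r Ψ ε o) {X : Rd d → ℝ} {u : ℝ}
    (hX : IntLE volume X u) (hXc : Continuous X) (hX0 : ∀ x, 0 ≤ X x) :
    IntLE volume (fun x => testMass ψ x * X x) (Ψ * u) := by
  refine ⟨hψ.test.integrable_testMass_mul hXc, ?_⟩
  calc ∫ x, testMass ψ x * X x ≤ ∫ x, Ψ * X x :=
        integral_mono (hψ.test.integrable_testMass_mul hXc) (hX.1.const_mul Ψ) fun x =>
          mul_le_mul_of_nonneg_right (hψ.mass_le x) (hX0 x)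
    _ = Ψ * ∫ x, X x := integral_const_mul _ _
    _ ≤ Ψ * u := mul_le_mul_of_nonneg_left hX.2 hψ.bound_nonneg

lemma intLE_mul_cv [IsFiniteMeasure ρ] {w h : Rd d → ℝ} {C : ℝ} (hε : 0 < ε) (hw : Integrable w ρ)
    (hh : Continuous h) (hC : ∀ x, |h x| ≤ C) (ho : ∀ x y, ‖x - y‖ ≤ ε → |h x - h y| ≤ o) :
    IntLE volume (fun x => h x * cv ρ w (moll ε) x)
      (∫ y, w y * h y ∂ρ + o * ∫ y, |w y| ∂ρ) := by
  refine ⟨(integrable_cv_moll hε hw).bdd_mul (c := C) hh.aestronglyMeasurable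
      (Filter.Eventually.of_forall hC), ?_⟩
  have := abs_le.1 (abs_integral_mul_cv_sub_le hε hw hh hC ho)
  linarith [this.2]

lemma abs_osc_of_osc {f : Rd d → ℝ} (h : ∀ x y, ‖x - y‖ ≤ ε → |f x - f y| ≤ o) :
    ∀ x y, ‖x - y‖ ≤ ε → |(|f x|) - (|f y|)| ≤ o :=
  fun x y hxy => (abs_abs_sub_abs_le _ _).trans (h x y hxy)

lemma neg_osc_of_osc {f : Rd d → ℝ} (h : ∀ x y, ‖x - y‖ ≤ ε → |f x - f y| ≤ o) :
    ∀ x y, ‖x - y‖ ≤ ε → |(-f x) - (-f y)| ≤ o := fun x y hxy => by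
  rw [show -f x - -f y = -(f x - f y) by ring, abs_neg]
  exact h x y hxy

/-- The principal part of the energy estimate. -/
def frozenMain (ρ1 ρ2 : Measure (Rd d)) (a : Fin d → Fin d → Rd d → ℝ) (b : Fin d → Rd d → ℝ)
    (c ψ : Rd d → ℝ) : ℝ :=
  ∑ i, ∑ j, ∫ y, |a i j y| * |pd j (pd i ψ) y| ∂ρ1 + ∑ i, ∫ y, |b i y| * |pd i ψ y| ∂ρ1
    + (3 / 4 * ∫ y, c y * ψ y ∂ρ1 - 1 / 4 * ∫ y, c y * ψ y ∂ρ2)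

/-- The left-hand side of the energy estimate: the rate of change of `∫ ψ R₁² / (R₁ + R₂ + δ)`. -/
def frozenRate (ρ1 ρ2 : Measure (Rd d)) (a : Fin d → Fin d → Rd d → ℝ) (b : Fin d → Rd d → ℝ)
    (c ψ : Rd d → ℝ) (ε δ : ℝ) : ℝ :=
  ∫ x, ψ x * (2 * (mollDens ρ1 ε x / (mollDens ρ1 ε x + mollDens ρ2 ε x + δ)) * mollGen ρ1 a b c ε x
    - (mollDens ρ1 ε x / (mollDens ρ1 ε x + mollDens ρ2 ε x + δ)) ^ 2
      * (mollGen ρ1 a b c ε x + mollGen ρ2 a b c ε x))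

lemma intLE_frozen_main (h1 : FrozenMeas ρ1 b c) (h2 : FrozenMeas ρ2 b c)
    (ha : FrozenCoeff r γ K Λ a) (hψ : TestBounds ψ r Ψ ε o) (hε : 0 < ε) :
    IntLE volume (fun x => ∑ i, ∑ j, (|pd j (pd i ψ) x| * cv ρ1 (fun y => |a i j y|) (moll ε) x
        + 2 * Λ * ε * Ψ * mollDens ρ1 ε x)
      + ∑ i, |pd i ψ x| * cv ρ1 (fun y => |b i y|) (moll ε) x
      + (3 / 4 * (ψ x * cv ρ1 c (moll ε) x) + 1 / 4 * (-ψ x * cv ρ2 c (moll ε) x)))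
      (frozenMain ρ1 ρ2 a b c ψ + (d ^ 2 * (o * K + 2 * Λ * ε * Ψ)
        + o * (∑ i, ∫ y, |b i y| ∂ρ1 + ∫ y, |c y| ∂ρ1 + ∫ y, |c y| ∂ρ2))) := by
  have := h1.isFiniteMeasure
  have := h2.isFiniteMeasure
  have ho := hψ.osc_nonneg hε
  have hΨ := hψ.bound_nonneg
  have hΛ := ha.lip_nonneg
  have g1 : ∀ i j, IntLE volume (fun x => |pd j (pd i ψ) x| * cv ρ1 (fun y => |a i j y|) (moll ε) x)
      (∫ y, |a i j y| * |pd j (pd i ψ) y| ∂ρ1 + o * K) := fun i j => by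
    refine (intLE_mul_cv hε (ha.integrable i j).abs ((hψ.test.pd i).pd j).continuous.abs
      (fun x => by rw [abs_abs]; exact hψ.hess_le i j x) (abs_osc_of_osc (hψ.hess_osc i j))).mono ?_
    have : ∫ y, |(|a i j y|)| ∂ρ1 ≤ K := by
      refine (integral_mono (ha.integrable i j).abs.abs (integrable_const K)
        fun y => by simpa using ha.bdd i j y).trans ?_
      simpa using mul_le_of_le_one_left ha.bdd_nonneg h1.real_le
    have := mul_le_mul_of_nonneg_left this ho
    linarith
  have g2 : ∀ i, IntLE volume (fun x => |pd i ψ x| * cv ρ1 (fun y => |b i y|) (moll ε) x)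
      (∫ y, |b i y| * |pd i ψ y| ∂ρ1 + o * ∫ y, |b i y| ∂ρ1) := fun i => by
    refine (intLE_mul_cv hε (h1.integrable_drift i).abs (hψ.test.pd i).continuous.abs (C := Ψ)
      (fun x => ?_) (abs_osc_of_osc (hψ.grad_osc i))).mono (by simp only [abs_abs]; exact le_rfl)
    rw [abs_abs]; exact (hψ.pd_le_testMass i x).trans (hψ.mass_le x)
  have hψb : ∀ x, |ψ x| ≤ Ψ := fun x => by
    rw [abs_of_nonneg (hψ.nonneg x)]; exact (le_testMass x).trans (hψ.mass_le x)
  have g3 := intLE_mul_cv hε h1.pot hψ.test.continuous hψb hψ.osc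
  have g4 := intLE_mul_cv (h := fun x => -ψ x) hε h2.pot hψ.test.continuous.neg
    (fun x => by rw [abs_neg]; exact hψb x) (neg_osc_of_osc hψ.osc)
  have gR := h1.intLE_mollDens (ρ := ρ1) hε
  have G1 := IntLE.sum (s := Finset.univ) fun i _ => IntLE.sum (s := Finset.univ) fun j _ =>
    (g1 i j).add (gR.const_mul (show 0 ≤ 2 * Λ * ε * Ψ by positivity))
  have G2 := IntLE.sum (s := Finset.univ) fun i _ => g2 i
  have G3 := (g3.const_mul (show (0 : ℝ) ≤ 3 / 4 by norm_num)).add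
    (g4.const_mul (show (0 : ℝ) ≤ 1 / 4 by norm_num))
  refine ((G1.add G2).add G3).mono ?_
  have c1 : 0 ≤ o * ∫ y, |c y| ∂ρ1 := mul_nonneg ho (integral_nonneg fun _ => abs_nonneg _)
  have c2 : 0 ≤ o * ∫ y, |c y| ∂ρ2 := mul_nonneg ho (integral_nonneg fun _ => abs_nonneg _)
  simp only [frozenMain, Finset.sum_add_distrib, Finset.sum_const, Finset.card_univ,
    Fintype.card_fin, nsmul_eq_mul, ← Finset.mul_sum, mul_neg, integral_neg]
  linarith

/-- The remainder in the energy estimate. -/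
def frozenErr (d : ℕ) (γ κ δ θ Ψ ξ1 ξ2 η1 η2 p1 p2 s : ℝ) (q1 q2 : Fin d → ℝ) : ℝ :=
  ∑ i, (8 / γ * (ξ1 + ξ2 + Ψ * q1 i + Ψ * q2 i) + 4 * η1 + η2 + 5 * θ * Ψ
      + Ψ * (4 * q1 i + q2 i) / θ)
    + Ψ * (5 * p1 + 3 * p2) + δ * (d * (4 / γ * κ ^ 2 + κ) + 3 * κ) * s

lemma intLE_frozen_err (h1 : FrozenMeas ρ1 b c) (h2 : FrozenMeas ρ2 b c)
    (hap : FrozenApprox bn cn κ ε m) (hκ : 0 ≤ Λ)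
    (hψ : TestBounds ψ r Ψ ε o) (hε : 0 < ε) (hγ : 0 < γ) (hθ : 0 < θ) (hδ : 0 < δ)
    {X1 X2 Y1 Y2 : Rd d → ℝ} {ξ1 ξ2 η1 η2 : ℝ}
    (hX1 : IntLE volume (fun x => testMass ψ x * X1 x) ξ1)
    (hX2 : IntLE volume (fun x => testMass ψ x * X2 x) ξ2)
    (hY1 : IntLE volume (fun x => testMass ψ x * Y1 x) η1)
    (hY2 : IntLE volume (fun x => testMass ψ x * Y2 x) η2) :
    IntLE volume (fun x => testMass ψ x * (∑ i, (4 / γ *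
          ((2 * X1 x + 2 * driftErr ρ1 b bn ε m i x) + (2 * X2 x + 2 * driftErr ρ2 b bn ε m i x))
          + 4 * (Y1 x + θ * mollDens ρ1 ε x + driftErr ρ1 b bn ε m i x / θ)
          + (Y2 x + θ * mollDens ρ2 ε x + driftErr ρ2 b bn ε m i x / θ))
        + 5 * potErr ρ1 c cn ε m x + 3 * potErr ρ2 c cn ε m x
        + δ * (d * (4 / γ * Λ ^ 2 + Λ) + 3 * Λ)))
      (frozenErr d γ Λ δ θ Ψ ξ1 ξ2 η1 η2 (∫ y, |c y - cn y| ∂ρ1 + m) (∫ y, |c y - cn y| ∂ρ2 + m)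
        (∫ x, testMass ψ x) (fun i => 2 * ∫ y, (b i y - bn i y) ^ 2 ∂ρ1 + 2 * m ^ 2)
        (fun i => 2 * ∫ y, (b i y - bn i y) ^ 2 ∂ρ2 + 2 * m ^ 2)) := by
  have := h1.isFiniteMeasure
  have := h2.isFiniteMeasure
  have hm := hap.osc_nonneg
  have cc : ∀ {ρ : Measure (Rd d)} [IsFiniteMeasure ρ] (_ : FrozenMeas ρ b c),
      Continuous (potErr ρ c cn ε m) := fun h =>
    (continuous_cv_moll hε (h.pot.sub hap.integrable_pot).abs).add
      ((continuous_cv_moll hε (integrable_const 1)).const_mul _)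
  have D1 := fun i => hψ.intLE_testMass_mul (h1.intLE_driftErr hap hε i)
    (continuous_driftErr hε i (h1.integrable_sub_sq hap i)) (driftErr_nonneg i)
  have D2 := fun i => hψ.intLE_testMass_mul (h2.intLE_driftErr hap hε i)
    (continuous_driftErr hε i (h2.integrable_sub_sq hap i)) (driftErr_nonneg i)
  have P1 := hψ.intLE_testMass_mul (h1.intLE_potErr hap hε) (cc h1) (potErr_nonneg hm)
  have P2 := hψ.intLE_testMass_mul (h2.intLE_potErr hap hε) (cc h2) (potErr_nonneg hm)
  have R1 := hψ.intLE_testMass_mul (h1.intLE_mollDens hε) (mollDens_contDiff hε).continuous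
    (mollDens_nonneg ε)
  have R2 := hψ.intLE_testMass_mul (h2.intLE_mollDens hε) (mollDens_contDiff hε).continuous
    (mollDens_nonneg ε)
  have S : IntLE volume (testMass ψ) (∫ x, testMass ψ x) := ⟨hψ.test.integrable_testMass, le_rfl⟩
  have h8 : (0 : ℝ) ≤ 8 / γ := by positivity
  have hθ' : (0 : ℝ) ≤ 1 / θ := by positivity
  have h4 : (0 : ℝ) ≤ 4 := by norm_num
  have I := IntLE.sum (s := Finset.univ) fun i _ =>
    ((((hX1.add hX2).add ((D1 i).add (D2 i))).const_mul h8).add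
      ((hY1.const_mul h4).add hY2)).add
      ((((R1.const_mul h4).add R2).const_mul hθ.le).add
        ((((D1 i).const_mul h4).add (D2 i)).const_mul hθ'))
  have J := (I.add ((P1.const_mul (show (0 : ℝ) ≤ 5 by norm_num)).add
    (P2.const_mul (show (0 : ℝ) ≤ 3 by norm_num)))).add
    (S.const_mul (show 0 ≤ δ * (d * (4 / γ * Λ ^ 2 + Λ) + 3 * Λ) by positivity))
  refine J.congr (fun x => ?_) (le_of_eq ?_)
  · have e : ∀ i, 4 / γ *
          ((2 * X1 x + 2 * driftErr ρ1 b bn ε m i x) + (2 * X2 x + 2 * driftErr ρ2 b bn ε m i x))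
          + 4 * (Y1 x + θ * mollDens ρ1 ε x + driftErr ρ1 b bn ε m i x / θ)
          + (Y2 x + θ * mollDens ρ2 ε x + driftErr ρ2 b bn ε m i x / θ)
        = 8 / γ * (X1 x + X2 x + (driftErr ρ1 b bn ε m i x + driftErr ρ2 b bn ε m i x))
          + (4 * Y1 x + Y2 x) + (θ * (4 * mollDens ρ1 ε x + mollDens ρ2 ε x)
          + 1 / θ * (4 * driftErr ρ1 b bn ε m i x + driftErr ρ2 b bn ε m i x)) := by
      intro i; ring
    simp only [e]
    rw [mul_add, mul_add, mul_add, Finset.mul_sum, add_assoc (∑ i, _)]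
    refine congrArg₂ _ (congrArg₂ _ (Finset.sum_congr rfl fun i _ => by ring) (by ring)) (by ring)
  · simp only [frozenErr]
    refine congrArg₂ _ (congrArg₂ _ (Finset.sum_congr rfl fun i _ => by ring) (by ring)) (by ring)

set_option maxHeartbeats 400000 in
/-- The energy estimate at a fixed time. -/
lemma frozenRate_le (h1 : FrozenMeas ρ1 b c) (h2 : FrozenMeas ρ2 b c)
    (ha : FrozenCoeff r γ K Λ a) (hap : FrozenApprox bn cn κ ε m)
    (hψ : TestBounds ψ r Ψ ε o) (hε : 0 < ε) (hε1 : ε ≤ 1) (hθ : 0 < θ) (hδ : 0 < δ)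
    {X1 X2 Y1 Y2 : Rd d → ℝ} {ξ1 ξ2 η1 η2 : ℝ}
    (hX1 : IntLE volume (fun x => testMass ψ x * X1 x) ξ1)
    (hX2 : IntLE volume (fun x => testMass ψ x * X2 x) ξ2)
    (hY1 : IntLE volume (fun x => testMass ψ x * Y1 x) η1)
    (hY2 : IntLE volume (fun x => testMass ψ x * Y2 x) η2)
    (hX1n : ∀ x, 0 ≤ X1 x) (hX2n : ∀ x, 0 ≤ X2 x)
    (hcX1 : ∀ x ∈ Metric.ball (0 : Rd d) r, ∀ i,
      mollComm ρ1 a ε i x ^ 2 ≤ mollDens ρ1 ε x * X1 x)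
    (hcX2 : ∀ x ∈ Metric.ball (0 : Rd d) r, ∀ i,
      mollComm ρ2 a ε i x ^ 2 ≤ mollDens ρ2 ε x * X2 x)
    (hcY1 : ∀ x ∈ Metric.ball (0 : Rd d) r, ∀ i, |mollComm ρ1 a ε i x| ≤ Y1 x)
    (hcY2 : ∀ x ∈ Metric.ball (0 : Rd d) r, ∀ i, |mollComm ρ2 a ε i x| ≤ Y2 x) :
    frozenRate ρ1 ρ2 a b c ψ ε δ ≤ frozenMain ρ1 ρ2 a b c ψ
      + (d ^ 2 * (o * K + 2 * Λ * ε * Ψ)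
        + o * (∑ i, ∫ y, |b i y| ∂ρ1 + ∫ y, |c y| ∂ρ1 + ∫ y, |c y| ∂ρ2))
      + frozenErr d γ (d * (Λ * mollGradConst d * mollMass d 3) + κ) δ θ Ψ ξ1 ξ2 η1 η2
        (∫ y, |c y - cn y| ∂ρ1 + m) (∫ y, |c y - cn y| ∂ρ2 + m)
        (∫ x, testMass ψ x) (fun i => 2 * ∫ y, (b i y - bn i y) ^ 2 ∂ρ1 + 2 * m ^ 2)
        (fun i => 2 * ∫ y, (b i y - bn i y) ^ 2 ∂ρ2 + 2 * m ^ 2) := by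
  have := h1.isFiniteMeasure
  have := h2.isFiniteMeasure
  set κ' := d * (Λ * mollGradConst d * mollMass d 3) + κ with hκ'
  have hsub : Metric.ball (0 : Rd d) r ⊆ Metric.ball 0 (r + 1) :=
    Metric.ball_subset_ball (by linarith)
  have hκκ' : κ ≤ κ' := le_add_of_nonneg_left (mul_nonneg (Nat.cast_nonneg d)
    (mul_nonneg (mul_nonneg ha.lip_nonneg (mollGradConst_nonneg d)) (mollMass_nonneg d 3)))
  have hκ0 : 0 ≤ κ' := hap.bdd_nonneg.trans hκκ'
  have gm := intLE_frozen_main h1 h2 ha hψ hε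
  have ge := intLE_frozen_err h1 h2 hap hκ0 hψ hε ha.ell_pos hθ hδ hX1 hX2 hY1 hY2
  have g := gm.add ge
  have hR1 := mollDens_contDiff (ρ := ρ1) hε
  have hR2 := mollDens_contDiff (ρ := ρ2) hε
  have hR10 := mollDens_nonneg (ρ := ρ1) ε
  have hR20 := mollDens_nonneg (ρ := ρ2) ε
  have hJ1 := fun i => mollFlux_contDiff ha h1.integrable_drift hε i
  have hJ2 := fun i => mollFlux_contDiff ha h2.integrable_drift hε i
  have hC1 := continuous_cv_moll hε h1.pot
  have hC2 := continuous_cv_moll hε h2.pot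
  have hA := mollCoeff_contDiff ha hε
  have key := energy_inequality (ψ := ψ) (R := mollDens ρ1 ε)
    (M := fun x => mollDens ρ1 ε x + mollDens ρ2 ε x + δ) (cn := cn) (C1 := cv ρ1 c (moll ε))
    (Cm := fun x => cv ρ1 c (moll ε) x + cv ρ2 c (moll ε) x) (J1 := mollFlux ρ1 a b ε)
    (Jm := fun i x => mollFlux ρ1 a b ε i x + mollFlux ρ2 a b ε i x) (bn := bn)
    (A := mollCoeff a ε) (γ := γ) hψ.test hψ.nonneg hR1 ((hR1.add hR2).add contDiff_const)
    hR10 (fun x => by linarith [hR20 x]) (fun x => by linarith [hR10 x, hR20 x]) hA hJ1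
    (fun i => (hJ1 i).add (hJ2 i)) hC1 (hC1.add hC2) ha.ell_pos
    (fun x hx ξ => mollCoeff_ell ha hε hε1
      (hsub (hψ.supp (subset_tsupport _ hx))) ξ) g.1 (fun x => ?_)
  · refine le_trans (le_of_eq ?_) (key.trans g.2)
    refine integral_congr_ae (Filter.Eventually.of_forall fun x => ?_)
    have e : ∀ i, pd i (fun x => mollFlux ρ1 a b ε i x + mollFlux ρ2 a b ε i x) x
        = pd i (mollFlux ρ1 a b ε i) x + pd i (mollFlux ρ2 a b ε i) x := fun i =>
      pd_add i ((hJ1 i).differentiable one_ne_zero x) ((hJ2 i).differentiable one_ne_zero x)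
    simp only [mollGen, e, Finset.sum_add_distrib]
    ring
  · by_cases hx : x ∈ tsupport ψ
    · have hxr := hψ.supp hx
      have b1 := fun i => h1.fluxDefect_bounds hap hε hθ i (hcX1 x hxr i) (hcY1 x hxr i)
      have b2 := fun i => h2.fluxDefect_bounds hap hε hθ i (hcX2 x hxr i) (hcY2 x hxr i)
      have he0 : ∀ i, |bn i x - ∑ j, pd j (mollCoeff a ε i j) x| ≤ κ' := by
        intro i
        have h3 : |∑ j, pd j (mollCoeff a ε i j) x|
            ≤ d * (Λ * mollGradConst d * mollMass d 3) :=
          (Finset.abs_sum_le_sum_abs _ _).trans ((Finset.sum_le_sum fun j _ =>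
            abs_pd_mollCoeff_le ha hε hε1 (hsub hxr) i j j).trans (by simp))
        have := (abs_sub (bn i x) (∑ j, pd j (mollCoeff a ε i j) x)).trans
          (add_le_add (hap.drift_bdd i x) h3)
        linarith
      have hp1 := (abs_cv_sub_le_mollDev h1.pot hε (cn x) x).trans
        (mollDev_le_potErr h1.pot hap.integrable_pot hε hap.pot_osc x)
      have hp2 := (abs_cv_sub_le_mollDev h2.pot hε (cn x) x).trans
        (mollDev_le_potErr h2.pot hap.integrable_pot hε hap.pot_osc x)
      refine (energy_rhs_pointwise (B1 := fun i => cv ρ1 (fun y => |b i y|) (moll ε) x)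
        (S := testMass ψ x) (R2 := mollDens ρ2 ε x) (δ := δ) (κ := κ') (hψ.nonneg x) (le_testMass x)
        (fun i => hψ.pd_le_testMass i x) (hR10 x) (hR20 x) hδ ha.ell_pos hκ0 (hap.pot_nonpos x)
        ((hap.pot_bdd x).trans hκκ') hp1 hp2
        (fun i => fluxDefect_add_const (J1 := mollFlux ρ1 a b ε) (J2 := mollFlux ρ2 a b ε) δ hA hR1 hR2 i x) he0
        (fun i => (b1 i).1) (fun i => (b2 i).1)
        (fun i => by linarith [hX1n x, driftErr_nonneg (ρ := ρ1) (b := b) (bn := bn) (ε := ε) (m := m) i x])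
        (fun i => by linarith [hX2n x, driftErr_nonneg (ρ := ρ2) (b := b) (bn := bn) (ε := ε) (m := m) i x])
        (fun i => (b1 i).2.1) (fun i => (b2 i).2.1) (fun i => (b1 i).2.2)).trans ?_
      have t : ∑ i, ∑ j, |mollCoeff a ε i j x| * mollDens ρ1 ε x * |pd j (pd i ψ) x|
          ≤ ∑ i, ∑ j, (|pd j (pd i ψ) x| * cv ρ1 (fun y => |a i j y|) (moll ε) x
            + 2 * Λ * ε * Ψ * mollDens ρ1 ε x) := by
        refine Finset.sum_le_sum fun i _ => Finset.sum_le_sum fun j _ => ?_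
        have h3 := mul_le_mul_of_nonneg_right
          (abs_mollCoeff_mul_mollDens_le (ρ := ρ1) ha hε hε1 (hsub hxr) i j) (abs_nonneg (pd j (pd i ψ) x))
        have hΛ := ha.lip_nonneg
        have h4 := mul_le_mul_of_nonneg_left (hψ.hess_le i j x)
          (show 0 ≤ 2 * Λ * ε * mollDens ρ1 ε x from mul_nonneg (by positivity) (hR10 x))
        linarith
      have t2 : ∑ i, cv ρ1 (fun y => |b i y|) (moll ε) x * |pd i ψ x|
          = ∑ i, |pd i ψ x| * cv ρ1 (fun y => |b i y|) (moll ε) x :=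
        Finset.sum_congr rfl fun i _ => mul_comm _ _
      rw [t2]
      linarith
    · have hΛ := ha.lip_nonneg
      have hΨ := hψ.bound_nonneg
      have e1 : ∀ i, pd i ψ x = 0 := fun i => pd_eq_zero_of_notMem_tsupport hx i
      have e2 : ∀ i j, pd j (pd i ψ) x = 0 := fun i j =>
        pd_pd_eq_zero_of_notMem_tsupport hx j i
      simp only [e1, e2, eq_zero_of_notMem_tsupport hx, testMass_eq_zero hx, mul_zero, zero_mul,
        abs_zero, Finset.sum_const_zero, zero_div, add_zero, neg_zero, zero_add]
      exact Finset.sum_nonneg fun i _ => Finset.sum_nonneg fun j _ =>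
        mul_nonneg (by positivity) (hR10 x)

end FrozenIntegrated

section FrozenDomination

variable {d : ℕ}

variable {ρ ρ1 ρ2 : Measure (Rd d)} {r γ K Λ κ ε m δ θ Ψ o : ℝ} {a : Fin d → Fin d → Rd d → ℝ}
  {b bn : Fin d → Rd d → ℝ} {c cn ψ : Rd d → ℝ}

lemma FrozenMeas.intLE_mollInt (h : FrozenMeas ρ b c) (hε : 0 < ε) {k : ℕ} (hk : k ≠ 0) :
    IntLE volume (mollInt ρ ε k) (mollMass d k) := by
  have := h.isFiniteMeasure
  refine ⟨integrable_mollInt hε hk, ?_⟩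
  rw [integral_mollInt hε hk]
  exact mul_le_of_le_one_left (mollMass_nonneg d k) h.real_le

lemma FrozenMeas.intLE_testMass_mul_mollInt (h : FrozenMeas ρ b c) (hψ : TestBounds ψ r Ψ ε o)
    (hε : 0 < ε) {k : ℕ} (hk : k ≠ 0) {C : ℝ} (hC : 0 ≤ C) :
    IntLE volume (fun x => testMass ψ x * (C * mollInt ρ ε k x)) (Ψ * (C * mollMass d k)) := by
  have := h.isFiniteMeasure
  exact hψ.intLE_testMass_mul ((h.intLE_mollInt hε hk).const_mul hC)
    ((mollInt_continuous hε hk).const_mul C) fun x => mul_nonneg hC (mollInt_nonneg ε k x)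

lemma FrozenMeas.integral_abs_drift_le (h : FrozenMeas ρ b c) (i : Fin d) :
    ∫ y, |b i y| ∂ρ ≤ 1 + ∫ y, b i y ^ 2 ∂ρ := by
  have := h.isFiniteMeasure
  calc ∫ y, |b i y| ∂ρ ≤ ∫ y, (1 + b i y ^ 2) ∂ρ :=
        integral_mono (h.integrable_drift i).abs ((integrable_const 1).add (h.drift_sq i)) fun y => by
          have := sq_nonneg (|b i y| - 1)
          have := sq_abs (b i y)
          show |b i y| ≤ 1 + b i y ^ 2
          nlinarith [abs_nonneg (b i y)]
    _ = ρ.real univ + ∫ y, b i y ^ 2 ∂ρ := by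
        rw [integral_add (integrable_const 1) (h.drift_sq i)]; simp
    _ ≤ _ := by linarith [h.real_le]

lemma integral_mul_le_of_abs_le {w h : Rd d → ℝ} {C : ℝ} (hw : Integrable w ρ)
    (hC : ∀ x, |h x| ≤ C) : |∫ y, w y * h y ∂ρ| ≤ C * ∫ y, |w y| ∂ρ := by
  rw [← integral_const_mul]
  refine abs_integral_le_of_abs_le (hw.abs.const_mul C) fun y => ?_
  rw [abs_mul, mul_comm]
  exact mul_le_mul_of_nonneg_right (hC y) (abs_nonneg _)

/-- The total size of the lower order coefficients with respect to two measures. -/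
def coeffMass (ρ1 ρ2 : Measure (Rd d)) (b : Fin d → Rd d → ℝ) (c : Rd d → ℝ) : ℝ :=
  1 + ∑ i, ∫ y, b i y ^ 2 ∂ρ1 + ∑ i, ∫ y, b i y ^ 2 ∂ρ2 + ∫ y, |c y| ∂ρ1 + ∫ y, |c y| ∂ρ2

lemma TestBounds.abs_le (hψ : TestBounds ψ r Ψ ε o) (x : Rd d) : |ψ x| ≤ Ψ := by
  rw [abs_of_nonneg (hψ.nonneg x)]; exact (le_testMass x).trans (hψ.mass_le x)

lemma TestBounds.abs_pd_le (hψ : TestBounds ψ r Ψ ε o) (i : Fin d) (x : Rd d) : |pd i ψ x| ≤ Ψ :=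
  (hψ.pd_le_testMass i x).trans (hψ.mass_le x)

lemma TestBounds.trivial_osc (hψ : TestBounds ψ r Ψ ε o) : TestBounds ψ r Ψ ε (2 * Ψ) where
  test := hψ.test
  nonneg := hψ.nonneg
  supp := hψ.supp
  mass_le := hψ.mass_le
  hess_le := hψ.hess_le
  osc x y _ := (abs_sub _ _).trans (by linarith [hψ.abs_le x, hψ.abs_le y])
  grad_osc i x y _ := (abs_sub _ _).trans (by linarith [hψ.abs_pd_le i x, hψ.abs_pd_le i y])
  hess_osc i j x y _ := (abs_sub _ _).trans (by linarith [hψ.hess_le i j x, hψ.hess_le i j y])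

lemma frozenMain_le (h1 : FrozenMeas ρ1 b c) (h2 : FrozenMeas ρ2 b c)
    (ha : FrozenCoeff r γ K Λ a) (hψ : TestBounds ψ r Ψ ε o) :
    frozenMain ρ1 ρ2 a b c ψ ≤ d ^ 2 * (Ψ * K) + Ψ * ∑ i, ∫ y, |b i y| ∂ρ1
      + Ψ * (∫ y, |c y| ∂ρ1 + ∫ y, |c y| ∂ρ2) := by
  have := h1.isFiniteMeasure
  have hΨ := hψ.bound_nonneg
  have t1 : ∀ i j, ∫ y, |a i j y| * |pd j (pd i ψ) y| ∂ρ1 ≤ Ψ * K := fun i j => by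
    have h3 := (abs_le.1 (integral_mul_le_of_abs_le (h := fun y => |pd j (pd i ψ) y|)
      (ha.integrable (ρ := ρ1) i j).abs (C := Ψ) fun x => by
        rw [abs_abs]; exact hψ.hess_le i j x)).2
    have h4 : ∫ y, |(|a i j y|)| ∂ρ1 ≤ K := by
      refine (integral_mono (ha.integrable i j).abs.abs (integrable_const K)
        fun y => by simpa using ha.bdd i j y).trans ?_
      simpa using mul_le_of_le_one_left ha.bdd_nonneg h1.real_le
    exact h3.trans (mul_le_mul_of_nonneg_left h4 hΨ)
  have t2 : ∀ i, ∫ y, |b i y| * |pd i ψ y| ∂ρ1 ≤ Ψ * ∫ y, |b i y| ∂ρ1 := fun i => by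
    have h3 := (abs_le.1 (integral_mul_le_of_abs_le (h := fun y => |pd i ψ y|)
      (h1.integrable_drift i).abs (C := Ψ) fun x => by
        rw [abs_abs]; exact hψ.abs_pd_le i x)).2
    simpa only [abs_abs] using h3
  have t3 := abs_le.1 (integral_mul_le_of_abs_le h1.pot hψ.abs_le)
  have t4 := abs_le.1 (integral_mul_le_of_abs_le h2.pot hψ.abs_le)
  have s1 : ∑ i, ∑ j, ∫ y, |a i j y| * |pd j (pd i ψ) y| ∂ρ1 ≤ d ^ 2 * (Ψ * K) :=
    (Finset.sum_le_sum fun i _ => Finset.sum_le_sum fun j _ => t1 i j).trans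
      (le_of_eq (by simp; ring))
  have s2 : ∑ i, ∫ y, |b i y| * |pd i ψ y| ∂ρ1 ≤ Ψ * ∑ i, ∫ y, |b i y| ∂ρ1 := by
    rw [Finset.mul_sum]; exact Finset.sum_le_sum fun i _ => t2 i
  have n1 : 0 ≤ Ψ * ∫ y, |c y| ∂ρ1 := mul_nonneg hΨ (integral_nonneg fun _ => abs_nonneg _)
  have n2 : 0 ≤ Ψ * ∫ y, |c y| ∂ρ2 := mul_nonneg hΨ (integral_nonneg fun _ => abs_nonneg _)
  unfold frozenMain
  linarith [t3.1, t3.2, t4.1, t4.2]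

lemma frozenApprox_zero (ε : ℝ) :
    FrozenApprox (fun (_ : Fin d) (_ : Rd d) => (0 : ℝ)) (fun _ => 0) 0 ε 0 where
  drift_cont _ := continuous_const
  pot_cont := continuous_const
  drift_bdd := by simp
  pot_bdd := by simp
  pot_nonpos := by simp
  drift_osc := by simp
  pot_osc := by simp
  bdd_nonneg := le_rfl
  osc_nonneg := le_rfl

/-- The energy rate is dominated by the size of the coefficients, uniformly in the parameters. -/
lemma exists_frozenRate_le (d : ℕ) {γ K Λ Ψ s : ℝ} (hγ : 0 < γ) (hK : 0 ≤ K) (hΛ : 0 ≤ Λ)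
    (hΨ : 0 ≤ Ψ) (hs : 0 ≤ s) : ∃ C, 0 ≤ C ∧ ∀ {ρ1 ρ2 : Measure (Rd d)} {r ε δ o : ℝ}
      {a : Fin d → Fin d → Rd d → ℝ} {b : Fin d → Rd d → ℝ} {c ψ : Rd d → ℝ},
      FrozenMeas ρ1 b c → FrozenMeas ρ2 b c → FrozenCoeff r γ K Λ a → TestBounds ψ r Ψ ε o →
      ∫ x, testMass ψ x ≤ s → 0 < ε → ε ≤ 1 → 0 < δ → δ ≤ 1 →
      frozenRate ρ1 ρ2 a b c ψ ε δ ≤ C * coeffMass ρ1 ρ2 b c := by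
  set ξ := Ψ * (commConst d Λ ^ 2 * mollMass d 2) with hξ
  set η := Ψ * (commConst d Λ * mollMass d 3) with hη
  set k := d * (Λ * mollGradConst d * mollMass d 3) + 0 with hk
  have hM2 := mollMass_nonneg d 2
  have hM3 := mollMass_nonneg d 3
  have hG := mollGradConst_nonneg d
  have hcc := commConst_nonneg d hΛ
  have hξ0 : 0 ≤ ξ := by positivity
  have hη0 : 0 ≤ η := by positivity
  have hk0 : 0 ≤ k := by positivity
  set c0 := d ^ 2 * (Ψ * K) + 3 * Ψ * d + d ^ 2 * (2 * Ψ * K + 2 * Λ * Ψ)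
    + d * (16 / γ * ξ + 5 * η + 5 * Ψ) + (d * (4 / γ * k ^ 2 + k) + 3 * k) * s with hc0
  set c1 := 3 * Ψ + 16 / γ * Ψ + 8 * Ψ with hc1
  set c2 := 8 * Ψ with hc2
  have hc0' : 0 ≤ c0 := by positivity
  have hc1' : 0 ≤ c1 := by positivity
  have hc2' : 0 ≤ c2 := by positivity
  refine ⟨c0 + c1 + c2, by positivity, ?_⟩
  intro ρ1 ρ2 r ε δ o a b c ψ h1 h2 ha hψ hsψ hε hε1 hδ hδ1
  have := h1.isFiniteMeasure
  have := h2.isFiniteMeasure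
  have hsub : Metric.ball (0 : Rd d) r ⊆ Metric.ball 0 (r + 1) :=
    Metric.ball_subset_ball (by linarith)
  have hψ' := hψ.trivial_osc
  have key := frozenRate_le h1 h2 ha (frozenApprox_zero ε) hψ' hε hε1 one_pos hδ
    (h1.intLE_testMass_mul_mollInt hψ hε two_ne_zero (sq_nonneg (commConst d Λ)))
    (h2.intLE_testMass_mul_mollInt hψ hε two_ne_zero (sq_nonneg (commConst d Λ)))
    (h1.intLE_testMass_mul_mollInt hψ hε three_ne_zero hcc)
    (h2.intLE_testMass_mul_mollInt hψ hε three_ne_zero hcc)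
    (fun x => mul_nonneg (sq_nonneg _) (mollInt_nonneg ε 2 x))
    (fun x => mul_nonneg (sq_nonneg _) (mollInt_nonneg ε 2 x))
    (fun x hx i => mollComm_sq_le ha hε hε1 (hsub hx) i)
    (fun x hx i => mollComm_sq_le ha hε hε1 (hsub hx) i)
    (fun x hx i => abs_mollComm_le ha hε hε1 (hsub hx) i)
    (fun x hx i => abs_mollComm_le ha hε hε1 (hsub hx) i)
  have hm := frozenMain_le h1 h2 ha hψ
  set B1 := ∑ i, ∫ y, b i y ^ 2 ∂ρ1 with hB1
  set B2 := ∑ i, ∫ y, b i y ^ 2 ∂ρ2 with hB2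
  set C1 := ∫ y, |c y| ∂ρ1 with hC1
  set C2 := ∫ y, |c y| ∂ρ2 with hC2
  have hB10 : 0 ≤ B1 := Finset.sum_nonneg fun i _ => integral_nonneg fun _ => sq_nonneg _
  have hB20 : 0 ≤ B2 := Finset.sum_nonneg fun i _ => integral_nonneg fun _ => sq_nonneg _
  have hC10 : 0 ≤ C1 := integral_nonneg fun _ => abs_nonneg _
  have hC20 : 0 ≤ C2 := integral_nonneg fun _ => abs_nonneg _
  have hβ : ∑ i, ∫ y, |b i y| ∂ρ1 ≤ d + B1 := by
    refine (Finset.sum_le_sum fun i _ => h1.integral_abs_drift_le i).trans (le_of_eq ?_)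
    simp [Finset.sum_add_distrib, hB1]
  set β := ∑ i, ∫ y, |b i y| ∂ρ1 with hβdef
  have herr : frozenErr d γ k δ 1 Ψ ξ ξ η η C1 C2 (∫ x, testMass ψ x)
      (fun i => 2 * ∫ y, b i y ^ 2 ∂ρ1) (fun i => 2 * ∫ y, b i y ^ 2 ∂ρ2)
      = d * (16 / γ * ξ + 5 * η + 5 * Ψ) + (16 / γ * Ψ + 8 * Ψ) * B1 + (16 / γ * Ψ + 2 * Ψ) * B2
        + Ψ * (5 * C1 + 3 * C2) + δ * (d * (4 / γ * k ^ 2 + k) + 3 * k) * ∫ x, testMass ψ x := by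
    simp only [frozenErr, hB1, hB2]
    congr 1
    congr 1
    have hd : ∀ v : ℝ, (d : ℝ) * v = ∑ _i : Fin d, v := fun v => by simp
    rw [Finset.mul_sum, Finset.mul_sum, hd, ← Finset.sum_add_distrib, ← Finset.sum_add_distrib]
    exact Finset.sum_congr rfl fun i _ => by ring
  simp only [sub_zero, add_zero, ne_eq, OfNat.ofNat_ne_zero, not_false_eq_true, zero_pow,
    mul_zero, ← hξ, ← hη, ← hC1, ← hC2] at key
  rw [add_zero] at hk
  rw [← hk, herr] at key
  have e1 : δ * (d * (4 / γ * k ^ 2 + k) + 3 * k) * ∫ x, testMass ψ x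
      ≤ (d * (4 / γ * k ^ 2 + k) + 3 * k) * s := by
    have h3 : 0 ≤ d * (4 / γ * k ^ 2 + k) + 3 * k := by positivity
    have h4 := mul_le_mul_of_nonneg_left hsψ h3
    have h5 : 0 ≤ (d * (4 / γ * k ^ 2 + k) + 3 * k) * ∫ x, testMass ψ x :=
      mul_nonneg h3 (integral_nonneg hψ.testMass_nonneg)
    have h6 := mul_le_mul_of_nonneg_right hδ1 h5
    linarith
  have e2 : d ^ 2 * (2 * Ψ * K + 2 * Λ * ε * Ψ) ≤ d ^ 2 * (2 * Ψ * K + 2 * Λ * Ψ) := by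
    have h3 := mul_le_mul_of_nonneg_left hε1 (show 0 ≤ 2 * Λ * Ψ by positivity)
    exact mul_le_mul_of_nonneg_left (by linarith) (by positivity)
  have e3 := mul_le_mul_of_nonneg_left hβ hΨ
  have f1 : 0 ≤ 16 / γ * Ψ := by positivity
  have f2 : 0 ≤ 16 / γ * Ψ * B2 := by positivity
  have f3 : 0 ≤ Ψ * B2 := by positivity
  have f4 : 0 ≤ Ψ * C1 := by positivity
  have f5 : 0 ≤ Ψ * C2 := by positivity
  have f6 : 0 ≤ Ψ * B1 := by positivity
  have tot : frozenRate ρ1 ρ2 a b c ψ ε δ ≤ c0 + c1 * (B1 + B2) + c2 * (C1 + C2) := by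
    rw [hc0, hc1, hc2]
    linarith
  refine tot.trans ?_
  unfold coeffMass
  rw [← hB1, ← hB2, ← hC1, ← hC2]
  have g1 := mul_nonneg hc0' (add_nonneg (add_nonneg hB10 hB20) (add_nonneg hC10 hC20))
  have g2 := mul_nonneg hc1' (add_nonneg zero_le_one (add_nonneg hC10 hC20))
  have g3 := mul_nonneg hc2' (add_nonneg zero_le_one (add_nonneg hB10 hB20))
  linarith

end FrozenDomination

section FrozenLimit

open Filter Topology

variable {d : ℕ}

variable {ρ ρ1 ρ2 : Measure (Rd d)} {r γ K Λ κ ε m δ θ Ψ o : ℝ} {a : Fin d → Fin d → Rd d → ℝ}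
  {b bn : Fin d → Rd d → ℝ} {c cn ψ : Rd d → ℝ}

lemma exists_osc_le {f : Rd d → ℝ} (hf : Continuous f) (hfc : HasCompactSupport f) {τ : ℝ}
    (hτ : 0 < τ) : ∃ η, 0 < η ∧ ∀ x y, ‖x - y‖ ≤ η → |f x - f y| ≤ τ := by
  obtain ⟨η, hη, h⟩ := Metric.uniformContinuous_iff.1
    (hfc.uniformContinuous_of_continuous hf) τ hτ
  refine ⟨η / 2, by positivity, fun x y hxy => ?_⟩
  have := h (a := x) (b := y) (by rw [dist_eq_norm]; linarith)
  rw [Real.dist_eq] at this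
  exact this.le

lemma abs_mollComm_le_of_density [IsFiniteMeasure ρ] (ha : FrozenCoeff r γ K Λ a)
    (hρ : ρ ≪ volume) {h : Rd d → ℝ} (hhc : Continuous h) (hhs : HasCompactSupport h) {τ : ℝ}
    (hε : 0 < ε) (hε1 : ε ≤ 1) (hosc : ∀ x y, ‖x - y‖ ≤ ε → |h x - h y| ≤ τ)
    {x : Rd d} (hx : x ∈ Metric.ball (0 : Rd d) (r + 1)) (i : Fin d) :
    |mollComm ρ a ε i x| ≤ commConst d Λ *
      (cv volume (fun y => |(ρ.rnDeriv volume y).toReal - h y|) (mollPow ε 3) x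
        + τ * mollMass d 3) := by
  have h3c := mollPow_hasCompactSupport (d := d) hε (k := 3) (by norm_num)
  have hf : Integrable (fun y => (ρ.rnDeriv volume y).toReal) := Measure.integrable_toReal_rnDeriv
  have hh : Integrable h := hhc.integrable_of_hasCompactSupport hhs
  have hG : Integrable (fun y => mollPow ε 3 (x - y)) (volume : Measure (Rd d)) :=
    ((mollPow_continuous ε 3).integrable_of_hasCompactSupport h3c).comp_sub_left x
  have hk := abs_commKer_le ha hε hε1 hx i
  have hkm : Measurable (commKer a ε i x) := by
    have h1 := fun j => (mollPow_contDiff (d := d) ε 4).pd_top j |>.continuous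
    have h2 := mollPow_continuous (d := d) ε 4
    have h4 := ha.meas
    unfold commKer
    refine Finset.measurable_fun_sum _ fun j _ => ?_
    refine (((h4 i j).sub_const _).mul ?_).sub (Measurable.const_mul ?_ _)
    · exact ((h1 j).comp (continuous_const.sub continuous_id)).measurable
    · exact (h2.comp (continuous_const.sub continuous_id)).measurable
  have hkb : ∃ C, ∀ y, |commKer a ε i x y| ≤ C := by
    obtain ⟨C, hC⟩ := (mollPow_continuous (d := d) ε 3).bounded_above_of_compact_support h3c
    refine ⟨commConst d Λ * C, fun y => (hk y).trans
      (mul_le_mul_of_nonneg_left ?_ (commConst_nonneg d ha.lip_nonneg))⟩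
    exact (le_abs_self _).trans (hC _)
  obtain ⟨C, hC⟩ := hkb
  have hki : Integrable (commKer a ε i x) :=
    (hG.const_mul (commConst d Λ)).mono' hkm.aestronglyMeasurable
      (Eventually.of_forall fun y => hk y)
  have hkf : Integrable (fun y => (ρ.rnDeriv volume y).toReal * commKer a ε i x y) := by
    have := hf.bdd_mul (c := C) hkm.aestronglyMeasurable (Eventually.of_forall fun y => hC y)
    simpa only [mul_comm] using this
  have e : mollComm ρ a ε i x
      = ∫ y, ((ρ.rnDeriv volume y).toReal - h x) * commKer a ε i x y := by
    simp only [sub_mul]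
    rw [mollComm_eq_integral ha hε, ← integral_rnDeriv_smul hρ, integral_sub hkf (hki.const_mul _),
      integral_const_mul, integral_commKer ha hε]
    simp
  have hd : Integrable (fun y => |(ρ.rnDeriv volume y).toReal - h y|) := (hf.sub hh).abs
  have i1 : Integrable (fun y => |(ρ.rnDeriv volume y).toReal - h y| * mollPow ε 3 (x - y)) :=
    integrable_mul_comp_sub hd (mollPow_continuous ε 3) h3c x
  have i2 : Integrable (fun y => τ * mollPow ε 3 (x - y)) := hG.const_mul τ
  rw [e]
  refine (abs_integral_le_of_abs_le
    (g := fun y => commConst d Λ * (|(ρ.rnDeriv volume y).toReal - h y| * mollPow ε 3 (x - y)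
      + τ * mollPow ε 3 (x - y))) ((i1.add i2).const_mul _) fun y => ?_).trans (le_of_eq ?_)
  · rw [abs_mul]
    have hg0 := mollPow_nonneg (d := d) ε 3 (x - y)
    have hcc := commConst_nonneg d ha.lip_nonneg
    calc |(ρ.rnDeriv volume y).toReal - h x| * |commKer a ε i x y|
        ≤ |(ρ.rnDeriv volume y).toReal - h x| * (commConst d Λ * mollPow ε 3 (x - y)) :=
          mul_le_mul_of_nonneg_left (hk y) (abs_nonneg _)
      _ = commConst d Λ * (|(ρ.rnDeriv volume y).toReal - h x| * mollPow ε 3 (x - y)) := by ring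
      _ ≤ _ := mul_le_mul_of_nonneg_left ?_ hcc
    by_cases h0 : mollPow ε 3 (x - y) = 0
    · simp [h0]
    have hxy : ‖x - y‖ ≤ ε := (not_le.1 fun h' => h0 (mollPow_eq_zero hε (by norm_num) h')).le
    rw [← add_mul]
    refine mul_le_mul_of_nonneg_right ?_ hg0
    have h5 := hosc x y hxy
    have h6 := abs_sub_le (ρ.rnDeriv volume y).toReal (h y) (h x)
    rw [abs_sub_comm (h y)] at h6
    linarith
  · rw [integral_const_mul, integral_add i1 i2, integral_const_mul,
      integral_sub_left_eq_self (mollPow ε 3), integral_mollPow_eq hε]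
    rfl

/-- The commutator vanishes in `L¹` for absolutely continuous measures. -/
lemma exists_intLE_mollComm [IsFiniteMeasure ρ] (ha : FrozenCoeff r γ K Λ a) (hρ : ρ ≪ volume)
    (hψ : IsTest ψ) (hψ0 : ∀ x, 0 ≤ ψ x) (hψs : tsupport ψ ⊆ Metric.ball 0 r)
    (hψm : ∀ x, testMass ψ x ≤ Ψ) {τ : ℝ} (hτ : 0 < τ) :
    ∃ ε0, 0 < ε0 ∧ ∀ ε, 0 < ε → ε ≤ ε0 →
      IntLE volume (fun x => testMass ψ x * ∑ i, |mollComm ρ a ε i x|) τ := by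
  have hS0 : ∀ x, 0 ≤ testMass ψ x := fun x =>
    add_nonneg (hψ0 x) (Finset.sum_nonneg fun _ _ => abs_nonneg _)
  have hΨ : 0 ≤ Ψ := (hS0 0).trans (hψm 0)
  have hcc := commConst_nonneg d ha.lip_nonneg
  have hM3 := mollMass_nonneg d 3
  set s := ∫ x, testMass ψ x with hs
  have hs0 : 0 ≤ s := integral_nonneg hS0
  set D := d * (commConst d Λ * (Ψ * mollMass d 3 + s * mollMass d 3)) with hD
  have hD0 : 0 ≤ D := by positivity
  set τ' := τ / (D + 1) with hτ'
  have hτ'0 : 0 < τ' := by positivity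
  have hf : Integrable (fun y => (ρ.rnDeriv volume y).toReal) (volume : Measure (Rd d)) :=
    Measure.integrable_toReal_rnDeriv
  obtain ⟨h, hhs, hhd, hhc, hhi⟩ := hf.exists_hasCompactSupport_integral_sub_le hτ'0
  obtain ⟨η, hη, hosc⟩ := exists_osc_le hhc hhs hτ'0
  refine ⟨min η 1, by positivity, fun ε hε hε0 => ?_⟩
  have hε1 : ε ≤ 1 := hε0.trans (min_le_right _ _)
  have hεη : ε ≤ η := hε0.trans (min_le_left _ _)
  have hc : Continuous (fun x => ∑ i, |mollComm ρ a ε i x|) :=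
    continuous_finsetSum _ fun i _ => (mollComm_continuous ha hε i).abs
  refine ⟨hψ.integrable_testMass_mul hc, ?_⟩
  have h3c := mollPow_hasCompactSupport (d := d) hε (k := 3) (by norm_num)
  have hd : Integrable (fun y => |(ρ.rnDeriv volume y).toReal - h y|) := (hf.sub hhi).abs
  have hcv := integrable_cv hd (mollPow_continuous (d := d) ε 3) h3c
  have hcv0 : ∀ x, 0 ≤ cv volume (fun y => |(ρ.rnDeriv volume y).toReal - h y|) (mollPow ε 3) x :=
    cv_nonneg (fun _ => abs_nonneg _) (mollPow_nonneg ε 3)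
  have hcvI : ∫ x, cv volume (fun y => |(ρ.rnDeriv volume y).toReal - h y|) (mollPow ε 3) x
      ≤ τ' * mollMass d 3 := by
    rw [integral_cv hd (mollPow_continuous (d := d) ε 3) h3c, integral_mollPow_eq hε]
    exact mul_le_mul_of_nonneg_right hhd hM3
  have hI : Integrable (testMass ψ) := hψ.integrable_testMass
  have hpt : ∀ x, testMass ψ x * ∑ i, |mollComm ρ a ε i x|
      ≤ d * commConst d Λ * (Ψ * cv volume (fun y => |(ρ.rnDeriv volume y).toReal - h y|)
        (mollPow ε 3) x + τ' * mollMass d 3 * testMass ψ x) := by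
    intro x
    by_cases hx : x ∈ tsupport ψ
    · have hxr : x ∈ Metric.ball (0 : Rd d) (r + 1) :=
        Metric.ball_subset_ball (by linarith) (hψs hx)
      have h1 := Finset.sum_le_sum (s := Finset.univ) fun i _ => abs_mollComm_le_of_density ha hρ
        hhc hhs hε hε1 (fun x y hxy => hosc x y (hxy.trans hεη)) hxr i
      rw [Finset.sum_const, Finset.card_univ, Fintype.card_fin, nsmul_eq_mul] at h1
      have h2 := mul_le_mul_of_nonneg_left h1 (hS0 x)
      have h3 := mul_le_mul_of_nonneg_left (mul_le_mul_of_nonneg_right (hψm x) (hcv0 x))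
        (show 0 ≤ d * commConst d Λ by positivity)
      linarith
    · rw [testMass_eq_zero hx, zero_mul, mul_zero, add_zero]
      exact mul_nonneg (by positivity) (mul_nonneg hΨ (hcv0 x))
  calc ∫ x, testMass ψ x * ∑ i, |mollComm ρ a ε i x|
      ≤ ∫ x, d * commConst d Λ * (Ψ * cv volume (fun y => |(ρ.rnDeriv volume y).toReal - h y|)
        (mollPow ε 3) x + τ' * mollMass d 3 * testMass ψ x) :=
        integral_mono (hψ.integrable_testMass_mul hc)
          (((hcv.const_mul Ψ).add (hI.const_mul (τ' * mollMass d 3))).const_mul _) hpt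
    _ = d * commConst d Λ * (Ψ * (∫ x, cv volume (fun y => |(ρ.rnDeriv volume y).toReal - h y|)
        (mollPow ε 3) x) + τ' * mollMass d 3 * s) := by
        rw [integral_const_mul, integral_add (hcv.const_mul Ψ) (hI.const_mul _),
          integral_const_mul, integral_const_mul]
    _ ≤ d * commConst d Λ * (Ψ * (τ' * mollMass d 3) + τ' * mollMass d 3 * s) := by
        have := mul_le_mul_of_nonneg_left hcvI hΨ
        exact mul_le_mul_of_nonneg_left (by linarith) (by positivity)
    _ = τ' * D := by rw [hD]; ring
    _ ≤ τ := by
        rw [hτ', div_mul_eq_mul_div, div_le_iff₀ (by positivity)]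
        nlinarith

end FrozenLimit

section FrozenLimit

open Filter Topology

variable {d : ℕ}

variable {ρ ρ1 ρ2 : Measure (Rd d)} {r γ K Λ κ ε m δ θ Ψ o : ℝ} {a : Fin d → Fin d → Rd d → ℝ}
  {b bn : Fin d → Rd d → ℝ} {c cn ψ : Rd d → ℝ}

lemma eventually_osc_le {f : Rd d → ℝ} (hf : Continuous f) (hfc : HasCompactSupport f) {τ : ℝ}
    (hτ : 0 < τ) : ∀ᶠ ε in 𝓝[>] (0 : ℝ), ∀ x y, ‖x - y‖ ≤ ε → |f x - f y| ≤ τ := by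
  obtain ⟨η, hη, h⟩ := exists_osc_le hf hfc hτ
  filter_upwards [Ioc_mem_nhdsGT hη] with ε hε x y hxy using h x y (hxy.trans hε.2)

lemma exists_sq_approx [IsFiniteMeasure ρ1] [IsFiniteMeasure ρ2] {f : Rd d → ℝ}
    (hf : Measurable f) (h1 : Integrable (fun y => f y ^ 2) ρ1)
    (h2 : Integrable (fun y => f y ^ 2) ρ2) {s : ℝ} (hs : 0 < s) :
    ∃ g : Rd d → ℝ, HasCompactSupport g ∧ Continuous g ∧
      ∫ y, (f y - g y) ^ 2 ∂ρ1 ≤ s ∧ ∫ y, (f y - g y) ^ 2 ∂ρ2 ≤ s := by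
  have hL : MemLp f (ENNReal.ofReal 2) (ρ1 + ρ2) := by
    rw [show ENNReal.ofReal 2 = 2 by norm_num, memLp_two_iff_integrable_sq hf.aestronglyMeasurable]
    exact h1.add_measure h2
  obtain ⟨g, hgs, hg, hgc, hgL⟩ := hL.exists_hasCompactSupport_integral_rpow_sub_le two_pos hs
  have hI : Integrable (fun y => (f y - g y) ^ 2) (ρ1 + ρ2) := by
    have := hL.sub hgL
    rw [show ENNReal.ofReal 2 = 2 by norm_num] at this
    exact this.integrable_sq
  have e : ∫ y, (f y - g y) ^ 2 ∂(ρ1 + ρ2) ≤ s := by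
    refine le_trans (le_of_eq ?_) hg
    congr 1 with y
    rw [Real.norm_eq_abs, Real.rpow_two, sq_abs]
  have i1 := hI.mono_measure (Measure.le_add_right (le_refl ρ1))
  have i2 := hI.mono_measure (Measure.le_add_left (le_refl ρ2))
  rw [integral_add_measure i1 i2] at e
  have n1 : 0 ≤ ∫ y, (f y - g y) ^ 2 ∂ρ1 := integral_nonneg fun _ => sq_nonneg _
  have n2 : 0 ≤ ∫ y, (f y - g y) ^ 2 ∂ρ2 := integral_nonneg fun _ => sq_nonneg _
  exact ⟨g, hgs, hgc, by linarith, by linarith⟩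

lemma exists_nonpos_approx [IsFiniteMeasure ρ1] [IsFiniteMeasure ρ2] {f : Rd d → ℝ}
    (hf0 : ∀ x, f x ≤ 0) (h1 : Integrable f ρ1) (h2 : Integrable f ρ2) {s : ℝ} (hs : 0 < s) :
    ∃ g : Rd d → ℝ, HasCompactSupport g ∧ Continuous g ∧ (∀ x, g x ≤ 0) ∧
      ∫ y, |f y - g y| ∂ρ1 ≤ s ∧ ∫ y, |f y - g y| ∂ρ2 ≤ s := by
  have hL : Integrable f (ρ1 + ρ2) := h1.add_measure h2
  obtain ⟨g, hgs, hg, hgc, hgL⟩ := hL.exists_hasCompactSupport_integral_sub_le hs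
  have hI : Integrable (fun y => |f y - g y|) (ρ1 + ρ2) := (hL.sub hgL).abs
  have hcs : HasCompactSupport (fun x => min (g x) 0) :=
    hgs.comp_left (g := fun t => min t 0) (min_self 0)
  have hc : Continuous (fun x => min (g x) 0) := hgc.min continuous_const
  have i1 := hI.mono_measure (Measure.le_add_right (le_refl ρ1))
  have i2 := hI.mono_measure (Measure.le_add_left (le_refl ρ2))
  have hle : ∀ y, |f y - min (g y) 0| ≤ |f y - g y| := fun y => by
    have := abs_min_sub_min_le_max (f y) 0 (g y) 0
    rwa [min_eq_left (hf0 y), sub_zero, abs_zero, max_eq_left (abs_nonneg _)] at this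
  have e : ∫ y, |f y - g y| ∂(ρ1 + ρ2) ≤ s := hg
  rw [integral_add_measure i1 i2] at e
  have n1 : 0 ≤ ∫ y, |f y - g y| ∂ρ1 := integral_nonneg fun _ => abs_nonneg _
  have n2 : 0 ≤ ∫ y, |f y - g y| ∂ρ2 := integral_nonneg fun _ => abs_nonneg _
  have m1 : Integrable (fun y => min (g y) 0) ρ1 :=
    hc.integrable_of_hasCompactSupport hcs
  have m2 : Integrable (fun y => min (g y) 0) ρ2 :=
    hc.integrable_of_hasCompactSupport hcs
  have l1 := integral_mono (h1.sub m1).abs i1 hle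
  have l2 := integral_mono (h2.sub m2).abs i2 hle
  exact ⟨_, hcs, hc, fun x => min_le_right _ _, l1.trans (by linarith), l2.trans (by linarith)⟩

lemma exists_testBounds (hψ : IsTest ψ) (hψ0 : ∀ x, 0 ≤ ψ x)
    (hψs : tsupport ψ ⊆ Metric.ball 0 r) : ∃ Ψ, ∀ ε, TestBounds ψ r Ψ ε (2 * Ψ) := by
  have hp := fun i => hψ.pd i
  have hpp := fun i j => (hp i).pd j
  obtain ⟨C0, hC0⟩ := hψ.continuous.bounded_above_of_compact_support hψ.2
  have h1 := fun i => (hp i).continuous.bounded_above_of_compact_support (hp i).2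
  have h2 := fun i j => (hpp i j).continuous.bounded_above_of_compact_support (hpp i j).2
  choose C1 hC1 using h1
  choose C2 hC2 using h2
  have hC0n : 0 ≤ C0 := (norm_nonneg _).trans (hC0 0)
  have hC1n := fun i => (norm_nonneg _).trans (hC1 i 0)
  have hC2n := fun i j => (norm_nonneg _).trans (hC2 i j 0)
  set Ψ := C0 + ∑ i, C1 i + ∑ i, ∑ j, C2 i j with hΨ
  have hs1 : 0 ≤ ∑ i, C1 i := Finset.sum_nonneg fun i _ => hC1n i
  have hs2 : 0 ≤ ∑ i, ∑ j, C2 i j := Finset.sum_nonneg fun i _ => Finset.sum_nonneg fun j _ => hC2n i j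
  have b0 : ∀ x, |ψ x| ≤ Ψ := fun x => (hC0 x).trans (by linarith)
  have b1 : ∀ i x, |pd i ψ x| ≤ Ψ := fun i x => (hC1 i x).trans (by
    have := Finset.single_le_sum (f := C1) (fun i _ => hC1n i) (Finset.mem_univ i)
    linarith)
  have b2 : ∀ i j x, |pd j (pd i ψ) x| ≤ Ψ := fun i j x => (hC2 i j x).trans (by
    have h1 := Finset.single_le_sum (f := C2 i) (fun j _ => hC2n i j) (Finset.mem_univ j)
    have h2 := Finset.single_le_sum (f := fun i => ∑ j, C2 i j)
      (fun i _ => Finset.sum_nonneg fun j _ => hC2n i j) (Finset.mem_univ i)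
    linarith)
  refine ⟨Ψ, fun ε => ⟨hψ, hψ0, hψs, fun x => ?_, b2,
    fun x y _ => (abs_sub _ _).trans (by linarith [b0 x, b0 y]),
    fun i x y _ => (abs_sub _ _).trans (by linarith [b1 i x, b1 i y]),
    fun i j x y _ => (abs_sub _ _).trans (by linarith [b2 i j x, b2 i j y])⟩⟩
  have h0 := (le_abs_self _).trans (hC0 x)
  have h1 := Finset.sum_le_sum (s := Finset.univ) fun i _ => hC1 i x
  simp only [Real.norm_eq_abs] at h1
  unfold testMass
  linarith

lemma TestBounds.eventually_osc (hψ : TestBounds ψ r Ψ ε o) {τ : ℝ} (hτ : 0 < τ) :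
    ∀ᶠ ε in 𝓝[>] (0 : ℝ), TestBounds ψ r Ψ ε τ := by
  have hp := fun i => hψ.test.pd i
  have hpp := fun i j => (hp i).pd j
  filter_upwards [eventually_osc_le hψ.test.continuous hψ.test.2 hτ,
    eventually_all.2 fun i => eventually_osc_le (hp i).continuous (hp i).2 hτ,
    eventually_all.2 fun i => eventually_all.2 fun j =>
      eventually_osc_le (hpp i j).continuous (hpp i j).2 hτ] with ε h0 h1 h2
  exact ⟨hψ.test, hψ.nonneg, hψ.supp, hψ.mass_le, hψ.hess_le, h0, h1, h2⟩

/-- Bound for the error terms in `frozenRate_le` in terms of the approximation parameters. -/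
def limitErr (d : ℕ) (γ K Λ Ψ B κ S θ s τ : ℝ) : ℝ :=
  d ^ 2 * (τ * K + 2 * Λ * τ * Ψ) + τ * B
    + (d * (8 / γ * (2 * (Ψ * (θ * mollMass d 1) + commConst d Λ ^ 3 / θ * τ)
        + 2 * (Ψ * (2 * s + 2 * τ ^ 2))) + 5 * τ + 5 * θ * Ψ + 5 * Ψ * (2 * s + 2 * τ ^ 2) / θ)
      + 8 * Ψ * (s + τ) + τ * ((d * (4 / γ * κ ^ 2 + κ) + 3 * κ) * S))

lemma exists_limitErr_lt (d : ℕ) (γ K Λ Ψ B S : ℝ) {e : ℝ} (he : 0 < e) :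
    ∃ θ s, 0 < θ ∧ 0 < s ∧ ∀ κ, ∃ τ, 0 < τ ∧ τ ≤ 1 ∧ limitErr d γ K Λ Ψ B κ S θ s τ < e := by
  have hθ : ∀ᶠ θ in 𝓝[>] (0 : ℝ), d * (8 / γ * (2 * (Ψ * (θ * mollMass d 1))) + 5 * θ * Ψ) < e := by
    have hc : Continuous fun θ : ℝ => d * (8 / γ * (2 * (Ψ * (θ * mollMass d 1))) + 5 * θ * Ψ) := by
      fun_prop
    exact ((hc.tendsto 0).eventually_lt_const (by simpa using he)).filter_mono nhdsWithin_le_nhds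
  obtain ⟨θ, hθe, hθ0⟩ := (hθ.and self_mem_nhdsWithin).exists
  have hs : ∀ᶠ s in 𝓝[>] (0 : ℝ), limitErr d γ K Λ Ψ B 0 S θ s 0 < e := by
    have hc : Continuous fun s : ℝ => limitErr d γ K Λ Ψ B 0 S θ s 0 := by
      unfold limitErr
      fun_prop
    refine ((hc.tendsto 0).eventually_lt_const ?_).filter_mono nhdsWithin_le_nhds
    unfold limitErr
    simpa using hθe
  obtain ⟨s, hse, hs0⟩ := (hs.and self_mem_nhdsWithin).exists
  refine ⟨θ, s, hθ0, hs0, fun κ => ?_⟩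
  have hτ : ∀ᶠ τ in 𝓝[>] (0 : ℝ), limitErr d γ K Λ Ψ B κ S θ s τ < e := by
    have hc : Continuous fun τ : ℝ => limitErr d γ K Λ Ψ B κ S θ s τ := by
      unfold limitErr
      fun_prop
    refine ((hc.tendsto 0).eventually_lt_const ?_).filter_mono nhdsWithin_le_nhds
    unfold limitErr at hse ⊢
    simpa using hse
  obtain ⟨τ, hτe, hτ0, hτ1⟩ := (hτ.and (Ioc_mem_nhdsGT one_pos)).exists
  exact ⟨τ, hτ0, hτ1, hτe⟩

/-- Asymptotic upper bound for the rate of change of the mollified functional. -/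
lemma eventually_frozenRate_le (h1 : FrozenMeas ρ1 b c) (h2 : FrozenMeas ρ2 b c)
    (hac1 : ρ1 ≪ volume) (hac2 : ρ2 ≪ volume) (hc0 : ∀ x, c x ≤ 0)
    (ha : FrozenCoeff r γ K Λ a) (hψ : TestBounds ψ r Ψ ε o) {e : ℝ} (he : 0 < e) :
    ∀ᶠ ε in 𝓝[>] (0 : ℝ), frozenRate ρ1 ρ2 a b c ψ ε ε ≤ frozenMain ρ1 ρ2 a b c ψ + e := by
  have := h1.isFiniteMeasure
  have := h2.isFiniteMeasure
  have hK := ha.bdd_nonneg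
  have hΛ := ha.lip_nonneg
  have hγ := ha.ell_pos
  have hΨ := hψ.bound_nonneg
  have hcc := commConst_nonneg d hΛ
  have hM1 := mollMass_nonneg d 1
  set B := ∑ i, ∫ y, |b i y| ∂ρ1 + ∫ y, |c y| ∂ρ1 + ∫ y, |c y| ∂ρ2 with hB
  have hB0 : 0 ≤ B := add_nonneg (add_nonneg (Finset.sum_nonneg fun i _ =>
    integral_nonneg fun _ => abs_nonneg _) (integral_nonneg fun _ => abs_nonneg _))
    (integral_nonneg fun _ => abs_nonneg _)
  set S := ∫ x, testMass ψ x with hS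
  have hS0 : 0 ≤ S := integral_nonneg hψ.testMass_nonneg
  obtain ⟨θ, s, hθ, hs, hτ⟩ := exists_limitErr_lt d γ K Λ Ψ B S he
  choose bn hbns hbnc hbn1 hbn2 using fun i =>
    exists_sq_approx (h1.drift_meas i) (h1.drift_sq i) (h2.drift_sq i) hs
  obtain ⟨cn, hcns, hcnc, hcn0, hcn1, hcn2⟩ := exists_nonpos_approx hc0 h1.pot h2.pot hs
  choose κb hκb using fun i => (hbnc i).bounded_above_of_compact_support (hbns i)
  obtain ⟨κc, hκc⟩ := hcnc.bounded_above_of_compact_support hcns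
  have hκbn := fun i => (norm_nonneg _).trans (hκb i 0)
  have hκcn := (norm_nonneg _).trans (hκc 0)
  set κ := ∑ i, κb i + κc with hκ
  have hκs : 0 ≤ ∑ i, κb i := Finset.sum_nonneg fun i _ => hκbn i
  set κ' := d * (Λ * mollGradConst d * mollMass d 3) + κ with hκ'
  have hgc := mollGradConst_nonneg d
  have hM3 := mollMass_nonneg d 3
  have hκ'0 : 0 ≤ κ' := by positivity
  obtain ⟨τ, hτ0, hτ1, hτe⟩ := hτ κ'
  obtain ⟨ε1, hε1, hY1⟩ := exists_intLE_mollComm ha hac1 hψ.test hψ.nonneg hψ.supp hψ.mass_le hτ0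
  obtain ⟨ε2, hε2, hY2⟩ := exists_intLE_mollComm ha hac2 hψ.test hψ.nonneg hψ.supp hψ.mass_le hτ0
  filter_upwards [hψ.eventually_osc hτ0, eventually_osc_le hcnc hcns hτ0,
    eventually_all.2 fun i => eventually_osc_le (hbnc i) (hbns i) hτ0, Ioc_mem_nhdsGT hτ0,
    Ioc_mem_nhdsGT hε1, Ioc_mem_nhdsGT hε2] with ε hψε hcε hbε hετ hεε1 hεε2
  have hε := hετ.1
  have hap : FrozenApprox bn cn κ ε τ :=
    ⟨hbnc, hcnc, fun i x => (hκb i x).trans (by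
      have := Finset.single_le_sum (f := κb) (fun i _ => hκbn i) (Finset.mem_univ i)
      linarith), fun x => (hκc x).trans (by linarith), hcn0, hbε, hcε, by positivity, hτ0.le⟩
  have hsub : ∀ x ∈ Metric.ball (0 : Rd d) r, x ∈ Metric.ball (0 : Rd d) (r + 1) :=
    fun x hx => Metric.ball_subset_ball (by linarith) hx
  have hle : ∀ (ρ : Measure (Rd d)) (i : Fin d) x,
      |mollComm ρ a ε i x| ≤ ∑ i, |mollComm ρ a ε i x| := fun ρ i x =>
    Finset.single_le_sum (f := fun i => |mollComm ρ a ε i x|) (fun _ _ => abs_nonneg _)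
      (Finset.mem_univ i)
  have hXle : ∀ {ρ : Measure (Rd d)}, FrozenMeas ρ b c →
      IntLE volume (fun x => testMass ψ x * ∑ i, |mollComm ρ a ε i x|) τ →
      IntLE volume (fun x => testMass ψ x * (θ * mollInt ρ ε 1 x
        + commConst d Λ ^ 3 / θ * ∑ i, |mollComm ρ a ε i x|))
        (Ψ * (θ * mollMass d 1) + commConst d Λ ^ 3 / θ * τ) := fun h hY =>
    ((h.intLE_testMass_mul_mollInt hψε hε one_ne_zero hθ.le).add
      (hY.const_mul (by positivity))).congr (fun x => by ring) le_rfl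
  have hXn : ∀ {ρ : Measure (Rd d)} x, 0 ≤ θ * mollInt ρ ε 1 x
        + commConst d Λ ^ 3 / θ * ∑ i, |mollComm ρ a ε i x| := fun x =>
    add_nonneg (mul_nonneg hθ.le (mollInt_nonneg ε 1 x)) (mul_nonneg (by positivity)
      (Finset.sum_nonneg fun _ _ => abs_nonneg _))
  have hcX : ∀ {ρ : Measure (Rd d)}, FrozenMeas ρ b c → ∀ x ∈ Metric.ball (0 : Rd d) r, ∀ i,
      mollComm ρ a ε i x ^ 2 ≤ mollDens ρ ε x * (θ * mollInt ρ ε 1 x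
        + commConst d Λ ^ 3 / θ * ∑ i, |mollComm ρ a ε i x|) := fun {ρ} h x hx i => by
    have := h.isFiniteMeasure
    refine (mollComm_sq_le_interpolation ha hε (hετ.2.trans hτ1) (hsub x hx) i hθ).trans ?_
    exact mul_le_mul_of_nonneg_left (add_le_add le_rfl
      (mul_le_mul_of_nonneg_left (hle ρ i x) (by positivity))) (mollDens_nonneg ε x)
  have main := frozenRate_le h1 h2 ha hap hψε hε (hετ.2.trans hτ1) hθ hε
    (hXle h1 (hY1 ε hε hεε1.2)) (hXle h2 (hY2 ε hε hεε2.2)) (hY1 ε hε hεε1.2) (hY2 ε hε hεε2.2)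
    hXn hXn (hcX h1) (hcX h2) (fun x _ i => hle ρ1 i x) (fun x _ i => hle ρ2 i x)
  refine main.trans ?_
  rw [add_assoc]
  refine add_le_add le_rfl (le_trans ?_ hτe.le)
  unfold limitErr
  have g1 : 0 ≤ d * (4 / γ * κ' ^ 2 + κ') + 3 * κ' := by positivity
  refine add_le_add (add_le_add ?_ le_rfl) ?_
  · have := hετ.2
    gcongr
  unfold frozenErr
  refine add_le_add (add_le_add ?_ ?_) ?_
  · have e : ∀ X : ℝ, (d : ℝ) * X = ∑ _i : Fin d, X := fun X => by simp
    rw [e]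
    refine Finset.sum_le_sum fun i _ => ?_
    have q1 := hbn1 i
    have q2 := hbn2 i
    have := div_le_div_of_nonneg_right (mul_le_mul_of_nonneg_left (show
      4 * (2 * ∫ y, (b i y - bn i y) ^ 2 ∂ρ1 + 2 * τ ^ 2)
        + (2 * ∫ y, (b i y - bn i y) ^ 2 ∂ρ2 + 2 * τ ^ 2) ≤ 5 * (2 * s + 2 * τ ^ 2) by linarith)
      hΨ) hθ.le
    have h8 := mul_le_mul_of_nonneg_left (show
      Ψ * (2 * ∫ y, (b i y - bn i y) ^ 2 ∂ρ1 + 2 * τ ^ 2)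
        + Ψ * (2 * ∫ y, (b i y - bn i y) ^ 2 ∂ρ2 + 2 * τ ^ 2) ≤ 2 * (Ψ * (2 * s + 2 * τ ^ 2)) by
      rw [← mul_add, mul_left_comm]
      exact mul_le_mul_of_nonneg_left (by linarith) hΨ) (show 0 ≤ 8 / γ by positivity)
    rw [show 5 * Ψ * (2 * s + 2 * τ ^ 2) = Ψ * (5 * (2 * s + 2 * τ ^ 2)) by ring]
    linarith
  · have := mul_le_mul_of_nonneg_left (show 5 * (∫ y, |c y - cn y| ∂ρ1 + τ)
      + 3 * (∫ y, |c y - cn y| ∂ρ2 + τ) ≤ 8 * (s + τ) by linarith) hΨ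
    linarith
  · rw [mul_assoc]
    exact mul_le_mul_of_nonneg_right hετ.2 (mul_nonneg g1 hS0)

end FrozenLimit

section Dissipation

variable {d : ℕ}

variable {ρ : Measure (Rd d)} {r γ K Λ ε Ψ o s : ℝ} {a : Fin d → Fin d → Rd d → ℝ}
  {b : Fin d → Rd d → ℝ} {c ψ : Rd d → ℝ}

/-- The error constant in the dissipation estimate. -/
def dissipConst (d : ℕ) (γ K Ψ s : ℝ) : ℝ :=
  Ψ * (2 / γ + 1 + d ^ 2 * (K ^ 2 * (8 * (d + 1) / (s * γ))) + d)

lemma dissipConst_nonneg (d : ℕ) (hγ : 0 < γ) (hΨ : 0 ≤ Ψ) (hs : 0 < s) :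
    0 ≤ dissipConst d γ K Ψ s := by
  unfold dissipConst
  positivity

lemma dissip_pointwise {A : Fin d → Fin d → ℝ} {p q V W : Fin d → ℝ} {v m R w : ℝ} (hγ : 0 < γ)
    (hs : 0 < s) (hs1 : s ≤ 1) (hR : 0 ≤ R) (hw : 0 ≤ w) (hw1 : w * (1 + R) ≤ 1)
    (hA : γ * ∑ i, q i ^ 2 ≤ ∑ i, ∑ j, A i j * q i * q j) (hAK : ∀ i j, |A i j| ≤ K)
    (hv : 0 ≤ v) (hvm : v ≤ m) (hp : ∀ i, |p i| ≤ m) (hm : m ≤ Ψ)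
    (hV : ∀ i, V i ^ 2 ≤ R * W i) (hW : ∀ i, 0 ≤ W i) :
    s * γ / 2 * (v ^ 2 * w * ∑ i, q i ^ 2)
      ≤ ∑ i, (s * (v ^ 2 * w * q i) - 2 * v * p i * (w * (1 + R))) * (∑ j, A i j * q j + V i)
        + dissipConst d γ K Ψ s * (m * (1 + R + ∑ i, W i)) := by
  have hm0 : 0 ≤ m := hv.trans hvm
  have hΨ : 0 ≤ Ψ := hm0.trans hm
  have hmm : m * m ≤ Ψ * m := mul_le_mul_of_nonneg_right hm hm0
  have hvv : v ^ 2 ≤ Ψ * m := by nlinarith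
  have hpp : ∀ i, p i ^ 2 ≤ Ψ * m := fun i => by
    have := mul_self_le_mul_self (abs_nonneg _) (hp i)
    rw [abs_mul_abs_self] at this
    nlinarith
  have hwR : w * R ≤ 1 := by nlinarith
  set t := s * γ / (8 * (d + 1)) with ht
  have ht0 : 0 < t := by positivity
  have hti : 8 * (d + 1) / (s * γ) = 1 / t := by rw [ht, one_div_div]
  set Q := ∑ i, q i ^ 2 with hQ
  have hQ0 : 0 ≤ Q := Finset.sum_nonneg fun _ _ => sq_nonneg _
  have hell : s * γ * (v ^ 2 * w * Q) ≤ ∑ i, s * (v ^ 2 * w * q i) * ∑ j, A i j * q j := by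
    have e : ∑ i, s * (v ^ 2 * w * q i) * ∑ j, A i j * q j
        = s * (v ^ 2 * w) * ∑ i, ∑ j, A i j * q i * q j := by
      rw [Finset.mul_sum]
      refine Finset.sum_congr rfl fun i _ => ?_
      rw [Finset.mul_sum, Finset.mul_sum]
      exact Finset.sum_congr rfl fun j _ => by ring
    rw [e]
    have := mul_le_mul_of_nonneg_left hA (show 0 ≤ s * (v ^ 2 * w) by positivity)
    linarith
  have hVterm : ∀ i, -(s * γ / 8 * (v ^ 2 * w * q i ^ 2) + 2 / γ * (Ψ * m) * W i)
      ≤ s * (v ^ 2 * w * q i) * V i := fun i => by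
    have h1 : 0 ≤ γ / 8 * q i ^ 2 + q i * V i + 2 / γ * V i ^ 2 := by
      have : γ / 8 * q i ^ 2 + q i * V i + 2 / γ * V i ^ 2
          = 2 / γ * ((γ / 4 * q i + V i) ^ 2) := by
        field_simp
        ring
      rw [this]
      positivity
    have h2 : w * V i ^ 2 ≤ W i := by
      have := mul_le_mul_of_nonneg_left (hV i) hw
      have h3 := mul_le_mul_of_nonneg_right hwR (hW i)
      linarith
    have h4 := mul_nonneg (show 0 ≤ s * (v ^ 2 * w) by positivity) h1
    have h5 : s * v ^ 2 ≤ Ψ * m := by nlinarith [sq_nonneg v]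
    have h6 : s * v ^ 2 * (2 / γ) * (w * V i ^ 2) ≤ Ψ * m * (2 / γ) * W i :=
      mul_le_mul (mul_le_mul_of_nonneg_right h5 (by positivity)) h2 (by positivity) (by positivity)
    linarith
  have hAterm : ∀ i j, -(t * (v ^ 2 * w * q j ^ 2) + K ^ 2 * (1 / t) * (Ψ * m) * (1 + R))
      ≤ -(2 * v * p i * (w * (1 + R))) * (A i j * q j) := fun i j => by
    have h1 : 0 ≤ t * (v ^ 2 * q j ^ 2) - 2 * (v * q j) * (p i * (1 + R) * A i j)
        + 1 / t * (p i * (1 + R) * A i j) ^ 2 := by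
      have : t * (v ^ 2 * q j ^ 2) - 2 * (v * q j) * (p i * (1 + R) * A i j)
          + 1 / t * (p i * (1 + R) * A i j) ^ 2
          = 1 / t * (t * (v * q j) - p i * (1 + R) * A i j) ^ 2 := by
        field_simp
        ring
      rw [this]
      positivity
    have hAA : A i j ^ 2 ≤ K ^ 2 := sq_le_sq' (by linarith [neg_abs_le (A i j), hAK i j])
      ((le_abs_self _).trans (hAK i j))
    have h2 : w * (1 + R) * (1 + R) ≤ 1 * (1 + R) := mul_le_mul_of_nonneg_right hw1 (by linarith)
    have h3 : p i ^ 2 * A i j ^ 2 ≤ Ψ * m * K ^ 2 :=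
      mul_le_mul (hpp i) hAA (sq_nonneg _) (by positivity)
    have h4 : 1 / t * (p i ^ 2 * A i j ^ 2) * (w * (1 + R) * (1 + R))
        ≤ 1 / t * (Ψ * m * K ^ 2) * (1 * (1 + R)) :=
      mul_le_mul (mul_le_mul_of_nonneg_left h3 (by positivity)) h2 (by positivity) (by positivity)
    have h5 := mul_nonneg hw h1
    linarith
  have hCterm : ∀ i, -(Ψ * m * (R + W i)) ≤ -(2 * v * p i * (w * (1 + R))) * V i := fun i => by
    have h1 : 2 * |V i| ≤ R + W i := by
      refine abs_le_of_sq_le_sq' ?_ (by linarith [hW i]) |>.2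
      rw [mul_pow, sq_abs]
      nlinarith [hV i, sq_nonneg (R - W i)]
    have h2 : |2 * v * p i * (w * (1 + R)) * V i| ≤ Ψ * m * (R + W i) := by
      have h3 : |2 * v * p i * (w * (1 + R)) * V i| = v * |p i| * (w * (1 + R)) * (2 * |V i|) := by
        rw [abs_mul, abs_mul, abs_mul, abs_mul, abs_of_nonneg hv,
          abs_of_nonneg (show 0 ≤ w * (1 + R) by positivity), abs_two]
        ring
      rw [h3]
      have h4 : v * |p i| ≤ Ψ * m := (mul_le_mul hvm (hp i) (abs_nonneg _) hm0).trans hmm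
      have h5 : v * |p i| * (w * (1 + R)) ≤ Ψ * m * 1 :=
        mul_le_mul h4 hw1 (by positivity) (by positivity)
      exact mul_le_mul (by linarith) h1 (by positivity) (by positivity)
    have := le_abs_self (2 * v * p i * (w * (1 + R)) * V i)
    linarith
  have expand : ∑ i, (s * (v ^ 2 * w * q i) - 2 * v * p i * (w * (1 + R))) * (∑ j, A i j * q j + V i)
      = ∑ i, s * (v ^ 2 * w * q i) * ∑ j, A i j * q j
        + ∑ i, ∑ j, -(2 * v * p i * (w * (1 + R))) * (A i j * q j)
        + ∑ i, s * (v ^ 2 * w * q i) * V i + ∑ i, -(2 * v * p i * (w * (1 + R))) * V i := by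
    simp only [← Finset.sum_add_distrib, ← Finset.mul_sum]
    exact Finset.sum_congr rfl fun i _ => by ring
  have s1 := Finset.sum_le_sum (s := Finset.univ) fun i _ => hVterm i
  have s2 := Finset.sum_le_sum (s := Finset.univ) fun i _ =>
    Finset.sum_le_sum (s := Finset.univ) fun j _ => hAterm i j
  have s3 := Finset.sum_le_sum (s := Finset.univ) fun i _ => hCterm i
  simp only [Finset.sum_neg_distrib, Finset.sum_add_distrib, ← Finset.mul_sum, Finset.sum_const,
    Finset.card_univ, Fintype.card_fin, nsmul_eq_mul, ← hQ, neg_mul] at s1 s2 s3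
  simp only [neg_mul, Finset.sum_neg_distrib, ← Finset.mul_sum] at expand
  rw [expand]
  unfold dissipConst
  rw [hti]
  set SW := ∑ i, W i with hSW
  have hSW0 : 0 ≤ SW := Finset.sum_nonneg fun i _ => hW i
  set Z := v ^ 2 * w * Q with hZ
  have hZ0 : 0 ≤ Z := by positivity
  have htd : d * t ≤ s * γ / 8 := by
    rw [ht, mul_div_assoc', div_le_div_iff₀ (by positivity) (by norm_num)]
    nlinarith [mul_pos hs hγ]
  have htdZ := mul_le_mul_of_nonneg_right htd hZ0
  have hY0 : 0 ≤ Ψ * m := by positivity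
  have hsZ : 0 ≤ s * γ * Z := by positivity
  rw [show v ^ 2 * w * (d * Q) = d * Z by rw [hZ]; ring] at s2
  have hd : (0 : ℝ) ≤ d := Nat.cast_nonneg d
  have e1 : 0 ≤ Ψ * m * (2 / γ) * (1 + R) := by positivity
  have e2 : 0 ≤ Ψ * m * SW * (d ^ 2 * (K ^ 2 * (1 / t))) := by positivity
  have e3 : 0 ≤ Ψ * m * SW * d := by positivity
  have e4 : 0 ≤ Ψ * m * (1 + R) := by positivity
  have e5 : 0 ≤ Ψ * m * d := by positivity
  linarith

end Dissipation

section Dissipation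

variable {d : ℕ}

variable {ρ : Measure (Rd d)} {r γ K Λ ε Ψ o s : ℝ} {a : Fin d → Fin d → Rd d → ℝ}
  {b : Fin d → Rd d → ℝ} {c ψ : Rd d → ℝ}

lemma contDiff_one_add_rpow {R : Rd d → ℝ} (hR : ContDiff ℝ 1 R) (hR0 : ∀ x, 0 ≤ R x) (k : ℝ) :
    ContDiff ℝ 1 (fun x => (1 + R x) ^ k) :=
  (contDiff_const.add hR).rpow_const_of_ne fun x => by linarith [hR0 x]

lemma pd_one_add_rpow {R : Rd d → ℝ} (hR : ContDiff ℝ 1 R) (hR0 : ∀ x, 0 ≤ R x) (k : ℝ)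
    (i : Fin d) (x : Rd d) :
    pd i (fun x => (1 + R x) ^ k) x = k * (1 + R x) ^ (k - 1) * pd i R x := by
  have h := ((hR.differentiable one_ne_zero x).hasFDerivAt.const_add 1).rpow_const (p := k)
    (Or.inl (by linarith [hR0 x]))
  rw [pd_eq_of_hasFDerivAt i h]
  simp [pd]

/-- The weighted energy of the mollified density. -/
def mollDissip (ρ : Measure (Rd d)) (ψ : Rd d → ℝ) (s ε : ℝ) : ℝ :=
  ∫ x, ψ x ^ 2 * (1 + mollDens ρ ε x) ^ (-s - 1) * ∑ i, pd i (mollDens ρ ε) x ^ 2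

/-- The part of the mollified flux not given by the gradient of the density. -/
def fluxRem (ρ : Measure (Rd d)) (a : Fin d → Fin d → Rd d → ℝ) (b : Fin d → Rd d → ℝ) (ε : ℝ)
    (i : Fin d) (x : Rd d) : ℝ :=
  mollFlux ρ a b ε i x - ∑ j, mollCoeff a ε i j x * pd j (mollDens ρ ε) x

/-- The constant bounding the first derivatives of the mollified coefficients. -/
def gradBound (d : ℕ) (Λ : ℝ) : ℝ := d * (Λ * mollGradConst d * mollMass d 3)

/-- The quadratic control of `fluxRem`. -/
def fluxRemBound (ρ : Measure (Rd d)) (b : Fin d → Rd d → ℝ) (Λ ε : ℝ) (i : Fin d) (x : Rd d) : ℝ :=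
  4 * (commConst d Λ ^ 2 * mollInt ρ ε 2 x) + 4 * driftErr ρ b (fun _ _ => 0) ε 0 i x
    + 2 * gradBound d Λ ^ 2 * mollDens ρ ε x

lemma fluxRemBound_nonneg (i : Fin d) (x : Rd d) : 0 ≤ fluxRemBound ρ b Λ ε i x := by
  have h1 := mollInt_nonneg (ρ := ρ) ε 2 x
  have h2 := driftErr_nonneg (ρ := ρ) (b := b) (bn := fun _ _ => 0) (ε := ε) (m := 0) i x
  have h3 := mollDens_nonneg (ρ := ρ) ε x
  unfold fluxRemBound
  positivity

lemma fluxRem_sq_le (h : FrozenMeas ρ b c) (ha : FrozenCoeff r γ K Λ a) (hε : 0 < ε) (hε1 : ε ≤ 1)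
    {x : Rd d} (hx : x ∈ Metric.ball (0 : Rd d) (r + 1)) (i : Fin d) :
    fluxRem ρ a b ε i x ^ 2 ≤ mollDens ρ ε x * fluxRemBound ρ b Λ ε i x := by
  have := h.isFiniteMeasure
  have hE := (h.fluxDefect_bounds (frozenApprox_zero ε) hε one_pos i
    (mollComm_sq_le ha hε hε1 hx i) (abs_mollComm_le ha hε hε1 hx i)).1
  have hR := mollDens_nonneg (ρ := ρ) ε x
  have hΛ := ha.lip_nonneg
  have e : fluxRem ρ a b ε i x
      = fluxDefect (mollCoeff a ε) (fun _ _ => 0) (mollDens ρ ε) (mollFlux ρ a b ε) i x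
        + (∑ j, pd j (mollCoeff a ε i j) x) * mollDens ρ ε x := by
    have h1 : ∀ j, pd j (fun y => mollCoeff a ε i j y * mollDens ρ ε y) x
        = pd j (mollCoeff a ε i j) x * mollDens ρ ε x
          + mollCoeff a ε i j x * pd j (mollDens ρ ε) x := fun j =>
      pd_mul j ((mollCoeff_contDiff ha hε i j).differentiable one_ne_zero x)
        ((mollDens_contDiff hε).differentiable one_ne_zero x)
    simp only [fluxRem, fluxDefect, h1, Finset.sum_add_distrib, Finset.sum_mul]
    ring
  have hk : |∑ j, pd j (mollCoeff a ε i j) x| ≤ gradBound d Λ := by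
    refine (Finset.abs_sum_le_sum_abs _ _).trans
      ((Finset.sum_le_sum fun j _ => abs_pd_mollCoeff_le ha hε hε1 hx i j j).trans (le_of_eq ?_))
    simp [gradBound]
  have hk2 := sq_le_sq' (by linarith [neg_abs_le (∑ j, pd j (mollCoeff a ε i j) x)])
    ((le_abs_self _).trans hk)
  rw [e]
  have h2 := add_sq_le (a := fluxDefect (mollCoeff a ε) (fun _ _ => 0) (mollDens ρ ε)
    (mollFlux ρ a b ε) i x) (b := (∑ j, pd j (mollCoeff a ε i j) x) * mollDens ρ ε x)
  rw [mul_pow] at h2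
  have h3 := mul_le_mul_of_nonneg_right hk2 (sq_nonneg (mollDens ρ ε x))
  unfold fluxRemBound
  linarith

lemma intLE_fluxRemBound (h : FrozenMeas ρ b c) (hψ : TestBounds ψ r Ψ ε o) (hε : 0 < ε)
    (i : Fin d) : IntLE volume (fun x => testMass ψ x * fluxRemBound ρ b Λ ε i x)
      (4 * (Ψ * (commConst d Λ ^ 2 * mollMass d 2)) + 4 * (Ψ * (2 * ∫ y, b i y ^ 2 ∂ρ))
        + 2 * gradBound d Λ ^ 2 * (Ψ * 1)) := by
  have := h.isFiniteMeasure
  have hap := frozenApprox_zero (d := d) ε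
  have h1 := (h.intLE_testMass_mul_mollInt hψ hε two_ne_zero
    (sq_nonneg (commConst d Λ))).const_mul (show (0 : ℝ) ≤ 4 by norm_num)
  have h2 := (hψ.intLE_testMass_mul (h.intLE_driftErr hap hε i)
    (continuous_driftErr hε i (h.integrable_sub_sq hap i))
    fun x => driftErr_nonneg i x).const_mul (show (0 : ℝ) ≤ 4 by norm_num)
  have h3 := (hψ.intLE_testMass_mul (h.intLE_mollDens hε) (mollDens_contDiff hε).continuous
    (mollDens_nonneg ε)).const_mul (show (0 : ℝ) ≤ 2 * gradBound d Λ ^ 2 by positivity)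
  refine ((h1.add h2).add h3).congr (fun x => ?_) (le_of_eq ?_)
  · unfold fluxRemBound
    ring
  · simp

/-- Coercivity of the mollified generator tested against a decreasing power of the density. -/
lemma mollDissip_le (h : FrozenMeas ρ b c) (ha : FrozenCoeff r γ K Λ a)
    (hψ : TestBounds ψ r Ψ ε o) (hε : 0 < ε) (hε1 : ε ≤ 1) (hs : 0 < s) (hs1 : s ≤ 1) :
    s * γ / 2 * mollDissip ρ ψ s ε
      ≤ (∫ x, ψ x ^ 2 * ((1 + mollDens ρ ε x) ^ (-s) * mollGen ρ a b c ε x))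
        + Ψ ^ 2 * (∫ y, |c y| ∂ρ) + dissipConst d γ K Ψ s * ((∫ x, testMass ψ x) + Ψ
          + ∑ i, (4 * (Ψ * (commConst d Λ ^ 2 * mollMass d 2)) + 4 * (Ψ * (2 * ∫ y, b i y ^ 2 ∂ρ))
            + 2 * gradBound d Λ ^ 2 * (Ψ * 1))) := by
  have := h.isFiniteMeasure
  have hΨ := hψ.bound_nonneg
  set R := mollDens ρ ε with hRdef
  have hR1 : ContDiff ℝ 1 R := mollDens_contDiff hε
  have hR0 : ∀ x, 0 ≤ R x := mollDens_nonneg ε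
  set J := mollFlux ρ a b ε with hJdef
  have hJ1 : ∀ i, ContDiff ℝ 1 (J i) := mollFlux_contDiff ha h.integrable_drift hε
  have hψ1 := hψ.test.contDiff_one
  set u : Rd d → ℝ := fun x => ψ x * ψ x * (1 + R x) ^ (-s) with hu
  have hu1 : ContDiff ℝ 1 u := (hψ1.mul hψ1).mul (contDiff_one_add_rpow hR1 hR0 _)
  have huc : HasCompactSupport u := (hψ.test.2.mul_right (f' := ψ)).mul_right
  have hpos : ∀ x, 0 < 1 + R x := fun x => by linarith [hR0 x]
  have hw1 : ∀ x, (1 + R x) ^ (-s - 1) * (1 + R x) = (1 + R x) ^ (-s) := fun x => by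
    rw [← Real.rpow_add_one (hpos x).ne']
    congr 1
    ring
  have hg1 : ∀ x, (1 + R x) ^ (-s) ≤ 1 := fun x =>
    Real.rpow_le_one_of_one_le_of_nonpos (by linarith [hR0 x]) (by linarith)
  have hpdu : ∀ i x, pd i u x = 2 * ψ x * pd i ψ x * ((1 + R x) ^ (-s - 1) * (1 + R x))
      - s * (ψ x ^ 2 * (1 + R x) ^ (-s - 1) * pd i R x) := fun i x => by
    rw [hu, pd_mul i ((hψ1.mul hψ1).differentiable one_ne_zero x)
      ((contDiff_one_add_rpow hR1 hR0 (-s)).differentiable one_ne_zero x),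
      pd_mul i (hψ1.differentiable one_ne_zero x) (hψ1.differentiable one_ne_zero x),
      pd_one_add_rpow hR1 hR0, hw1]
    ring
  have hpt : ∀ x, s * γ / 2 * (ψ x ^ 2 * (1 + R x) ^ (-s - 1) * ∑ i, pd i R x ^ 2)
      ≤ -∑ i, pd i u x * J i x + dissipConst d γ K Ψ s
        * (testMass ψ x + testMass ψ x * R x + ∑ i, testMass ψ x * fluxRemBound ρ b Λ ε i x) := by
    intro x
    by_cases hx : x ∈ tsupport ψ
    · have hxr : x ∈ Metric.ball (0 : Rd d) (r + 1) :=
        Metric.ball_subset_ball (by linarith) (hψ.supp hx)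
      have key := dissip_pointwise (A := fun i j => mollCoeff a ε i j x)
        (p := fun i => pd i ψ x) (q := fun i => pd i R x) (V := fun i => fluxRem ρ a b ε i x)
        (W := fun i => fluxRemBound ρ b Λ ε i x) (v := ψ x) (m := testMass ψ x) (R := R x)
        (w := (1 + R x) ^ (-s - 1)) ha.ell_pos hs hs1 (hR0 x) (Real.rpow_nonneg (hpos x).le _)
        ((hw1 x).le.trans (hg1 x)) (mollCoeff_ell ha hε hε1 hxr _)
        (fun i j => abs_mollCoeff_le ha hε i j x) (hψ.nonneg x)
        (le_testMass x) (fun i => hψ.pd_le_testMass i x) (hψ.mass_le x)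
        (fun i => fluxRem_sq_le h ha hε hε1 hxr i) (fun i => fluxRemBound_nonneg i x)
      refine key.trans (le_of_eq ?_)
      congr 1
      · rw [← Finset.sum_neg_distrib]
        refine Finset.sum_congr rfl fun i _ => ?_
        rw [hpdu i x]
        simp only [fluxRem, ← hRdef, ← hJdef]
        ring
      · rw [← Finset.mul_sum]
        ring
    · have h1 : ∀ i, pd i u x = 0 := fun i => by
        rw [hpdu, eq_zero_of_notMem_tsupport hx]
        ring
      simp [h1, eq_zero_of_notMem_tsupport hx, testMass_eq_zero hx]
  have hcg := (contDiff_one_add_rpow hR1 hR0 (-s)).continuous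
  have hcw := (contDiff_one_add_rpow hR1 hR0 (-s - 1)).continuous
  have hqc : ∀ i, Continuous (pd i R) := fun i => hR1.pd_continuous i
  have hψc := hψ.test.continuous
  have hIL : Integrable (fun x => ψ x ^ 2 * (1 + R x) ^ (-s - 1) * ∑ i, pd i R x ^ 2) := by
    refine integrable_of_eq_zero_off_tsupport ?_ hψ.test.2 fun x hx => ?_
    · exact ((hψc.pow 2).mul hcw).mul (continuous_finsetSum _ fun i _ => (hqc i).pow 2)
    · simp [eq_zero_of_notMem_tsupport hx]
  have hIJ : ∀ i, Integrable (fun x => pd i u x * J i x) := fun i =>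
    ((hu1.pd_continuous i).mul (hJ1 i).continuous).integrable_of_hasCompactSupport
      (huc.pd i).mul_right
  have hIuJ : ∀ i, Integrable (fun x => u x * pd i (J i) x) := fun i =>
    (hu1.continuous.mul ((hJ1 i).pd_continuous i)).integrable_of_hasCompactSupport huc.mul_right
  have hIS : Integrable (fun x => -∑ i, pd i u x * J i x) :=
    (integrable_finsetSum _ fun i _ => hIJ i).neg
  have hE1 : IntLE volume (fun x => testMass ψ x) (∫ x, testMass ψ x) :=
    ⟨hψ.test.integrable_testMass, le_rfl⟩
  have hE2 : IntLE volume (fun x => testMass ψ x * R x) Ψ := by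
    simpa using hψ.intLE_testMass_mul (h.intLE_mollDens hε) hR1.continuous hR0
  have hE := ((hE1.add hE2).add (IntLE.sum (s := Finset.univ) fun i _ =>
    intLE_fluxRemBound (Λ := Λ) h hψ hε i)).const_mul
      (dissipConst_nonneg d (K := K) ha.ell_pos hΨ hs)
  have hint := integral_mono (hIL.const_mul (s * γ / 2)) (hIS.add hE.1) hpt
  simp only [Pi.add_apply] at hint
  rw [integral_const_mul, integral_add hIS hE.1, integral_neg,
    integral_finsetSum _ fun i _ => hIJ i] at hint
  have hcvI := integrable_cv_moll hε h.pot
  have hcvA := integrable_cv_moll hε h.pot.abs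
  have hcvc := continuous_cv_moll hε h.pot
  have hIc : Integrable (fun x => u x * cv ρ c (moll ε) x) :=
    (hu1.continuous.mul hcvc).integrable_of_hasCompactSupport huc.mul_right
  have hgen : ∫ x, ψ x ^ 2 * ((1 + R x) ^ (-s) * mollGen ρ a b c ε x)
      = (∑ i, ∫ x, u x * pd i (J i) x) + ∫ x, u x * cv ρ c (moll ε) x := by
    have e1 : ∫ x, ∑ i, u x * pd i (J i) x = ∑ i, ∫ x, u x * pd i (J i) x :=
      integral_finsetSum _ fun i _ => hIuJ i
    have e2 : Integrable (fun x => ∑ i, u x * pd i (J i) x) :=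
      integrable_finsetSum _ fun i _ => hIuJ i
    rw [← e1, ← integral_add e2 hIc]
    refine integral_congr_ae (Filter.Eventually.of_forall fun x => ?_)
    simp only [mollGen, hu, ← Finset.mul_sum]
    ring
  have hibp : -∑ i, ∫ x, pd i u x * J i x = ∑ i, ∫ x, u x * pd i (J i) x := by
    rw [← Finset.sum_neg_distrib]
    exact Finset.sum_congr rfl fun i _ => (integral_mul_pd i hu1 huc (hJ1 i)).symm
  have hcb : |∫ x, u x * cv ρ c (moll ε) x| ≤ Ψ ^ 2 * ∫ y, |c y| ∂ρ := by
    rw [← integral_cv_moll hε h.pot.abs, ← integral_const_mul]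
    refine abs_integral_le_of_abs_le (hcvA.const_mul _) fun x => ?_
    rw [abs_mul]
    have h1 : |u x| ≤ Ψ ^ 2 := by
      rw [hu]
      simp only [abs_mul, abs_of_nonneg (Real.rpow_nonneg (hpos x).le (-s))]
      calc |ψ x| * |ψ x| * (1 + R x) ^ (-s) ≤ Ψ * Ψ * 1 :=
            mul_le_mul (mul_le_mul (hψ.abs_le x) (hψ.abs_le x) (abs_nonneg _) hΨ) (hg1 x)
              (Real.rpow_nonneg (hpos x).le _) (by positivity)
        _ = Ψ ^ 2 := by ring
    have h2 : |cv ρ c (moll ε) x| ≤ cv ρ (fun y => |c y|) (moll ε) x := by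
      refine (abs_cv_le x).trans (le_of_eq ?_)
      congr 1
      exact funext fun z => abs_of_nonneg (mollPow_nonneg ε 4 z)
    exact mul_le_mul h1 h2 (abs_nonneg _) (sq_nonneg _)
  have := neg_le_of_abs_le hcb
  unfold mollDissip
  rw [hgen]
  linarith [hE.2]

end Dissipation

section Evolution

variable {d : ℕ}

lemma AbsolutelyContinuousOnInterval.comp_lipschitz_pair {f g V : ℝ → ℝ} {a b L : ℝ}
    (hf : AbsolutelyContinuousOnInterval f a b) (hg : AbsolutelyContinuousOnInterval g a b)
    (h : ∀ s ∈ uIcc a b, ∀ t ∈ uIcc a b, dist (V s) (V t) ≤ L * (dist (f s) (f t) + dist (g s) (g t))) :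
    AbsolutelyContinuousOnInterval V a b := by
  unfold AbsolutelyContinuousOnInterval at *
  have h0 := (hf.add hg).const_mul L
  rw [add_zero, mul_zero] at h0
  refine squeeze_zero' (Filter.Eventually.of_forall fun E =>
    Finset.sum_nonneg fun _ _ => dist_nonneg) ?_ h0
  refine Filter.Eventually.filter_mono inf_le_right ?_
  rw [Filter.eventually_principal]
  intro E hE
  rw [← Finset.sum_add_distrib, Finset.mul_sum]
  exact Finset.sum_le_sum fun i hi => h _ (hE.1 i hi).1 _ (hE.1 i hi).2

/-- A function on the closed quadrant with bounded partial derivatives `G1` and `G2`. -/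
structure EnergyFun (G G1 G2 : ℝ × ℝ → ℝ) (L : ℝ) : Prop where
  hasFDeriv : ∀ p : ℝ × ℝ, 0 ≤ p.1 → 0 ≤ p.2 →
    HasFDerivAt G (G1 p • ContinuousLinearMap.fst ℝ ℝ ℝ + G2 p • ContinuousLinearMap.snd ℝ ℝ ℝ) p
  bdd1 : ∀ p : ℝ × ℝ, 0 ≤ p.1 → 0 ≤ p.2 → |G1 p| ≤ L
  bdd2 : ∀ p : ℝ × ℝ, 0 ≤ p.1 → 0 ≤ p.2 → |G2 p| ≤ L
  meas1 : Measurable G1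
  meas2 : Measurable G2

variable {G G1 G2 : ℝ × ℝ → ℝ} {L : ℝ}

lemma EnergyFun.dist_le (hG : EnergyFun G G1 G2 L) {p q : ℝ × ℝ} (hp1 : 0 ≤ p.1) (hp2 : 0 ≤ p.2)
    (hq1 : 0 ≤ q.1) (hq2 : 0 ≤ q.2) : dist (G p) (G q) ≤ 2 * L * (dist p.1 q.1 + dist p.2 q.2) := by
  have hL : 0 ≤ L := (abs_nonneg _).trans (hG.bdd1 p hp1 hp2)
  have hconv : Convex ℝ (Ici (0 : ℝ) ×ˢ Ici (0 : ℝ)) := (convex_Ici 0).prod (convex_Ici 0)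
  have := hconv.norm_image_sub_le_of_norm_hasFDerivWithin_le (f := G) (C := 2 * L)
    (fun z hz => (hG.hasFDeriv z hz.1 hz.2).hasFDerivWithinAt) (fun z hz => ?_)
    (show q ∈ _ from ⟨hq1, hq2⟩) (show p ∈ _ from ⟨hp1, hp2⟩)
  · rw [dist_eq_norm]
    refine this.trans (mul_le_mul_of_nonneg_left ?_ (by positivity))
    rw [Prod.norm_def, Real.dist_eq, Real.dist_eq]
    exact max_le_add_of_nonneg (abs_nonneg _) (abs_nonneg _)
  · refine (norm_add_le _ _).trans ?_
    rw [norm_smul, norm_smul, Real.norm_eq_abs, Real.norm_eq_abs]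
    have h1 := mul_le_mul (hG.bdd1 z hz.1 hz.2) (ContinuousLinearMap.norm_fst_le ℝ ℝ ℝ)
      (norm_nonneg _) hL
    have h2 := mul_le_mul (hG.bdd2 z hz.1 hz.2) (ContinuousLinearMap.norm_snd_le ℝ ℝ ℝ)
      (norm_nonneg _) hL
    linarith

/-- The chain rule for primitives of integrable functions. -/
lemma EnergyFun.chain (hG : EnergyFun G G1 G2 L) {D1 D2 : ℝ → ℝ} {u1 u2 t : ℝ} (ht : 0 ≤ t)
    (h1 : IntervalIntegrable D1 volume 0 t) (h2 : IntervalIntegrable D2 volume 0 t)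
    (hU1 : ∀ r ∈ Icc 0 t, 0 ≤ u1 + ∫ s in (0 : ℝ)..r, D1 s)
    (hU2 : ∀ r ∈ Icc 0 t, 0 ≤ u2 + ∫ s in (0 : ℝ)..r, D2 s) :
    G (u1 + ∫ s in (0 : ℝ)..t, D1 s, u2 + ∫ s in (0 : ℝ)..t, D2 s) = G (u1, u2)
      + ∫ r in (0 : ℝ)..t, (G1 (u1 + ∫ s in (0 : ℝ)..r, D1 s, u2 + ∫ s in (0 : ℝ)..r, D2 s) * D1 r
        + G2 (u1 + ∫ s in (0 : ℝ)..r, D1 s, u2 + ∫ s in (0 : ℝ)..r, D2 s) * D2 r) := by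
  set U1 : ℝ → ℝ := fun r => u1 + ∫ s in (0 : ℝ)..r, D1 s with hU1d
  set U2 : ℝ → ℝ := fun r => u2 + ∫ s in (0 : ℝ)..r, D2 s with hU2d
  have hI : uIcc 0 t = Icc 0 t := uIcc_of_le ht
  have a1 := h1.absolutelyContinuousOnInterval_intervalIntegral (c := 0) (by simp)
  have a2 := h2.absolutelyContinuousOnInterval_intervalIntegral (c := 0) (by simp)
  have hV : AbsolutelyContinuousOnInterval (fun r => G (U1 r, U2 r)) 0 t := by
    refine a1.comp_lipschitz_pair a2 (L := 2 * L) fun s hs r hr => ?_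
    rw [hI] at hs hr
    refine (hG.dist_le (hU1 s hs) (hU2 s hs) (hU1 r hr) (hU2 r hr)).trans (le_of_eq ?_)
    simp [hU1d, hU2d]
  have key := hV.integral_deriv_eq_sub
  have hcongr : ∫ r in (0 : ℝ)..t, deriv (fun r => G (U1 r, U2 r)) r
      = ∫ r in (0 : ℝ)..t, (G1 (U1 r, U2 r) * D1 r + G2 (U1 r, U2 r) * D2 r) := by
    refine intervalIntegral.integral_congr_ae ?_
    filter_upwards [h1.ae_hasDerivAt_integral, h2.ae_hasDerivAt_integral] with r hr1 hr2 hr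
    have hr' := uIoc_subset_uIcc hr
    have e1 := (hr1 hr' 0 (by simp)).const_add u1
    have e2 := (hr2 hr' 0 (by simp)).const_add u2
    rw [hI] at hr'
    have := (hG.hasFDeriv (U1 r, U2 r) (hU1 r hr') (hU2 r hr')).comp_hasDerivAt r (e1.prodMk e2)
    refine this.deriv.trans ?_
    simp
  rw [hcongr] at key
  have e0 : G (U1 0, U2 0) = G (u1, u2) := by simp [hU1d, hU2d]
  simp only [e0] at key
  linarith

lemma nonneg_primitive_of_ae {D : ℝ → ℝ} {u T : ℝ} (hT : 0 < T)
    (hD : IntervalIntegrable D volume 0 T)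
    (h : ∀ᵐ t ∂(volume.restrict (Icc 0 T)), 0 ≤ u + ∫ s in (0 : ℝ)..t, D s) :
    ∀ t ∈ Icc 0 T, 0 ≤ u + ∫ s in (0 : ℝ)..t, D s := by
  have hc : ContinuousOn (fun t => u + ∫ s in (0 : ℝ)..t, D s) (Icc 0 T) := by
    refine continuousOn_const.add ?_
    have := intervalIntegral.continuousOn_primitive_interval' hD (a := 0) (by simp)
    rwa [uIcc_of_le hT.le] at this
  have hae : (fun t => u + ∫ s in (0 : ℝ)..t, D s) =ᵐ[volume.restrict (Icc 0 T)]
      fun t => |u + ∫ s in (0 : ℝ)..t, D s| := by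
    filter_upwards [h] with t ht
    exact (abs_of_nonneg ht).symm
  intro t ht
  have := Measure.eqOn_Icc_of_ae_eq volume hT.ne hae hc hc.abs ht
  exact abs_eq_self.1 this.symm

/-- Evolution of a nonlinear functional of two functions that are absolutely continuous in time. -/
lemma EnergyFun.evolution (hG : EnergyFun G G1 G2 L) {T : ℝ} (hT : 0 < T) {ψ : Rd d → ℝ}
    (hψ : Continuous ψ) (hψc : HasCompactSupport ψ) {R1 R2 D1 D2 : ℝ → Rd d → ℝ}
    {R01 R02 : Rd d → ℝ} {m : ℝ → ℝ} (hm : IntegrableOn m (Icc 0 T))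
    (hR1 : Measurable (Function.uncurry R1)) (hR2 : Measurable (Function.uncurry R2))
    (hD1 : Measurable (Function.uncurry D1)) (hD2 : Measurable (Function.uncurry D2))
    (hR1n : ∀ t x, 0 ≤ R1 t x) (hR2n : ∀ t x, 0 ≤ R2 t x)
    (hR01 : Continuous R01) (hR02 : Continuous R02)
    (hR01n : ∀ x, 0 ≤ R01 x) (hR02n : ∀ x, 0 ≤ R02 x)
    (hm1 : ∀ᵐ s ∂(volume.restrict (Icc 0 T)), ∀ x ∈ tsupport ψ, |D1 s x| ≤ m s)
    (hm2 : ∀ᵐ s ∂(volume.restrict (Icc 0 T)), ∀ x ∈ tsupport ψ, |D2 s x| ≤ m s)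
    (he1 : ∀ᵐ t ∂(volume.restrict (Icc 0 T)), ∀ x ∈ tsupport ψ,
      R1 t x = R01 x + ∫ s in (0 : ℝ)..t, D1 s x)
    (he2 : ∀ᵐ t ∂(volume.restrict (Icc 0 T)), ∀ x ∈ tsupport ψ,
      R2 t x = R02 x + ∫ s in (0 : ℝ)..t, D2 s x) :
    IntegrableOn (fun s => ∫ x, ψ x * (G1 (R1 s x, R2 s x) * D1 s x + G2 (R1 s x, R2 s x) * D2 s x))
      (Icc 0 T) ∧ ∀ᵐ t ∂(volume.restrict (Icc 0 T)),
      ∫ x, ψ x * G (R1 t x, R2 t x) = (∫ x, ψ x * G (R01 x, R02 x)) + ∫ s in (0 : ℝ)..t,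
        ∫ x, ψ x * (G1 (R1 s x, R2 s x) * D1 s x + G2 (R1 s x, R2 s x) * D2 s x) := by
  set H : ℝ × Rd d → ℝ := fun z => ψ z.2 * (G1 (R1 z.1 z.2, R2 z.1 z.2) * D1 z.1 z.2
    + G2 (R1 z.1 z.2, R2 z.1 z.2) * D2 z.1 z.2) with hH
  have hL : 0 ≤ L := (abs_nonneg _).trans (hG.bdd1 0 le_rfl le_rfl)
  have hHm : Measurable H := by
    have hR : Measurable fun z : ℝ × Rd d => (R1 z.1 z.2, R2 z.1 z.2) := hR1.prodMk hR2
    exact (hψ.measurable.comp measurable_snd).mul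
      (((hG.meas1.comp hR).mul hD1).add ((hG.meas2.comp hR).mul hD2))
  have hHI : Integrable H ((volume.restrict (Icc 0 T)).prod volume) := by
    refine ((hm.const_mul (2 * L)).mul_prod
      (hψ.abs.integrable_of_hasCompactSupport hψc.abs)).mono' hHm.aestronglyMeasurable ?_
    filter_upwards [Measure.quasiMeasurePreserving_fst.ae hm1,
      Measure.quasiMeasurePreserving_fst.ae hm2] with z h1 h2
    by_cases hz : z.2 ∈ tsupport ψ
    · rw [hH, Real.norm_eq_abs, abs_mul, mul_comm]
      refine mul_le_mul_of_nonneg_right ((abs_add_le _ _).trans ?_) (abs_nonneg _)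
      rw [abs_mul, abs_mul]
      have k1 := mul_le_mul (hG.bdd1 (R1 z.1 z.2, R2 z.1 z.2) (hR1n _ _) (hR2n _ _)) (h1 _ hz)
        (abs_nonneg _) hL
      have k2 := mul_le_mul (hG.bdd2 (R1 z.1 z.2, R2 z.1 z.2) (hR1n _ _) (hR2n _ _)) (h2 _ hz)
        (abs_nonneg _) hL
      linarith
    · simp [hH, eq_zero_of_notMem_tsupport hz]
  refine ⟨hHI.integral_prod_left, ?_⟩
  have hDI : ∀ (D : ℝ → Rd d → ℝ), Measurable (Function.uncurry D) →
      (∀ᵐ s ∂(volume.restrict (Icc 0 T)), ∀ x ∈ tsupport ψ, |D s x| ≤ m s) →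
      ∀ x ∈ tsupport ψ, ∀ t ∈ Icc 0 T, IntervalIntegrable (fun s => D s x) volume 0 t := by
    intro D hD hb x hx t ht
    rw [intervalIntegrable_iff_integrableOn_Icc_of_le ht.1]
    refine IntegrableOn.mono_set ?_ (Icc_subset_Icc_right ht.2)
    refine hm.mono' (hD.comp (measurable_id.prodMk measurable_const)).aestronglyMeasurable ?_
    filter_upwards [hb] with s hs
    exact hs x hx
  have hT' : T ∈ Icc 0 T := ⟨hT.le, le_rfl⟩
  have hU1 : ∀ x ∈ tsupport ψ, ∀ t ∈ Icc 0 T, 0 ≤ R01 x + ∫ s in (0 : ℝ)..t, D1 s x :=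
    fun x hx => nonneg_primitive_of_ae hT (hDI D1 hD1 hm1 x hx T hT') <| by
      filter_upwards [he1] with t ht
      rw [← ht x hx]
      exact hR1n t x
  have hU2 : ∀ x ∈ tsupport ψ, ∀ t ∈ Icc 0 T, 0 ≤ R02 x + ∫ s in (0 : ℝ)..t, D2 s x :=
    fun x hx => nonneg_primitive_of_ae hT (hDI D2 hD2 hm2 x hx T hT') <| by
      filter_upwards [he2] with t ht
      rw [← ht x hx]
      exact hR2n t x
  filter_upwards [he1, he2, ae_restrict_mem measurableSet_Icc] with t ht1 ht2 ht
  have hpt : ∀ x, ψ x * G (R1 t x, R2 t x)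
      = ψ x * G (R01 x, R02 x) + ∫ s in (0 : ℝ)..t, H (s, x) := by
    intro x
    by_cases hx : x ∈ tsupport ψ
    · have hsub : Icc 0 t ⊆ Icc 0 T := Icc_subset_Icc_right ht.2
      rw [ht1 x hx, ht2 x hx, hG.chain ht.1 (hDI D1 hD1 hm1 x hx t ht) (hDI D2 hD2 hm2 x hx t ht)
        (fun r hr => hU1 x hx r (hsub hr)) (fun r hr => hU2 x hx r (hsub hr)), mul_add,
        ← intervalIntegral.integral_const_mul]
      congr 1
      refine intervalIntegral.integral_congr_ae ?_
      have e1 := (ae_restrict_iff' measurableSet_Icc).1 he1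
      have e2 := (ae_restrict_iff' measurableSet_Icc).1 he2
      filter_upwards [e1, e2] with s hs1 hs2 hs
      rw [uIoc_of_le ht.1] at hs
      have hs' : s ∈ Icc 0 T := hsub ⟨hs.1.le, hs.2⟩
      simp only [hH]
      rw [hs1 hs' x hx, hs2 hs' x hx]
    · simp [hH, eq_zero_of_notMem_tsupport hx]
  have hG0 : Continuous fun x => G (R01 x, R02 x) := by
    refine continuous_iff_continuousAt.2 fun x => ?_
    exact ContinuousAt.comp (f := fun x => (R01 x, R02 x))
      (hG.hasFDeriv (R01 x, R02 x) (hR01n x) (hR02n x)).continuousAt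
      (hR01.prodMk hR02).continuousAt
  have hI0 : Integrable fun x => ψ x * G (R01 x, R02 x) :=
    (hψ.mul hG0).integrable_of_hasCompactSupport hψc.mul_right
  have hHt : Integrable H ((volume.restrict (Ioc 0 t)).prod volume) :=
    hHI.mono_measure (Measure.prod_mono (Measure.restrict_mono
      (Ioc_subset_Icc_self.trans (Icc_subset_Icc_right ht.2)) le_rfl) le_rfl)
  have hI1 : Integrable fun x => ∫ s in (0 : ℝ)..t, H (s, x) := by
    simp only [intervalIntegral.integral_of_le ht.1]
    exact hHt.integral_prod_right
  rw [integral_congr_ae (Filter.Eventually.of_forall hpt), integral_add hI0 hI1]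
  congr 1
  simp only [intervalIntegral.integral_of_le ht.1]
  exact (integral_integral_swap (f := fun s x => H (s, x)) hHt).symm

end Evolution

section FrozenGenerator

variable {d : ℕ}

variable {ρ : Measure (Rd d)} {r γ K Λ ε : ℝ} {a : Fin d → Fin d → Rd d → ℝ}
  {b : Fin d → Rd d → ℝ} {c : Rd d → ℝ}

lemma isTest_moll (hε : 0 < ε) : IsTest (moll (d := d) ε) :=
  ⟨mollPow_contDiff ε 4, mollPow_hasCompactSupport hε (by norm_num)⟩

/-- The mollified generator with all derivatives on the mollifier. -/
def convGen (ρ : Measure (Rd d)) (a : Fin d → Fin d → Rd d → ℝ) (b : Fin d → Rd d → ℝ)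
    (c : Rd d → ℝ) (ε : ℝ) (x : Rd d) : ℝ :=
  ∑ i, ∑ j, cv ρ (a i j) (pd i (pd j (moll ε))) x - ∑ i, cv ρ (b i) (pd i (moll ε)) x
    + cv ρ c (moll ε) x

lemma mollGen_eq_convGen (h : FrozenMeas ρ b c) (ha : FrozenCoeff r γ K Λ a) (hε : 0 < ε)
    (x : Rd d) : mollGen ρ a b c ε x = convGen ρ a b c ε x := by
  have := h.isFiniteMeasure
  have hm := isTest_moll (d := d) hε
  have h1 : ∀ i j, ContDiff ℝ 1 (cv ρ (a i j) (pd j (moll ε))) := fun i j =>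
    contDiff_cv (n := 1) (ha.integrable i j) (hm.pd j).contDiff_one (hm.pd j).2
  have h2 : ∀ i, ContDiff ℝ 1 (cv ρ (b i) (moll ε)) := fun i =>
    contDiff_cv (n := 1) (h.integrable_drift i) hm.contDiff_one hm.2
  have h3 : ∀ i, pd i (mollFlux ρ a b ε i) x
      = ∑ j, cv ρ (a i j) (pd i (pd j (moll ε))) x - cv ρ (b i) (pd i (moll ε)) x := by
    intro i
    have e : mollFlux ρ a b ε i
        = fun x => (∑ j, cv ρ (a i j) (pd j (moll ε)) x) - cv ρ (b i) (moll ε) x := rfl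
    rw [e, pd_sub i (DifferentiableAt.fun_sum fun j _ => (h1 i j).differentiable one_ne_zero x)
      ((h2 i).differentiable one_ne_zero x),
      pd_sum i fun j _ => (h1 i j).differentiable one_ne_zero x,
      pd_cv (h.integrable_drift i) hm.contDiff_one hm.2]
    congr 1
    exact Finset.sum_congr rfl fun j _ => by
      rw [pd_cv (ha.integrable i j) (hm.pd j).contDiff_one (hm.pd j).2]
  simp only [mollGen, convGen, h3, Finset.sum_sub_distrib]

lemma abs_cv_le_mul {w φ : Rd d → ℝ} {C : ℝ} (hw : Integrable w ρ) (hφ : ∀ x, |φ x| ≤ C)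
    (x : Rd d) : |cv ρ w φ x| ≤ C * ∫ y, |w y| ∂ρ := by
  rw [← integral_const_mul]
  refine abs_integral_le_of_abs_le (hw.abs.const_mul C) fun y => ?_
  rw [abs_mul, mul_comm]
  exact mul_le_mul_of_nonneg_right (hφ _) (abs_nonneg _)

lemma one_le_coeffMass (ρ1 ρ2 : Measure (Rd d)) (b : Fin d → Rd d → ℝ) (c : Rd d → ℝ) :
    1 ≤ coeffMass ρ1 ρ2 b c := by
  have h1 : 0 ≤ ∑ i, ∫ y, b i y ^ 2 ∂ρ1 :=
    Finset.sum_nonneg fun i _ => integral_nonneg fun y => sq_nonneg _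
  have h2 : 0 ≤ ∑ i, ∫ y, b i y ^ 2 ∂ρ2 :=
    Finset.sum_nonneg fun i _ => integral_nonneg fun y => sq_nonneg _
  have h3 : 0 ≤ ∫ y, |c y| ∂ρ1 := integral_nonneg fun y => abs_nonneg _
  have h4 : 0 ≤ ∫ y, |c y| ∂ρ2 := integral_nonneg fun y => abs_nonneg _
  unfold coeffMass
  linarith

lemma add_le_coeffMass (ρ : Measure (Rd d)) (b : Fin d → Rd d → ℝ) (c : Rd d → ℝ) :
    1 + ∑ i, ∫ y, b i y ^ 2 ∂ρ + ∫ y, |c y| ∂ρ ≤ coeffMass ρ ρ b c := by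
  have h1 : 0 ≤ ∑ i, ∫ y, b i y ^ 2 ∂ρ :=
    Finset.sum_nonneg fun i _ => integral_nonneg fun y => sq_nonneg _
  have h3 : 0 ≤ ∫ y, |c y| ∂ρ := integral_nonneg fun y => abs_nonneg _
  unfold coeffMass
  linarith

lemma exists_abs_convGen_le (d : ℕ) (K : ℝ) (hε : 0 < ε) : ∃ C, 0 ≤ C ∧
    ∀ {ρ : Measure (Rd d)} {r γ Λ : ℝ} {a : Fin d → Fin d → Rd d → ℝ} {b : Fin d → Rd d → ℝ}
      {c : Rd d → ℝ}, FrozenMeas ρ b c → FrozenCoeff r γ K Λ a →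
      ∀ x, |convGen ρ a b c ε x| ≤ C * coeffMass ρ ρ b c := by
  have hm := isTest_moll (d := d) hε
  obtain ⟨B0, hB0⟩ := hm.continuous.bounded_above_of_compact_support hm.2
  have h1 := fun i => (hm.pd i).continuous.bounded_above_of_compact_support (hm.pd i).2
  have h2 := fun i j =>
    ((hm.pd j).pd i).continuous.bounded_above_of_compact_support ((hm.pd j).pd i).2
  choose B1 hB1 using h1
  choose B2 hB2 using h2
  have p0 : 0 ≤ B0 := (norm_nonneg _).trans (hB0 0)
  have p1 : ∀ i, 0 ≤ B1 i := fun i => (norm_nonneg _).trans (hB1 i 0)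
  have p2 : ∀ i j, 0 ≤ B2 i j := fun i j => (norm_nonneg _).trans (hB2 i j 0)
  set B := B0 + ∑ i, B1 i + ∑ i, ∑ j, B2 i j with hB
  have q1 : 0 ≤ ∑ i, B1 i := Finset.sum_nonneg fun i _ => p1 i
  have q2 : 0 ≤ ∑ i, ∑ j, B2 i j := Finset.sum_nonneg fun i _ => Finset.sum_nonneg fun j _ => p2 i j
  have hBn : 0 ≤ B := by positivity
  have b0 : B0 ≤ B := by linarith
  have b1 : ∀ i, B1 i ≤ B := fun i => by
    have := Finset.single_le_sum (fun i _ => p1 i) (Finset.mem_univ i)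
    linarith
  have b2 : ∀ i j, B2 i j ≤ B := fun i j => by
    have e1 := Finset.single_le_sum (fun j _ => p2 i j) (Finset.mem_univ j)
    have e2 := Finset.single_le_sum (f := fun i => ∑ j, B2 i j)
      (fun i _ => Finset.sum_nonneg fun j _ => p2 i j) (Finset.mem_univ i)
    linarith
  refine ⟨B * (d * (d * |K|) + d + 1), by positivity, ?_⟩
  intro ρ r γ Λ a b c h ha x
  have := h.isFiniteMeasure
  have hK := ha.bdd_nonneg
  have e1 : |∑ i, ∑ j, cv ρ (a i j) (pd i (pd j (moll ε))) x| ≤ d * (d * (B * |K|)) := by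
    refine (Finset.abs_sum_le_sum_abs _ _).trans ((Finset.sum_le_sum fun i _ =>
      (Finset.abs_sum_le_sum_abs _ _).trans (Finset.sum_le_sum fun j _ => ?_)).trans
      (le_of_eq (a := (∑ _i : Fin d, ∑ _j : Fin d, B * |K|)) (by simp)))
    refine (abs_cv_le_mul (ha.integrable i j) (fun y => (hB2 i j y).trans (b2 i j)) x).trans ?_
    refine mul_le_mul_of_nonneg_left ?_ hBn
    have : ∫ y, |a i j y| ∂ρ ≤ ∫ _y, K ∂ρ :=
      integral_mono (ha.integrable i j).abs (integrable_const _) fun y => ha.bdd i j y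
    rw [integral_const, smul_eq_mul] at this
    have h2 := h.real_le
    rw [abs_of_nonneg hK]
    nlinarith
  have e2 : |∑ i, cv ρ (b i) (pd i (moll ε)) x| ≤ B * (d + ∑ i, ∫ y, b i y ^ 2 ∂ρ) := by
    refine (Finset.abs_sum_le_sum_abs _ _).trans ((Finset.sum_le_sum fun i _ =>
      (abs_cv_le_mul (h.integrable_drift i) (fun y => (hB1 i y).trans (b1 i)) x).trans
      (mul_le_mul_of_nonneg_left (h.integral_abs_drift_le i) hBn)).trans ?_)
    rw [← Finset.mul_sum, Finset.sum_add_distrib]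
    simp
  have e3 : |cv ρ c (moll ε) x| ≤ B * ∫ y, |c y| ∂ρ :=
    abs_cv_le_mul h.pot (fun y => (hB0 y).trans b0) x
  have e4 := add_le_coeffMass ρ b c
  have e5 := one_le_coeffMass ρ ρ b c
  have e6 : |convGen ρ a b c ε x| ≤ d * (d * (B * |K|)) + B * (d + ∑ i, ∫ y, b i y ^ 2 ∂ρ)
      + B * ∫ y, |c y| ∂ρ :=
    (abs_add_le _ _).trans (add_le_add ((abs_sub _ _).trans (add_le_add e1 e2)) e3)
  refine e6.trans ?_
  have e7 : B * (1 + ∑ i, ∫ y, b i y ^ 2 ∂ρ + ∫ y, |c y| ∂ρ) ≤ B * coeffMass ρ ρ b c :=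
    mul_le_mul_of_nonneg_left e4 hBn
  have e8 : (B * (d * (d * |K|) + d)) * 1 ≤ (B * (d * (d * |K|) + d)) * coeffMass ρ ρ b c :=
    mul_le_mul_of_nonneg_left e5 (by positivity)
  nlinarith

end FrozenGenerator

section EnergyFunctions

lemma energyFun_power {s : ℝ} (hs : 0 < s) (hs1 : s < 1) :
    EnergyFun (fun p => (1 + p.1) ^ (1 - s) / (1 - s)) (fun p => (1 + p.1) ^ (-s)) (fun _ => 0) 1 where
  hasFDeriv p h1 _ := by
    have hp : (1 + p.1) ≠ 0 := by linarith
    have h := ((hasFDerivAt_fst (𝕜 := ℝ) (p := p)).const_add 1).rpow_const (p := 1 - s) (Or.inl hp)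
    have h' := h.mul_const (1 - s)⁻¹
    simp only [div_eq_mul_inv]
    refine h'.congr_fderiv ?_
    have : (1 - s) ≠ 0 := by linarith
    ext <;> (simp; try field_simp)
  bdd1 p h1 _ := by
    rw [abs_of_nonneg (Real.rpow_nonneg (by linarith) _)]
    exact Real.rpow_le_one_of_one_le_of_nonpos (by linarith) (by linarith)
  bdd2 p _ _ := by simp
  meas1 := by fun_prop
  meas2 := measurable_const

lemma energyFun_quotient {δ : ℝ} (hδ : 0 < δ) :
    EnergyFun (fun p => p.1 ^ 2 / (p.1 + p.2 + δ))
      (fun p => 2 * (p.1 / (p.1 + p.2 + δ)) - (p.1 / (p.1 + p.2 + δ)) ^ 2)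
      (fun p => -(p.1 / (p.1 + p.2 + δ)) ^ 2) 1 where
  hasFDeriv p h1 h2 := by
    have hp : p.1 + p.2 + δ ≠ 0 := by linarith
    have h0 : HasFDerivAt (fun q : ℝ × ℝ => q.1 + q.2 + δ)
        (ContinuousLinearMap.fst ℝ ℝ ℝ + ContinuousLinearMap.snd ℝ ℝ ℝ) p :=
      (hasFDerivAt_fst.add hasFDerivAt_snd).add_const δ
    have hinv := (hasDerivAt_inv hp).comp_hasFDerivAt p h0
    have h := ((hasFDerivAt_fst (𝕜 := ℝ) (p := p)).pow 2).mul hinv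
    simp only [div_eq_mul_inv]
    refine h.congr_fderiv ?_
    ext
    · simp
      field_simp
      ring
    · simp
      field_simp
  bdd1 p h1 h2 := by
    have hp : 0 < p.1 + p.2 + δ := by linarith
    have q1 : 0 ≤ p.1 / (p.1 + p.2 + δ) := by positivity
    have q2 : p.1 / (p.1 + p.2 + δ) ≤ 1 := (div_le_one hp).2 (by linarith)
    exact abs_le.2 ⟨by nlinarith, by nlinarith [sq_nonneg (p.1 / (p.1 + p.2 + δ) - 1)]⟩
  bdd2 p h1 h2 := by
    have hp : 0 < p.1 + p.2 + δ := by linarith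
    have q1 : 0 ≤ p.1 / (p.1 + p.2 + δ) := by positivity
    have q2 : p.1 / (p.1 + p.2 + δ) ≤ 1 := (div_le_one hp).2 (by linarith)
    rw [abs_neg]
    exact abs_le.2 ⟨by nlinarith, by nlinarith⟩
  meas1 := by fun_prop
  meas2 := by fun_prop

end EnergyFunctions

section LocalSolutions

open ProbabilityTheory

variable {d : ℕ}

/-- The restriction of a space-time function to a fixed time. -/
abbrev timeSlice (f : ℝ × Rd d → ℝ) (s : ℝ) (y : Rd d) : ℝ := f (s, y)

/-- A solution of the Fokker–Planck–Kolmogorov equation in the ball of radius `r`, tested against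
mollifiers, with coefficients cut off outside a larger ball. -/
structure LocalSol (T r γ K Λ : ℝ) (κ : Kernel ℝ (Rd d)) (a : Fin d → Fin d → ℝ × Rd d → ℝ)
    (b : Fin d → ℝ × Rd d → ℝ) (c : ℝ × Rd d → ℝ) (ν : Measure (Rd d)) : Prop where
  coeff : ∀ s ∈ Icc 0 T, FrozenCoeff r γ K Λ fun i j => timeSlice (a i j) s
  coeff_meas : ∀ i j, Measurable (a i j)
  drift_meas : ∀ i, Measurable (b i)
  pot_meas : Measurable c
  mass : ∀ s, κ s univ ≤ 1
  frozen : ∀ᵐ s ∂(volume.restrict (Icc 0 T)),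
    FrozenMeas (κ s) (fun i => timeSlice (b i) s) (timeSlice c s)
  integrable : IntegrableOn
    (fun s => coeffMass (κ s) (κ s) (fun i => timeSlice (b i) s) (timeSlice c s)) (Icc 0 T)
  evol : ∀ ε, 0 < ε → ε ≤ 1 → ∀ᵐ t ∂(volume.restrict (Icc 0 T)), ∀ x ∈ Metric.ball (0 : Rd d) r,
    mollDens (κ t) ε x = mollDens ν ε x + ∫ s in (0 : ℝ)..t,
      convGen (κ s) (fun i j => timeSlice (a i j) s) (fun i => timeSlice (b i) s) (timeSlice c s) ε x

variable {κ κ1 κ2 : Kernel ℝ (Rd d)} {T r γ K Λ ε Ψ o : ℝ} {a : Fin d → Fin d → ℝ × Rd d → ℝ}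
  {b : Fin d → ℝ × Rd d → ℝ} {c : ℝ × Rd d → ℝ} {ν : Measure (Rd d)} {ψ : Rd d → ℝ}

lemma LocalSol.isFiniteKernel (h : LocalSol T r γ K Λ κ a b c ν) : IsFiniteKernel κ :=
  ⟨1, ENNReal.one_lt_top, h.mass⟩

lemma measurable_cv_timeSlice [IsSFiniteKernel κ] {w : ℝ × Rd d → ℝ} (hw : Measurable w)
    {φ : Rd d → ℝ} (hφ : Continuous φ) :
    Measurable (Function.uncurry fun s x => cv (κ s) (timeSlice w s) φ x) := by
  have hm : Measurable fun z : (ℝ × Rd d) × Rd d => w (z.1.1, z.2) * φ (z.1.2 - z.2) :=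
    (hw.comp ((measurable_fst.comp measurable_fst).prodMk measurable_snd)).mul
      (hφ.measurable.comp ((measurable_snd.comp measurable_fst).sub measurable_snd))
  exact (hm.stronglyMeasurable.integral_kernel_prod_right'
    (κ := κ.comap Prod.fst measurable_fst)).measurable

lemma measurable_convGen [IsSFiniteKernel κ] (ha : ∀ i j, Measurable (a i j))
    (hb : ∀ i, Measurable (b i)) (hc : Measurable c) (hε : 0 < ε) :
    Measurable (Function.uncurry fun s x => convGen (κ s) (fun i j => timeSlice (a i j) s)
      (fun i => timeSlice (b i) s) (timeSlice c s) ε x) := by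
  have hm := isTest_moll (d := d) hε
  have h1 := fun i j => measurable_cv_timeSlice (κ := κ) (ha i j) ((hm.pd j).pd i).continuous
  have h2 := fun i => measurable_cv_timeSlice (κ := κ) (hb i) (hm.pd i).continuous
  have h3 := measurable_cv_timeSlice (κ := κ) hc hm.continuous
  exact ((Finset.measurable_fun_sum _ fun i _ => Finset.measurable_fun_sum _ fun j _ => h1 i j).sub
    (Finset.measurable_fun_sum _ fun i _ => h2 i)).add h3

lemma LocalSol.measurable_convGen (h : LocalSol T r γ K Λ κ a b c ν) (hε : 0 < ε) :
    Measurable (Function.uncurry fun s x => convGen (κ s) (fun i j => timeSlice (a i j) s)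
      (fun i => timeSlice (b i) s) (timeSlice c s) ε x) := by
  have := h.isFiniteKernel
  exact _root_.measurable_convGen h.coeff_meas h.drift_meas h.pot_meas hε

lemma LocalSol.measurable_mollDens (h : LocalSol T r γ K Λ κ a b c ν) (hε : 0 < ε) :
    Measurable (Function.uncurry fun s x => mollDens (κ s) ε x) := by
  have := h.isFiniteKernel
  exact measurable_cv_timeSlice (κ := κ) (w := fun _ => 1) measurable_const
    (isTest_moll hε).continuous

lemma LocalSol.evolution [IsFiniteMeasure ν] (h1 : LocalSol T r γ K Λ κ1 a b c ν)
    (h2 : LocalSol T r γ K Λ κ2 a b c ν) (hT : 0 < T) {G G1 G2 : ℝ × ℝ → ℝ} {L : ℝ}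
    (hG : EnergyFun G G1 G2 L) (hψ : Continuous ψ) (hψc : HasCompactSupport ψ)
    (hψs : tsupport ψ ⊆ Metric.ball 0 r) (hε : 0 < ε) (hε1 : ε ≤ 1) :
    IntegrableOn (fun s => ∫ x, ψ x * (G1 (mollDens (κ1 s) ε x, mollDens (κ2 s) ε x)
        * mollGen (κ1 s) (fun i j => timeSlice (a i j) s) (fun i => timeSlice (b i) s)
          (timeSlice c s) ε x
      + G2 (mollDens (κ1 s) ε x, mollDens (κ2 s) ε x)
        * mollGen (κ2 s) (fun i j => timeSlice (a i j) s) (fun i => timeSlice (b i) s)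
          (timeSlice c s) ε x)) (Icc 0 T) ∧
    ∀ᵐ t ∂(volume.restrict (Icc 0 T)),
      ∫ x, ψ x * G (mollDens (κ1 t) ε x, mollDens (κ2 t) ε x)
        = (∫ x, ψ x * G (mollDens ν ε x, mollDens ν ε x)) + ∫ s in (0 : ℝ)..t, ∫ x, ψ x *
          (G1 (mollDens (κ1 s) ε x, mollDens (κ2 s) ε x)
            * mollGen (κ1 s) (fun i j => timeSlice (a i j) s) (fun i => timeSlice (b i) s)
              (timeSlice c s) ε x
          + G2 (mollDens (κ1 s) ε x, mollDens (κ2 s) ε x)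
            * mollGen (κ2 s) (fun i j => timeSlice (a i j) s) (fun i => timeSlice (b i) s)
              (timeSlice c s) ε x) := by
  obtain ⟨C, hC, hCb⟩ := exists_abs_convGen_le d K hε
  have hs1 : ∀ᵐ s ∂(volume.restrict (Icc 0 T)), ∀ x, mollGen (κ1 s) (fun i j => timeSlice (a i j) s)
      (fun i => timeSlice (b i) s) (timeSlice c s) ε x = convGen (κ1 s)
      (fun i j => timeSlice (a i j) s) (fun i => timeSlice (b i) s) (timeSlice c s) ε x := by
    filter_upwards [h1.frozen, ae_restrict_mem measurableSet_Icc] with s hs hsT x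
    exact mollGen_eq_convGen hs (h1.coeff s hsT) hε x
  have hs2 : ∀ᵐ s ∂(volume.restrict (Icc 0 T)), ∀ x, mollGen (κ2 s) (fun i j => timeSlice (a i j) s)
      (fun i => timeSlice (b i) s) (timeSlice c s) ε x = convGen (κ2 s)
      (fun i j => timeSlice (a i j) s) (fun i => timeSlice (b i) s) (timeSlice c s) ε x := by
    filter_upwards [h2.frozen, ae_restrict_mem measurableSet_Icc] with s hs hsT x
    exact mollGen_eq_convGen hs (h2.coeff s hsT) hε x
  have hν := mollDens_contDiff (ρ := ν) hε
  have key := hG.evolution hT hψ hψc (m := fun s =>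
      C * coeffMass (κ1 s) (κ1 s) (fun i => timeSlice (b i) s) (timeSlice c s)
      + C * coeffMass (κ2 s) (κ2 s) (fun i => timeSlice (b i) s) (timeSlice c s))
    ((h1.integrable.const_mul C).add (h2.integrable.const_mul C))
    (h1.measurable_mollDens hε) (h2.measurable_mollDens hε)
    (h1.measurable_convGen hε) (h2.measurable_convGen hε) (fun t x => mollDens_nonneg ε x)
    (fun t x => mollDens_nonneg ε x) hν.continuous hν.continuous (mollDens_nonneg ε)
    (mollDens_nonneg ε) ?_ ?_ ?_ ?_
  · refine ⟨key.1.congr ?_, ?_⟩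
    · filter_upwards [hs1, hs2] with s e1 e2
      simp only [e1, e2]
    · filter_upwards [key.2, ae_restrict_mem measurableSet_Icc] with t ht htT
      rw [ht]
      congr 1
      refine intervalIntegral.integral_congr_ae ?_
      filter_upwards [(ae_restrict_iff' measurableSet_Icc).1 hs1,
        (ae_restrict_iff' measurableSet_Icc).1 hs2] with s e1 e2 hs
      rw [uIoc_of_le htT.1] at hs
      have hs' : s ∈ Icc 0 T := ⟨hs.1.le, hs.2.trans htT.2⟩
      simp only [e1 hs', e2 hs']
  · filter_upwards [h1.frozen, ae_restrict_mem measurableSet_Icc] with s hs hsT x _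
    have e1 := hCb hs (h1.coeff s hsT) x
    have e2 := mul_nonneg hC (zero_le_one.trans
      (one_le_coeffMass (κ2 s) (κ2 s) (fun i => timeSlice (b i) s) (timeSlice c s)))
    linarith
  · filter_upwards [h2.frozen, ae_restrict_mem measurableSet_Icc] with s hs hsT x _
    have e1 := hCb hs (h2.coeff s hsT) x
    have e2 := mul_nonneg hC (zero_le_one.trans
      (one_le_coeffMass (κ1 s) (κ1 s) (fun i => timeSlice (b i) s) (timeSlice c s)))
    linarith
  · filter_upwards [h1.evol ε hε hε1] with t ht x hx
    exact ht x (hψs hx)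
  · filter_upwards [h2.evol ε hε hε1] with t ht x hx
    exact ht x (hψs hx)

end LocalSolutions

section Fatou

lemma ae_exists_frequently_le_of_integral_le {T C : ℝ} (hT : 0 < T) {f : ℕ → ℝ → ℝ}
    (hf : ∀ n, IntegrableOn (f n) (Icc 0 T))
    (hf0 : ∀ n, ∀ᵐ s ∂(volume.restrict (Icc 0 T)), 0 ≤ f n s)
    (hC : ∀ n, ∀ᵐ t ∂(volume.restrict (Icc 0 T)), ∫ s in (0 : ℝ)..t, f n s ≤ C) :
    ∀ᵐ s ∂(volume.restrict (Icc 0 T)), ∃ B, ∃ᶠ n in Filter.atTop, f n s ≤ B := by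
  have hT' : ∀ n, ∫ s in Icc 0 T, f n s ≤ C := fun n => by
    have hi : IntervalIntegrable (fun s => -f n s) volume 0 T :=
      ((intervalIntegrable_iff_integrableOn_Icc_of_le hT.le).2 (hf n)).neg
    have := nonneg_primitive_of_ae hT hi (u := C) (by
      filter_upwards [hC n] with t ht
      rw [intervalIntegral.integral_neg]
      linarith) T ⟨hT.le, le_rfl⟩
    rw [intervalIntegral.integral_neg, intervalIntegral.integral_of_le hT.le,
      ← integral_Icc_eq_integral_Ioc] at this
    linarith
  have hle : ∀ n, ∫⁻ s in Icc 0 T, ENNReal.ofReal (f n s) ≤ ENNReal.ofReal C := fun n => by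
    rw [← ofReal_integral_eq_lintegral_ofReal (hf n) (hf0 n)]
    exact ENNReal.ofReal_le_ofReal (hT' n)
  have hm : ∀ n, AEMeasurable (fun s => ENNReal.ofReal (f n s)) (volume.restrict (Icc 0 T)) :=
    fun n => (hf n).aestronglyMeasurable.aemeasurable.ennreal_ofReal
  have hfin : ∫⁻ s in Icc 0 T, Filter.liminf (fun n => ENNReal.ofReal (f n s)) Filter.atTop
      < ⊤ := by
    have hC' : ENNReal.ofReal C < ⊤ := ENNReal.ofReal_lt_top
    refine (lintegral_liminf_le' hm).trans_lt (lt_of_le_of_lt ?_ hC')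
    exact Filter.liminf_le_of_frequently_le' (Filter.Frequently.of_forall hle)
  have hmk : ∀ᵐ s ∂(volume.restrict (Icc 0 T)), ∀ n, ENNReal.ofReal (f n s) = (hm n).mk _ s :=
    ae_all_iff.2 fun n => (hm n).ae_eq_mk
  have hlm : AEMeasurable (fun s => Filter.liminf (fun n => ENNReal.ofReal (f n s)) Filter.atTop)
      (volume.restrict (Icc 0 T)) := by
    refine ⟨fun s => Filter.liminf (fun n => (hm n).mk _ s) Filter.atTop,
      Measurable.liminf fun n => (hm n).measurable_mk, ?_⟩
    filter_upwards [hmk] with s hs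
    simp only [hs]
  filter_upwards [ae_lt_top' hlm hfin.ne] with s hs
  obtain ⟨B, hB, -⟩ := ENNReal.lt_iff_exists_nnreal_btwn.1 hs
  refine ⟨B, (Filter.frequently_lt_of_liminf_lt (by isBoundedDefault) hB).mono fun n hn => ?_⟩
  exact ENNReal.ofReal_le_coe.1 hn.le

end Fatou

section Density

variable {d : ℕ}

lemma enorm_le_lintegral_enorm_fderiv_of_one {u : Rd 1 → ℝ} (hu : ContDiff ℝ 1 u)
    (huc : HasCompactSupport u) (x : Rd 1) : ‖u x‖ₑ ≤ ∫⁻ y, ‖fderiv ℝ u y‖ₑ := by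
  set e : ℝ →L[ℝ] Rd 1 := ContinuousLinearMap.toSpanSingleton ℝ (EuclideanSpace.single 0 1) with he
  have hmp : MeasurePreserving (fun t : ℝ => e t) volume volume := by
    have h1 := ((volume_preserving_funUnique (Fin 1) ℝ).symm).comp (MeasurePreserving.id volume)
    have h2 := (PiLp.volume_preserving_toLp (Fin 1)).comp h1
    have h3 : (fun t : ℝ => e t)
        = WithLp.toLp 2 ∘ (MeasurableEquiv.funUnique (Fin 1) ℝ).symm ∘ id := by
      funext t
      refine PiLp.ext fun i => ?_
      fin_cases i
      simp [he]
    rw [h3]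
    exact h2
  have hnorm : ∀ t, ‖e t‖ = ‖t‖ := fun t => by simp [he, norm_smul]
  have hiso : Isometry e := AddMonoidHomClass.isometry_of_norm e hnorm
  have hd : ∀ t, HasDerivAt (fun t => u (e t)) (pd 0 u (e t)) t := fun t => by
    have := ((hu.differentiable one_ne_zero) (e t)).hasFDerivAt.comp_hasDerivAt t e.hasDerivAt
    have h1 : e 1 = EuclideanSpace.single 0 1 := by simp [he]
    rw [h1] at this
    exact this
  have hc : ContDiff ℝ 1 fun t => u (e t) := hu.comp e.contDiff
  have hcs : HasCompactSupport fun t => u (e t) :=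
    huc.comp_isClosedEmbedding hiso.isClosedEmbedding
  have hx : x = e (x 0) := by
    refine PiLp.ext fun i => ?_
    fin_cases i
    simp [he]
  have h1 : ‖u (e (x 0))‖ₑ ≤ _ := hcs.enorm_le_lintegral_Ici_deriv hc (x 0)
  rw [← hx] at h1
  refine h1.trans ((setLIntegral_le_lintegral _ _).trans ?_)
  calc ∫⁻ t, ‖deriv (fun t => u (e t)) t‖ₑ ≤ ∫⁻ t, ‖fderiv ℝ u (e t)‖ₑ := by
        refine lintegral_mono fun t => ?_
        rw [(hd t).deriv]
        refine enorm_le_iff_norm_le.2 ?_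
        exact abs_pd_le_norm_fderiv 0 u (e t)
    _ = ∫⁻ y, ‖fderiv ℝ u y‖ₑ :=
        hmp.lintegral_comp (hu.continuous_fderiv one_ne_zero).enorm.measurable

/-- A Sobolev inequality, with an exponent large enough for the powers of the density which are
controlled by the dissipation. -/
lemma exists_sobolev (hd : d ≠ 0) (r : ℝ) : ∃ q : ℝ, 1 < q ∧
    1 < (1 - 1 / ((d : ℝ) + 1) / 2) * q ∧ ∃ C : ENNReal, C ≠ ⊤ ∧
    ∀ u : Rd d → ℝ, ContDiff ℝ 1 u → HasCompactSupport u → tsupport u ⊆ Metric.ball 0 r →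
      ∫⁻ x, ‖u x‖ₑ ^ q ≤ C * (∫⁻ x, ‖fderiv ℝ u x‖ₑ) ^ q := by
  by_cases h1 : d = 1
  · subst h1
    refine ⟨2, by norm_num, by norm_num, volume (Metric.ball (0 : Rd 1) r),
      measure_ball_lt_top.ne, fun u hu huc hus => ?_⟩
    calc ∫⁻ x, ‖u x‖ₑ ^ (2 : ℝ) = ∫⁻ x in Metric.ball (0 : Rd 1) r, ‖u x‖ₑ ^ (2 : ℝ) := by
          rw [setLIntegral_eq_of_support_subset]
          intro x hx
          by_contra h
          exact hx (by simp [eq_zero_of_notMem_tsupport fun h' => h (hus h')])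
      _ ≤ ∫⁻ _ in Metric.ball (0 : Rd 1) r, (∫⁻ y, ‖fderiv ℝ u y‖ₑ) ^ (2 : ℝ) :=
          lintegral_mono fun x =>
            ENNReal.rpow_le_rpow (enorm_le_lintegral_enorm_fderiv_of_one hu huc x) (by norm_num)
      _ = _ := by rw [setLIntegral_const, mul_comm]
  · have hd2 : (2 : ℝ) ≤ d := by exact_mod_cast (by omega : 2 ≤ d)
    have hq : Real.HolderConjugate (Module.finrank ℝ (Rd d)) ((d : ℝ) / (d - 1)) := by
      rw [finrank_euclideanSpace_fin]
      exact Real.HolderConjugate.conjExponent (by linarith)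
    refine ⟨(d : ℝ) / (d - 1), ?_, ?_, _, ?_, fun u hu huc _ =>
      lintegral_pow_le_pow_lintegral_fderiv volume hu huc hq⟩
    · rw [lt_div_iff₀ (by linarith)]
      linarith
    · rw [← mul_div_assoc, lt_div_iff₀ (by linarith)]
      have : 1 / ((d : ℝ) + 1) / 2 * d < 1 := by
        rw [div_div, div_mul_eq_mul_div, div_lt_one (by linarith)]
        linarith
      nlinarith
    · exact ENNReal.coe_ne_top

variable {ρ : Measure (Rd d)} [IsFiniteMeasure ρ] {b : Fin d → Rd d → ℝ} {c : Rd d → ℝ}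
  {r ε s P : ℝ} {ψ : Rd d → ℝ}

/-- The power of the density to which the Sobolev inequality is applied. -/
def densPower (ρ : Measure (Rd d)) (ψ : Rd d → ℝ) (s ε : ℝ) (x : Rd d) : ℝ :=
  (1 + mollDens ρ ε x) ^ (1 - s / 2) * ψ x

lemma densPower_contDiff (hψ : IsTest ψ) (hε : 0 < ε) : ContDiff ℝ 1 (densPower ρ ψ s ε) :=
  ((contDiff_const.add (mollDens_contDiff hε)).rpow_const_of_ne fun x => by
    have := mollDens_nonneg (ρ := ρ) ε x
    positivity).mul hψ.contDiff_one

lemma pd_densPower (hψ : IsTest ψ) (hε : 0 < ε) (i : Fin d) (x : Rd d) :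
    pd i (densPower ρ ψ s ε) x = (1 - s / 2) * (1 + mollDens ρ ε x) ^ (-s / 2)
      * pd i (mollDens ρ ε) x * ψ x + (1 + mollDens ρ ε x) ^ (1 - s / 2) * pd i ψ x := by
  have h0 : 0 < 1 + mollDens ρ ε x := by linarith [mollDens_nonneg (ρ := ρ) ε x]
  have hR : HasFDerivAt (fun y => 1 + mollDens ρ ε y) (fderiv ℝ (mollDens ρ ε) x) x :=
    (((mollDens_contDiff hε).differentiable one_ne_zero) x).hasFDerivAt.const_add 1
  have h1 := hR.rpow_const (p := 1 - s / 2) (Or.inl h0.ne')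
  have h2 := h1.mul ((hψ.contDiff_one.differentiable one_ne_zero) x).hasFDerivAt
  rw [pd_eq_of_hasFDerivAt (f := densPower ρ ψ s ε) i h2, show 1 - s / 2 - 1 = -s / 2 by ring]
  simp [pd]
  ring

lemma abs_pd_densPower_le (hψ : IsTest ψ) (hε : 0 < ε) (hs : 0 ≤ s) (hs1 : s ≤ 1)
    (hP : ∀ i x, |pd i ψ x| ≤ P) (i : Fin d) (x : Rd d) :
    |pd i (densPower ρ ψ s ε) x| ≤ (1 / 2 + P) * (1 + mollDens ρ ε x)
      + ψ x ^ 2 * (1 + mollDens ρ ε x) ^ (-s - 1) * pd i (mollDens ρ ε) x ^ 2 := by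
  have h0 : 0 ≤ mollDens ρ ε x := mollDens_nonneg ε x
  set M := 1 + mollDens ρ ε x with hM
  have hM1 : 1 ≤ M := by linarith
  have hM0 : 0 < M := by linarith
  set q := pd i (mollDens ρ ε) x
  rw [pd_densPower hψ hε]
  have e1 : M ^ (1 - s / 2) ≤ M := by
    conv_rhs => rw [← Real.rpow_one M]
    exact Real.rpow_le_rpow_of_exponent_le hM1 (by linarith)
  have e2 : 0 ≤ M ^ (1 - s / 2) := by positivity
  have e3 : M * M ^ (-s - 1) = (M ^ (-s / 2)) ^ 2 := by
    rw [← Real.rpow_natCast, ← Real.rpow_mul hM0.le]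
    conv_lhs => rw [← Real.rpow_one M, ← Real.rpow_mul hM0.le, ← Real.rpow_add hM0]
    congr 1
    push_cast
    ring
  set w := M ^ (-s / 2)
  have hw : 0 ≤ w := by positivity
  set v := M ^ (-s - 1)
  have hv : 0 ≤ v := by positivity
  have e4 : |w * q * ψ x| ≤ 1 / 2 * M + ψ x ^ 2 * v * q ^ 2 := by
    have hn : 0 ≤ 1 / 2 * M + ψ x ^ 2 * v * q ^ 2 := by positivity
    refine abs_le_of_sq_le_sq ?_ hn
    have hsq : (w * q * ψ x) ^ 2 = M * (ψ x ^ 2 * v * q ^ 2) := by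
      rw [mul_pow, mul_pow, ← e3]
      ring
    rw [hsq]
    nlinarith [sq_nonneg (1 / 2 * M - ψ x ^ 2 * v * q ^ 2)]
  calc |(1 - s / 2) * w * q * ψ x + M ^ (1 - s / 2) * pd i ψ x|
      ≤ (1 - s / 2) * |w * q * ψ x| + M ^ (1 - s / 2) * |pd i ψ x| := by
        refine (abs_add_le _ _).trans (le_of_eq ?_)
        rw [show (1 - s / 2) * w * q * ψ x = (1 - s / 2) * (w * q * ψ x) by ring, abs_mul,
          abs_mul (M ^ (1 - s / 2)), abs_of_nonneg (by linarith : (0 : ℝ) ≤ 1 - s / 2),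
          abs_of_nonneg e2]
    _ ≤ 1 * |w * q * ψ x| + M * P := by
        gcongr
        · linarith
        · exact hP i x
    _ ≤ _ := by linarith

lemma lintegral_fderiv_densPower_le (hψ : IsTest ψ) (hψs : tsupport ψ ⊆ Metric.ball 0 r)
    (hε : 0 < ε) (hs : 0 ≤ s) (hs1 : s ≤ 1) (hP0 : 0 ≤ P) (hP : ∀ i x, |pd i ψ x| ≤ P)
    (hR : IntLE volume (mollDens ρ ε) 1) :
    ∫⁻ x, ‖fderiv ℝ (densPower ρ ψ s ε) x‖ₑ
      ≤ ENNReal.ofReal (d * ((1 / 2 + P) * (volume.real (Metric.ball (0 : Rd d) r) + 1))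
        + mollDissip ρ ψ s ε) := by
  set B := Metric.ball (0 : Rd d) r
  set f1 : Rd d → ℝ := B.indicator fun x => (1 / 2 + P) * (1 + mollDens ρ ε x) with hf1
  set f2 : Rd d → ℝ := fun x =>
    ψ x ^ 2 * (1 + mollDens ρ ε x) ^ (-s - 1) * ∑ i, pd i (mollDens ρ ε) x ^ 2 with hf2
  have hRB : IntegrableOn (fun x => (1 / 2 + P) * (1 + mollDens ρ ε x)) B :=
    ((integrableOn_const measure_ball_lt_top.ne).add hR.1.integrableOn).const_mul _
  have hi1 : Integrable f1 := hRB.integrable_indicator measurableSet_ball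
  have hR0 := mollDens_nonneg (ρ := ρ) ε
  have hRc := mollDens_contDiff (ρ := ρ) hε
  have hi2 : Integrable f2 := by
    refine Continuous.integrable_of_hasCompactSupport ?_ ?_
    · refine ((hψ.continuous.pow 2).mul ((continuous_const.add hRc.continuous).rpow_const
        fun x => Or.inl ?_)).mul (continuous_finsetSum _ fun i _ => (hRc.pd_continuous i).pow 2)
      have := hR0 x
      simp only [Pi.add_apply]
      positivity
    · refine hψ.2.mono' fun x hx => ?_
      by_contra h
      exact hx (by simp [hf2, eq_zero_of_notMem_tsupport h])
  have hle : ∀ x, ‖fderiv ℝ (densPower ρ ψ s ε) x‖ ≤ d * f1 x + f2 x := fun x => by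
    refine (norm_fderiv_le_sum_pd _ _).trans ?_
    by_cases hx : x ∈ B
    · refine (Finset.sum_le_sum fun i _ => abs_pd_densPower_le hψ hε hs hs1 hP i x).trans
        (le_of_eq ?_)
      rw [Finset.sum_add_distrib, hf1, indicator_of_mem hx, hf2, Finset.sum_const, Finset.card_univ, Fintype.card_fin, nsmul_eq_mul,
        ← Finset.mul_sum]
    · have hx' : x ∉ tsupport ψ := fun h => hx (hψs h)
      have : ∀ i, pd i (densPower ρ ψ s ε) x = 0 := fun i => by
        rw [pd_densPower hψ hε, eq_zero_of_notMem_tsupport hx', pd_eq_zero_of_notMem_tsupport hx' i]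
        simp
      simp only [this, abs_zero, Finset.sum_const_zero]
      rw [hf1, indicator_of_notMem hx, hf2]
      simp [eq_zero_of_notMem_tsupport hx']
  calc ∫⁻ x, ‖fderiv ℝ (densPower ρ ψ s ε) x‖ₑ
      ≤ ∫⁻ x, ENNReal.ofReal (d * f1 x + f2 x) := lintegral_mono fun x => by
        rw [← ofReal_norm]
        exact ENNReal.ofReal_le_ofReal (hle x)
    _ = ENNReal.ofReal (∫ x, (d * f1 x + f2 x)) := by
        exact (ofReal_integral_eq_lintegral_ofReal ((hi1.const_mul _).add hi2)
          (ae_of_all _ fun x => (norm_nonneg _).trans (hle x))).symm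
    _ ≤ _ := by
        refine ENNReal.ofReal_le_ofReal ?_
        rw [integral_add (hi1.const_mul _) hi2, integral_const_mul]
        have h1 : ∫ x, f1 x ≤ (1 / 2 + P) * (volume.real B + 1) := by
          have : IsFiniteMeasure (volume.restrict B) := ⟨by simp [B, measure_ball_lt_top]⟩
          rw [hf1, integral_indicator measurableSet_ball, integral_const_mul, integral_add
            (integrable_const 1) hR.1.integrableOn]
          refine mul_le_mul_of_nonneg_left ?_ (by positivity)
          refine add_le_add (by simp [B]) (le_trans ?_ hR.2)
          exact setIntegral_le_integral hR.1 (ae_of_all _ hR0)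
        have h2 : ∫ x, f2 x = mollDissip ρ ψ s ε := rfl
        rw [h2]
        gcongr

omit [IsFiniteMeasure ρ] in
lemma measure_le_lintegral_mollDens [IsFiniteMeasure ρ] {K U : Set (Rd d)} (hK : IsCompact K)
    (hU : IsOpen U) (hKU : K ⊆ U) :
    ∃ e > 0, ∀ ε, 0 < ε → ε < e → ρ K ≤ ∫⁻ x in U, ENNReal.ofReal (mollDens ρ ε x) := by
  obtain ⟨e, he, heU⟩ := hK.exists_thickening_subset_open hU hKU
  refine ⟨e, he, fun ε hε hεe => ?_⟩
  have hm := isTest_moll (d := d) hε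
  set w : Rd d → ℝ := K.indicator fun _ => 1 with hw
  have hwi : Integrable w ρ := (integrable_const 1).indicator hK.measurableSet
  have hnn : ∀ x, 0 ≤ cv ρ w (moll ε) x := fun x =>
    integral_nonneg fun y => mul_nonneg (indicator_nonneg (fun _ _ => zero_le_one) y)
      (mollPow_nonneg ε 4 _)
  have hint : ∫ x, cv ρ w (moll ε) x = ρ.real K := by
    rw [integral_cv hwi hm.continuous hm.2, integral_moll ε hε, hw,
      integral_indicator hK.measurableSet]
    simp
  calc ρ K = ENNReal.ofReal (∫ x, cv ρ w (moll ε) x) := by rw [hint, ofReal_measureReal]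
    _ = ∫⁻ x, ENNReal.ofReal (cv ρ w (moll ε) x) := by
        rw [ofReal_integral_eq_lintegral_ofReal (integrable_cv hwi hm.continuous hm.2)
          (ae_of_all _ hnn)]
    _ = ∫⁻ x in U, ENNReal.ofReal (cv ρ w (moll ε) x) := by
        rw [setLIntegral_eq_of_support_subset]
        intro x hx
        by_contra hxU
        refine hx ?_
        have : cv ρ w (moll ε) x = 0 := by
          refine integral_eq_zero_of_ae (ae_of_all _ fun y => ?_)
          by_cases hy : y ∈ K
          · have : e ≤ ‖x - y‖ := by
              by_contra hlt
              refine hxU (heU (Metric.mem_thickening_iff.2 ⟨y, hy, ?_⟩))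
              rw [dist_eq_norm]
              exact not_le.1 hlt
            simp [mollPow_eq_zero hε (k := 4) (by norm_num) (hεe.le.trans this)]
          · simp [hw, hy]
        simp [this]
    _ ≤ _ := lintegral_mono fun x => ENNReal.ofReal_le_ofReal <|
        cv_mono hwi (integrable_const 1) hm.continuous hm.2 hm.continuous hm.2 x fun y =>
          mul_le_mul_of_nonneg_right (indicator_le_self' (fun _ _ => zero_le_one) y)
            (mollPow_nonneg ε 4 _)

lemma le_add_rpow_mul {A k x : ℝ} (hA : 0 < A) (hk : 1 < k) (hx : 0 ≤ x) :
    x ≤ A + A ^ (1 - k) * (1 + x) ^ k := by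
  have h1 : 0 < 1 + x := by linarith
  rcases le_total (1 + x) A with h | h
  · have : 0 ≤ A ^ (1 - k) * (1 + x) ^ k := by positivity
    linarith
  · have e1 : (1 + x) ^ (1 - k) * (1 + x) ^ k = 1 + x := by
      rw [← Real.rpow_add h1]
      simp
    have e2 : (1 + x) ^ (1 - k) ≤ A ^ (1 - k) :=
      Real.rpow_le_rpow_of_nonpos hA h (by linarith)
    have := mul_le_mul_of_nonneg_right e2 (by positivity : 0 ≤ (1 + x) ^ k)
    linarith

/-- Uniform integrability of the mollified densities implies absolute continuity. -/
lemma absolutelyContinuous_of_frequently {V : Set (Rd d)} (hV : IsOpen V) {k : ℝ} (hk : 1 < k)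
    {B : ENNReal} (hB : B ≠ ⊤) {e : ℕ → ℝ} (he0 : ∀ n, 0 < e n)
    (he : Filter.Tendsto e Filter.atTop (nhds 0))
    (h : ∃ᶠ n in Filter.atTop, ∫⁻ x in V, ENNReal.ofReal ((1 + mollDens ρ (e n) x) ^ k) ≤ B) :
    ρ.restrict V ≪ volume := by
  have hopen : ∀ (K U : Set (Rd d)), IsCompact K → IsOpen U → K ⊆ U → U ⊆ V → ∀ A : ℝ, 0 < A →
      ρ K ≤ ENNReal.ofReal A * volume U + ENNReal.ofReal (A ^ (1 - k)) * B := by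
    intro K U hK hU hKU hUV A hA
    obtain ⟨δ, hδ, hδK⟩ := measure_le_lintegral_mollDens (ρ := ρ) hK hU hKU
    obtain ⟨n, hn, hnδ⟩ := (h.and_eventually (he.eventually_lt_const hδ)).exists
    calc ρ K ≤ ∫⁻ x in U, ENNReal.ofReal (mollDens ρ (e n) x) := hδK _ (he0 n) hnδ
      _ ≤ ∫⁻ x in U, (ENNReal.ofReal A + ENNReal.ofReal (A ^ (1 - k))
            * ENNReal.ofReal ((1 + mollDens ρ (e n) x) ^ k)) := by
          refine lintegral_mono fun x => ?_
          have hx := mollDens_nonneg (ρ := ρ) (e n) x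
          rw [← ENNReal.ofReal_mul (by positivity), ← ENNReal.ofReal_add hA.le (by positivity)]
          exact ENNReal.ofReal_le_ofReal (le_add_rpow_mul hA hk hx)
      _ = ENNReal.ofReal A * volume U + ENNReal.ofReal (A ^ (1 - k))
            * ∫⁻ x in U, ENNReal.ofReal ((1 + mollDens ρ (e n) x) ^ k) := by
          rw [lintegral_add_left measurable_const, setLIntegral_const,
            lintegral_const_mul' _ _ ENNReal.ofReal_ne_top]
      _ ≤ _ := by
          gcongr
          exact (lintegral_mono_set hUV).trans hn
  have hnull : ∀ K : Set (Rd d), IsCompact K → K ⊆ V → volume K = 0 → ρ K = 0 := by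
    intro K hK hKV hK0
    have h1 : ∀ A : ℝ, 0 < A → ρ K ≤ ENNReal.ofReal (A ^ (1 - k)) * B := fun A hA => by
      refine ENNReal.le_of_forall_pos_le_add fun η hη _ => ?_
      obtain ⟨U, hKU, hU, hUη⟩ := K.exists_isOpen_lt_of_lt (μ := volume)
        ((η : ENNReal) / ENNReal.ofReal A) (by
          rw [hK0]
          exact ENNReal.div_pos (by simpa using hη.ne') ENNReal.ofReal_ne_top)
      refine (hopen K (U ∩ V) hK (hU.inter hV) (subset_inter hKU hKV) inter_subset_right A hA).trans
        ?_
      rw [add_comm]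
      gcongr
      calc ENNReal.ofReal A * volume (U ∩ V) ≤ ENNReal.ofReal A * (η / ENNReal.ofReal A) := by
            gcongr
            exact (measure_mono inter_subset_left).trans hUη.le
        _ ≤ η := ENNReal.mul_div_le
    have h2 : Filter.Tendsto (fun A : ℝ => ENNReal.ofReal (A ^ (1 - k)) * B) Filter.atTop
        (nhds 0) := by
      have := ENNReal.tendsto_ofReal (tendsto_rpow_neg_atTop (by linarith : 0 < k - 1))
      have := ENNReal.Tendsto.mul_const (b := B) this (Or.inr hB)
      simpa using this
    refine le_antisymm (ge_of_tendsto h2 ?_) zero_le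
    filter_upwards [Filter.eventually_gt_atTop 0] with A hA using h1 A hA
  refine Measure.AbsolutelyContinuous.mk fun N hN hN0 => ?_
  rw [Measure.restrict_apply hN, (hN.inter hV.measurableSet).measure_eq_iSup_isCompact]
  simp only [ENNReal.iSup_eq_zero]
  intro K hKN hK
  exact hnull K hK (hKN.trans inter_subset_right)
    (measure_mono_null (hKN.trans inter_subset_left) hN0)

lemma absolutelyContinuous_of_dim_zero (m : Measure (Rd 0)) : m ≪ volume := by
  refine Measure.AbsolutelyContinuous.mk fun N hN hN0 => ?_
  rcases N.eq_empty_or_nonempty with rfl | ⟨x, hx⟩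
  · simp
  · exfalso
    have hN1 : N = univ := by
      ext y
      simp [Subsingleton.elim y x, hx]
    rw [hN1] at hN0
    exact NeZero.ne _ (Measure.measure_univ_eq_zero.1 hN0)

/-- A bound on the dissipation along a sequence of mollification scales implies absolute
continuity of the measure. -/
lemma absolutelyContinuous_of_mollDissip (h : FrozenMeas ρ b c) (hψ : IsTest ψ)
    (hψs : tsupport ψ ⊆ Metric.ball 0 r) {V : Set (Rd d)} (hV : IsOpen V) (hψV : ∀ x ∈ V, ψ x = 1)
    {e : ℕ → ℝ} (he0 : ∀ n, 0 < e n) (he : Filter.Tendsto e Filter.atTop (nhds 0))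
    (hB : ∃ B, ∃ᶠ n in Filter.atTop, mollDissip ρ ψ (1 / ((d : ℝ) + 1)) (e n) ≤ B) :
    ρ.restrict V ≪ volume := by
  obtain ⟨B, hB⟩ := hB
  rcases eq_or_ne d 0 with rfl | hd
  · exact absolutelyContinuous_of_dim_zero _
  obtain ⟨q, hq, hq1, C, hC, hS⟩ := exists_sobolev hd r
  set s : ℝ := 1 / ((d : ℝ) + 1) with hs
  have hs0 : 0 ≤ s := by positivity
  have hs1 : s ≤ 1 := by
    rw [hs, div_le_one (by positivity)]
    linarith [(Nat.cast_nonneg d : (0 : ℝ) ≤ d)]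
  obtain ⟨P, hP0, hP⟩ : ∃ P : ℝ, 0 ≤ P ∧ ∀ i x, |pd i ψ x| ≤ P := by
    obtain ⟨P, hP⟩ := (hψ.contDiff_one.continuous_fderiv one_ne_zero).bounded_above_of_compact_support
      (hψ.2.fderiv ℝ)
    exact ⟨P, (norm_nonneg _).trans (hP 0), fun i x => (abs_pd_le_norm_fderiv i ψ x).trans (hP x)⟩
  refine absolutelyContinuous_of_frequently hV hq1 (B := C * (ENNReal.ofReal
    (d * ((1 / 2 + P) * (volume.real (Metric.ball (0 : Rd d) r) + 1)) + B)) ^ q)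
    (ENNReal.mul_ne_top hC (ENNReal.rpow_ne_top_of_nonneg (by linarith) ENNReal.ofReal_ne_top))
    he0 he (hB.mono fun n hn => ?_)
  have hts : tsupport (densPower ρ ψ s (e n)) ⊆ tsupport ψ := tsupport_mul_subset_right
  calc ∫⁻ x in V, ENNReal.ofReal ((1 + mollDens ρ (e n) x) ^ ((1 - s / 2) * q))
      = ∫⁻ x in V, ‖densPower ρ ψ s (e n) x‖ₑ ^ q := by
        refine setLIntegral_congr_fun hV.measurableSet fun x hx => ?_
        have h0 : 0 ≤ 1 + mollDens ρ (e n) x := by linarith [mollDens_nonneg (ρ := ρ) (e n) x]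
        have h1 : 0 ≤ (1 + mollDens ρ (e n) x) ^ (1 - s / 2) := by positivity
        simp only [densPower, hψV x hx, mul_one]
        rw [← ofReal_norm, Real.norm_of_nonneg h1, ENNReal.ofReal_rpow_of_nonneg h1 (by linarith),
          ← Real.rpow_mul h0]
    _ ≤ ∫⁻ x, ‖densPower ρ ψ s (e n) x‖ₑ ^ q := setLIntegral_le_lintegral _ _
    _ ≤ C * (∫⁻ x, ‖fderiv ℝ (densPower ρ ψ s (e n)) x‖ₑ) ^ q :=
        hS _ (densPower_contDiff hψ (he0 n)) (hψ.2.mono' ((subset_tsupport _).trans hts))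
          (hts.trans hψs)
    _ ≤ _ := by
        gcongr
        refine (lintegral_fderiv_densPower_le hψ hψs (he0 n) hs0 hs1 hP0 hP
          (h.intLE_mollDens (he0 n))).trans (ENNReal.ofReal_le_ofReal ?_)
        linarith

end Density

section DensityInTime

open ProbabilityTheory

variable {d : ℕ} {ρ : Measure (Rd d)} {κ : Kernel ℝ (Rd d)} {T r γ K Λ Ψ s ε o : ℝ}

lemma mollDissip_nonneg (ρ : Measure (Rd d)) (ψ : Rd d → ℝ) (s ε : ℝ) :
    0 ≤ mollDissip ρ ψ s ε := by
  refine integral_nonneg fun x => ?_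
  have := mollDens_nonneg (ρ := ρ) ε x
  exact mul_nonneg (mul_nonneg (sq_nonneg _) (by positivity))
    (Finset.sum_nonneg fun i _ => sq_nonneg _)

lemma exists_mollDissip_le (d : ℕ) {γ K Λ Ψ s : ℝ} (ψ : Rd d → ℝ) (hγ : 0 < γ) (hΨ : 0 ≤ Ψ)
    (hs : 0 < s) (hs1 : s ≤ 1) : ∃ C : ℝ, 0 ≤ C ∧ ∀ {ρ : Measure (Rd d)} {r ε o : ℝ}
    {a : Fin d → Fin d → Rd d → ℝ} {b : Fin d → Rd d → ℝ} {c : Rd d → ℝ}, FrozenMeas ρ b c →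
    FrozenCoeff r γ K Λ a → TestBounds ψ r Ψ ε o → 0 < ε → ε ≤ 1 →
    s * γ / 2 * mollDissip ρ ψ s ε
      ≤ (∫ x, ψ x ^ 2 * ((1 + mollDens ρ ε x) ^ (-s) * mollGen ρ a b c ε x))
        + C * coeffMass ρ ρ b c := by
  have hD := dissipConst_nonneg (K := K) d hγ hΨ hs
  set D := dissipConst d γ K Ψ s
  have hM := mollMass_nonneg d 2
  set J := |∫ x, testMass ψ x|
  set E := 4 * (Ψ * (commConst d Λ ^ 2 * mollMass d 2)) + 2 * gradBound d Λ ^ 2 * (Ψ * 1) with hE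
  have hE0 : 0 ≤ E := by positivity
  refine ⟨Ψ ^ 2 + D * (J + Ψ + d * E + 8 * Ψ), by positivity, ?_⟩
  intro ρ r ε o a b c h ha hψ hε hε1
  refine (mollDissip_le h ha hψ hε hε1 hs hs1).trans ?_
  rw [add_assoc]
  gcongr
  have h1 := one_le_coeffMass ρ ρ b c
  have h2 := add_le_coeffMass ρ b c
  set m := coeffMass ρ ρ b c
  have h3 : 0 ≤ ∑ i, ∫ y, b i y ^ 2 ∂ρ :=
    Finset.sum_nonneg fun i _ => integral_nonneg fun y => sq_nonneg _
  have h4 : 0 ≤ ∫ y, |c y| ∂ρ := integral_nonneg fun y => abs_nonneg _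
  have h5 : ∑ i, (4 * (Ψ * (commConst d Λ ^ 2 * mollMass d 2)) + 4 * (Ψ * (2 * ∫ y, b i y ^ 2 ∂ρ))
      + 2 * gradBound d Λ ^ 2 * (Ψ * 1)) = d * E + 8 * Ψ * ∑ i, ∫ y, b i y ^ 2 ∂ρ := by
    rw [Finset.mul_sum, hE]
    simp only [Finset.sum_add_distrib, Finset.sum_const, Finset.card_univ, Fintype.card_fin,
      nsmul_eq_mul]
    rw [mul_add, add_assoc, add_assoc, add_comm (∑ i, 4 * _)]
    congr 2
    exact Finset.sum_congr rfl fun i _ => by ring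
  rw [h5]
  have e1 : Ψ ^ 2 * (∫ y, |c y| ∂ρ) ≤ Ψ ^ 2 * m := by gcongr; linarith
  have e2 : (∫ x, testMass ψ x) + Ψ + (d * E + 8 * Ψ * ∑ i, ∫ y, b i y ^ 2 ∂ρ)
      ≤ (J + Ψ + d * E + 8 * Ψ) * m := by
    have e3 : (J + Ψ + d * E) * 1 ≤ (J + Ψ + d * E) * m := by gcongr
    have e4 : 8 * Ψ * ∑ i, ∫ y, b i y ^ 2 ∂ρ ≤ 8 * Ψ * m := by gcongr; linarith
    have e5 := le_abs_self (∫ x, testMass ψ x)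
    linarith
  have := mul_le_mul_of_nonneg_left e2 hD
  linarith

/-- Solutions in a ball have densities in the interior of the ball at almost every time. -/
theorem LocalSol.ae_absolutelyContinuous {a : Fin d → Fin d → ℝ × Rd d → ℝ}
    {b : Fin d → ℝ × Rd d → ℝ} {c : ℝ × Rd d → ℝ} {ν : Measure (Rd d)} [IsFiniteMeasure ν]
    {ψ : Rd d → ℝ} (h : LocalSol T r γ K Λ κ a b c ν) (hT : 0 < T) (hψ : IsTest ψ)
    (hψ0 : ∀ x, 0 ≤ ψ x) (hψs : tsupport ψ ⊆ Metric.ball 0 r) {V : Set (Rd d)} (hV : IsOpen V)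
    (hψV : ∀ x ∈ V, ψ x = 1) :
    ∀ᵐ s ∂(volume.restrict (Icc 0 T)), (κ s).restrict V ≪ volume := by
  rcases eq_or_ne d 0 with rfl | hd
  · exact ae_of_all _ fun s => absolutelyContinuous_of_dim_zero _
  have := h.isFiniteKernel
  have hγ : 0 < γ := (h.coeff 0 ⟨le_rfl, hT.le⟩).ell_pos
  obtain ⟨Ψ, hΨ⟩ := exists_testBounds hψ hψ0 hψs
  have hΨ0 : 0 ≤ Ψ := (abs_nonneg _).trans ((hΨ 1).abs_le 0)
  set σ : ℝ := 1 / ((d : ℝ) + 1) with hσ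
  have hd1 : (1 : ℝ) ≤ d := by exact_mod_cast Nat.one_le_iff_ne_zero.2 hd
  have hσ0 : 0 < σ := by positivity
  have hσ1 : σ < 1 := by
    rw [hσ, div_lt_one (by positivity)]
    linarith
  obtain ⟨C, hC, hCb⟩ := exists_mollDissip_le d (K := K) (Λ := Λ) ψ hγ hΨ0 hσ0 hσ1.le
  set e : ℕ → ℝ := fun n => 1 / ((n : ℝ) + 1) with he
  have he0 : ∀ n, 0 < e n := fun n => by positivity
  have he1 : ∀ n, e n ≤ 1 := fun n => by
    rw [he, div_le_one (by positivity)]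
    linarith [(Nat.cast_nonneg n : (0 : ℝ) ≤ n)]
  set g : ℕ → ℝ → ℝ := fun n s => ∫ x, ψ x ^ 2 * ((1 + mollDens (κ s) (e n) x) ^ (-σ)
    * mollGen (κ s) (fun i j => timeSlice (a i j) s) (fun i => timeSlice (b i) s)
      (timeSlice c s) (e n) x) with hg
  set m : ℝ → ℝ := fun s => coeffMass (κ s) (κ s) (fun i => timeSlice (b i) s) (timeSlice c s)
    with hm
  have hψ2 : HasCompactSupport fun x => ψ x ^ 2 :=
    hψ.2.mono' fun x hx => by
      by_contra hx'
      exact hx (by simp [eq_zero_of_notMem_tsupport hx'])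
  have hψ2s : tsupport (fun x => ψ x ^ 2) ⊆ Metric.ball 0 r :=
    (closure_minimal (fun x hx => by
      by_contra hx'
      exact hx (by simp [eq_zero_of_notMem_tsupport hx'])) (isClosed_tsupport ψ)).trans hψs
  have hev := fun n => h.evolution h hT (energyFun_power hσ0 hσ1) (ψ := fun x => ψ x ^ 2)
    (hψ.continuous.pow 2) hψ2 hψ2s (he0 n) (he1 n)
  simp only [zero_mul, add_zero] at hev
  have hle : ∀ n, ∀ᵐ s ∂(volume.restrict (Icc 0 T)),
      σ * γ / 2 * mollDissip (κ s) ψ σ (e n) ≤ g n s + C * m s := fun n => by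
    filter_upwards [h.frozen, ae_restrict_mem measurableSet_Icc] with s hs hsT
    exact hCb hs (h.coeff s hsT) (hΨ (e n)) (he0 n) (he1 n)
  have hfat := ae_exists_frequently_le_of_integral_le hT (f := fun n s => g n s + C * m s)
    (C := (Ψ ^ 2 * (volume.real (Metric.ball (0 : Rd d) r) + 1)) / (1 - σ) + C * ∫ s in Icc 0 T, m s)
    (fun n => (hev n).1.add (h.integrable.const_mul C))
    (fun n => (hle n).mono fun s hs => (mul_nonneg (by positivity) (mollDissip_nonneg _ _ _ _)).trans
      hs) ?_
  · filter_upwards [hfat, h.frozen, ae_all_iff.2 hle] with s hs hfr hles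
    obtain ⟨B, hB⟩ := hs
    refine absolutelyContinuous_of_mollDissip hfr hψ hψs hV hψV he0
      tendsto_one_div_add_atTop_nhds_zero_nat ⟨B / (σ * γ / 2), hB.mono fun n hn => ?_⟩
    rw [le_div_iff₀ (by positivity), mul_comm]
    exact (hles n).trans hn
  · intro n
    filter_upwards [(hev n).2, h.frozen, ae_restrict_mem measurableSet_Icc] with t ht hfr htT
    have hsub : Ioc 0 t ⊆ Icc 0 T := fun x hx => ⟨hx.1.le, hx.2.trans htT.2⟩
    have hgi : IntervalIntegrable (g n) volume 0 t :=
      (intervalIntegrable_iff_integrableOn_Ioc_of_le htT.1).2 ((hev n).1.mono_set hsub)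
    have hmi : IntervalIntegrable (fun s => C * m s) volume 0 t :=
      (intervalIntegrable_iff_integrableOn_Ioc_of_le htT.1).2
        (IntegrableOn.mono_set (h.integrable.const_mul C) hsub)
    rw [intervalIntegral.integral_add hgi hmi, intervalIntegral.integral_const_mul]
    have h1 : ∫ s in (0 : ℝ)..t, m s ≤ ∫ s in Icc 0 T, m s := by
      rw [intervalIntegral.integral_of_le htT.1]
      exact setIntegral_mono_set h.integrable (ae_of_all _ fun s =>
        zero_le_one.trans (one_le_coeffMass _ _ _ _)) hsub.eventuallyLE
    have h2 : 0 ≤ ∫ x, ψ x ^ 2 * ((1 + mollDens ν (e n) x) ^ (1 - σ) / (1 - σ)) := by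
      refine integral_nonneg fun x => ?_
      have := mollDens_nonneg (ρ := ν) (e n) x
      have : 0 < 1 - σ := by linarith
      positivity
    have h3 : ∫ x, ψ x ^ 2 * ((1 + mollDens (κ t) (e n) x) ^ (1 - σ) / (1 - σ))
        ≤ (Ψ ^ 2 * (volume.real (Metric.ball (0 : Rd d) r) + 1)) / (1 - σ) := by
      have hR := hfr.intLE_mollDens (he0 n)
      have hfin : IsFiniteMeasure (volume.restrict (Metric.ball (0 : Rd d) r)) :=
        ⟨by simp [measure_ball_lt_top]⟩
      have hRi : IntegrableOn (fun x => Ψ ^ 2 * (1 + mollDens (κ t) (e n) x) / (1 - σ))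
          (Metric.ball (0 : Rd d) r) :=
        (((integrable_const 1).add hR.1.integrableOn).const_mul _).div_const _
      calc _ ≤ ∫ x in Metric.ball (0 : Rd d) r,
            Ψ ^ 2 * (1 + mollDens (κ t) (e n) x) / (1 - σ) := by
            rw [← integral_indicator measurableSet_ball]
            refine integral_mono_of_nonneg (ae_of_all _ fun x => ?_)
              (hRi.integrable_indicator measurableSet_ball) (ae_of_all _ fun x => ?_)
            · have := mollDens_nonneg (ρ := κ t) (e n) x
              have : 0 < 1 - σ := by linarith
              simp only [Pi.zero_apply]
              positivity
            · by_cases hx : x ∈ Metric.ball (0 : Rd d) r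
              · simp only [indicator_of_mem hx]
                have h0 := mollDens_nonneg (ρ := κ t) (e n) x
                have h1 : 0 < 1 - σ := by linarith
                rw [← mul_div_assoc]
                gcongr
                · exact hψ0 x
                · exact (le_abs_self _).trans ((hΨ 1).abs_le x)
                · conv_rhs => rw [← Real.rpow_one (1 + mollDens (κ t) (e n) x)]
                  exact Real.rpow_le_rpow_of_exponent_le (by linarith) (by linarith)
              · simp only [indicator_of_notMem hx]
                rw [eq_zero_of_notMem_tsupport fun h' => hx (hψs h')]
                simp
        _ = Ψ ^ 2 * (volume.real (Metric.ball (0 : Rd d) r)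
              + ∫ x in Metric.ball (0 : Rd d) r, mollDens (κ t) (e n) x) / (1 - σ) := by
            rw [integral_div, integral_const_mul, integral_add (integrable_const 1)
              hR.1.integrableOn]
            simp
        _ ≤ _ := by
            have : 0 < 1 - σ := by linarith
            gcongr
            exact (setIntegral_le_integral hR.1 (ae_of_all _ (mollDens_nonneg (e n)))).trans hR.2
    have h4 := mul_le_mul_of_nonneg_left h1 hC
    have h5 : ∫ s in (0 : ℝ)..t, g n s = _ := (sub_eq_of_eq_add' ht).symm
    rw [h5]
    linarith

end DensityInTime

section MainInequality

open ProbabilityTheory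

variable {d : ℕ} {ρ ρ1 ρ2 : Measure (Rd d)} {κ κ1 κ2 : Kernel ℝ (Rd d)} {T r γ K Λ Ψ ε o : ℝ}

lemma tendsto_integral_mul_mollDens [IsFiniteMeasure ρ] {f : Rd d → ℝ} (hf : Continuous f)
    (hfc : HasCompactSupport f) {e : ℕ → ℝ} (he0 : ∀ n, 0 < e n)
    (he : Filter.Tendsto e Filter.atTop (nhds 0)) :
    Filter.Tendsto (fun n => ∫ x, f x * mollDens ρ (e n) x) Filter.atTop (nhds (∫ y, f y ∂ρ)) := by
  have he' : Filter.Tendsto e Filter.atTop (nhdsWithin 0 (Ioi 0)) :=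
    tendsto_nhdsWithin_iff.2 ⟨he, Filter.Eventually.of_forall he0⟩
  obtain ⟨C, hC⟩ := hf.bounded_above_of_compact_support hfc
  rw [Metric.tendsto_nhds]
  intro τ hτ
  have hM : 0 ≤ ρ.real univ := measureReal_nonneg
  filter_upwards [he'.eventually (eventually_osc_le hf hfc
    (τ := τ / (2 * (ρ.real univ + 1))) (by positivity))] with n hn
  have h := abs_integral_mul_cv_sub_le (he0 n) (integrable_const (μ := ρ) (1 : ℝ)) hf hC hn
  simp only [one_mul, abs_one, integral_const, smul_eq_mul, mul_one] at h
  rw [Real.dist_eq]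
  refine h.trans_lt ?_
  rw [div_mul_eq_mul_div, div_lt_iff₀ (by positivity)]
  nlinarith

lemma sq_div_add_ge {R1 R2 δ h : ℝ} (h1 : 0 ≤ R1) (h2 : 0 ≤ R2) (hδ : 0 < δ) :
    2 * h * R1 - h ^ 2 * (R1 + R2 + δ) ≤ R1 ^ 2 / (R1 + R2 + δ) := by
  have hM : 0 < R1 + R2 + δ := by linarith
  rw [le_div_iff₀ hM]
  nlinarith [sq_nonneg (R1 - h * (R1 + R2 + δ))]

lemma sq_div_add_le {R δ : ℝ} (h : 0 ≤ R) (hδ : 0 < δ) :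
    R ^ 2 / (R + R + δ) ≤ 1 / 2 * R := by
  rw [div_le_iff₀ (by linarith)]
  nlinarith

lemma abs_frozenMain_le {a : Fin d → Fin d → Rd d → ℝ} {b : Fin d → Rd d → ℝ} {c ψ : Rd d → ℝ}
    (h1 : FrozenMeas ρ1 b c) (h2 : FrozenMeas ρ2 b c) (ha : FrozenCoeff r γ K Λ a)
    (hψ : TestBounds ψ r Ψ ε o) :
    |frozenMain ρ1 ρ2 a b c ψ| ≤ (d * (d * (K * Ψ)) + (d + 2) * Ψ) * coeffMass ρ1 ρ2 b c := by
  have hf1 := h1.isFiniteMeasure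
  have hf2 := h2.isFiniteMeasure
  have hΨ : 0 ≤ Ψ := (abs_nonneg _).trans (hψ.abs_le 0)
  have hK := ha.bdd_nonneg
  have hpd : ∀ i x, |pd i ψ x| ≤ Ψ := fun i x => by
    refine le_trans ?_ (hψ.mass_le x)
    have := Finset.single_le_sum (f := fun i => |pd i ψ x|) (fun i _ => abs_nonneg _)
      (Finset.mem_univ i)
    have := hψ.nonneg x
    unfold testMass
    linarith
  have e1 : ∀ i j, |∫ y, |a i j y| * |pd j (pd i ψ) y| ∂ρ1| ≤ K * Ψ := fun i j => by
    refine (abs_integral_le_of_abs_le (integrable_const (K * Ψ)) fun y => ?_).trans ?_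
    · rw [abs_mul, abs_abs, abs_abs]
      exact mul_le_mul (ha.bdd i j y) (hψ.hess_le i j y) (abs_nonneg _) hK
    · rw [integral_const, smul_eq_mul]
      exact mul_le_of_le_one_left (by positivity) h1.real_le
  have e2 : ∀ i, |∫ y, |b i y| * |pd i ψ y| ∂ρ1| ≤ Ψ + Ψ * ∫ y, b i y ^ 2 ∂ρ1 := fun i => by
    refine (abs_integral_le_of_abs_le (g := fun y => Ψ * (1 + b i y ^ 2))
      (((integrable_const 1).add (h1.drift_sq i)).const_mul _) fun y => ?_).trans ?_
    · rw [abs_mul, abs_abs, abs_abs, mul_comm]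
      refine mul_le_mul (hpd i y) ?_ (abs_nonneg _) hΨ
      nlinarith [sq_abs (b i y), sq_nonneg (|b i y| - 1)]
    · rw [integral_const_mul, integral_add (integrable_const 1) (h1.drift_sq i), mul_add]
      gcongr
      rw [integral_const, smul_eq_mul, mul_one]
      exact mul_le_of_le_one_right hΨ h1.real_le
  have e3 : ∀ {ρ : Measure (Rd d)}, FrozenMeas ρ b c →
      |∫ y, c y * ψ y ∂ρ| ≤ Ψ * ∫ y, |c y| ∂ρ := fun h => by
    rw [← integral_const_mul]
    refine abs_integral_le_of_abs_le (h.pot.abs.const_mul _) fun y => ?_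
    rw [abs_mul, mul_comm]
    exact mul_le_mul_of_nonneg_right (hψ.abs_le y) (abs_nonneg _)
  have s1 : |∑ i, ∑ j, ∫ y, |a i j y| * |pd j (pd i ψ) y| ∂ρ1| ≤ d * (d * (K * Ψ)) := by
    refine (Finset.abs_sum_le_sum_abs _ _).trans ((Finset.sum_le_sum fun i _ =>
      (Finset.abs_sum_le_sum_abs _ _).trans (Finset.sum_le_sum fun j _ => e1 i j)).trans ?_)
    simp
  have s2 : |∑ i, ∫ y, |b i y| * |pd i ψ y| ∂ρ1| ≤ d * Ψ + Ψ * ∑ i, ∫ y, b i y ^ 2 ∂ρ1 := by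
    refine (Finset.abs_sum_le_sum_abs _ _).trans ((Finset.sum_le_sum fun i _ => e2 i).trans ?_)
    rw [Finset.sum_add_distrib, ← Finset.mul_sum]
    simp
  have t1 := e3 h1
  have t2 := e3 h2
  have u1 : 0 ≤ ∑ i, ∫ y, b i y ^ 2 ∂ρ1 :=
    Finset.sum_nonneg fun i _ => integral_nonneg fun y => sq_nonneg _
  have u2 : 0 ≤ ∑ i, ∫ y, b i y ^ 2 ∂ρ2 :=
    Finset.sum_nonneg fun i _ => integral_nonneg fun y => sq_nonneg _
  have u3 : 0 ≤ ∫ y, |c y| ∂ρ1 := integral_nonneg fun y => abs_nonneg _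
  have u4 : 0 ≤ ∫ y, |c y| ∂ρ2 := integral_nonneg fun y => abs_nonneg _
  have hm1 := one_le_coeffMass ρ1 ρ2 b c
  have hm : coeffMass ρ1 ρ2 b c = 1 + ∑ i, ∫ y, b i y ^ 2 ∂ρ1 + ∑ i, ∫ y, b i y ^ 2 ∂ρ2
    + ∫ y, |c y| ∂ρ1 + ∫ y, |c y| ∂ρ2 := rfl
  set m := coeffMass ρ1 ρ2 b c
  unfold frozenMain
  have f1 : (d * (d * (K * Ψ)) + d * Ψ) * 1 ≤ (d * (d * (K * Ψ)) + d * Ψ) * m := by gcongr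
  have f2 : Ψ * ∑ i, ∫ y, b i y ^ 2 ∂ρ1 ≤ Ψ * m := by gcongr; linarith
  have f3 : Ψ * (∫ y, |c y| ∂ρ1) ≤ Ψ * m := by gcongr; linarith
  have f4 : Ψ * (∫ y, |c y| ∂ρ2) ≤ Ψ * m := by gcongr; linarith
  rw [abs_le] at s1 s2 t1 t2 ⊢
  constructor <;> linarith [s1.1, s1.2, s2.1, s2.2, t1.1, t1.2, t2.1, t2.2]

variable {a : Fin d → Fin d → ℝ × Rd d → ℝ} {b : Fin d → ℝ × Rd d → ℝ} {c : ℝ × Rd d → ℝ}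
  {ν : Measure (Rd d)} {ψ : Rd d → ℝ}

lemma measurable_integral_timeSlice [IsSFiniteKernel κ] {w : ℝ × Rd d → ℝ} (hw : Measurable w) :
    Measurable fun s => ∫ y, w (s, y) ∂(κ s) :=
  (hw.stronglyMeasurable.integral_kernel_prod_right' (κ := κ)).measurable

/-- The rate of the main inequality at a given time. -/
def mainRate (κ1 κ2 : Kernel ℝ (Rd d)) (a : Fin d → Fin d → ℝ × Rd d → ℝ)
    (b : Fin d → ℝ × Rd d → ℝ) (c : ℝ × Rd d → ℝ) (ψ : Rd d → ℝ) (s : ℝ) : ℝ :=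
  frozenMain (κ1 s) (κ2 s) (fun i j => timeSlice (a i j) s) (fun i => timeSlice (b i) s)
    (timeSlice c s) ψ

lemma LocalSol.measurable_mainRate (h1 : LocalSol T r γ K Λ κ1 a b c ν)
    (h2 : LocalSol T r γ K Λ κ2 a b c ν) (hψ : IsTest ψ) :
    Measurable (mainRate κ1 κ2 a b c ψ) := by
  have := h1.isFiniteKernel
  have := h2.isFiniteKernel
  have m1 := fun i j => measurable_integral_timeSlice (κ := κ1)
    (w := fun z => |a i j z| * |pd j (pd i ψ) z.2|) ((h1.coeff_meas i j).abs.mul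
      (((hψ.pd i).pd j).continuous.measurable.comp measurable_snd).abs)
  have m2 := fun i => measurable_integral_timeSlice (κ := κ1)
    (w := fun z => |b i z| * |pd i ψ z.2|) ((h1.drift_meas i).abs.mul
      ((hψ.pd i).continuous.measurable.comp measurable_snd).abs)
  have hcψ : Measurable fun z : ℝ × Rd d => c z * ψ z.2 :=
    h1.pot_meas.mul (hψ.continuous.measurable.comp measurable_snd)
  have m3 := measurable_integral_timeSlice (κ := κ1) hcψ
  have m4 := measurable_integral_timeSlice (κ := κ2) hcψ
  exact ((Finset.measurable_fun_sum _ fun i _ => Finset.measurable_fun_sum _ fun j _ => m1 i j).add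
    (Finset.measurable_fun_sum _ fun i _ => m2 i)).add ((m3.const_mul _).sub (m4.const_mul _))

lemma LocalSol.integrable_coeffMass (h1 : LocalSol T r γ K Λ κ1 a b c ν)
    (h2 : LocalSol T r γ K Λ κ2 a b c ν) : IntegrableOn (fun s =>
      coeffMass (κ1 s) (κ2 s) (fun i => timeSlice (b i) s) (timeSlice c s)) (Icc 0 T) := by
  refine ((h1.integrable.add h2.integrable).const_mul (1 / 2)).congr (ae_of_all _ fun s => ?_)
  simp only [Pi.add_apply, coeffMass]
  ring

/-- The comparison inequality for two solutions with densities. -/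
theorem LocalSol.integral_le [IsFiniteMeasure ν] (h1 : LocalSol T r γ K Λ κ1 a b c ν)
    (h2 : LocalSol T r γ K Λ κ2 a b c ν) (hT : 0 < T) (hc : ∀ z, c z ≤ 0)
    (hac1 : ∀ᵐ s ∂(volume.restrict (Icc 0 T)), κ1 s ≪ volume)
    (hac2 : ∀ᵐ s ∂(volume.restrict (Icc 0 T)), κ2 s ≪ volume)
    (hψ : IsTest ψ) (hψ0 : ∀ x, 0 ≤ ψ x) (hψs : tsupport ψ ⊆ Metric.ball 0 r) :
    IntegrableOn (mainRate κ1 κ2 a b c ψ) (Icc 0 T) ∧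
    ∀ᵐ t ∂(volume.restrict (Icc 0 T)), ∀ h : Rd d → ℝ, Continuous h →
      2 * (∫ y, ψ y * h y ∂(κ1 t)) - (∫ y, ψ y * h y ^ 2 ∂(κ1 t)) - ∫ y, ψ y * h y ^ 2 ∂(κ2 t)
        ≤ 1 / 2 * (∫ y, ψ y ∂ν) + ∫ s in (0 : ℝ)..t, mainRate κ1 κ2 a b c ψ s := by
  have hk1 := h1.isFiniteKernel
  have hk2 := h2.isFiniteKernel
  have ha0 := h1.coeff 0 ⟨le_rfl, hT.le⟩
  obtain ⟨Ψ, hΨ⟩ := exists_testBounds hψ hψ0 hψs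
  have hΨ0 : 0 ≤ Ψ := (abs_nonneg _).trans ((hΨ 1).abs_le 0)
  obtain ⟨C, hC, hCb⟩ := exists_frozenRate_le d ha0.ell_pos ha0.bdd_nonneg ha0.lip_nonneg hΨ0
    (abs_nonneg (∫ x, testMass ψ x))
  set C' := d * (d * (K * Ψ)) + (d + 2) * Ψ with hC'
  set e : ℕ → ℝ := fun n => 1 / ((n : ℝ) + 1) with he
  have he0 : ∀ n, 0 < e n := fun n => by positivity
  have he1 : ∀ n, e n ≤ 1 := fun n => by
    rw [he, div_le_one (by positivity)]
    linarith [(Nat.cast_nonneg n : (0 : ℝ) ≤ n)]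
  have het : Filter.Tendsto e Filter.atTop (nhds 0) := tendsto_one_div_add_atTop_nhds_zero_nat
  have het' : Filter.Tendsto e Filter.atTop (nhdsWithin 0 (Ioi 0)) :=
    tendsto_nhdsWithin_iff.2 ⟨het, Filter.Eventually.of_forall he0⟩
  set m : ℝ → ℝ := fun s => coeffMass (κ1 s) (κ2 s) (fun i => timeSlice (b i) s) (timeSlice c s)
    with hm
  have hmi : IntegrableOn m (Icc 0 T) := h1.integrable_coeffMass h2
  set f : ℕ → ℝ → ℝ := fun n s => frozenRate (κ1 s) (κ2 s) (fun i j => timeSlice (a i j) s)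
    (fun i => timeSlice (b i) s) (timeSlice c s) ψ (e n) (e n) with hf
  set F := mainRate κ1 κ2 a b c ψ with hF
  have hFle : ∀ᵐ s ∂(volume.restrict (Icc 0 T)), |F s| ≤ C' * m s := by
    filter_upwards [h1.frozen, h2.frozen, ae_restrict_mem measurableSet_Icc] with s f1 f2 hsT
    exact abs_frozenMain_le f1 f2 (h1.coeff s hsT) (hΨ 1)
  have hFi : IntegrableOn F (Icc 0 T) :=
    (hmi.const_mul C').mono' (h1.measurable_mainRate h2 hψ).aestronglyMeasurable hFle
  refine ⟨hFi, ?_⟩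
  have hev := fun n => h1.evolution h2 hT (energyFun_quotient (he0 n)) hψ.continuous hψ.2 hψs
    (he0 n) (he1 n)
  have hfe : ∀ n s, f n s = ∫ x, ψ x * ((2 * (mollDens (κ1 s) (e n) x
      / (mollDens (κ1 s) (e n) x + mollDens (κ2 s) (e n) x + e n))
      - (mollDens (κ1 s) (e n) x / (mollDens (κ1 s) (e n) x + mollDens (κ2 s) (e n) x + e n)) ^ 2)
        * mollGen (κ1 s) (fun i j => timeSlice (a i j) s) (fun i => timeSlice (b i) s)
          (timeSlice c s) (e n) x
      + -(mollDens (κ1 s) (e n) x / (mollDens (κ1 s) (e n) x + mollDens (κ2 s) (e n) x + e n)) ^ 2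
        * mollGen (κ2 s) (fun i j => timeSlice (a i j) s) (fun i => timeSlice (b i) s)
          (timeSlice c s) (e n) x) := fun n s =>
    integral_congr_ae (ae_of_all _ fun x => by ring)
  simp only [← hfe] at hev
  set g : ℕ → ℝ → ℝ := fun n s => max (f n s) (F s) with hg
  have hfb : ∀ n, ∀ᵐ s ∂(volume.restrict (Icc 0 T)), f n s ≤ C * m s := fun n => by
    filter_upwards [h1.frozen, h2.frozen, ae_restrict_mem measurableSet_Icc] with s f1 f2 hsT
    exact hCb f1 f2 (h1.coeff s hsT) (hΨ (e n)) (le_abs_self _) (he0 n) (he1 n) (he0 n) (he1 n)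
  have hgb : ∀ n, ∀ᵐ s ∂(volume.restrict (Icc 0 T)), ‖g n s‖ ≤ |F s| + C * m s := fun n => by
    filter_upwards [hfb n] with s hs
    have hms : 0 ≤ C * m s := mul_nonneg hC (zero_le_one.trans (one_le_coeffMass _ _ _ _))
    rw [Real.norm_eq_abs, abs_le]
    refine ⟨?_, max_le ?_ ?_⟩
    · have := le_max_right (f n s) (F s)
      have := neg_abs_le (F s)
      simp only [hg]
      linarith
    · have := abs_nonneg (F s)
      linarith
    · have := le_abs_self (F s)
      linarith
  have hgi : ∀ n, IntegrableOn (g n) (Icc 0 T) := fun n => (hev n).1.sup hFi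
  have hlim : ∀ᵐ s ∂(volume.restrict (Icc 0 T)),
      Filter.Tendsto (fun n => g n s) Filter.atTop (nhds (F s)) := by
    filter_upwards [h1.frozen, h2.frozen, ae_restrict_mem measurableSet_Icc, hac1, hac2]
      with s f1 f2 hsT a1 a2
    rw [Metric.tendsto_nhds]
    intro τ hτ
    filter_upwards [het'.eventually (eventually_frozenRate_le f1 f2 a1 a2 (fun x => hc (s, x))
      (h1.coeff s hsT) (hΨ 1) (half_pos hτ))] with n hn
    have l1 : g n s ≤ F s + τ / 2 := max_le hn (by linarith)
    have l2 : F s ≤ g n s := le_max_right _ _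
    rw [Real.dist_eq, abs_of_nonneg (by linarith)]
    linarith
  filter_upwards [ae_all_iff.2 fun n => (hev n).2, h1.frozen, h2.frozen,
    ae_restrict_mem measurableSet_Icc] with t ht f1 f2 htT h hh
  have hsub : Ioc 0 t ⊆ Icc 0 T := fun x hx => ⟨hx.1.le, hx.2.trans htT.2⟩
  have hle : volume.restrict (uIoc 0 t) ≤ volume.restrict (Icc 0 T) := by
    rw [uIoc_of_le htT.1]
    exact Measure.restrict_mono hsub le_rfl
  have hii : ∀ {u : ℝ → ℝ}, IntegrableOn u (Icc 0 T) → IntervalIntegrable u volume 0 t :=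
    fun hu => (intervalIntegrable_iff_integrableOn_Ioc_of_le htT.1).2 (hu.mono_set hsub)
  have hL : Filter.Tendsto (fun n => ∫ s in (0 : ℝ)..t, g n s) Filter.atTop
      (nhds (∫ s in (0 : ℝ)..t, F s)) := by
    refine intervalIntegral.tendsto_integral_filter_of_dominated_convergence
      (fun s => |F s| + C * m s) (Filter.Eventually.of_forall fun n => ?_)
      (Filter.Eventually.of_forall fun n => ?_)
      (hii (Integrable.add (Integrable.abs hFi) (Integrable.const_mul hmi C))) ?_
    · exact (hgi n).aestronglyMeasurable.mono_measure hle
    · exact (ae_restrict_iff' measurableSet_uIoc).1 (ae_mono hle (hgb n))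
    · exact (ae_restrict_iff' measurableSet_uIoc).1 (ae_mono hle hlim)
  have hψh : Continuous fun y => ψ y * h y := hψ.continuous.mul hh
  have hψh2 : Continuous fun y => ψ y * h y ^ 2 := hψ.continuous.mul (hh.pow 2)
  have hch : HasCompactSupport fun y => ψ y * h y := hψ.2.mul_right
  have hch2 : HasCompactSupport fun y => ψ y * h y ^ 2 := hψ.2.mul_right
  have hI : ∀ {ρ : Measure (Rd d)} [IsFiniteMeasure ρ] {w : Rd d → ℝ} (n : ℕ), Continuous w →
      HasCompactSupport w → Integrable fun x => w x * mollDens ρ (e n) x := fun n hw hwc =>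
    (hw.mul (mollDens_contDiff (he0 n)).continuous).integrable_of_hasCompactSupport hwc.mul_right
  have hlow : Filter.Tendsto (fun n => 2 * (∫ x, ψ x * h x * mollDens (κ1 t) (e n) x)
      - (∫ x, ψ x * h x ^ 2 * mollDens (κ1 t) (e n) x)
      - (∫ x, ψ x * h x ^ 2 * mollDens (κ2 t) (e n) x) - e n * ∫ x, ψ x * h x ^ 2) Filter.atTop
      (nhds (2 * (∫ y, ψ y * h y ∂(κ1 t)) - (∫ y, ψ y * h y ^ 2 ∂(κ1 t))
        - (∫ y, ψ y * h y ^ 2 ∂(κ2 t)) - 0 * ∫ x, ψ x * h x ^ 2)) :=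
    ((((tendsto_integral_mul_mollDens hψh hch he0 het).const_mul 2).sub
      (tendsto_integral_mul_mollDens hψh2 hch2 he0 het)).sub
      (tendsto_integral_mul_mollDens hψh2 hch2 he0 het)).sub (het.mul_const _)
  have hup := ((tendsto_integral_mul_mollDens (ρ := ν) hψ.continuous hψ.2 he0 het).const_mul
    (1 / 2)).add hL
  rw [zero_mul, sub_zero] at hlow
  refine le_of_tendsto_of_tendsto' hlow hup fun n => ?_
  have hn := ht n
  have b1 : 2 * (∫ x, ψ x * h x * mollDens (κ1 t) (e n) x)
      - (∫ x, ψ x * h x ^ 2 * mollDens (κ1 t) (e n) x)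
      - (∫ x, ψ x * h x ^ 2 * mollDens (κ2 t) (e n) x) - e n * (∫ x, ψ x * h x ^ 2)
      ≤ ∫ x, ψ x * (mollDens (κ1 t) (e n) x ^ 2
        / (mollDens (κ1 t) (e n) x + mollDens (κ2 t) (e n) x + e n)) := by
    have i1 : Integrable (fun x => 2 * (ψ x * h x * mollDens (κ1 t) (e n) x)) :=
      (hI n hψh hch).const_mul 2
    have i12 : Integrable (fun x => 2 * (ψ x * h x * mollDens (κ1 t) (e n) x)
        - ψ x * h x ^ 2 * mollDens (κ1 t) (e n) x) := i1.sub (hI n hψh2 hch2)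
    have i123 : Integrable (fun x => 2 * (ψ x * h x * mollDens (κ1 t) (e n) x)
        - ψ x * h x ^ 2 * mollDens (κ1 t) (e n) x
        - ψ x * h x ^ 2 * mollDens (κ2 t) (e n) x) := i12.sub (hI n hψh2 hch2)
    have i4 : Integrable (fun x => e n * (ψ x * h x ^ 2)) :=
      (hψh2.integrable_of_hasCompactSupport hch2).const_mul _
    rw [← integral_const_mul, ← integral_const_mul, ← integral_sub i1 (hI n hψh2 hch2),
      ← integral_sub i12 (hI n hψh2 hch2), ← integral_sub i123 i4]
    refine integral_mono (i123.sub i4) ?_ fun x => ?_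
    · refine Continuous.integrable_of_hasCompactSupport (hψ.continuous.mul
        (((mollDens_contDiff (he0 n)).continuous.pow 2).div
          (((mollDens_contDiff (he0 n)).continuous.add
            (mollDens_contDiff (he0 n)).continuous).add continuous_const) fun x => ?_))
        hψ.2.mul_right
      have := mollDens_nonneg (ρ := κ1 t) (e n) x
      have := mollDens_nonneg (ρ := κ2 t) (e n) x
      have := he0 n
      positivity
    · have := mul_le_mul_of_nonneg_left (sq_div_add_ge (h := h x)
        (mollDens_nonneg (ρ := κ1 t) (e n) x) (mollDens_nonneg (ρ := κ2 t) (e n) x) (he0 n)) (hψ0 x)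
      simp only
      linarith
  have b2 : ∫ x, ψ x * (mollDens ν (e n) x ^ 2 / (mollDens ν (e n) x + mollDens ν (e n) x + e n))
      ≤ 1 / 2 * ∫ x, ψ x * mollDens ν (e n) x := by
    rw [← integral_const_mul]
    refine integral_mono_of_nonneg (ae_of_all _ fun x => ?_)
      ((hI n hψ.continuous hψ.2).const_mul _) (ae_of_all _ fun x => ?_)
    · have := mollDens_nonneg (ρ := ν) (e n) x
      have := he0 n
      have := hψ0 x
      simp only [Pi.zero_apply]
      positivity
    · have := mul_le_mul_of_nonneg_left (sq_div_add_le (mollDens_nonneg (ρ := ν) (e n) x) (he0 n))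
        (hψ0 x)
      simp only
      linarith
  have b3 : ∫ s in (0 : ℝ)..t, f n s ≤ ∫ s in (0 : ℝ)..t, g n s :=
    intervalIntegral.integral_mono htT.1 (hii (hev n).1) (hii (hgi n)) fun s => le_max_left _ _
  linarith

end MainInequality

section Localization

open ProbabilityTheory

variable {d : ℕ} {T r γ K Λ ε R : ℝ} {a : Fin d → Fin d → ℝ × Rd d → ℝ}
  {b : Fin d → ℝ × Rd d → ℝ} {c : ℝ × Rd d → ℝ} {ν : Measure (Rd d)} {μ : ℝ → Measure (Rd d)}

/-- A measurable path of measures, extended by zero outside `[0, T]`, as a kernel. -/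
def pathKernel (T : ℝ) (μ : ℝ → Measure (Rd d))
    (hμ : ∀ A : Set (Rd d), MeasurableSet A → Measurable fun t => μ t A) : Kernel ℝ (Rd d) :=
  Kernel.piecewise (s := Icc 0 T) measurableSet_Icc
    ⟨μ, Measure.measurable_of_measurable_coe μ hμ⟩ 0

lemma pathKernel_apply (hμ : ∀ A : Set (Rd d), MeasurableSet A → Measurable fun t => μ t A)
    {s : ℝ} (hs : s ∈ Icc 0 T) : pathKernel T μ hμ s = μ s := by
  rw [pathKernel, Kernel.piecewise_apply, if_pos hs]
  rfl

lemma pathKernel_apply_of_notMem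
    (hμ : ∀ A : Set (Rd d), MeasurableSet A → Measurable fun t => μ t A)
    {s : ℝ} (hs : s ∉ Icc 0 T) : pathKernel T μ hμ s = 0 := by
  rw [pathKernel, Kernel.piecewise_apply, if_neg hs]
  rfl

lemma MemSP.kernel_le_one (h : MemSP T a b c ν μ) (s : ℝ) : pathKernel T μ h.1 s univ ≤ 1 := by
  by_cases hs : s ∈ Icc 0 T
  · rw [pathKernel_apply h.1 hs]
    exact h.2.1 s hs
  · rw [pathKernel_apply_of_notMem h.1 hs]
    simp

lemma MemSP.isFiniteKernel (h : MemSP T a b c ν μ) : IsFiniteKernel (pathKernel T μ h.1) :=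
  ⟨1, ENNReal.one_lt_top, h.kernel_le_one⟩

lemma integrable_of_lintegral_kernel_lt_top {κ : Kernel ℝ (Rd d)} [IsSFiniteKernel κ]
    {f : ℝ × Rd d → ℝ} (hf : Measurable f) {τ : Measure ℝ}
    (h : ∫⁻ s, ∫⁻ y, ENNReal.ofReal |f (s, y)| ∂(κ s) ∂τ < ⊤) :
    (∀ᵐ s ∂τ, Integrable (timeSlice f s) (κ s)) ∧
      Integrable (fun s => ∫ y, |f (s, y)| ∂(κ s)) τ := by
  have hfs : ∀ s, Measurable fun y => f (s, y) := fun s => hf.comp (by fun_prop)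
  have hm : Measurable fun s => ∫⁻ y, ENNReal.ofReal |f (s, y)| ∂(κ s) :=
    (hf.abs.ennreal_ofReal).lintegral_kernel_prod_right'
  constructor
  · filter_upwards [ae_lt_top hm h.ne] with s hs
    refine ⟨(hfs s).aestronglyMeasurable, ?_⟩
    rw [hasFiniteIntegral_iff_norm]
    exact hs
  · refine (integrable_toReal_of_lintegral_ne_top hm.aemeasurable h.ne).congr
      (ae_of_all _ fun s => ?_)
    exact (integral_eq_lintegral_of_nonneg_ae (ae_of_all _ fun y => abs_nonneg _)
      (hfs s).abs.aestronglyMeasurable).symm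

open Classical in
/-- Coefficients set to zero outside the ball of radius `R`. -/
def cutCoeff (R : ℝ) (a : Fin d → Fin d → ℝ × Rd d → ℝ) (i j : Fin d) (z : ℝ × Rd d) : ℝ :=
  if z.2 ∈ Metric.ball (0 : Rd d) R then a i j z else 0

lemma cutCoeff_apply {i j : Fin d} {s : ℝ} {y : Rd d} (hy : y ∈ Metric.ball (0 : Rd d) R) :
    cutCoeff R a i j (s, y) = a i j (s, y) := by
  rw [cutCoeff, if_pos hy]

lemma cutCoeff_apply_of_notMem {i j : Fin d} {s : ℝ} {y : Rd d}
    (hy : y ∉ Metric.ball (0 : Rd d) R) : cutCoeff R a i j (s, y) = 0 := by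
  rw [cutCoeff, if_neg hy]

lemma measurable_cutCoeff (ha : ∀ i j, Measurable (a i j)) (i j : Fin d) :
    Measurable (cutCoeff R a i j) :=
  Measurable.ite (measurableSet_ball.preimage measurable_snd) (ha i j) measurable_const

lemma abs_le_of_quadratic_bounds {α : Fin d → Fin d → ℝ} {M : ℝ} (hs : ∀ i j, α i j = α j i)
    (h0 : ∀ ξ : Fin d → ℝ, 0 ≤ ∑ i, ∑ j, α i j * ξ i * ξ j)
    (hM : ∀ ξ : Fin d → ℝ, ∑ i, ∑ j, α i j * ξ i * ξ j ≤ M * ∑ i, ξ i ^ 2) (i j : Fin d) :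
    |α i j| ≤ M := by
  have hdiag : ∀ k, 0 ≤ α k k ∧ α k k ≤ M := fun k => by
    have h1 := h0 (Pi.single k 1)
    have h2 := hM (Pi.single k 1)
    simp [Pi.single_apply] at h1 h2
    exact ⟨h1, h2⟩
  rcases eq_or_ne i j with rfl | hij
  · rw [abs_of_nonneg (hdiag i).1]
    exact (hdiag i).2
  have key : ∀ σ : ℝ, σ ^ 2 = 1 → α i i + α j j + 2 * σ * α i j ≤ 2 * M := fun σ hσ => by
    have h2 := hM (fun k => Pi.single (M := fun _ => ℝ) i 1 k + σ * Pi.single (M := fun _ => ℝ) j 1 k)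
    simp only [Pi.single_apply, mul_add, add_mul, Finset.sum_add_distrib, add_sq, mul_ite, ite_mul,
      mul_one, mul_zero, zero_mul, Finset.sum_ite_eq', Finset.mem_univ, if_true, ite_pow] at h2
    simp [hij.symm] at h2
    rw [hs j i, hσ, mul_assoc (α j j), ← sq, hσ] at h2
    linarith
  have k1 := key 1 (by norm_num)
  have k2 := key (-1) (by norm_num)
  rw [abs_le]
  constructor <;> linarith [(hdiag i).1, (hdiag j).1]

lemma exists_frozenCoeff (hr : 0 < r) (hameas : ∀ i j, Measurable (a i j))
    (hasymm : ∀ i j z, a i j z = a j i z)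
    (hapos : ∀ z : ℝ × Rd d, ∀ ξ : Fin d → ℝ, 0 ≤ ∑ i, ∑ j, a i j z * ξ i * ξ j)
    (hH1 : CondH1 T a) (hH2 : CondH2 T a) : ∃ γ K Λ : ℝ, ∀ s ∈ Icc 0 T,
      FrozenCoeff r γ K Λ fun i j => timeSlice (cutCoeff (r + 2) a i j) s := by
  obtain ⟨γ, M, hγ, hM, h1⟩ := hH1 (r + 2) (by linarith)
  obtain ⟨Λ, hΛ, h2⟩ := hH2 (r + 2) (by linarith)
  refine ⟨γ, M, Λ, fun s hs => ⟨fun i j => (measurable_cutCoeff hameas i j).comp (by fun_prop),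
    fun i j x => ?_, fun i j x hx => cutCoeff_apply_of_notMem hx, fun x hx ξ => ?_,
    fun x hx y hy i j => ?_, hγ, hM.le, hΛ.le⟩⟩
  · by_cases hx : x ∈ Metric.ball (0 : Rd d) (r + 2)
    · rw [timeSlice, cutCoeff_apply hx]
      exact abs_le_of_quadratic_bounds (α := fun i j => a i j (s, x)) (fun i j => hasymm i j _)
        (hapos _) (fun ξ => (h1 s hs x hx ξ).2) i j
    · rw [timeSlice, cutCoeff_apply_of_notMem hx, abs_zero]
      exact hM.le
  · simp only [timeSlice, cutCoeff_apply hx]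
    exact (h1 s hs x hx ξ).1
  · simp only [timeSlice, cutCoeff_apply hx, cutCoeff_apply hy]
    exact h2 s hs x hx y hy i j

lemma pd_comp_const_sub {φ : Rd d → ℝ} (hφ : Differentiable ℝ φ) (x : Rd d) (i : Fin d) :
    pd i (fun y => φ (x - y)) = fun y => -pd i φ (x - y) := by
  funext y
  have h : HasFDerivAt (fun y => φ (x - y)) ((fderiv ℝ φ (x - y)).comp
      (-ContinuousLinearMap.id ℝ (Rd d))) y :=
    (hφ (x - y)).hasFDerivAt.comp y ((hasFDerivAt_id y).const_sub x)
  rw [pd_eq_of_hasFDerivAt i h]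
  simp [pd]

lemma IsTest.comp_const_sub {φ : Rd d → ℝ} (hφ : IsTest φ) (x : Rd d) :
    IsTest fun y => φ (x - y) :=
  ⟨hφ.1.comp (contDiff_const.sub contDiff_id),
    hφ.2.comp_homeomorph (Homeomorph.subLeft x)⟩

lemma pd2_comp_const_sub {φ : Rd d → ℝ} (hφ : IsTest φ) (x : Rd d) (i j : Fin d) :
    pd2 i j (fun y => φ (x - y)) = fun y => pd i (pd j φ) (x - y) := by
  have h1 := pd_comp_const_sub (hφ.contDiff_one.differentiable one_ne_zero) x j
  have h2 := pd_comp_const_sub ((hφ.pd j).contDiff_one.differentiable one_ne_zero) x i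
  rw [pd2_eq, h1]
  funext y
  have h3 : DifferentiableAt ℝ (fun y => pd j φ (x - y)) y :=
    ((hφ.pd j).comp_const_sub x).contDiff_one.differentiable one_ne_zero y
  have h4 : pd i (fun y => -pd j φ (x - y)) y = -pd i (fun y => pd j φ (x - y)) y := by
    simp only [pd]
    rw [fderiv_fun_neg]
    rfl
  rw [h4, h2, neg_neg]

lemma moll_sub_notMem {x y : Rd d} (hε : 0 < ε) (hε1 : ε ≤ 1) (hx : x ∈ Metric.ball (0 : Rd d) r)
    (hy : y ∉ Metric.ball (0 : Rd d) (r + 2)) : x - y ∉ tsupport (moll (d := d) ε) := fun h => by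
  have h1 := tsupport_mollPow_subset hε (by norm_num) h
  rw [mem_closedBall_zero_iff] at h1
  rw [mem_ball_zero_iff] at hx hy
  have := norm_sub_norm_le y x
  rw [norm_sub_rev] at this
  linarith

lemma integral_L0_moll_eq_convGen {ρ : Measure (Rd d)} {s : ℝ}
    (hf : FrozenMeas (ρ.restrict (Metric.ball 0 (r + 2))) (fun i => timeSlice (b i) s)
      (timeSlice c s))
    (ha : FrozenCoeff r γ K Λ fun i j => timeSlice (cutCoeff (r + 2) a i j) s)
    (hε : 0 < ε) (hε1 : ε ≤ 1) {x : Rd d} (hx : x ∈ Metric.ball (0 : Rd d) r) :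
    ∫ y, L0 a b c (fun y => moll ε (x - y)) (s, y) ∂ρ
      = convGen (ρ.restrict (Metric.ball 0 (r + 2)))
        (fun i j => timeSlice (cutCoeff (r + 2) a i j) s) (fun i => timeSlice (b i) s)
        (timeSlice c s) ε x := by
  have hm := isTest_moll (d := d) hε
  have := hf.isFiniteMeasure
  have e : ∀ y, L0 a b c (fun y => moll ε (x - y)) (s, y)
      = ∑ i, ∑ j, a i j (s, y) * pd i (pd j (moll ε)) (x - y)
        - ∑ i, b i (s, y) * pd i (moll ε) (x - y) + c (s, y) * moll ε (x - y) := fun y => by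
    simp only [L0, pd2_comp_const_sub hm,
      pd_comp_const_sub (hm.contDiff_one.differentiable one_ne_zero), mul_neg,
      Finset.sum_neg_distrib, ← sub_eq_add_neg]
  have hz : ∀ y, y ∉ Metric.ball (0 : Rd d) (r + 2) →
      L0 a b c (fun y => moll ε (x - y)) (s, y) = 0 := fun y hy => by
    have h0 := moll_sub_notMem hε hε1 hx hy
    rw [e]
    simp [eq_zero_of_notMem_tsupport h0, pd_eq_zero_of_notMem_tsupport h0,
      pd_pd_eq_zero_of_notMem_tsupport h0]
  rw [← setIntegral_eq_integral_of_forall_compl_eq_zero (s := Metric.ball 0 (r + 2)) hz]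
  have i1 : ∀ i j, Integrable (fun y => timeSlice (cutCoeff (r + 2) a i j) s y
      * pd i (pd j (moll ε)) (x - y)) (ρ.restrict (Metric.ball 0 (r + 2))) := fun i j =>
    integrable_mul_comp_sub (ha.integrable i j) ((hm.pd j).pd i).continuous ((hm.pd j).pd i).2 x
  have i1s : ∀ i, Integrable (fun y => ∑ j, timeSlice (cutCoeff (r + 2) a i j) s y
      * pd i (pd j (moll ε)) (x - y)) (ρ.restrict (Metric.ball 0 (r + 2))) := fun i =>
    integrable_finsetSum _ fun j _ => i1 i j
  have i1t : Integrable (fun y => ∑ i, ∑ j, timeSlice (cutCoeff (r + 2) a i j) s y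
      * pd i (pd j (moll ε)) (x - y)) (ρ.restrict (Metric.ball 0 (r + 2))) :=
    integrable_finsetSum _ fun i _ => i1s i
  have i2 : ∀ i, Integrable (fun y => timeSlice (b i) s y * pd i (moll ε) (x - y))
      (ρ.restrict (Metric.ball 0 (r + 2))) := fun i =>
    integrable_mul_comp_sub (hf.integrable_drift i) (hm.pd i).continuous (hm.pd i).2 x
  have i2s : Integrable (fun y => ∑ i, timeSlice (b i) s y * pd i (moll ε) (x - y))
      (ρ.restrict (Metric.ball 0 (r + 2))) := integrable_finsetSum _ fun i _ => i2 i
  have i3 : Integrable (fun y => timeSlice c s y * moll ε (x - y))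
      (ρ.restrict (Metric.ball 0 (r + 2))) :=
    integrable_mul_comp_sub hf.pot hm.continuous hm.2 x
  have i12 : Integrable (fun y => ∑ i, ∑ j, timeSlice (cutCoeff (r + 2) a i j) s y
      * pd i (pd j (moll ε)) (x - y) - ∑ i, timeSlice (b i) s y * pd i (moll ε) (x - y))
      (ρ.restrict (Metric.ball 0 (r + 2))) := i1t.sub i2s
  calc ∫ y in Metric.ball 0 (r + 2), L0 a b c (fun y => moll ε (x - y)) (s, y) ∂ρ
      = ∫ y in Metric.ball 0 (r + 2), ((∑ i, ∑ j, timeSlice (cutCoeff (r + 2) a i j) s y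
        * pd i (pd j (moll ε)) (x - y) - ∑ i, timeSlice (b i) s y * pd i (moll ε) (x - y))
        + timeSlice c s y * moll ε (x - y)) ∂ρ := by
        refine setIntegral_congr_fun measurableSet_ball fun y hy => ?_
        simp only [e, timeSlice, cutCoeff_apply hy]
    _ = _ := by
        rw [integral_add i12 i3, integral_sub i1t i2s, integral_finsetSum _ fun i _ => i1s i,
          integral_finsetSum _ fun i _ => i2 i]
        simp only [integral_finsetSum _ fun j _ => i1 _ j]
        rfl

lemma continuous_convGen {ρ : Measure (Rd d)} {a : Fin d → Fin d → Rd d → ℝ}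
    {b : Fin d → Rd d → ℝ} {c : Rd d → ℝ} (h : FrozenMeas ρ b c) (ha : FrozenCoeff r γ K Λ a)
    (hε : 0 < ε) : Continuous (convGen ρ a b c ε) := by
  have hm := isTest_moll (d := d) hε
  have := h.isFiniteMeasure
  have h1 := fun i j => continuous_cv (ha.integrable (ρ := ρ) i j) ((hm.pd j).pd i).continuous
    ((hm.pd j).pd i).2
  have h2 := fun i => continuous_cv (h.integrable_drift i) (hm.pd i).continuous (hm.pd i).2
  have h3 := continuous_cv h.pot hm.continuous hm.2
  exact ((continuous_finsetSum _ fun i _ => continuous_finsetSum _ fun j _ => h1 i j).sub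
    (continuous_finsetSum _ fun i _ => h2 i)).add h3

lemma mollDens_restrict_ball {ρ : Measure (Rd d)} (hε : 0 < ε) (hε1 : ε ≤ 1) {x : Rd d}
    (hx : x ∈ Metric.ball (0 : Rd d) r) :
    mollDens (ρ.restrict (Metric.ball 0 (r + 2))) ε x = ∫ y, moll ε (x - y) ∂ρ := by
  simp only [mollDens, cv, one_mul]
  exact setIntegral_eq_integral_of_forall_compl_eq_zero fun y hy =>
    eq_zero_of_notMem_tsupport (moll_sub_notMem hε hε1 hx hy)

/-- The kernel of a solution, restricted to a ball. -/
def MemSP.ballKernel (h : MemSP T a b c ν μ) (R : ℝ) : Kernel ℝ (Rd d) :=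
  (pathKernel T μ h.1).restrict (s := Metric.ball 0 R) measurableSet_ball

lemma MemSP.ballKernel_apply (h : MemSP T a b c ν μ) {s : ℝ} (hs : s ∈ Icc 0 T) :
    h.ballKernel R s = (μ s).restrict (Metric.ball 0 R) := by
  rw [MemSP.ballKernel, Kernel.restrict_apply, pathKernel_apply h.1 hs]

lemma MemSP.ballKernel_le_one (h : MemSP T a b c ν μ) (s : ℝ) : h.ballKernel R s univ ≤ 1 := by
  rw [MemSP.ballKernel, Kernel.restrict_apply]
  exact (Measure.restrict_apply_le _ _).trans (h.kernel_le_one s)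

lemma MemSP.isFiniteKernel_ballKernel (h : MemSP T a b c ν μ) :
    IsFiniteKernel (h.ballKernel R) :=
  ⟨1, ENNReal.one_lt_top, h.ballKernel_le_one⟩

lemma MemSP.lintegral_ballKernel (h : MemSP T a b c ν μ) (f : ℝ → Rd d → ENNReal) :
    ∫⁻ s in Icc 0 T, ∫⁻ y, f s y ∂(h.ballKernel R s)
      = ∫⁻ s in Icc 0 T, ∫⁻ y in Metric.ball (0 : Rd d) R, f s y ∂(μ s) :=
  setLIntegral_congr_fun measurableSet_Icc fun s hs => by
    simp only [h.ballKernel_apply hs]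

lemma MemSP.drift_sq (h : MemSP T a b c ν μ) (hb : ∀ i, Measurable (b i)) (hR : 0 < R)
    (i : Fin d) : (∀ᵐ s ∂(volume.restrict (Icc 0 T)),
      Integrable (timeSlice (fun z => b i z ^ 2) s) (h.ballKernel R s)) ∧
    IntegrableOn (fun s => ∫ y, |b i (s, y) ^ 2| ∂(h.ballKernel R s)) (Icc 0 T) := by
  have := h.isFiniteKernel_ballKernel (R := R)
  have hL2 := h.2.2.2.2.2.2.2.1
  refine integrable_of_lintegral_kernel_lt_top (f := fun z => b i z ^ 2) ((hb i).pow_const 2) ?_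
  rw [MemSP.lintegral_ballKernel]
  refine lt_of_le_of_lt (lintegral_mono fun s => lintegral_mono fun y => ?_) (hL2 R hR)
  refine ENNReal.ofReal_le_ofReal ?_
  rw [abs_of_nonneg (sq_nonneg _)]
  exact Finset.single_le_sum (f := fun i => b i (s, y) ^ 2) (fun i _ => sq_nonneg _)
    (Finset.mem_univ i)

lemma MemSP.pot (h : MemSP T a b c ν μ) (hc : Measurable c) (hR : 0 < R) :
    (∀ᵐ s ∂(volume.restrict (Icc 0 T)), Integrable (timeSlice c s) (h.ballKernel R s)) ∧
    IntegrableOn (fun s => ∫ y, |c (s, y)| ∂(h.ballKernel R s)) (Icc 0 T) := by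
  have := h.isFiniteKernel_ballKernel (R := R)
  have hL := h.2.2.2.2.1
  refine integrable_of_lintegral_kernel_lt_top hc ?_
  rw [MemSP.lintegral_ballKernel]
  exact hL R hR

lemma MemSP.frozen (h : MemSP T a b c ν μ) (hb : ∀ i, Measurable (b i)) (hc : Measurable c)
    (hR : 0 < R) : ∀ᵐ s ∂(volume.restrict (Icc 0 T)),
      FrozenMeas (h.ballKernel R s) (fun i => timeSlice (b i) s) (timeSlice c s) := by
  filter_upwards [ae_all_iff.2 fun i => (h.drift_sq hb hR i).1, (h.pot hc hR).1] with s h1 h2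
  exact ⟨h.ballKernel_le_one s, fun i => (hb i).comp (by fun_prop), h1, h2⟩

lemma MemSP.integrable_coeffMass (h : MemSP T a b c ν μ) (hb : ∀ i, Measurable (b i))
    (hc : Measurable c) (hR : 0 < R) : IntegrableOn (fun s => coeffMass (h.ballKernel R s)
      (h.ballKernel R s) (fun i => timeSlice (b i) s) (timeSlice c s)) (Icc 0 T) := by
  have h1 : ∀ i, Integrable (fun s => ∫ y, b i (s, y) ^ 2 ∂(h.ballKernel R s))
      (volume.restrict (Icc 0 T)) := fun i => by
    refine (h.drift_sq hb hR i).2.congr (ae_of_all _ fun s => ?_)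
    simp only [abs_pow, sq_abs]
  have h1s : Integrable (fun s => ∑ i, ∫ y, b i (s, y) ^ 2 ∂(h.ballKernel R s))
      (volume.restrict (Icc 0 T)) := integrable_finsetSum _ fun i _ => h1 i
  have h2 : Integrable (fun s => ∫ y, |c (s, y)| ∂(h.ballKernel R s))
      (volume.restrict (Icc 0 T)) := (h.pot hc hR).2
  exact ((((integrable_const 1).add h1s).add h1s).add h2).add h2

lemma MemSP.evol (h : MemSP T a b c ν μ) [IsFiniteMeasure ν] (hr : 0 < r)
    (hameas : ∀ i j, Measurable (a i j)) (hb : ∀ i, Measurable (b i)) (hc : Measurable c)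
    (ha : ∀ s ∈ Icc 0 T, FrozenCoeff r γ K Λ fun i j => timeSlice (cutCoeff (r + 2) a i j) s)
    (hε : 0 < ε) (hε1 : ε ≤ 1) :
    ∀ᵐ t ∂(volume.restrict (Icc 0 T)), ∀ x ∈ Metric.ball (0 : Rd d) r,
      mollDens (h.ballKernel (r + 2) t) ε x = mollDens ν ε x + ∫ s in (0 : ℝ)..t,
        convGen (h.ballKernel (r + 2) s) (fun i j => timeSlice (cutCoeff (r + 2) a i j) s)
          (fun i => timeSlice (b i) s) (timeSlice c s) ε x := by
  have hm := isTest_moll (d := d) hε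
  have hR : 0 < r + 2 := by linarith
  have hk := h.isFiniteKernel_ballKernel (R := r + 2)
  have hfr := h.frozen hb hc hR
  have hmi := h.integrable_coeffMass hb hc hR
  have hevol := h.2.2.2.2.2.1
  obtain ⟨C, hC, hCb⟩ := exists_abs_convGen_le d K hε
  obtain ⟨S, hSc, hSd⟩ := TopologicalSpace.exists_countable_dense (Rd d)
  have hS : ∀ᵐ t ∂(volume.restrict (Icc 0 T)), ∀ x ∈ S,
      ∫ y, moll ε (x - y) ∂(μ t) = ∫ y, moll ε (x - y) ∂ν
        + ∫ s in (0 : ℝ)..t, ∫ y, L0 a b c (fun y => moll ε (x - y)) (s, y) ∂(μ s) :=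
    (ae_ball_iff hSc).2 fun x _ => hevol _ (hm.comp_const_sub x)
  have hfrozen : ∀ᵐ s ∂(volume.restrict (Icc 0 T)),
      (FrozenMeas (h.ballKernel (r + 2) s) (fun i => timeSlice (b i) s) (timeSlice c s) ∧
      FrozenCoeff r γ K Λ fun i j => timeSlice (cutCoeff (r + 2) a i j) s) ∧
      ∀ x ∈ Metric.ball (0 : Rd d) r,
      ∫ y, L0 a b c (fun y => moll ε (x - y)) (s, y) ∂(μ s)
        = convGen (h.ballKernel (r + 2) s) (fun i j => timeSlice (cutCoeff (r + 2) a i j) s)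
          (fun i => timeSlice (b i) s) (timeSlice c s) ε x := by
    filter_upwards [hfr, ae_restrict_mem measurableSet_Icc] with s hs hsT
    refine ⟨⟨hs, ha s hsT⟩, fun x hx => ?_⟩
    rw [h.ballKernel_apply hsT] at hs ⊢
    exact integral_L0_moll_eq_convGen hs (ha s hsT) hε hε1 hx
  filter_upwards [hS, ae_restrict_mem measurableSet_Icc] with t ht htT
  have hsub : Ioc 0 t ⊆ Icc 0 T := fun x hx => ⟨hx.1.le, hx.2.trans htT.2⟩
  have hle : volume.restrict (uIoc 0 t) ≤ volume.restrict (Icc 0 T) := by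
    rw [uIoc_of_le htT.1]
    exact Measure.restrict_mono hsub le_rfl
  have hgood := (ae_restrict_iff' measurableSet_uIoc).1 (ae_mono hle hfrozen)
  have hmeas := measurable_convGen (κ := h.ballKernel (r + 2))
    (measurable_cutCoeff (R := r + 2) hameas) hb hc hε
  have hcont : Continuous fun x => ∫ s in (0 : ℝ)..t,
      convGen (h.ballKernel (r + 2) s) (fun i j => timeSlice (cutCoeff (r + 2) a i j) s)
        (fun i => timeSlice (b i) s) (timeSlice c s) ε x := by
    refine intervalIntegral.continuous_of_dominated_interval (bound := fun s => C * coeffMass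
      (h.ballKernel (r + 2) s) (h.ballKernel (r + 2) s) (fun i => timeSlice (b i) s)
      (timeSlice c s)) (fun x => ?_) (fun x => ?_) ?_ ?_
    · exact (hmeas.comp (measurable_id.prodMk measurable_const)).aestronglyMeasurable
    · filter_upwards [hgood] with s hs hsI
      exact hCb (hs hsI).1.1 (hs hsI).1.2 x
    · rw [intervalIntegrable_iff_integrableOn_Ioc_of_le htT.1]
      exact IntegrableOn.mono_set (Integrable.const_mul hmi C) hsub
    · filter_upwards [hgood] with s hs hsI
      exact continuous_convGen (hs hsI).1.1 (hs hsI).1.2 hε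
  have hclosed : IsClosed {x | mollDens (h.ballKernel (r + 2) t) ε x = mollDens ν ε x
      + ∫ s in (0 : ℝ)..t, convGen (h.ballKernel (r + 2) s)
        (fun i j => timeSlice (cutCoeff (r + 2) a i j) s) (fun i => timeSlice (b i) s)
        (timeSlice c s) ε x} :=
    isClosed_eq (mollDens_contDiff hε).continuous ((mollDens_contDiff hε).continuous.add hcont)
  refine fun x hx => closure_minimal (fun y hy => ?_) hclosed
    (hSd.open_subset_closure_inter Metric.isOpen_ball hx)
  have hyt := ht y hy.2
  rw [mem_ofPred_eq, h.ballKernel_apply htT, mollDens_restrict_ball hε hε1 hy.1, hyt]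
  congr 1
  · simp only [mollDens, cv, one_mul]
  · refine intervalIntegral.integral_congr_ae ?_
    filter_upwards [hgood] with s hs hsI
    exact (hs hsI).2 y hy.1

theorem MemSP.localSol (h : MemSP T a b c ν μ) [IsFiniteMeasure ν] (hr : 0 < r)
    (hameas : ∀ i j, Measurable (a i j)) (hb : ∀ i, Measurable (b i)) (hc : Measurable c)
    (ha : ∀ s ∈ Icc 0 T, FrozenCoeff r γ K Λ fun i j => timeSlice (cutCoeff (r + 2) a i j) s) :
    LocalSol T r γ K Λ (h.ballKernel (r + 2)) (cutCoeff (r + 2) a) b c ν where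
  coeff := ha
  coeff_meas := measurable_cutCoeff hameas
  drift_meas := hb
  pot_meas := hc
  mass := h.ballKernel_le_one
  frozen := h.frozen hb hc (by linarith)
  integrable := h.integrable_coeffMass hb hc (by linarith)
  evol _ hε hε1 := h.evol hr hameas hb hc ha hε hε1

end Localization

section Cutoff

variable {d : ℕ}

lemma pd_comp_smul {f : Rd d → ℝ} (hf : Differentiable ℝ f) (k : ℝ) (i : Fin d) :
    pd i (fun x => f (k • x)) = fun x => k * pd i f (k • x) := by
  funext x
  have h : HasFDerivAt (fun x => f (k • x)) ((fderiv ℝ f (k • x)).comp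
      (k • ContinuousLinearMap.id ℝ (Rd d))) x :=
    (hf (k • x)).hasFDerivAt.comp x (k • ContinuousLinearMap.id ℝ (Rd d)).hasFDerivAt
  rw [pd_eq_of_hasFDerivAt i h]
  simp [pd]

lemma pd_const_mul {f : Rd d → ℝ} (hf : Differentiable ℝ f) (k : ℝ) (i : Fin d) :
    pd i (fun x => k * f x) = fun x => k * pd i f x := by
  funext x
  rw [pd_eq_of_hasFDerivAt i ((hf x).hasFDerivAt.const_mul k)]
  simp [pd]

/-- The bump function behind the cutoff functions. -/
def cutBump (d : ℕ) : ContDiffBump (0 : Rd d) := ⟨1, 2, by norm_num, by norm_num⟩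

lemma isTest_cutBump : IsTest (cutBump d) := ⟨(cutBump d).contDiff, (cutBump d).hasCompactSupport⟩

/-- Smooth functions equal to one on large balls, with derivatives that decay. -/
def cutoff (n : ℕ) (x : Rd d) : ℝ := cutBump d (((n : ℝ) + 1)⁻¹ • x)

lemma cutoff_nonneg (n : ℕ) (x : Rd d) : 0 ≤ cutoff n x := (cutBump d).nonneg

lemma cutoff_le_one (n : ℕ) (x : Rd d) : cutoff n x ≤ 1 := (cutBump d).le_one

lemma abs_cutoff_le_one (n : ℕ) (x : Rd d) : |cutoff n x| ≤ 1 := by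
  rw [abs_of_nonneg (cutoff_nonneg n x)]
  exact cutoff_le_one n x

lemma tsupport_cutBump : tsupport (cutBump d) = Metric.closedBall 0 2 := (cutBump d).tsupport_eq

lemma smul_mem_tsupport_cutBump {n : ℕ} {x : Rd d}
    (h : ((n : ℝ) + 1)⁻¹ • x ∈ tsupport (cutBump d)) : ‖x‖ ≤ 2 * (n + 1) := by
  have hn : (0 : ℝ) < n + 1 := by positivity
  rw [tsupport_cutBump, mem_closedBall_zero_iff, norm_smul, norm_inv, Real.norm_of_nonneg hn.le,
    inv_mul_le_iff₀ hn] at h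
  linarith

lemma tsupport_cutoff_subset (n : ℕ) :
    tsupport (cutoff (d := d) n) ⊆ Metric.closedBall 0 (2 * (n + 1)) := by
  refine closure_minimal (fun x hx => ?_) Metric.isClosed_closedBall
  rw [mem_closedBall_zero_iff]
  exact smul_mem_tsupport_cutBump (subset_tsupport _ hx)

lemma tsupport_cutoff_subset_ball (n : ℕ) :
    tsupport (cutoff (d := d) n) ⊆ Metric.ball 0 (2 * n + 3) :=
  (tsupport_cutoff_subset n).trans (Metric.closedBall_subset_ball (by linarith))

lemma isTest_cutoff (n : ℕ) : IsTest (cutoff (d := d) n) :=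
  ⟨isTest_cutBump.1.comp (contDiff_const_smul _),
    (isCompact_closedBall _ _).of_isClosed_subset (isClosed_tsupport _) (tsupport_cutoff_subset n)⟩

lemma pd_cutoff (n : ℕ) (i : Fin d) : pd i (cutoff n) = fun x : Rd d =>
    ((n : ℝ) + 1)⁻¹ * pd i (cutBump d) (((n : ℝ) + 1)⁻¹ • x) :=
  pd_comp_smul (isTest_cutBump.contDiff_one.differentiable one_ne_zero) _ _

lemma pd_pd_cutoff (n : ℕ) (i j : Fin d) : pd i (pd j (cutoff n)) = fun x : Rd d =>
    ((n : ℝ) + 1)⁻¹ * (((n : ℝ) + 1)⁻¹ * pd i (pd j (cutBump d)) (((n : ℝ) + 1)⁻¹ • x)) := by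
  have h := (isTest_cutBump (d := d)).pd j |>.contDiff_one.differentiable one_ne_zero
  rw [pd_cutoff, pd_const_mul (f := fun x => pd j (cutBump d) (((n : ℝ) + 1)⁻¹ • x))
    (h.comp (by fun_prop : Differentiable ℝ fun x : Rd d => ((n : ℝ) + 1)⁻¹ • x)), pd_comp_smul h]

lemma eventually_cutoff_eq_one {n : ℕ} {x : Rd d} (hx : ‖x‖ < n + 1) :
    cutoff n =ᶠ[nhds x] fun _ => 1 := by
  filter_upwards [Metric.isOpen_ball.mem_nhds (mem_ball_zero_iff.2 hx)] with y hy
  have hn : (0 : ℝ) < n + 1 := by positivity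
  refine (cutBump d).one_of_mem_closedBall ?_
  rw [mem_ball_zero_iff] at hy
  rw [mem_closedBall_zero_iff, norm_smul, norm_inv, Real.norm_of_nonneg hn.le]
  exact (inv_mul_le_iff₀ hn).2 (hy.le.trans_eq (mul_one _).symm)

lemma pd_eq_of_eventuallyEq {f g : Rd d → ℝ} {x : Rd d} (h : f =ᶠ[nhds x] g) (i : Fin d) :
    pd i f =ᶠ[nhds x] pd i g := by
  filter_upwards [h.fderiv (𝕜 := ℝ)] with y hy
  rw [pd, pd, hy]

lemma pd_const (k : ℝ) (i : Fin d) : pd i (fun _ : Rd d => k) = fun _ => 0 := by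
  funext x
  simp [pd]

lemma eventually_norm_lt (x : Rd d) : ∀ᶠ n : ℕ in Filter.atTop, ‖x‖ < n + 1 := by
  filter_upwards [Filter.eventually_ge_atTop ⌈‖x‖⌉₊] with n hn
  linarith [Nat.ceil_le.1 hn]

lemma tendsto_cutoff (x : Rd d) :
    Filter.Tendsto (fun n => cutoff n x) Filter.atTop (nhds 1) := by
  refine tendsto_const_nhds.congr' ?_
  filter_upwards [eventually_norm_lt x] with n hn
  exact (eventually_cutoff_eq_one hn).eq_of_nhds.symm

lemma tendsto_pd_cutoff (i : Fin d) (x : Rd d) :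
    Filter.Tendsto (fun n => pd i (cutoff n) x) Filter.atTop (nhds 0) := by
  refine tendsto_const_nhds.congr' ?_
  filter_upwards [eventually_norm_lt x] with n hn
  rw [(pd_eq_of_eventuallyEq (eventually_cutoff_eq_one hn) i).eq_of_nhds, pd_const]

lemma tendsto_pd_pd_cutoff (i j : Fin d) (x : Rd d) :
    Filter.Tendsto (fun n => pd i (pd j (cutoff n)) x) Filter.atTop (nhds 0) := by
  refine tendsto_const_nhds.congr' ?_
  filter_upwards [eventually_norm_lt x] with n hn
  rw [(pd_eq_of_eventuallyEq (pd_eq_of_eventuallyEq (eventually_cutoff_eq_one hn) j) i).eq_of_nhds,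
    pd_const, pd_const]

lemma exists_pd_cutoff_le (d : ℕ) : ∃ C : ℝ, 0 ≤ C ∧
    (∀ (n : ℕ) (i : Fin d) (x : Rd d), |pd i (cutoff n) x| ≤ C / (1 + ‖x‖)) ∧
    ∀ (n : ℕ) (i j : Fin d) (x : Rd d), |pd i (pd j (cutoff n)) x| ≤ C / (1 + ‖x‖ ^ 2) := by
  have hb := isTest_cutBump (d := d)
  choose B1 hB1 using fun i => (hb.pd i).continuous.bounded_above_of_compact_support (hb.pd i).2
  choose B2 hB2 using fun i j =>
    ((hb.pd j).pd i).continuous.bounded_above_of_compact_support ((hb.pd j).pd i).2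
  have p1 : ∀ i, 0 ≤ B1 i := fun i => (norm_nonneg _).trans (hB1 i 0)
  have p2 : ∀ i j, 0 ≤ B2 i j := fun i j => (norm_nonneg _).trans (hB2 i j 0)
  set B := ∑ i, B1 i + ∑ i, ∑ j, B2 i j with hB
  have q1 : 0 ≤ ∑ i, B1 i := Finset.sum_nonneg fun i _ => p1 i
  have q2 : 0 ≤ ∑ i, ∑ j, B2 i j := Finset.sum_nonneg fun i _ => Finset.sum_nonneg fun j _ => p2 i j
  have l1 : ∀ i, B1 i ≤ B := fun i => by
    linarith [Finset.single_le_sum (fun i _ => p1 i) (Finset.mem_univ i)]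
  have l2 : ∀ i j, B2 i j ≤ B := fun i j => by
    have h1 := Finset.single_le_sum (fun j _ => p2 i j) (Finset.mem_univ j)
    have h2 := Finset.single_le_sum (f := fun i => ∑ j, B2 i j)
      (fun i _ => Finset.sum_nonneg fun j _ => p2 i j) (Finset.mem_univ i)
    linarith
  have hB0 : 0 ≤ B := by linarith
  refine ⟨5 * B, by positivity, fun n i x => ?_, fun n i j x => ?_⟩
  · have hn : (1 : ℝ) ≤ n + 1 := by linarith [(Nat.cast_nonneg n : (0 : ℝ) ≤ n)]
    simp only [pd_cutoff]
    by_cases hx : ((n : ℝ) + 1)⁻¹ • x ∈ tsupport (cutBump d)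
    · have h := smul_mem_tsupport_cutBump hx
      have h1 := (hB1 i (((n : ℝ) + 1)⁻¹ • x)).trans (l1 i)
      rw [Real.norm_eq_abs] at h1
      rw [abs_mul, abs_of_pos (by positivity), le_div_iff₀ (by positivity), mul_assoc,
        inv_mul_le_iff₀ (by positivity)]
      calc _ ≤ B * (1 + ‖x‖) := mul_le_mul_of_nonneg_right h1 (by positivity)
        _ ≤ B * (5 * (n + 1)) := mul_le_mul_of_nonneg_left (by linarith) hB0
        _ = _ := by ring
    · rw [pd_eq_zero_of_notMem_tsupport hx, mul_zero, abs_zero]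
      positivity
  · have hn : (1 : ℝ) ≤ n + 1 := by linarith [(Nat.cast_nonneg n : (0 : ℝ) ≤ n)]
    simp only [pd_pd_cutoff]
    by_cases hx : ((n : ℝ) + 1)⁻¹ • x ∈ tsupport (cutBump d)
    · have h := smul_mem_tsupport_cutBump hx
      have h1 := (hB2 i j (((n : ℝ) + 1)⁻¹ • x)).trans (l2 i j)
      rw [Real.norm_eq_abs] at h1
      have h2 : 1 + ‖x‖ ^ 2 ≤ 5 * ((n + 1) * (n + 1)) := by nlinarith [norm_nonneg x]
      rw [abs_mul, abs_mul, abs_of_pos (by positivity : (0 : ℝ) < ((n : ℝ) + 1)⁻¹),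
        le_div_iff₀ (by positivity), mul_assoc, inv_mul_le_iff₀ (by positivity), mul_assoc,
        inv_mul_le_iff₀ (by positivity)]
      calc _ ≤ B * (1 + ‖x‖ ^ 2) := mul_le_mul_of_nonneg_right h1 (by positivity)
        _ ≤ B * (5 * ((n + 1) * (n + 1))) := mul_le_mul_of_nonneg_left h2 hB0
        _ = _ := by ring
    · rw [pd_pd_eq_zero_of_notMem_tsupport hx, mul_zero, mul_zero, abs_zero]
      positivity

end Cutoff

section Density

variable {d : ℕ} {T R : ℝ} {a : Fin d → Fin d → ℝ × Rd d → ℝ}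
  {b : Fin d → ℝ × Rd d → ℝ} {c : ℝ × Rd d → ℝ} {ν : Measure (Rd d)} {μ : ℝ → Measure (Rd d)}

theorem MemSP.ae_absolutelyContinuous (h : MemSP T a b c ν μ) [IsFiniteMeasure ν] (hT : 0 < T)
    (hameas : ∀ i j, Measurable (a i j)) (hb : ∀ i, Measurable (b i)) (hc : Measurable c)
    (hasymm : ∀ i j z, a i j z = a j i z)
    (hapos : ∀ z : ℝ × Rd d, ∀ ξ : Fin d → ℝ, 0 ≤ ∑ i, ∑ j, a i j z * ξ i * ξ j)
    (hH1 : CondH1 T a) (hH2 : CondH2 T a) (hR : 0 < R) :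
    ∀ᵐ s ∂(volume.restrict (Icc 0 T)), h.ballKernel R s ≪ volume := by
  obtain ⟨γ, K, Λ, ha⟩ := exists_frozenCoeff (r := R + 2) (by linarith) hameas hasymm hapos hH1 hH2
  have hsol := h.localSol (by linarith) hameas hb hc ha
  let ψ : ContDiffBump (0 : Rd d) := ⟨R, R + 1, hR, by linarith⟩
  have hψs : tsupport ψ ⊆ Metric.ball 0 (R + 2) := by
    rw [ψ.tsupport_eq]
    exact Metric.closedBall_subset_ball (by simp only [ψ]; linarith)
  filter_upwards [hsol.ae_absolutelyContinuous hT ⟨ψ.contDiff, ψ.hasCompactSupport⟩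
    (fun x => ψ.nonneg) hψs (V := Metric.ball 0 R) Metric.isOpen_ball fun x hx =>
      ψ.one_of_mem_closedBall (Metric.ball_subset_closedBall hx),
    ae_restrict_mem measurableSet_Icc] with s hs hsT
  rw [h.ballKernel_apply hsT] at hs ⊢
  rwa [Measure.restrict_restrict measurableSet_ball,
    inter_eq_left.2 (Metric.ball_subset_ball (by linarith))] at hs

end Density

section Comparison

open ProbabilityTheory

variable {d : ℕ} {T t : ℝ} {a : Fin d → Fin d → ℝ × Rd d → ℝ}
  {b : Fin d → ℝ × Rd d → ℝ} {c : ℝ × Rd d → ℝ} {ν : Measure (Rd d)} {μ μ' : ℝ → Measure (Rd d)}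

lemma tendsto_integral_kernel {κ : Kernel ℝ (Rd d)} [IsSFiniteKernel κ] {F : ℕ → ℝ × Rd d → ℝ}
    {f G : ℝ × Rd d → ℝ} (hF : ∀ n, Measurable (F n)) (hG : Measurable G)
    (hGi : ∫⁻ s in Icc 0 T, ∫⁻ y, ENNReal.ofReal |G (s, y)| ∂(κ s) < ⊤)
    (hle : ∀ n z, |F n z| ≤ |G z|)
    (hlim : ∀ z, Filter.Tendsto (fun n => F n z) Filter.atTop (nhds (f z))) (ht : t ∈ Icc 0 T) :
    Filter.Tendsto (fun n => ∫ s in (0 : ℝ)..t, ∫ y, F n (s, y) ∂(κ s)) Filter.atTop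
      (nhds (∫ s in (0 : ℝ)..t, ∫ y, f (s, y) ∂(κ s))) := by
  obtain ⟨h1, h2⟩ := integrable_of_lintegral_kernel_lt_top hG hGi
  have hsub : Ioc 0 t ⊆ Icc 0 T := fun x hx => ⟨hx.1.le, hx.2.trans ht.2⟩
  have hle' : volume.restrict (uIoc 0 t) ≤ volume.restrict (Icc 0 T) := by
    rw [uIoc_of_le ht.1]
    exact Measure.restrict_mono hsub le_rfl
  refine intervalIntegral.tendsto_integral_filter_of_dominated_convergence
    (fun s => ∫ y, |G (s, y)| ∂(κ s)) (Filter.Eventually.of_forall fun n => ?_)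
    (Filter.Eventually.of_forall fun n => ?_)
    ((intervalIntegrable_iff_integrableOn_Ioc_of_le ht.1).2 (IntegrableOn.mono_set h2 hsub)) ?_
  · exact (measurable_integral_timeSlice (hF n)).aestronglyMeasurable
  · filter_upwards [(ae_restrict_iff' measurableSet_uIoc).1 (ae_mono hle' h1)] with s hs hsI
    exact abs_integral_le_of_abs_le (hs hsI).abs fun y => hle n (s, y)
  · filter_upwards [(ae_restrict_iff' measurableSet_uIoc).1 (ae_mono hle' h1)] with s hs hsI
    exact tendsto_integral_of_dominated_convergence (fun y => |G (s, y)|)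
      (fun n => ((hF n).comp (by fun_prop)).aestronglyMeasurable) (hs hsI).abs
      (fun n => ae_of_all _ fun y => hle n (s, y)) (ae_of_all _ fun y => hlim (s, y))

lemma integrable_integral_kernel {κ : Kernel ℝ (Rd d)} [IsSFiniteKernel κ]
    {F G : ℝ × Rd d → ℝ} (hF : Measurable F) (hG : Measurable G)
    (hGi : ∫⁻ s in Icc 0 T, ∫⁻ y, ENNReal.ofReal |G (s, y)| ∂(κ s) < ⊤)
    (hle : ∀ z, |F z| ≤ |G z|) : IntegrableOn (fun s => ∫ y, F (s, y) ∂(κ s)) (Icc 0 T) := by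
  obtain ⟨h1, h2⟩ := integrable_of_lintegral_kernel_lt_top hG hGi
  refine Integrable.mono' h2 (measurable_integral_timeSlice hF).aestronglyMeasurable ?_
  filter_upwards [h1] with s hs
  exact abs_integral_le_of_abs_le hs.abs fun y => hle (s, y)

lemma MemSP.lintegral_pathKernel (h : MemSP T a b c ν μ) (f : ℝ → Rd d → ENNReal) :
    ∫⁻ s in Icc 0 T, ∫⁻ y, f s y ∂(pathKernel T μ h.1 s)
      = ∫⁻ s in Icc 0 T, ∫⁻ y, f s y ∂(μ s) :=
  setLIntegral_congr_fun measurableSet_Icc fun s hs => by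
    simp only [pathKernel_apply h.1 hs]

lemma MemSP.integral_pathKernel (h : MemSP T a b c ν μ) (ht : t ∈ Icc 0 T) (f : ℝ × Rd d → ℝ) :
    ∫ s in (0 : ℝ)..t, ∫ y, f (s, y) ∂(pathKernel T μ h.1 s)
      = ∫ s in (0 : ℝ)..t, ∫ y, f (s, y) ∂(μ s) := by
  refine intervalIntegral.integral_congr fun s hs => ?_
  rw [uIcc_of_le ht.1] at hs
  simp only [pathKernel_apply h.1 (⟨hs.1, hs.2.trans ht.2⟩ : s ∈ Icc 0 T)]

/-- The growth of the coefficients, as it enters the cutoff argument. -/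
def growth (a : Fin d → Fin d → ℝ × Rd d → ℝ) (b : Fin d → ℝ × Rd d → ℝ) (z : ℝ × Rd d) : ℝ :=
  ∑ i, ∑ j, (|a i j z| / (1 + ‖z.2‖ ^ 2) + |b i z| / (1 + ‖z.2‖))

lemma growth_nonneg (z : ℝ × Rd d) : 0 ≤ growth a b z :=
  Finset.sum_nonneg fun i _ => Finset.sum_nonneg fun j _ => by positivity

lemma measurable_growth (hameas : ∀ i j, Measurable (a i j)) (hb : ∀ i, Measurable (b i)) :
    Measurable (growth a b) := by
  refine Finset.measurable_fun_sum _ fun i _ => Finset.measurable_fun_sum _ fun j _ => ?_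
  have h1 := hameas i j
  have h2 := hb i
  exact (h1.abs.div (by fun_prop)).add (h2.abs.div (by fun_prop))

/-- A dominating function for the coefficients tested against the cutoff functions. -/
def dominant (C : ℝ) (a : Fin d → Fin d → ℝ × Rd d → ℝ) (b : Fin d → ℝ × Rd d → ℝ)
    (c : ℝ × Rd d → ℝ) (z : ℝ × Rd d) : ℝ := 2 * C * growth a b z + |c z|

lemma sum_abs_mul_add_le {C : ℝ} (hC : 0 ≤ C) {z : ℝ × Rd d} {D : Fin d → ℝ}
    {H : Fin d → Fin d → ℝ} (hD : ∀ i, |D i| ≤ C / (1 + ‖z.2‖))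
    (hH : ∀ i j, |H i j| ≤ C / (1 + ‖z.2‖ ^ 2)) :
    ∑ i, ∑ j, |a i j z| * |H i j| + ∑ i, |b i z| * |D i| ≤ 2 * C * growth a b z := by
  have h1 : ∑ i, ∑ j, |a i j z| * |H i j| ≤ C * growth a b z := by
    rw [growth, Finset.mul_sum]
    refine Finset.sum_le_sum fun i _ => ?_
    rw [Finset.mul_sum]
    refine Finset.sum_le_sum fun j _ => ?_
    have h3 := mul_le_mul_of_nonneg_left (hH i j) (abs_nonneg (a i j z))
    have h4 : 0 ≤ C * (|b i z| / (1 + ‖z.2‖)) := by positivity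
    have h5 : |a i j z| * (C / (1 + ‖z.2‖ ^ 2)) = C * (|a i j z| / (1 + ‖z.2‖ ^ 2)) := by ring
    linarith
  have h2 : ∑ i, |b i z| * |D i| ≤ C * growth a b z := by
    rw [growth, Finset.mul_sum]
    refine Finset.sum_le_sum fun i _ => ?_
    have h3 := mul_le_mul_of_nonneg_left (hD i) (abs_nonneg (b i z))
    have h4 : |a i i z| / (1 + ‖z.2‖ ^ 2) + |b i z| / (1 + ‖z.2‖)
        ≤ ∑ j, (|a i j z| / (1 + ‖z.2‖ ^ 2) + |b i z| / (1 + ‖z.2‖)) :=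
      Finset.single_le_sum (f := fun j => |a i j z| / (1 + ‖z.2‖ ^ 2) + |b i z| / (1 + ‖z.2‖))
        (fun j _ => by positivity) (Finset.mem_univ i)
    have h5 : 0 ≤ |a i i z| / (1 + ‖z.2‖ ^ 2) := by positivity
    calc |b i z| * |D i| ≤ C * (|b i z| / (1 + ‖z.2‖)) := by
          refine h3.trans_eq ?_
          ring
      _ ≤ _ := mul_le_mul_of_nonneg_left (by linarith) hC
  linarith

end Comparison

section Uniqueness

open ProbabilityTheory

variable {d : ℕ} {T t : ℝ} {a : Fin d → Fin d → ℝ × Rd d → ℝ}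
  {b : Fin d → ℝ × Rd d → ℝ} {c : ℝ × Rd d → ℝ} {ν : Measure (Rd d)} {μ μ' : ℝ → Measure (Rd d)}

lemma measurable_dominant {C : ℝ} (hameas : ∀ i j, Measurable (a i j))
    (hb : ∀ i, Measurable (b i)) (hc : Measurable c) : Measurable (dominant C a b c) :=
  ((measurable_growth hameas hb).const_mul _).add hc.abs

lemma dominant_nonneg {C : ℝ} (hC : 0 ≤ C) (z : ℝ × Rd d) : 0 ≤ dominant C a b c z :=
  add_nonneg (mul_nonneg (by linarith) (growth_nonneg z)) (abs_nonneg _)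

lemma MemSP.lintegral_pot (h : MemSP T a b c ν μ) :
    ∫⁻ s in Icc 0 T, ∫⁻ y, ENNReal.ofReal |c (s, y)| ∂(pathKernel T μ h.1 s) < ⊤ := by
  rw [h.lintegral_pathKernel]
  exact h.2.2.2.2.2.2.1

lemma MemSP.lintegral_dominant (h : MemSP T a b c ν μ) {C : ℝ} (hC : 0 ≤ C)
    (hameas : ∀ i j, Measurable (a i j)) (hb : ∀ i, Measurable (b i)) (hc : Measurable c)
    (hμint : ∀ i j : Fin d, ∫⁻ t in Set.Icc (0 : ℝ) T, ∫⁻ x,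
      ENNReal.ofReal (|a i j (t, x)| / (1 + ‖x‖ ^ 2) + |b i (t, x)| / (1 + ‖x‖)) ∂(μ t) < ⊤) :
    ∫⁻ s in Icc 0 T, ∫⁻ y, ENNReal.ofReal |dominant C a b c (s, y)| ∂(pathKernel T μ h.1 s)
      < ⊤ := by
  have := h.isFiniteKernel
  set κ := pathKernel T μ h.1
  have hm : ∀ i j, Measurable fun z : ℝ × Rd d => ENNReal.ofReal
      (|a i j z| / (1 + ‖z.2‖ ^ 2) + |b i z| / (1 + ‖z.2‖)) := fun i j => by
    have h1 := hameas i j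
    have h2 := hb i
    exact ((h1.abs.div (by fun_prop)).add (h2.abs.div (by fun_prop))).ennreal_ofReal
  have hm' : ∀ i j s, Measurable fun y : Rd d => ENNReal.ofReal
      (|a i j (s, y)| / (1 + ‖y‖ ^ 2) + |b i (s, y)| / (1 + ‖y‖)) := fun i j s =>
    (hm i j).comp (by fun_prop : Measurable fun y : Rd d => (s, y))
  have hi : ∀ i j, Measurable fun s => ∫⁻ y, ENNReal.ofReal
      (|a i j (s, y)| / (1 + ‖y‖ ^ 2) + |b i (s, y)| / (1 + ‖y‖)) ∂(κ s) := fun i j =>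
    (hm i j).lintegral_kernel_prod_right'
  have hcm : Measurable fun z => ENNReal.ofReal |c z| := hc.abs.ennreal_ofReal
  have hcm' : ∀ s, Measurable fun y => ENNReal.ofReal |c (s, y)| := fun s =>
    hcm.comp (by fun_prop : Measurable fun y : Rd d => (s, y))
  have key : ∀ s y, ENNReal.ofReal |dominant C a b c (s, y)| = ENNReal.ofReal (2 * C) *
      (∑ i, ∑ j, ENNReal.ofReal (|a i j (s, y)| / (1 + ‖y‖ ^ 2) + |b i (s, y)| / (1 + ‖y‖)))
        + ENNReal.ofReal |c (s, y)| := fun s y => by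
    rw [abs_of_nonneg (dominant_nonneg hC _), dominant,
      ENNReal.ofReal_add (mul_nonneg (by linarith) (growth_nonneg _)) (abs_nonneg _),
      ENNReal.ofReal_mul (by linarith), growth,
      ENNReal.ofReal_sum_of_nonneg fun i _ => Finset.sum_nonneg fun j _ => by positivity]
    congr 2
    refine Finset.sum_congr rfl fun i _ => ?_
    rw [ENNReal.ofReal_sum_of_nonneg fun j _ => by positivity]
  have hin : ∀ s, ∫⁻ y, ENNReal.ofReal |dominant C a b c (s, y)| ∂(κ s)
      = ENNReal.ofReal (2 * C) * (∑ i, ∑ j, ∫⁻ y, ENNReal.ofReal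
        (|a i j (s, y)| / (1 + ‖y‖ ^ 2) + |b i (s, y)| / (1 + ‖y‖)) ∂(κ s))
        + ∫⁻ y, ENNReal.ofReal |c (s, y)| ∂(κ s) := fun s => by
    simp_rw [key]
    rw [lintegral_add_right _ (hcm' s), lintegral_const_mul _
      (Finset.measurable_fun_sum _ fun i _ => Finset.measurable_fun_sum _ fun j _ => hm' i j s),
      lintegral_finsetSum _ fun i _ => Finset.measurable_fun_sum _ fun j _ => hm' i j s]
    congr 2
    exact Finset.sum_congr rfl fun i _ => lintegral_finsetSum _ fun j _ => hm' i j s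
  simp_rw [hin]
  rw [lintegral_add_right _ hcm.lintegral_kernel_prod_right', lintegral_const_mul _
      (Finset.measurable_fun_sum _ fun i _ => Finset.measurable_fun_sum _ fun j _ => hi i j),
      lintegral_finsetSum _ fun i _ => Finset.measurable_fun_sum _ fun j _ => hi i j]
  refine ENNReal.add_lt_top.2 ⟨ENNReal.mul_lt_top ENNReal.ofReal_lt_top
    (ENNReal.sum_lt_top.2 fun i _ => ?_), h.lintegral_pot⟩
  rw [lintegral_finsetSum _ fun j _ => hi i j]
  refine ENNReal.sum_lt_top.2 fun j _ => ?_
  rw [h.lintegral_pathKernel]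
  exact hμint i j

lemma IsTest.measurable_comp_snd {φ : Rd d → ℝ} (hφ : IsTest φ) :
    Measurable fun z : ℝ × Rd d => φ z.2 := hφ.continuous.measurable.comp measurable_snd

lemma measurable_L0 (hameas : ∀ i j, Measurable (a i j)) (hb : ∀ i, Measurable (b i))
    (hc : Measurable c) {φ : Rd d → ℝ} (hφ : IsTest φ) : Measurable (L0 a b c φ) := by
  have h1 : ∀ i j, Measurable fun z : ℝ × Rd d => pd2 i j φ z.2 := fun i j =>
    ((hφ.pd j).pd i).measurable_comp_snd
  exact ((Finset.measurable_fun_sum _ fun i _ => Finset.measurable_fun_sum _ fun j _ =>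
    (hameas i j).mul (h1 i j)).add (Finset.measurable_fun_sum _ fun i _ =>
      (hb i).mul (hφ.pd i).measurable_comp_snd)).add (hc.mul hφ.measurable_comp_snd)

lemma abs_L0_cutoff_le {C : ℝ} (hC : 0 ≤ C)
    (h1 : ∀ (n : ℕ) (i : Fin d) (x : Rd d), |pd i (cutoff n) x| ≤ C / (1 + ‖x‖))
    (h2 : ∀ (n : ℕ) (i j : Fin d) (x : Rd d),
      |pd i (pd j (cutoff n)) x| ≤ C / (1 + ‖x‖ ^ 2)) (n : ℕ) (z : ℝ × Rd d) :
    |L0 a b c (cutoff n) z| ≤ |dominant C a b c z| := by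
  rw [abs_of_nonneg (dominant_nonneg hC z)]
  refine (abs_add_le _ _).trans (add_le_add ((abs_add_le _ _).trans
    (le_trans (add_le_add ?_ ?_) (sum_abs_mul_add_le hC (fun i => h1 n i z.2)
      fun i j => h2 n i j z.2))) ?_)
  · refine (Finset.abs_sum_le_sum_abs _ _).trans (Finset.sum_le_sum fun i _ =>
      (Finset.abs_sum_le_sum_abs _ _).trans (Finset.sum_le_sum fun j _ => ?_))
    rw [abs_mul, pd2_eq]
  · refine (Finset.abs_sum_le_sum_abs _ _).trans (Finset.sum_le_sum fun i _ => ?_)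
    rw [abs_mul]
  · rw [abs_mul]
    exact mul_le_of_le_one_right (abs_nonneg _) (abs_cutoff_le_one n z.2)

lemma tendsto_L0_cutoff (z : ℝ × Rd d) :
    Filter.Tendsto (fun n => L0 a b c (cutoff n) z) Filter.atTop (nhds (c z)) := by
  have h : Filter.Tendsto (fun n => L0 a b c (cutoff n) z) Filter.atTop
      (nhds (∑ i, ∑ j, a i j z * 0 + ∑ i, b i z * 0 + c z * 1)) :=
    ((tendsto_finsetSum _ fun i _ => tendsto_finsetSum _ fun j _ =>
      (tendsto_pd_pd_cutoff i j z.2).const_mul _).add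
      (tendsto_finsetSum _ fun i _ => (tendsto_pd_cutoff i z.2).const_mul _)).add
      ((tendsto_cutoff z.2).const_mul _)
  simpa using h

lemma tendsto_integral_cutoff_mul {ρ : Measure (Rd d)} {f : Rd d → ℝ} (hf : Integrable f ρ) :
    Filter.Tendsto (fun n => ∫ y, cutoff n y * f y ∂ρ) Filter.atTop (nhds (∫ y, f y ∂ρ)) := by
  refine tendsto_integral_of_dominated_convergence (fun y => |f y|)
    (fun n => (isTest_cutoff n).continuous.aestronglyMeasurable.mul hf.aestronglyMeasurable) hf.abs
    (fun n => ae_of_all _ fun y => ?_) (ae_of_all _ fun y => ?_)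
  · rw [Real.norm_eq_abs, abs_mul]
    exact mul_le_of_le_one_left (abs_nonneg _) (abs_cutoff_le_one n y)
  · simpa using (tendsto_cutoff y).mul_const (f y)

lemma tendsto_integral_cutoff (ρ : Measure (Rd d)) [IsFiniteMeasure ρ] :
    Filter.Tendsto (fun n => ∫ y, cutoff n y ∂ρ) Filter.atTop (nhds (ρ univ).toReal) := by
  have h := tendsto_integral_cutoff_mul (integrable_const (1 : ℝ) (μ := ρ))
  simpa [Measure.real] using h

lemma MemSP.isFiniteMeasure (h : MemSP T a b c ν μ) (ht : t ∈ Icc 0 T) : IsFiniteMeasure (μ t) :=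
  ⟨(h.2.1 t ht).trans_lt ENNReal.one_lt_top⟩

/-- A solution which is integrable against the growth of the coefficients loses no mass at
infinity. -/
lemma MemSP.mass_eq (h : MemSP T a b c ν μ) [IsProbabilityMeasure ν]
    (hameas : ∀ i j, Measurable (a i j)) (hb : ∀ i, Measurable (b i)) (hc : Measurable c)
    (hμint : ∀ i j : Fin d, ∫⁻ t in Set.Icc (0 : ℝ) T, ∫⁻ x,
      ENNReal.ofReal (|a i j (t, x)| / (1 + ‖x‖ ^ 2) + |b i (t, x)| / (1 + ‖x‖)) ∂(μ t) < ⊤) :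
    ∀ᵐ t ∂(volume.restrict (Icc 0 T)),
      (μ t univ).toReal = 1 + ∫ s in (0 : ℝ)..t, ∫ y, c (s, y) ∂(μ s) := by
  have := h.isFiniteKernel
  obtain ⟨C, hC, h1, h2⟩ := exists_pd_cutoff_le d
  filter_upwards [ae_all_iff.2 fun n : ℕ => h.2.2.2.2.2.1 (cutoff n) (isTest_cutoff n),
    ae_restrict_mem measurableSet_Icc] with t ht htT
  have := h.isFiniteMeasure htT
  have h3 := tendsto_integral_kernel (κ := pathKernel T μ h.1)
    (fun n => measurable_L0 hameas hb hc (isTest_cutoff n)) (measurable_dominant hameas hb hc)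
    (h.lintegral_dominant hC hameas hb hc hμint) (abs_L0_cutoff_le hC h1 h2) tendsto_L0_cutoff htT
  simp_rw [h.integral_pathKernel htT] at h3
  have h4 := (tendsto_integral_cutoff ν).add h3
  rw [measure_univ, ENNReal.toReal_one] at h4
  exact tendsto_nhds_unique ((tendsto_integral_cutoff (μ t)).congr ht) h4

/-- The integrand of the production rate of the first solution. -/
def rateDens (a : Fin d → Fin d → ℝ × Rd d → ℝ) (b : Fin d → ℝ × Rd d → ℝ) (c : ℝ × Rd d → ℝ)
    (ψ : Rd d → ℝ) (z : ℝ × Rd d) : ℝ :=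
  ∑ i, ∑ j, |a i j z| * |pd j (pd i ψ) z.2| + ∑ i, |b i z| * |pd i ψ z.2|
    + 3 / 4 * (c z * ψ z.2)

lemma measurable_rateDens (hameas : ∀ i j, Measurable (a i j)) (hb : ∀ i, Measurable (b i))
    (hc : Measurable c) {φ : Rd d → ℝ} (hφ : IsTest φ) : Measurable (rateDens a b c φ) :=
  ((Finset.measurable_fun_sum _ fun i _ => Finset.measurable_fun_sum _ fun j _ =>
    (hameas i j).abs.mul ((hφ.pd i).pd j).measurable_comp_snd.abs).add
    (Finset.measurable_fun_sum _ fun i _ => (hb i).abs.mul (hφ.pd i).measurable_comp_snd.abs)).add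
    ((hc.mul hφ.measurable_comp_snd).const_mul _)

lemma abs_rateDens_cutoff_le {C : ℝ} (hC : 0 ≤ C)
    (h1 : ∀ (n : ℕ) (i : Fin d) (x : Rd d), |pd i (cutoff n) x| ≤ C / (1 + ‖x‖))
    (h2 : ∀ (n : ℕ) (i j : Fin d) (x : Rd d),
      |pd i (pd j (cutoff n)) x| ≤ C / (1 + ‖x‖ ^ 2)) (n : ℕ) (z : ℝ × Rd d) :
    |rateDens a b c (cutoff n) z| ≤ |dominant C a b c z| := by
  rw [abs_of_nonneg (dominant_nonneg hC z)]
  refine (abs_add_le _ _).trans (add_le_add (le_trans (le_of_eq (abs_of_nonneg ?_)) ?_) ?_)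
  · exact add_nonneg (Finset.sum_nonneg fun i _ => Finset.sum_nonneg fun j _ => by positivity)
      (Finset.sum_nonneg fun i _ => by positivity)
  · exact sum_abs_mul_add_le hC (fun i => h1 n i z.2) fun i j => h2 n j i z.2
  · rw [abs_mul, abs_mul, abs_of_pos (by norm_num : (0 : ℝ) < 3 / 4)]
    have := mul_le_of_le_one_right (abs_nonneg (c z)) (abs_cutoff_le_one n z.2)
    have h4 := abs_nonneg (c z)
    linarith

lemma tendsto_rateDens_cutoff (z : ℝ × Rd d) :
    Filter.Tendsto (fun n => rateDens a b c (cutoff n) z) Filter.atTop (nhds (3 / 4 * c z)) := by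
  have h : Filter.Tendsto (fun n => rateDens a b c (cutoff n) z) Filter.atTop
      (nhds (∑ i, ∑ j, |a i j z| * |0| + ∑ i, |b i z| * |0| + 3 / 4 * (c z * 1))) :=
    ((tendsto_finsetSum _ fun i _ => tendsto_finsetSum _ fun j _ =>
      (tendsto_pd_pd_cutoff j i z.2).abs.const_mul _).add
      (tendsto_finsetSum _ fun i _ => (tendsto_pd_cutoff i z.2).abs.const_mul _)).add
      (((tendsto_cutoff z.2).const_mul _).const_mul _)
  simpa using h

end Uniqueness

section MainTheorem

open ProbabilityTheory

variable {d : ℕ} {T t : ℝ} {a : Fin d → Fin d → ℝ × Rd d → ℝ}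
  {b : Fin d → ℝ × Rd d → ℝ} {c : ℝ × Rd d → ℝ} {ν : Measure (Rd d)} {μ μ' : ℝ → Measure (Rd d)}

lemma integral_rateDens_eq {ρ : Measure (Rd d)} {C s : ℝ} (hC : 0 ≤ C)
    (h1 : ∀ (n : ℕ) (i : Fin d) (x : Rd d), |pd i (cutoff n) x| ≤ C / (1 + ‖x‖))
    (h2 : ∀ (n : ℕ) (i j : Fin d) (x : Rd d), |pd i (pd j (cutoff n)) x| ≤ C / (1 + ‖x‖ ^ 2))
    (hameas : ∀ i j, Measurable (a i j)) (hb : ∀ i, Measurable (b i)) (hc : Measurable c)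
    (hG : Integrable (timeSlice (dominant C a b c) s) ρ) (n : ℕ) :
    ∫ y, rateDens a b c (cutoff n) (s, y) ∂ρ
      = ∑ i, ∑ j, ∫ y, |a i j (s, y)| * |pd j (pd i (cutoff n)) y| ∂ρ
        + ∑ i, ∫ y, |b i (s, y)| * |pd i (cutoff n) y| ∂ρ
        + 3 / 4 * ∫ y, c (s, y) * cutoff n y ∂ρ := by
  have hs : Measurable fun y : Rd d => (s, y) := by fun_prop
  have hle : ∀ y : Rd d, ∑ i, ∑ j, |a i j (s, y)| * |pd j (pd i (cutoff n)) y|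
      + ∑ i, |b i (s, y)| * |pd i (cutoff n) y| ≤ dominant C a b c (s, y) := fun y =>
    (sum_abs_mul_add_le (z := (s, y)) hC (fun i => h1 n i y) fun i j => h2 n j i y).trans
      (le_add_of_nonneg_right (abs_nonneg _))
  have hA0 : ∀ (i j : Fin d) (y : Rd d), 0 ≤ |a i j (s, y)| * |pd j (pd i (cutoff n)) y| :=
    fun i j y => by positivity
  have hB0 : ∀ (i : Fin d) (y : Rd d), 0 ≤ |b i (s, y)| * |pd i (cutoff n) y| :=
    fun i y => by positivity
  have hA : ∀ i j, Integrable (fun y => |a i j (s, y)| * |pd j (pd i (cutoff n)) y|) ρ := by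
    refine fun i j => hG.mono' (((hameas i j).comp hs).abs.mul
      (((isTest_cutoff n).pd i).pd j).continuous.measurable.abs).aestronglyMeasurable
      (ae_of_all _ fun y => ?_)
    rw [Real.norm_of_nonneg (hA0 i j y)]
    refine le_trans ?_ (hle y)
    refine le_add_of_le_of_nonneg ?_ (Finset.sum_nonneg fun i _ => hB0 i y)
    exact (Finset.single_le_sum (f := fun j => |a i j (s, y)| * |pd j (pd i (cutoff n)) y|)
      (fun j _ => hA0 i j y) (Finset.mem_univ j)).trans
      (Finset.single_le_sum (f := fun i => ∑ j, |a i j (s, y)| * |pd j (pd i (cutoff n)) y|)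
      (fun i _ => Finset.sum_nonneg fun j _ => hA0 i j y) (Finset.mem_univ i))
  have hB : ∀ i, Integrable (fun y => |b i (s, y)| * |pd i (cutoff n) y|) ρ := by
    refine fun i => hG.mono' (((hb i).comp hs).abs.mul
      ((isTest_cutoff n).pd i).continuous.measurable.abs).aestronglyMeasurable
      (ae_of_all _ fun y => ?_)
    rw [Real.norm_of_nonneg (hB0 i y)]
    refine le_trans ?_ (hle y)
    refine le_add_of_nonneg_of_le (Finset.sum_nonneg fun i _ => Finset.sum_nonneg fun j _ =>
      hA0 i j y) ?_
    exact Finset.single_le_sum (f := fun i => |b i (s, y)| * |pd i (cutoff n) y|)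
      (fun i _ => hB0 i y) (Finset.mem_univ i)
  have hP : Integrable (fun y => c (s, y) * cutoff n y) ρ := by
    refine hG.mono' ((hc.comp hs).mul
      (isTest_cutoff n).continuous.measurable).aestronglyMeasurable (ae_of_all _ fun y => ?_)
    rw [Real.norm_eq_abs, abs_mul]
    refine (mul_le_of_le_one_right (abs_nonneg _) (abs_cutoff_le_one n y)).trans ?_
    exact le_add_of_nonneg_left (mul_nonneg (by linarith) (growth_nonneg _))
  have hA' : Integrable (fun y => ∑ i, ∑ j, |a i j (s, y)| * |pd j (pd i (cutoff n)) y|) ρ :=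
    integrable_finsetSum _ fun i _ => integrable_finsetSum _ fun j _ => hA i j
  have hB' : Integrable (fun y => ∑ i, |b i (s, y)| * |pd i (cutoff n) y|) ρ :=
    integrable_finsetSum _ fun i _ => hB i
  have hP' : Integrable (fun y => 3 / 4 * (c (s, y) * cutoff n y)) ρ := hP.const_mul _
  have hAB : Integrable (fun y => ∑ i, ∑ j, |a i j (s, y)| * |pd j (pd i (cutoff n)) y|
      + ∑ i, |b i (s, y)| * |pd i (cutoff n) y|) ρ := hA'.add hB'
  simp only [rateDens]
  rw [integral_add hAB hP', integral_add hA' hB', integral_const_mul,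
    integral_finsetSum _ fun i _ => integrable_finsetSum _ fun j _ => hA i j,
    integral_finsetSum _ fun i _ => hB i]
  congr 2
  exact Finset.sum_congr rfl fun i _ => integral_finsetSum _ fun j _ => hA i j

lemma setIntegral_ball_eq_integral {ρ : Measure (Rd d)} {R : ℝ} {ψ f : Rd d → ℝ}
    (hψ : tsupport ψ ⊆ Metric.ball 0 R) (hf : ∀ y ∉ tsupport ψ, f y = 0) :
    ∫ y in Metric.ball (0 : Rd d) R, f y ∂ρ = ∫ y, f y ∂ρ :=
  setIntegral_eq_integral_of_forall_compl_eq_zero fun y hy => hf y fun h => hy (hψ h)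

lemma frozenMain_restrict_ball {ρ1 ρ2 : Measure (Rd d)} {R s : ℝ} {ψ : Rd d → ℝ}
    (hψ : tsupport ψ ⊆ Metric.ball 0 R) :
    frozenMain (ρ1.restrict (Metric.ball 0 R)) (ρ2.restrict (Metric.ball 0 R))
        (fun i j => timeSlice (cutCoeff R a i j) s) (fun i => timeSlice (b i) s) (timeSlice c s) ψ
      = ∑ i, ∑ j, ∫ y, |a i j (s, y)| * |pd j (pd i ψ) y| ∂ρ1
        + ∑ i, ∫ y, |b i (s, y)| * |pd i ψ y| ∂ρ1
        + (3 / 4 * ∫ y, c (s, y) * ψ y ∂ρ1 - 1 / 4 * ∫ y, c (s, y) * ψ y ∂ρ2) := by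
  have h3 : ∀ ρ : Measure (Rd d), ∫ y in Metric.ball (0 : Rd d) R, c (s, y) * ψ y ∂ρ
      = ∫ y, c (s, y) * ψ y ∂ρ := fun ρ => setIntegral_ball_eq_integral hψ fun y hy => by
    rw [image_eq_zero_of_notMem_tsupport hy, mul_zero]
  rw [frozenMain, h3, h3]
  congr 2
  · refine Finset.sum_congr rfl fun i _ => Finset.sum_congr rfl fun j _ => ?_
    refine (setIntegral_congr_fun measurableSet_ball fun y hy => ?_).trans
      (setIntegral_ball_eq_integral hψ fun y hy => by
        rw [pd_pd_eq_zero_of_notMem_tsupport hy, abs_zero, mul_zero])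
    simp only [timeSlice, cutCoeff_apply hy]
  · refine Finset.sum_congr rfl fun i _ => setIntegral_ball_eq_integral hψ fun y hy => ?_
    rw [pd_eq_zero_of_notMem_tsupport hy, abs_zero, mul_zero]

/-- The localized comparison inequality for two solutions, the first of which is integrable
against the growth of the coefficients. -/
lemma MemSP.cutoff_inequality [IsProbabilityMeasure ν] {C : ℝ} (hC : 0 ≤ C)
    (h1 : ∀ (n : ℕ) (i : Fin d) (x : Rd d), |pd i (cutoff n) x| ≤ C / (1 + ‖x‖))
    (h2 : ∀ (n : ℕ) (i j : Fin d) (x : Rd d), |pd i (pd j (cutoff n)) x| ≤ C / (1 + ‖x‖ ^ 2))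
    (h : MemSP T a b c ν μ) (h' : MemSP T a b c ν μ') (hT : 0 < T)
    (hameas : ∀ i j, Measurable (a i j)) (hb : ∀ i, Measurable (b i)) (hc : Measurable c)
    (hc0 : ∀ z, c z ≤ 0) (hasymm : ∀ i j z, a i j z = a j i z)
    (hapos : ∀ z : ℝ × Rd d, ∀ ξ : Fin d → ℝ, 0 ≤ ∑ i, ∑ j, a i j z * ξ i * ξ j)
    (hH1 : CondH1 T a) (hH2 : CondH2 T a)
    (hμint : ∀ i j : Fin d, ∫⁻ t in Set.Icc (0 : ℝ) T, ∫⁻ x,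
      ENNReal.ofReal (|a i j (t, x)| / (1 + ‖x‖ ^ 2) + |b i (t, x)| / (1 + ‖x‖)) ∂(μ t) < ⊤)
    (n : ℕ) : ∀ᵐ t ∂(volume.restrict (Icc 0 T)), ∀ f : Rd d → ℝ, Continuous f →
      2 * (∫ y, cutoff n y * f y ∂(μ t)) - (∫ y, cutoff n y * f y ^ 2 ∂(μ t))
          - ∫ y, cutoff n y * f y ^ 2 ∂(μ' t)
        ≤ 1 / 2 * (∫ y, cutoff n y ∂ν)
          + ((∫ s in (0 : ℝ)..t, ∫ y, rateDens a b c (cutoff n) (s, y) ∂(μ s))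
          - 1 / 4 * ∫ s in (0 : ℝ)..t, ∫ y, c (s, y) * cutoff n y ∂(μ' s)) := by
  have := h.isFiniteKernel
  have := h'.isFiniteKernel
  have hr : (0 : ℝ) < 2 * n + 3 := by positivity
  have hR : (0 : ℝ) < 2 * n + 3 + 2 := by positivity
  obtain ⟨γ, K, Λ, ha⟩ := exists_frozenCoeff hr hameas hasymm hapos hH1 hH2
  have hψs := tsupport_cutoff_subset_ball (d := d) n
  have hψR : tsupport (cutoff (d := d) n) ⊆ Metric.ball 0 (2 * n + 3 + 2) :=
    hψs.trans (Metric.ball_subset_ball (by linarith))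
  have hmain := ((h.localSol hr hameas hb hc ha).integral_le (h'.localSol hr hameas hb hc ha) hT hc0
    (h.ae_absolutelyContinuous hT hameas hb hc hasymm hapos hH1 hH2 hR)
    (h'.ae_absolutelyContinuous hT hameas hb hc hasymm hapos hH1 hH2 hR)
    (isTest_cutoff n) (cutoff_nonneg n) hψs).2
  have hQ := measurable_rateDens hameas hb hc (isTest_cutoff n)
  have hP : Measurable fun z : ℝ × Rd d => c z * cutoff n z.2 :=
    hc.mul (isTest_cutoff n).measurable_comp_snd
  have hQi := integrable_integral_kernel (κ := pathKernel T μ h.1) hQ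
    (measurable_dominant hameas hb hc) (h.lintegral_dominant hC hameas hb hc hμint)
    (abs_rateDens_cutoff_le hC h1 h2 n)
  have hPi := integrable_integral_kernel (κ := pathKernel T μ' h'.1) hP hc h'.lintegral_pot
    fun z => by
      rw [abs_mul]
      exact mul_le_of_le_one_right (abs_nonneg _) (abs_cutoff_le_one n z.2)
  have hrate : ∀ᵐ s ∂(volume.restrict (Icc 0 T)),
      mainRate (h.ballKernel (2 * n + 3 + 2)) (h'.ballKernel (2 * n + 3 + 2))
        (cutCoeff (2 * n + 3 + 2) a) b c (cutoff n) s
      = (∫ y, rateDens a b c (cutoff n) (s, y) ∂(pathKernel T μ h.1 s))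
        - 1 / 4 * ∫ y, c (s, y) * cutoff n y ∂(pathKernel T μ' h'.1 s) := by
    filter_upwards [(integrable_of_lintegral_kernel_lt_top (measurable_dominant hameas hb hc)
      (h.lintegral_dominant hC hameas hb hc hμint)).1, ae_restrict_mem measurableSet_Icc]
      with s hs hsT
    rw [integral_rateDens_eq hC h1 h2 hameas hb hc hs, mainRate, h.ballKernel_apply hsT,
      h'.ballKernel_apply hsT, frozenMain_restrict_ball hψR, pathKernel_apply _ hsT,
      pathKernel_apply _ hsT]
    ring
  filter_upwards [hmain, ae_restrict_mem measurableSet_Icc] with t ht htT f hf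
  have h3 := ht f hf
  have hsub : Ioc 0 t ⊆ Icc 0 T := fun x hx => ⟨hx.1.le, hx.2.trans htT.2⟩
  have hQi' := (intervalIntegrable_iff_integrableOn_Ioc_of_le htT.1).2 (hQi.mono_set hsub)
  have hPi' := (intervalIntegrable_iff_integrableOn_Ioc_of_le htT.1).2 (hPi.mono_set hsub)
  have hcut : ∀ (ρ : Measure (Rd d)) (g : Rd d → ℝ),
      ∫ y in Metric.ball (0 : Rd d) (2 * n + 3 + 2), cutoff n y * g y ∂ρ
        = ∫ y, cutoff n y * g y ∂ρ := fun ρ g => setIntegral_ball_eq_integral hψR fun y hy => by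
    rw [image_eq_zero_of_notMem_tsupport hy, zero_mul]
  have hint : ∫ s in (0 : ℝ)..t, mainRate (h.ballKernel (2 * n + 3 + 2))
      (h'.ballKernel (2 * n + 3 + 2)) (cutCoeff (2 * n + 3 + 2) a) b c (cutoff n) s
      = ∫ s in (0 : ℝ)..t, ((∫ y, rateDens a b c (cutoff n) (s, y) ∂(pathKernel T μ h.1 s))
        - 1 / 4 * ∫ y, c (s, y) * cutoff n y ∂(pathKernel T μ' h'.1 s)) :=
    intervalIntegral.integral_congr_ae_restrict (by
      rw [uIoc_of_le htT.1]
      exact ae_mono (Measure.restrict_mono hsub le_rfl) hrate)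
  rw [h.ballKernel_apply htT, h'.ballKernel_apply htT, hcut, hcut, hcut, hint,
    intervalIntegral.integral_sub hQi' (hPi'.const_mul _), intervalIntegral.integral_const_mul,
    h.integral_pathKernel htT,
    h'.integral_pathKernel htT (fun z => c z * cutoff n z.2)] at h3
  exact h3

lemma integrable_sq_boundedContinuous (f : BoundedContinuousFunction (Rd d) ℝ) (ρ : Measure (Rd d))
    [IsFiniteMeasure ρ] : Integrable (fun y => f y ^ 2) ρ :=
  ((f * f).integrable ρ).congr (ae_of_all _ fun y => (sq (f y)).symm)

lemma MemSP.comparison_inequality [IsProbabilityMeasure ν]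
    (h : MemSP T a b c ν μ) (h' : MemSP T a b c ν μ') (hT : 0 < T)
    (hameas : ∀ i j, Measurable (a i j)) (hb : ∀ i, Measurable (b i)) (hc : Measurable c)
    (hc0 : ∀ z, c z ≤ 0) (hasymm : ∀ i j z, a i j z = a j i z)
    (hapos : ∀ z : ℝ × Rd d, ∀ ξ : Fin d → ℝ, 0 ≤ ∑ i, ∑ j, a i j z * ξ i * ξ j)
    (hH1 : CondH1 T a) (hH2 : CondH2 T a)
    (hμint : ∀ i j : Fin d, ∫⁻ t in Set.Icc (0 : ℝ) T, ∫⁻ x,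
      ENNReal.ofReal (|a i j (t, x)| / (1 + ‖x‖ ^ 2) + |b i (t, x)| / (1 + ‖x‖)) ∂(μ t) < ⊤) :
    ∀ᵐ t ∂(volume.restrict (Icc 0 T)), ∀ f : BoundedContinuousFunction (Rd d) ℝ,
      2 * (∫ y, f y ∂(μ t)) - (∫ y, f y ^ 2 ∂(μ t)) - ∫ y, f y ^ 2 ∂(μ' t)
        ≤ 1 / 2 + (3 / 4 * (∫ s in (0 : ℝ)..t, ∫ y, c (s, y) ∂(μ s))
          - 1 / 4 * ∫ s in (0 : ℝ)..t, ∫ y, c (s, y) ∂(μ' s)) := by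
  have := h.isFiniteKernel
  have := h'.isFiniteKernel
  obtain ⟨C, hC, h1, h2⟩ := exists_pd_cutoff_le d
  filter_upwards [ae_all_iff.2 (h.cutoff_inequality hC h1 h2 h' hT hameas hb hc hc0 hasymm hapos
    hH1 hH2 hμint), ae_restrict_mem measurableSet_Icc] with t ht htT f
  have := h.isFiniteMeasure htT
  have := h'.isFiniteMeasure htT
  have hQ := tendsto_integral_kernel (κ := pathKernel T μ h.1)
    (fun n => measurable_rateDens hameas hb hc (isTest_cutoff n)) (measurable_dominant hameas hb hc)
    (h.lintegral_dominant hC hameas hb hc hμint) (abs_rateDens_cutoff_le hC h1 h2)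
    tendsto_rateDens_cutoff htT
  have hP := tendsto_integral_kernel (κ := pathKernel T μ' h'.1)
    (F := fun n z => c z * cutoff n z.2) (f := c)
    (fun n => hc.mul (isTest_cutoff n).measurable_comp_snd) hc h'.lintegral_pot
    (fun n z => by
      rw [abs_mul]
      exact mul_le_of_le_one_right (abs_nonneg _) (abs_cutoff_le_one n z.2))
    (fun z => by simpa using (tendsto_cutoff z.2).const_mul (c z)) htT
  simp only [h.integral_pathKernel htT] at hQ
  rw [h.integral_pathKernel htT (fun z => 3 / 4 * c z)] at hQ
  simp only [integral_const_mul, intervalIntegral.integral_const_mul] at hQ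
  rw [h'.integral_pathKernel htT c] at hP
  simp only [fun n : ℕ => h'.integral_pathKernel htT (fun z => c z * cutoff n z.2)] at hP
  have hν := tendsto_integral_cutoff ν
  rw [measure_univ, ENNReal.toReal_one] at hν
  have hlim := (hν.const_mul (1 / 2)).add (hQ.sub (hP.const_mul (1 / 4)))
  rw [mul_one] at hlim
  have hf1 : Integrable (fun y => f y) (μ t) := f.integrable (μ t)
  exact le_of_tendsto_of_tendsto' ((((tendsto_integral_cutoff_mul hf1).const_mul 2).sub
    (tendsto_integral_cutoff_mul (integrable_sq_boundedContinuous f (μ t)))).sub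
    (tendsto_integral_cutoff_mul (integrable_sq_boundedContinuous f (μ' t)))) hlim fun n => ht n f f.continuous

lemma eq_of_forall_mul_le {x y S : ℝ} (h : ∀ k : ℝ, k * (x - y) ≤ k ^ 2 * S) : x = y := by
  by_contra hne
  have hp : 0 < (x - y) ^ 2 := by
    have := sub_ne_zero.2 hne
    positivity
  have hS : 0 < |S| + 1 := by positivity
  have h1 := h ((x - y) / (|S| + 1))
  have h2 : (x - y) / (|S| + 1) * (x - y) = (x - y) ^ 2 / (|S| + 1) := by ring
  have h3 : ((x - y) / (|S| + 1)) ^ 2 * S = (x - y) ^ 2 / (|S| + 1) * (S / (|S| + 1)) := by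
    field_simp
  rw [h2, h3] at h1
  have h4 : S / (|S| + 1) < 1 := (div_lt_one hS).2 (by linarith [le_abs_self S])
  have h5 : 0 < (x - y) ^ 2 / (|S| + 1) := by positivity
  nlinarith

lemma eq_of_forall_integral_le {ρ ρ' : Measure (Rd d)} [IsFiniteMeasure ρ] [IsFiniteMeasure ρ']
    {I I' : ℝ} (hρ : (ρ univ).toReal = 1 + I) (hρ' : (ρ' univ).toReal ≤ 1 + I')
    (h : ∀ f : BoundedContinuousFunction (Rd d) ℝ,
      2 * (∫ y, f y ∂ρ) - (∫ y, f y ^ 2 ∂ρ) - ∫ y, f y ^ 2 ∂ρ' ≤ 1 / 2 + (3 / 4 * I - 1 / 4 * I')) :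
    ρ' = ρ := by
  refine (ext_of_forall_integral_eq_of_IsFiniteMeasure fun g => ?_).symm
  refine eq_of_forall_mul_le (S := (∫ y, g y ^ 2 ∂ρ) + ∫ y, g y ^ 2 ∂ρ') fun k => ?_
  have h1 := h (BoundedContinuousFunction.const (Rd d) (1 / 2 : ℝ) + k • g)
  have e1 : ∫ y, (BoundedContinuousFunction.const (Rd d) (1 / 2 : ℝ) + k • g) y ∂ρ
      = 1 / 2 * (ρ univ).toReal + k * ∫ y, g y ∂ρ := by
    have i1 : Integrable (fun _ : Rd d => (1 / 2 : ℝ)) ρ := integrable_const _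
    have i2 : Integrable (fun y => k * g y) ρ := (g.integrable ρ).const_mul k
    simp only [BoundedContinuousFunction.add_apply, BoundedContinuousFunction.const_apply,
      BoundedContinuousFunction.smul_apply, smul_eq_mul]
    rw [integral_add i1 i2, integral_const_mul, integral_const, Measure.real, smul_eq_mul, mul_comm]
  have e2 : ∀ τ : Measure (Rd d), IsFiniteMeasure τ →
      ∫ y, (BoundedContinuousFunction.const (Rd d) (1 / 2 : ℝ) + k • g) y ^ 2 ∂τ
      = 1 / 4 * (τ univ).toReal + k * (∫ y, g y ∂τ) + k ^ 2 * ∫ y, g y ^ 2 ∂τ := fun τ _ => by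
    have i1 : Integrable (fun _ : Rd d => (1 / 4 : ℝ)) τ := integrable_const _
    have i2 : Integrable (fun y => k * g y) τ := (g.integrable τ).const_mul k
    have i3 : Integrable (fun y => k ^ 2 * g y ^ 2) τ := (integrable_sq_boundedContinuous g τ).const_mul _
    have i12 : Integrable (fun y => 1 / 4 + k * g y) τ := i1.add i2
    have e : ∀ y, (BoundedContinuousFunction.const (Rd d) (1 / 2 : ℝ) + k • g) y ^ 2
        = 1 / 4 + k * g y + k ^ 2 * g y ^ 2 := fun y => by
      simp only [BoundedContinuousFunction.add_apply, BoundedContinuousFunction.const_apply,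
        BoundedContinuousFunction.smul_apply, smul_eq_mul]
      ring
    simp_rw [e]
    rw [integral_add i12 i3, integral_add i1 i2, integral_const_mul, integral_const_mul,
      integral_const, Measure.real, smul_eq_mul, mul_comm (τ univ).toReal]
  rw [e1, e2 ρ inferInstance, e2 ρ' inferInstance] at h1
  linarith

end MainTheorem

/-- Under (H1), (H2) and local `L^p`-integrability of `b` and `c` for some
`p > d+2`, if some `(μ_t) ∈ 𝓢𝓟_ν` satisfies the global integrability condition
`|a^{ij}|/(1+|x|²) + |b^i|/(1+|x|) ∈ L¹([0,T] × ℝ^d, μ_t dt)`, then every element of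
`𝓢𝓟_ν` coincides with it a.e.; in particular `𝓢𝓟_ν` has exactly one element. -/
theorem fpk_uniqueness_lipschitz
    {d : ℕ} (T : ℝ) (hT : 0 < T)
    (a : Fin d → Fin d → ℝ × Rd d → ℝ) (b : Fin d → ℝ × Rd d → ℝ)
    (c : ℝ × Rd d → ℝ)
    (hameas : ∀ i j, Measurable (a i j)) (hbmeas : ∀ i, Measurable (b i))
    (hcmeas : Measurable c) (hc : ∀ z, c z ≤ 0)
    (hasymm : ∀ i j z, a i j z = a j i z)
    (hapos : ∀ z : ℝ × Rd d, ∀ ξ : Fin d → ℝ, 0 ≤ ∑ i, ∑ j, a i j z * ξ i * ξ j)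
    (hH1 : CondH1 T a) (hH2 : CondH2 T a)
    (p : ℝ) (hp : (d : ℝ) + 2 < p)
    (hbLp : ∀ i, MemLplocDtDx T p (b i)) (hcLp : MemLplocDtDx T (p / 2) c)
    (ν : Measure (Rd d)) [IsProbabilityMeasure ν]
    (μ : ℝ → Measure (Rd d)) (hμ : MemSP T a b c ν μ)
    (hμint : ∀ i j : Fin d,
      ∫⁻ t in Set.Icc (0 : ℝ) T, ∫⁻ x,
        ENNReal.ofReal (|a i j (t, x)| / (1 + ‖x‖ ^ 2) + |b i (t, x)| / (1 + ‖x‖))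
          ∂(μ t) < ⊤) :
    ∀ μ' : ℝ → Measure (Rd d), MemSP T a b c ν μ' →
      ∀ᵐ t ∂(volume.restrict (Set.Icc (0 : ℝ) T)), μ' t = μ t := by
  intro μ' hμ'
  filter_upwards [hμ.comparison_inequality hμ' hT hameas hbmeas hcmeas hc hasymm hapos hH1 hH2
    hμint, hμ.mass_eq hameas hbmeas hcmeas hμint, hμ'.2.2.2.2.2.2.2.2.2,
    ae_restrict_mem measurableSet_Icc] with t ht hmass hmass' htT
  have := hμ.isFiniteMeasure htT
  have := hμ'.isFiniteMeasure htT
  rw [measure_univ (μ := ν), ENNReal.toReal_one] at hmass'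
  exact eq_of_forall_integral_le hmass hmass' ht

end
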